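/- Let ψ: ℝ^{d−1} → ℝ be Lipschitz with ψ(0) = 0 and ‖∇ψ‖_∞ ≤ M, and set Δ(r) = {(x′,ψ(x′)) : |x′| < r} and D(r) = {(x′,x_d) : |x′| < r, ψ(x′) < x_d < 10√d(M+1)r}. Let L = −div(A∇) with A ∈ Λ(μ,λ,τ), A* = A, and A ∈ C²(ℝ^d). Suppose L(u) = 0 in D(8r) for some r > 0, where u ∈ C²(D(8r)), the nontangential maximal function of ∇u relative to D(8r) lies in L²(Δ(6r)), and ∇u exists n.t. on Δ(6r). Then ∫_{Δ(r)} |∇u|² dσ ≤ C∫_{Δ(4r)} |∂u/∂ν|² dσ + (C/r)∫_{D(4r)} |∇u|² dX, and ∫_{Δ(r)} |∇u|² dσ ≤ C∫_{Δ(4r)} |∇_tan u|² dσ + (C/r)∫_{D(4r)} |∇u|² dX, where C depends only on μ, λ, τ and M. -/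

import Mathlib

open MeasureTheory Metric Filter Set
open scoped ENNReal NNReal Topology MeasureTheory

noncomputable section

/-- A coefficient matrix `A(X) = (a_{ij}^{αβ}(X))`. -/
abbrev Coeff (d m : ℕ) :=
  EuclideanSpace ℝ (Fin d) → Fin d → Fin d → Fin m → Fin m → ℝ

/-- The ellipticity condition `μ|ξ|² ≤ a_{ij}^{αβ} ξ_i^α ξ_j^β ≤ μ⁻¹|ξ|²`. -/
def IsElliptic {d m : ℕ} (μ : ℝ) (A : Coeff d m) : Prop :=
  ∀ (X : EuclideanSpace ℝ (Fin d)) (ξ : Fin d → Fin m → ℝ),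
    μ * (∑ i, ∑ α, (ξ i α) ^ 2) ≤ (∑ i, ∑ j, ∑ α, ∑ β, A X i j α β * ξ i α * ξ j β) ∧
    (∑ i, ∑ j, ∑ α, ∑ β, A X i j α β * ξ i α * ξ j β) ≤ μ⁻¹ * (∑ i, ∑ α, (ξ i α) ^ 2)

/-- Periodicity with respect to `ℤ^d`. -/
def IsPeriodicCoeff {d m : ℕ} (A : Coeff d m) : Prop :=
  ∀ (X Z : EuclideanSpace ℝ (Fin d)), (∀ i, ∃ k : ℤ, Z i = (k : ℝ)) → A (X + Z) = A X

/-- The Hölder condition `|A(X) − A(Y)| ≤ τ|X−Y|^λ`. -/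
def IsHolderCoeff {d m : ℕ} (lam τ : ℝ) (A : Coeff d m) : Prop :=
  ∀ X Y i j α β, |A X i j α β - A Y i j α β| ≤ τ * ‖X - Y‖ ^ lam

/-- Membership in the class `Λ(μ,λ,τ)`. -/
def MemLambdaClass {d m : ℕ} (μ lam τ : ℝ) (A : Coeff d m) : Prop :=
  IsElliptic μ A ∧ IsPeriodicCoeff A ∧ IsHolderCoeff lam τ A

/-- The symmetry condition `A* = A`. -/
def IsSymmCoeff {d m : ℕ} (A : Coeff d m) : Prop :=
  ∀ X i j α β, A X i j α β = A X j i β α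

/-- Surface measure on `∂Ω`: the `(d−1)`-dimensional Hausdorff measure restricted to the
topological boundary. -/
def surfMeasure (d : ℕ) (Ω : Set (EuclideanSpace ℝ (Fin d))) :
    Measure (EuclideanSpace ℝ (Fin d)) :=
  (μH[(d : ℝ) - 1]).restrict (frontier Ω)

/-- `Ω` is a bounded Lipschitz domain of character `(M,N)`: the boundary is covered by `N`
balls in which, after choosing a unit direction `e`, `Ω` coincides with the region above the
graph of an `M`-Lipschitz function `ψ` with `ψ(0) = 0`. -/
def MemLipschitzClass (d : ℕ) (M : ℝ) (N : ℕ)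
    (Ω : Set (EuclideanSpace ℝ (Fin d))) : Prop :=
  IsOpen Ω ∧ Bornology.IsBounded Ω ∧ Ω.Nonempty ∧
  ∃ r > 0, ∃ P : Fin N → EuclideanSpace ℝ (Fin d),
    (∀ k, P k ∈ frontier Ω) ∧
    frontier Ω ⊆ ⋃ k, Metric.ball (P k) r ∧
    (∀ k, ∃ e : EuclideanSpace ℝ (Fin d), ‖e‖ = 1 ∧
      ∃ ψ : ((Submodule.span ℝ {e})ᗮ : Submodule ℝ (EuclideanSpace ℝ (Fin d))) → ℝ,
        LipschitzWith (Real.toNNReal M) ψ ∧ ψ 0 = 0 ∧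
        ∀ X ∈ Metric.ball (P k) (10 * (M + 1) * r),
          (X ∈ Ω ↔
            ψ (Submodule.orthogonalProjection ((Submodule.span ℝ {e})ᗮ) (X - P k)) <
              (inner ℝ (X - P k) e : ℝ)))

/-- Nontangential approach region with aperture `C₀` inside `S`, relative to boundary `B`. -/
def ntRegion {d : ℕ} (C₀ : ℝ) (S B : Set (EuclideanSpace ℝ (Fin d)))
    (P : EuclideanSpace ℝ (Fin d)) : Set (EuclideanSpace ℝ (Fin d)) :=
  {X | X ∈ S ∧ dist X P < C₀ * Metric.infDist X B}

/-- Nontangential maximal function (with values in `ℝ≥0∞`). -/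
def ntMax {d : ℕ} {F : Type*} [NormedAddCommGroup F] (C₀ : ℝ)
    (S B : Set (EuclideanSpace ℝ (Fin d))) (u : EuclideanSpace ℝ (Fin d) → F)
    (P : EuclideanSpace ℝ (Fin d)) : ℝ≥0∞ :=
  ⨆ X ∈ ntRegion C₀ S B P, (‖u X‖₊ : ℝ≥0∞)

/-- Nontangential convergence of `u` to the value `v` at the boundary point `P`. -/
def NTLim {d : ℕ} {F : Type*} [TopologicalSpace F] (C₀ : ℝ)
    (S B : Set (EuclideanSpace ℝ (Fin d))) (u : EuclideanSpace ℝ (Fin d) → F)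
    (P : EuclideanSpace ℝ (Fin d)) (v : F) : Prop :=
  Filter.Tendsto u (nhdsWithin P (ntRegion C₀ S B P)) (nhds v)

/-- `u` is a weak solution of `−div(A∇u) = 0` in `Ω`. -/
def IsWeakSolution {d m : ℕ} (A : Coeff d m) (Ω : Set (EuclideanSpace ℝ (Fin d)))
    (u : EuclideanSpace ℝ (Fin d) → Fin m → ℝ) : Prop :=
  (∀ X ∈ Ω, DifferentiableAt ℝ u X) ∧
  ∀ φ : EuclideanSpace ℝ (Fin d) → Fin m → ℝ,
    ContDiff ℝ (⊤ : ℕ∞) φ → HasCompactSupport φ → tsupport φ ⊆ Ω →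
    ∫ X in Ω, ∑ i, ∑ j, ∑ α, ∑ β,
      A X i j α β * fderiv ℝ u X (EuclideanSpace.single j 1) β *
        fderiv ℝ φ X (EuclideanSpace.single i 1) α = 0

/-- `Γ` is the matrix of fundamental solutions for `−div(A∇)` in `ℝ^d`:  it is differentiable
off the diagonal, satisfies the natural size estimates, and the representation formula
`φ^γ(Y) = ∫ a_{ij}^{αβ} ∂_j Γ^{βγ}(·,Y) ∂_i φ^α`. -/
def IsFundamentalSolution {d m : ℕ} (A : Coeff d m)
    (Γ : EuclideanSpace ℝ (Fin d) → EuclideanSpace ℝ (Fin d) → Fin m → Fin m → ℝ) : Prop :=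
  (∀ X Y : EuclideanSpace ℝ (Fin d), X ≠ Y → ∀ α β,
      DifferentiableAt ℝ (fun Z => Γ Z Y α β) X ∧
      DifferentiableAt ℝ (fun Z => Γ X Z α β) Y) ∧
  (∃ C > 0, ∀ X Y : EuclideanSpace ℝ (Fin d), X ≠ Y → ∀ α β,
      |Γ X Y α β| ≤ C * ‖X - Y‖ ^ ((2 : ℝ) - d) ∧
      ‖fderiv ℝ (fun Z => Γ Z Y α β) X‖ + ‖fderiv ℝ (fun Z => Γ X Z α β) Y‖ ≤
        C * ‖X - Y‖ ^ ((1 : ℝ) - d)) ∧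
  ∀ φ : EuclideanSpace ℝ (Fin d) → Fin m → ℝ,
    ContDiff ℝ (⊤ : ℕ∞) φ → HasCompactSupport φ → ∀ Y γ,
      φ Y γ = ∫ X, ∑ i, ∑ j, ∑ α, ∑ β,
        A X i j α β * fderiv ℝ (fun Z => Γ Z Y β γ) X (EuclideanSpace.single j 1) *
          fderiv ℝ φ X (EuclideanSpace.single i 1) α

/-- `n` is the (a.e. defined) outward unit normal of `Ω`, characterized by the
Gauss–Green formula. -/
def IsOutwardNormal {d : ℕ} (Ω : Set (EuclideanSpace ℝ (Fin d)))
    (n : EuclideanSpace ℝ (Fin d) → EuclideanSpace ℝ (Fin d)) : Prop :=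
  (∀ᵐ P ∂(surfMeasure d Ω), ‖n P‖ = 1) ∧
  ∀ φ : EuclideanSpace ℝ (Fin d) → EuclideanSpace ℝ (Fin d),
    ContDiff ℝ (⊤ : ℕ∞) φ → HasCompactSupport φ →
    ∫ X in Ω, ∑ i, fderiv ℝ φ X (EuclideanSpace.single i 1) i =
      ∫ P, ∑ i, φ P i * n P i ∂(surfMeasure d Ω)

/-- The `(α,i)` entry of a total derivative `G`, i.e. `∂u^α/∂x_i`. -/
def gradEntry {d m : ℕ} (G : EuclideanSpace ℝ (Fin d) →L[ℝ] (Fin m → ℝ))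
    (α : Fin m) (i : Fin d) : ℝ :=
  G (EuclideanSpace.single i 1) α

/-- `|∇u|²` computed from a total derivative. -/
def gradNormSq {d m : ℕ} (G : EuclideanSpace ℝ (Fin d) →L[ℝ] (Fin m → ℝ)) : ℝ :=
  ∑ α, ∑ i, (gradEntry G α i) ^ 2

/-- The conormal derivative `(∂u/∂ν)^α = n_i a_{ij}^{αβ} ∂_j u^β` computed from a total
derivative `G` at the boundary point `P`. -/
def conormalDeriv {d m : ℕ} (A : Coeff d m)
    (n : EuclideanSpace ℝ (Fin d) → EuclideanSpace ℝ (Fin d))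
    (P : EuclideanSpace ℝ (Fin d)) (G : EuclideanSpace ℝ (Fin d) →L[ℝ] (Fin m → ℝ))
    (α : Fin m) : ℝ :=
  ∑ i, ∑ j, ∑ β, n P i * A P i j α β * gradEntry G β j

/-- `|∂u/∂ν|²`. -/
def conormalNormSq {d m : ℕ} (A : Coeff d m)
    (n : EuclideanSpace ℝ (Fin d) → EuclideanSpace ℝ (Fin d))
    (P : EuclideanSpace ℝ (Fin d)) (G : EuclideanSpace ℝ (Fin d) →L[ℝ] (Fin m → ℝ)) : ℝ :=
  ∑ α, (conormalDeriv A n P G α) ^ 2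

/-- `|∇_tan u|²`: the squared norm of the tangential part of the gradient. -/
def tanGradNormSq {d m : ℕ} (nP : EuclideanSpace ℝ (Fin d))
    (G : EuclideanSpace ℝ (Fin d) →L[ℝ] (Fin m → ℝ)) : ℝ :=
  ∑ α, ∑ i, (gradEntry G α i - (∑ k, gradEntry G α k * nP k) * nP i) ^ 2

/-- `|∇u(X)|²` for a function `u`. -/
def gradSq {d m : ℕ} (u : EuclideanSpace ℝ (Fin d) → Fin m → ℝ)
    (X : EuclideanSpace ℝ (Fin d)) : ℝ :=
  ∑ α, ∑ i, (fderiv ℝ u X (EuclideanSpace.single i 1) α) ^ 2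

/-- Single layer potential with density `g`. -/
def singleLayer {d m : ℕ} (Ω : Set (EuclideanSpace ℝ (Fin d)))
    (Γ : EuclideanSpace ℝ (Fin d) → EuclideanSpace ℝ (Fin d) → Fin m → Fin m → ℝ)
    (g : EuclideanSpace ℝ (Fin d) → Fin m → ℝ)
    (X : EuclideanSpace ℝ (Fin d)) : Fin m → ℝ :=
  fun α => ∫ Y, ∑ β, Γ X Y α β * g Y β ∂(surfMeasure d Ω)

/-- Double layer potential with density `f`. -/
def doubleLayer {d m : ℕ} (Ω : Set (EuclideanSpace ℝ (Fin d))) (A : Coeff d m)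
    (n : EuclideanSpace ℝ (Fin d) → EuclideanSpace ℝ (Fin d))
    (Γ : EuclideanSpace ℝ (Fin d) → EuclideanSpace ℝ (Fin d) → Fin m → Fin m → ℝ)
    (f : EuclideanSpace ℝ (Fin d) → Fin m → ℝ)
    (X : EuclideanSpace ℝ (Fin d)) : Fin m → ℝ :=
  fun α => ∫ Y, ∑ i, ∑ j, ∑ β, ∑ γ,
    n Y j * A Y i j β γ *
      fderiv ℝ (fun Z => Γ X Z α β) Y (EuclideanSpace.single i 1) * f Y γ
    ∂(surfMeasure d Ω)

/-- Identity coefficient matrix. -/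
def idCoeff (d m : ℕ) : Coeff d m :=
  fun _ i j α β => if i = j ∧ α = β then 1 else 0

/-- A solution of the `L²` Dirichlet problem with data `f`. -/
def IsDirichletSolution {d m : ℕ} (C₀ : ℝ) (A : Coeff d m)
    (Ω : Set (EuclideanSpace ℝ (Fin d)))
    (f u : EuclideanSpace ℝ (Fin d) → Fin m → ℝ) : Prop :=
  IsWeakSolution A Ω u ∧
  (∫⁻ P, (ntMax C₀ Ω (frontier Ω) u P) ^ 2 ∂(surfMeasure d Ω)) ≠ ⊤ ∧
  ∀ᵐ P ∂(surfMeasure d Ω), NTLim C₀ Ω (frontier Ω) u P (f P)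

/-- A solution of the `L²` regularity problem with data `f`. -/
def IsRegularitySolution {d m : ℕ} (C₀ : ℝ) (A : Coeff d m)
    (Ω : Set (EuclideanSpace ℝ (Fin d)))
    (f u : EuclideanSpace ℝ (Fin d) → Fin m → ℝ) : Prop :=
  IsWeakSolution A Ω u ∧
  (∫⁻ P, (ntMax C₀ Ω (frontier Ω) (fun X => fderiv ℝ u X) P) ^ 2 ∂(surfMeasure d Ω)) ≠ ⊤ ∧
  ∀ᵐ P ∂(surfMeasure d Ω), NTLim C₀ Ω (frontier Ω) u P (f P)

/-- A solution of the `L²` Neumann problem with data `f`: the conormal derivative attains `f`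
as a nontangential limit a.e. -/
def IsNeumannSolution {d m : ℕ} (C₀ : ℝ) (A : Coeff d m)
    (Ω : Set (EuclideanSpace ℝ (Fin d)))
    (n : EuclideanSpace ℝ (Fin d) → EuclideanSpace ℝ (Fin d))
    (f u : EuclideanSpace ℝ (Fin d) → Fin m → ℝ) : Prop :=
  IsWeakSolution A Ω u ∧
  (∫⁻ P, (ntMax C₀ Ω (frontier Ω) (fun X => fderiv ℝ u X) P) ^ 2 ∂(surfMeasure d Ω)) ≠ ⊤ ∧
  ∀ᵐ P ∂(surfMeasure d Ω),
    ∃ G, NTLim C₀ Ω (frontier Ω) (fun X => fderiv ℝ u X) P G ∧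
      ∀ α, conormalDeriv A n P G α = f P α

/-- Unique solvability of the `L²` Dirichlet problem with estimate `‖(u)*‖₂ ≤ C‖f‖₂`. -/
def SolvesDirichlet {d m : ℕ} (C₀ : ℝ) (A : Coeff d m)
    (Ω : Set (EuclideanSpace ℝ (Fin d))) (C : ℝ) : Prop :=
  ∀ f : EuclideanSpace ℝ (Fin d) → Fin m → ℝ, MemLp f 2 (surfMeasure d Ω) →
    ∃ u, IsDirichletSolution C₀ A Ω f u ∧
      (∀ v, IsDirichletSolution C₀ A Ω f v → Set.EqOn v u Ω) ∧
      (∫⁻ P, (ntMax C₀ Ω (frontier Ω) u P) ^ 2 ∂(surfMeasure d Ω)) ^ ((1 : ℝ) / 2) ≤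
        ENNReal.ofReal C * eLpNorm f 2 (surfMeasure d Ω)

/-- Unique solvability of the `L²` regularity problem with estimate
`‖(∇u)*‖₂ ≤ C‖∇_tan f‖₂`; the data is `f ∈ W^{1,2}(∂Ω)` together with its tangential
gradient `ft`. -/
def SolvesRegularity {d m : ℕ} (C₀ : ℝ) (A : Coeff d m)
    (Ω : Set (EuclideanSpace ℝ (Fin d))) (C : ℝ) : Prop :=
  ∀ (f : EuclideanSpace ℝ (Fin d) → Fin m → ℝ)
    (ft : EuclideanSpace ℝ (Fin d) → (EuclideanSpace ℝ (Fin d) →L[ℝ] (Fin m → ℝ))),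
    MemLp f 2 (surfMeasure d Ω) → MemLp ft 2 (surfMeasure d Ω) →
    (∀ᵐ P ∂(surfMeasure d Ω), HasFDerivWithinAt f (ft P) (frontier Ω) P) →
    ∃ u, IsRegularitySolution C₀ A Ω f u ∧
      (∀ v, IsRegularitySolution C₀ A Ω f v → Set.EqOn v u Ω) ∧
      (∫⁻ P, (ntMax C₀ Ω (frontier Ω) (fun X => fderiv ℝ u X) P) ^ 2
          ∂(surfMeasure d Ω)) ^ ((1 : ℝ) / 2) ≤
        ENNReal.ofReal C * eLpNorm ft 2 (surfMeasure d Ω)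

/-- Unique (up to constants) solvability of the `L²` Neumann problem with estimate
`‖(∇u)*‖₂ ≤ C‖f‖₂`. -/
def SolvesNeumann {d m : ℕ} (C₀ : ℝ) (A : Coeff d m)
    (Ω : Set (EuclideanSpace ℝ (Fin d)))
    (n : EuclideanSpace ℝ (Fin d) → EuclideanSpace ℝ (Fin d)) (C : ℝ) : Prop :=
  ∀ f : EuclideanSpace ℝ (Fin d) → Fin m → ℝ, MemLp f 2 (surfMeasure d Ω) →
    (∀ α, ∫ P, f P α ∂(surfMeasure d Ω) = 0) →
    ∃ u, IsNeumannSolution C₀ A Ω n f u ∧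
      (∀ v, IsNeumannSolution C₀ A Ω n f v →
        ∃ c : Fin m → ℝ, ∀ X ∈ Ω, ∀ α, v X α = u X α + c α) ∧
      (∫⁻ P, (ntMax C₀ Ω (frontier Ω) (fun X => fderiv ℝ u X) P) ^ 2
          ∂(surfMeasure d Ω)) ^ ((1 : ℝ) / 2) ≤
        ENNReal.ofReal C * eLpNorm f 2 (surfMeasure d Ω)

/-- The Rellich property of `−div(A∇)` in `Ω` with constant `C`. -/
def HasRellichProperty {d m : ℕ} (C₀ : ℝ) (A : Coeff d m)
    (Ω : Set (EuclideanSpace ℝ (Fin d))) (C : ℝ) : Prop :=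
  ∀ n, IsOutwardNormal Ω n →
  ∀ (u : EuclideanSpace ℝ (Fin d) → Fin m → ℝ)
    (G : EuclideanSpace ℝ (Fin d) → (EuclideanSpace ℝ (Fin d) →L[ℝ] (Fin m → ℝ))),
    IsWeakSolution A Ω u →
    (∫⁻ P, (ntMax C₀ Ω (frontier Ω) (fun X => fderiv ℝ u X) P) ^ 2 ∂(surfMeasure d Ω)) ≠ ⊤ →
    (∀ᵐ P ∂(surfMeasure d Ω), NTLim C₀ Ω (frontier Ω) (fun X => fderiv ℝ u X) P (G P)) →
    Real.sqrt (∫ P, gradNormSq (G P) ∂(surfMeasure d Ω)) ≤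
        C * Real.sqrt (∫ P, conormalNormSq A n P (G P) ∂(surfMeasure d Ω)) ∧
    Real.sqrt (∫ P, gradNormSq (G P) ∂(surfMeasure d Ω)) ≤
        C * Real.sqrt (∫ P, tanGradNormSq (n P) (G P) ∂(surfMeasure d Ω))

/-- Truncated singular integral with kernel `∇₁Γ(P,Y)` acting on `f`. -/
def trunc1 {d m : ℕ} (Ω : Set (EuclideanSpace ℝ (Fin d)))
    (Γ : EuclideanSpace ℝ (Fin d) → EuclideanSpace ℝ (Fin d) → Fin m → Fin m → ℝ)
    (f : EuclideanSpace ℝ (Fin d) → Fin m → ℝ) (ρ : ℝ)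
    (P : EuclideanSpace ℝ (Fin d)) : Fin m → Fin d → ℝ :=
  fun α i => ∫ Y in {Y | ρ < dist Y P}, ∑ β,
    fderiv ℝ (fun Z => Γ Z Y α β) P (EuclideanSpace.single i 1) * f Y β ∂(surfMeasure d Ω)

/-- Truncated singular integral with kernel `∇₂Γ(P,Y)` acting on `f`. -/
def trunc2 {d m : ℕ} (Ω : Set (EuclideanSpace ℝ (Fin d)))
    (Γ : EuclideanSpace ℝ (Fin d) → EuclideanSpace ℝ (Fin d) → Fin m → Fin m → ℝ)
    (f : EuclideanSpace ℝ (Fin d) → Fin m → ℝ) (ρ : ℝ)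
    (P : EuclideanSpace ℝ (Fin d)) : Fin m → Fin d → ℝ :=
  fun α i => ∫ Y in {Y | ρ < dist Y P}, ∑ β,
    fderiv ℝ (fun Z => Γ P Z α β) Y (EuclideanSpace.single i 1) * f Y β ∂(surfMeasure d Ω)

/-- Maximal singular integral associated with `trunc1`. -/
def maxTrunc1 {d m : ℕ} (Ω : Set (EuclideanSpace ℝ (Fin d)))
    (Γ : EuclideanSpace ℝ (Fin d) → EuclideanSpace ℝ (Fin d) → Fin m → Fin m → ℝ)
    (f : EuclideanSpace ℝ (Fin d) → Fin m → ℝ)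
    (P : EuclideanSpace ℝ (Fin d)) : ℝ≥0∞ :=
  ⨆ ρ ∈ Set.Ioi (0 : ℝ), (‖trunc1 Ω Γ f ρ P‖₊ : ℝ≥0∞)

/-- Maximal singular integral associated with `trunc2`. -/
def maxTrunc2 {d m : ℕ} (Ω : Set (EuclideanSpace ℝ (Fin d)))
    (Γ : EuclideanSpace ℝ (Fin d) → EuclideanSpace ℝ (Fin d) → Fin m → Fin m → ℝ)
    (f : EuclideanSpace ℝ (Fin d) → Fin m → ℝ)
    (P : EuclideanSpace ℝ (Fin d)) : ℝ≥0∞ :=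
  ⨆ ρ ∈ Set.Ioi (0 : ℝ), (‖trunc2 Ω Γ f ρ P‖₊ : ℝ≥0∞)

/-- Truncated version of the adjoint operator `K*_B`, the kernel being
`∑ K_B^{βα}(Y,P) f^β(Y)` where `K_B^{βα}(Y,P) = n_i(Y) b_{ij}^{βγ}(Y) ∂_{Y_j}Γ_B^{γα}(Y,P)`. -/
def truncKadj {d m : ℕ} (Ω : Set (EuclideanSpace ℝ (Fin d))) (B : Coeff d m)
    (n : EuclideanSpace ℝ (Fin d) → EuclideanSpace ℝ (Fin d))
    (Γ : EuclideanSpace ℝ (Fin d) → EuclideanSpace ℝ (Fin d) → Fin m → Fin m → ℝ)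
    (f : EuclideanSpace ℝ (Fin d) → Fin m → ℝ) (ρ : ℝ)
    (P : EuclideanSpace ℝ (Fin d)) : Fin m → ℝ :=
  fun α => ∫ Y in {Y | ρ < dist Y P}, ∑ β, ∑ i, ∑ j, ∑ γ,
    n Y i * B Y i j β γ *
      fderiv ℝ (fun Z => Γ Z P γ α) Y (EuclideanSpace.single j 1) * f Y β
    ∂(surfMeasure d Ω)

/-- The first `e` coordinates of a point of `ℝ^{e+1}`. -/
def projLast (e : ℕ) (X : EuclideanSpace ℝ (Fin (e + 1))) : EuclideanSpace ℝ (Fin e) :=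
  WithLp.toLp 2 (fun i => X i.castSucc)

/-- The domain above the graph of `ψ`. -/
def graphDomain (e : ℕ) (ψ : EuclideanSpace ℝ (Fin e) → ℝ) :
    Set (EuclideanSpace ℝ (Fin (e + 1))) :=
  {X | ψ (projLast e X) < X (Fin.last e)}

/-- The surface ball `Δ(r)` on the graph of `ψ`. -/
def graphDelta (e : ℕ) (ψ : EuclideanSpace ℝ (Fin e) → ℝ) (r : ℝ) :
    Set (EuclideanSpace ℝ (Fin (e + 1))) :=
  {X | X (Fin.last e) = ψ (projLast e X) ∧ ‖projLast e X‖ < r}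

/-- The region `D(r)` above the graph of `ψ`. -/
def graphD (e : ℕ) (M : ℝ) (ψ : EuclideanSpace ℝ (Fin e) → ℝ) (r : ℝ) :
    Set (EuclideanSpace ℝ (Fin (e + 1))) :=
  {X | ‖projLast e X‖ < r ∧ ψ (projLast e X) < X (Fin.last e) ∧
    X (Fin.last e) < 10 * Real.sqrt (e + 1) * (M + 1) * r}

set_option linter.unusedSectionVars false
set_option linter.unusedVariables false
set_option linter.unusedSimpArgs false
set_option linter.style.haveILetI false

namespace Rell
set_option maxSynthPendingDepth 3

noncomputable section
local notation:max "𝓩" E:max => E × ℝ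
local notation:max "𝓛" E:max Y:max => E × ℝ →L[ℝ] Y
local notation:max "𝓑" E:max Y:max => (E × ℝ →L[ℝ] Y) →L[ℝ] (E × ℝ →L[ℝ] Y) →L[ℝ] ℝ
section core
variable {E Y : Type*} [NormedAddCommGroup E] [NormedSpace ℝ E] [FiniteDimensional ℝ E]
  [MeasureSpace E] [BorelSpace E] [(volume : Measure E).IsAddHaarMeasure]
  [NormedAddCommGroup Y] [NormedSpace ℝ Y] [FiniteDimensional ℝ Y]
def box (E : Type*) [NormedAddCommGroup E] (b lo hi : ℝ) : Set 𝓩 E := {z | ‖z.1‖ < b ∧ lo < z.2 ∧ z.2 < hi}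

lemma box_eq (b lo hi : ℝ) : box E b lo hi = (ball (0:E) b) ×ˢ Ioo lo hi := by
  ext z; simp [box]

lemma box_meas (b lo hi : ℝ) : MeasurableSet (box E b lo hi) := by
  rw [box_eq]; exact measurableSet_ball.prod measurableSet_Ioo

lemma box_fin (b lo hi : ℝ) : volume (box E b lo hi) < ⊤ := by
  rw [box_eq, Measure.volume_eq_prod, Measure.prod_prod]
  exact ENNReal.mul_lt_top measure_ball_lt_top (by simp)

@[fun_prop]
def Bdd {α F : Type*} [MeasureSpace α] [NormedAddCommGroup F] (f : α → F) : Prop :=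
  AEStronglyMeasurable f ∧ ∃ C : ℝ, ∀ z, ‖f z‖ ≤ C

section bdd
variable {α F F' : Type*} [MeasureSpace α] [NormedAddCommGroup F] [NormedSpace ℝ F] [NormedAddCommGroup F'] [NormedSpace ℝ F']

lemma Bdd.exC {f : α → F} (hf : Bdd f) : ∃ C : ℝ, 0 ≤ C ∧ ∀ z, ‖f z‖ ≤ C := by
  obtain ⟨C, hC⟩ := hf.2
  exact ⟨max C 0, le_max_right _ _, fun z => (hC z).trans (le_max_left _ _)⟩

@[fun_prop] lemma Bdd.const (c : F) : Bdd (fun _ : α => c) := ⟨by fun_prop, ‖c‖, by simp⟩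
@[fun_prop] lemma Bdd.add {f g : α → F} (hf : Bdd f) (hg : Bdd g) : Bdd (fun z => f z + g z) := by
  obtain ⟨C, hC⟩ := hf.2; obtain ⟨D, hD⟩ := hg.2
  exact ⟨hf.1.add hg.1, C + D, fun z => (norm_add_le _ _).trans (add_le_add (hC z) (hD z))⟩
@[fun_prop] lemma Bdd.sub {f g : α → F} (hf : Bdd f) (hg : Bdd g) : Bdd (fun z => f z - g z) := by
  obtain ⟨C, hC⟩ := hf.2; obtain ⟨D, hD⟩ := hg.2
  exact ⟨hf.1.sub hg.1, C + D, fun z => (norm_sub_le _ _).trans (add_le_add (hC z) (hD z))⟩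

@[fun_prop] lemma Bdd.norm {f : α → F} (hf : Bdd f) : Bdd (fun z => ‖f z‖) := by
  obtain ⟨C, hC⟩ := hf.2
  exact ⟨hf.1.norm, C, fun z => by simpa using hC z⟩
@[fun_prop] lemma Bdd.smul {f : α → ℝ} {g : α → F} (hf : Bdd f) (hg : Bdd g) : Bdd (fun z => f z • g z) := by
  obtain ⟨C, hC0, hC⟩ := hf.exC; obtain ⟨D, hD0, hD⟩ := hg.exC
  refine ⟨hf.1.smul hg.1, C * D, fun z => ?_⟩
  rw [norm_smul]; exact mul_le_mul (hC z) (hD z) (norm_nonneg _) hC0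
@[fun_prop] lemma Bdd.mul {f g : α → ℝ} (hf : Bdd f) (hg : Bdd g) : Bdd (fun z => f z * g z) :=
  hf.smul hg
@[fun_prop] lemma Bdd.pow {f : α → ℝ} (hf : Bdd f) (n : ℕ) : Bdd (fun z => f z ^ n) := by
  induction n with
  | zero => simpa using Bdd.const (α := α) (1:ℝ)
  | succ k ih => simpa [pow_succ] using ih.mul hf
@[fun_prop] lemma Bdd.bil {B : α → (F →L[ℝ] F')} {f : α → F}
    (hB : Bdd B) (hf : Bdd f) : Bdd (fun z => B z (f z)) := by
  obtain ⟨C, hC0, hC⟩ := hB.exC; obtain ⟨D, hD0, hD⟩ := hf.exC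
  refine ⟨(isBoundedBilinearMap_apply (𝕜 := ℝ)).continuous.comp_aestronglyMeasurable (hB.1.prodMk hf.1), C * D, fun z => ?_⟩
  exact (ContinuousLinearMap.le_opNorm _ _).trans (mul_le_mul (hC z) (hD z) (norm_nonneg _) hC0)
@[fun_prop] lemma Bdd.smulRight {α F F' : Type*} [MeasureSpace α] [NormedAddCommGroup F] [NormedSpace ℝ F] [NormedAddCommGroup F'] [NormedSpace ℝ F'] {B : α → (F →L[ℝ] ℝ)} {f : α → F'}
    (hB : Bdd B) (hf : Bdd f) : Bdd (fun z => (B z).smulRight (f z)) := by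
  have := Bdd.bil (Bdd.bil (Bdd.const (α := α) (ContinuousLinearMap.smulRightL ℝ F F')) hB) hf
  simpa using this
lemma Bdd.congr {f g : α → F} (hf : Bdd f) (h : ∀ z, f z = g z) : Bdd g := by
  rwa [show g = f from funext fun z => (h z).symm]
lemma Bdd.ind {f : α → F} (hf : Bdd f) {s : Set α} (hs : MeasurableSet s) : Bdd (s.indicator f) := by
  obtain ⟨C, hC⟩ := hf.2
  exact ⟨hf.1.indicator hs, C, fun z => (norm_indicator_le_norm_self _ _).trans (hC z)⟩
lemma Bdd.intg {f : α → F} (hf : Bdd f)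
    (R : Set α) (hR' : volume R < ⊤) (h0 : ∀ z ∉ R, f z = 0) :
    Integrable f := by
  obtain ⟨C, h⟩ := hf.2
  have : IntegrableOn f R := Measure.integrableOn_of_bounded hR'.ne hf.1 (M := C)
     (Eventually.of_forall h)
  rw [← integrableOn_univ]
  exact this.of_forall_sdiff_eq_zero MeasurableSet.univ (by simpa using h0)
lemma Bdd.intgOn {f : α → F} (hf : Bdd f)
    {R : Set α} (hR' : volume R < ⊤) : IntegrableOn f R := by
  obtain ⟨C, h⟩ := hf.2
  exact Measure.integrableOn_of_bounded hR'.ne hf.1 (M := C)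
     (Eventually.of_forall h)
end bdd

instance instVolHaar : (volume : Measure 𝓩 E).IsAddHaarMeasure := by
  rw [Measure.volume_eq_prod]; infer_instance

def sh {F : Type*} (h : ℝ) (f : 𝓩 E → F) : 𝓩 E → F := fun z => f (z + (0, h))

lemma sh_apply {F : Type*} (h : ℝ) (f : 𝓩 E → F) (z : 𝓩 E) : sh h f z = f (z.1, z.2 + h) := by
  simp only [sh]; congr 1; ext <;> simp

@[fun_prop] lemma Bdd.sh {F : Type*} [NormedAddCommGroup F] {f : 𝓩 E → F} (hf : Bdd f) (h : ℝ) : Bdd (fun z => sh h f z) := by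
  obtain ⟨C, hC⟩ := hf.2
  refine ⟨?_, C, fun z => hC _⟩
  exact hf.1.comp_quasiMeasurePreserving (measurePreserving_add_right volume ((0:E), h)).quasiMeasurePreserving

lemma integral_sh {F : Type*} [NormedAddCommGroup F] [NormedSpace ℝ F] (h : ℝ) (f : 𝓩 E → F) : ∫ z, sh h f z = ∫ z, f z :=
  integral_add_right_eq_self f _

example (B : 𝓩 E → 𝓑 E Y) (hB : Bdd B)
  (p : 𝓩 E → 𝓛 E Y) (hp : Bdd p) (χ : 𝓩 E → ℝ) (hχ : Bdd χ) (h : ℝ):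
  Bdd (fun z => 3 * χ z * sh h B z (p z) (sh h p z - p z) - ‖p z‖^2 + (χ z - sh h χ z)) := by
  fun_prop

lemma vd_line (f : ℝ → Y) {K : ℝ≥0} (hf : LipschitzWith K f) (s h : ℝ) (hh : 0 ≤ h) :
    ‖f (s+h) - f s‖ ≤ ∫ σ in (0:ℝ)..h, ‖deriv f (s+σ)‖ := by
  obtain ⟨g, hg1, hg2⟩ := exists_dual_vector'' ℝ (f (s+h) - f s)
  have hG : LipschitzWith (‖g‖₊ * K) (fun t => g (f t)) := g.lipschitz.comp hf
  have h1 := (hG.lipschitzOnWith (s := uIcc s (s+h))).absolutelyContinuousOnInterval.integral_deriv_eq_sub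
  have h2 : ‖f (s+h) - f s‖ = ∫ t in s..(s+h), deriv (fun t => g (f t)) t := by
    rw [h1, ← map_sub, hg2]; simp
  rw [h2]
  have h3 : ∫ σ in (0:ℝ)..h, ‖deriv f (s+σ)‖ = ∫ t in s..(s+h), ‖deriv f t‖ := by
    rw [intervalIntegral.integral_comp_add_left (fun t => ‖deriv f t‖)]; simp
  rw [h3]
  have hb : ∀ t, ‖deriv f t‖ ≤ K := fun t => norm_deriv_le_of_lipschitz hf
  have hb' : ∀ t, ‖deriv (fun t => g (f t)) t‖ ≤ (‖g‖₊ * K : ℝ≥0) := fun t => norm_deriv_le_of_lipschitz hG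
  have hm : StronglyMeasurable (deriv f) := stronglyMeasurable_deriv f
  apply intervalIntegral.integral_mono_ae (by linarith)
  · rw [intervalIntegrable_iff]
    exact Measure.integrableOn_of_bounded (by simp) (stronglyMeasurable_deriv _).aestronglyMeasurable (Eventually.of_forall hb')
  · rw [intervalIntegrable_iff]
    exact Measure.integrableOn_of_bounded (by simp) hm.norm.aestronglyMeasurable (M := K) (Eventually.of_forall (fun t => by simpa using hb t))
  · filter_upwards [hf.ae_differentiableAt_real] with t ht
    have : deriv (fun t => g (f t)) t = g (deriv f t) :=
      (g.hasFDerivAt.comp_hasDerivAt t ht.hasDerivAt).deriv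
    rw [this]
    calc g (deriv f t) ≤ ‖g (deriv f t)‖ := le_abs_self _
      _ ≤ ‖g‖ * ‖deriv f t‖ := g.le_opNorm _
      _ ≤ 1 * ‖deriv f t‖ := by gcongr
      _ = _ := one_mul _

lemma intg_sh {F : Type*} [NormedAddCommGroup F] (h : ℝ) {f : 𝓩 E → F} (hf : Integrable f) : Integrable (sh h f) :=
  hf.comp_add_right _

lemma sq_int_le (k : ℝ → ℝ) (hk : StronglyMeasurable k) (C : ℝ) (hC : ∀ t, |k t| ≤ C) (h : ℝ) (hh : 0 ≤ h) :
    (∫ t in (0:ℝ)..h, k t)^2 ≤ h * ∫ t in (0:ℝ)..h, (k t)^2 := by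
  rcases hh.eq_or_lt with rfl | hh
  · simp
  have hi : IntervalIntegrable k volume 0 h := by
    rw [intervalIntegrable_iff]
    exact Measure.integrableOn_of_bounded (by simp) hk.aestronglyMeasurable (Eventually.of_forall hC)
  have hi2 : IntervalIntegrable (fun t => k t ^2) volume 0 h := by
    rw [intervalIntegrable_iff]
    refine Measure.integrableOn_of_bounded (by simp) (hk.pow 2).aestronglyMeasurable (M := C^2) (Eventually.of_forall fun t => ?_)
    rw [Real.norm_eq_abs, abs_pow]
    exact pow_le_pow_left₀ (abs_nonneg _) (hC t) 2
  set I := ∫ t in (0:ℝ)..h, k t with hI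
  set c := I / h
  have h0 : 0 ≤ ∫ t in (0:ℝ)..h, (k t - c)^2 := intervalIntegral.integral_nonneg hh.le (fun t _ => sq_nonneg _)
  have h1 : ∫ t in (0:ℝ)..h, (k t - c)^2 = (∫ t in (0:ℝ)..h, (k t)^2) - 2 * c * I + h * c^2 := by
    have : ∀ t, (k t - c)^2 = (k t)^2 - (2*c) * k t + c^2 := fun t => by ring
    simp_rw [this]
    rw [intervalIntegral.integral_add (hi2.sub (hi.const_mul _)) (by simp), intervalIntegral.integral_sub hi2 (hi.const_mul _), intervalIntegral.integral_const_mul, ← hI]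
    simp
  rw [h1] at h0
  have h2 : c * h = I := div_mul_cancel₀ _ hh.ne'
  have := mul_nonneg hh.le h0
  nlinarith

lemma vd_pt {f : 𝓩 E → Y} {K : ℝ≥0} (hf : LipschitzWith K f) (h : ℝ) (hh : 0 ≤ h) :
    ∀ᵐ z : 𝓩 E, ‖sh h f z - f z‖^2 ≤ h * ∫ σ in (0:ℝ)..h, ‖fderiv ℝ f (z + (0,σ)) (0,1)‖^2 := by
  have h1 : ∀ᵐ z : 𝓩 E, DifferentiableAt ℝ f z := hf.ae_differentiableAt
  rw [Measure.volume_eq_prod] at h1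
  have h2 := Measure.ae_ae_of_ae_prod h1
  have h3 : ∀ᵐ z : 𝓩 E, ∀ᵐ t : ℝ, DifferentiableAt ℝ f (z.1, t) := by
    rw [Measure.volume_eq_prod]
    exact Measure.quasiMeasurePreserving_fst.ae h2
  filter_upwards [h3] with z hz
  have hfz : LipschitzWith K (fun t => f (z.1, t)) := by
    have := hf.comp (LipschitzWith.prodMk_left z.1)
    rw [mul_one] at this; exact this
  have hl := vd_line _ hfz z.2 h hh
  have e1 : sh h f z - f z = f (z.1, z.2 + h) - f (z.1, z.2) := by rw [sh_apply]
  rw [e1]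
  have hz' : ∀ᵐ σ : ℝ, DifferentiableAt ℝ f (z.1, z.2 + σ) :=
    (measurePreserving_add_left volume z.2).quasiMeasurePreserving.ae hz
  have e2 : ∫ σ in (0:ℝ)..h, ‖deriv (fun t => f (z.1, t)) (z.2+σ)‖ = ∫ σ in (0:ℝ)..h, ‖fderiv ℝ f (z + (0,σ)) (0,1)‖ := by
    apply intervalIntegral.integral_congr_ae
    filter_upwards [hz'] with σ hσ _
    have : HasDerivAt (fun t => f (z.1, t)) (fderiv ℝ f (z.1, z.2 + σ) (0,1)) (z.2+σ) := by
      have hd : HasDerivAt (fun t : ℝ => (z.1, t)) ((0:E), (1:ℝ)) (z.2+σ) :=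
        (hasDerivAt_const _ _).prodMk (hasDerivAt_id _)
      exact hσ.hasFDerivAt.comp_hasDerivAt _ hd
    rw [this.deriv]
    congr 3
    ext <;> simp
  rw [e2] at hl
  have hs : StronglyMeasurable (fun σ : ℝ => ‖fderiv ℝ f (z + (0,σ)) (0,1)‖) := by
    borelize Y
    have h1 := measurable_fderiv_apply_const ℝ f ((0:E),(1:ℝ))
    have h2 : Measurable (fun σ : ℝ => z + ((0:E),σ)) := by fun_prop
    exact (h1.comp h2).stronglyMeasurable.norm
  refine le_trans (pow_le_pow_left₀ (norm_nonneg _) hl 2) (sq_int_le _ hs K (fun σ => ?_) h hh)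
  rw [abs_norm]
  refine (ContinuousLinearMap.le_opNorm _ _).trans ?_
  have := norm_fderiv_le_of_lipschitz ℝ hf (x₀ := z + (0,σ))
  have h01 : ‖((0:E),(1:ℝ))‖ = 1 := by simp [Prod.norm_def]
  rw [h01, mul_one]; exact this

lemma bdd_fderiv {f : 𝓩 E → Y} {K : ℝ≥0} (hf : LipschitzWith K f) : Bdd (fun z => fderiv ℝ f z) := by
  refine ⟨?_, K, fun z => norm_fderiv_le_of_lipschitz ℝ hf⟩
  exact (measurable_fderiv ℝ f).aestronglyMeasurable

lemma vd {f : 𝓩 E → Y} {K : ℝ≥0} (hf : LipschitzWith K f) (h : ℝ) (hh : 0 ≤ h) {A A' : Set 𝓩 E}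
    (hA : MeasurableSet A) (hA' : MeasurableSet A') (hAf : volume A < ⊤) (hAf' : volume A' < ⊤)
    (hAA : ∀ z ∈ A, ∀ σ, 0 < σ → σ < h → (z.1, z.2 + σ) ∈ A') :
    ∫ z in A, ‖sh h f z - f z‖^2 ≤ h^2 * ∫ z in A', ‖fderiv ℝ f z (0,1)‖^2 := by
  have hbf := bdd_fderiv hf
  have hb : Bdd (fun z => ‖fderiv ℝ f z (0,1)‖^2) := by fun_prop
  have hms : StronglyMeasurable (fun z => ‖fderiv ℝ f z ((0:E),(1:ℝ))‖^2) := by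
    borelize Y
    exact ((measurable_fderiv_apply_const ℝ f ((0:E),(1:ℝ))).stronglyMeasurable.norm).pow 2
  set g : 𝓩 E → ℝ := fun z => ‖fderiv ℝ f z (0,1)‖^2 with hg
  obtain ⟨C, hC0, hC⟩ := hb.exC
  have hsm : StronglyMeasurable (fun q : 𝓩 E × ℝ => g (q.1 + (0, q.2))) :=
    hms.comp_measurable (by fun_prop)
  have hint : Integrable (fun q : 𝓩 E × ℝ => g (q.1 + (0, q.2))) ((volume.restrict A).prod (volume.restrict (Ioc 0 h))) := by
    have : IsFiniteMeasure (volume.restrict A) := ⟨by simpa using hAf⟩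
    exact Integrable.of_bound hsm.aestronglyMeasurable C (Eventually.of_forall fun q => hC _)
  calc ∫ z in A, ‖sh h f z - f z‖^2 ≤ ∫ z in A, h * ∫ σ in (0:ℝ)..h, g (z + (0,σ)) := by
        apply integral_mono_of_nonneg
        · exact Eventually.of_forall fun z => by positivity
        · apply Integrable.const_mul
          have := hint.integral_prod_left
          simpa [intervalIntegral.integral_of_le hh] using this
        · exact ae_restrict_of_ae (vd_pt hf h hh)
    _ = h * ∫ σ in Ioc 0 h, ∫ z in A, g (z + (0,σ)) := by
        rw [integral_const_mul]
        simp_rw [intervalIntegral.integral_of_le hh]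
        rw [integral_integral_swap hint]
    _ ≤ h * ∫ σ in Ioc 0 h, ∫ z in A', g z := by
        gcongr ?_ * ?_
        apply integral_mono_of_nonneg
        · exact Eventually.of_forall fun σ => integral_nonneg fun z => by positivity
        · exact integrable_const _
        · filter_upwards [ae_restrict_mem measurableSet_Ioc, ae_restrict_of_ae (s := Ioc 0 h) (Measure.ae_ne volume h)] with σ hσ hne
          rw [← integral_indicator hA, ← integral_indicator hA', ← integral_sh (E := E) σ (A'.indicator g)]
          apply integral_mono_of_nonneg
          · exact Eventually.of_forall fun z => indicator_nonneg (fun z _ => by positivity) _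
          · exact intg_sh σ ((hb.ind hA').intg A' hAf' (fun z hz => indicator_of_notMem hz _))
          · refine Eventually.of_forall fun z => ?_
            by_cases hz : z ∈ A
            · rw [indicator_of_mem hz]
              have := hAA z hz σ hσ.1 (lt_of_le_of_ne hσ.2 hne)
              rw [sh_apply, indicator_of_mem this]
              apply le_of_eq; congr 1; ext <;> simp
            · rw [indicator_of_notMem hz]
              exact indicator_nonneg (fun z _ => by positivity) _
    _ = h^2 * ∫ z in A', g z := by
        simp [hh]; ring

def Lip {α β : Type*} [PseudoEMetricSpace α] [PseudoEMetricSpace β] (f : α → β) : Prop := ∃ K : ℝ≥0, LipschitzWith K f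

lemma Lip.of_norm {α β : Type*} [SeminormedAddCommGroup α] [SeminormedAddCommGroup β] {f : α → β} (K : ℝ) (h : ∀ x y, ‖f x - f y‖ ≤ K * ‖x - y‖) : Lip f := by
  refine ⟨K.toNNReal, LipschitzWith.of_dist_le_mul fun x y => ?_⟩
  rw [dist_eq_norm, dist_eq_norm]
  refine (h x y).trans ?_
  gcongr
  exact Real.le_coe_toNNReal K

lemma Lip.norm {α β : Type*} [SeminormedAddCommGroup α] [SeminormedAddCommGroup β] {f : α → β} (h : Lip f) : ∃ K : ℝ, 0 ≤ K ∧ ∀ x y, ‖f x - f y‖ ≤ K * ‖x - y‖ := by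
  obtain ⟨K, hK⟩ := h
  exact ⟨K, K.2, fun x y => by simpa [dist_eq_norm] using hK.dist_le_mul x y⟩

lemma Lip.sub {α β : Type*} [SeminormedAddCommGroup α] [SeminormedAddCommGroup β] {f g : α → β} (hf : Lip f) (hg : Lip g) : Lip (fun x => f x - g x) := by
  obtain ⟨K, hK⟩ := hf; obtain ⟨K', hK'⟩ := hg
  exact ⟨K + K', hK.sub hK'⟩

lemma Lip.smul {α : Type*} [SeminormedAddCommGroup α] {f : α → ℝ} {g : α → Y} (hf : Lip f) (hg : Lip g) (C D : ℝ) (hC : ∀ x, |f x| ≤ C)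
    (hD : ∀ x, ‖g x‖ ≤ D) : Lip (fun x => f x • g x) := by
  obtain ⟨K, hK0, hK⟩ := hf.norm; obtain ⟨K', hK0', hK'⟩ := hg.norm
  refine Lip.of_norm (C * K' + K * D) fun x y => ?_
  have : f x • g x - f y • g y = f x • (g x - g y) + (f x - f y) • g y := by
    rw [smul_sub, sub_smul]; abel
  rw [this]
  refine (norm_add_le _ _).trans ?_
  rw [norm_smul, norm_smul, add_mul]
  have h1 := hK x y
  rw [Real.norm_eq_abs (f x)]
  refine add_le_add ?_ ?_
  · calc |f x| * ‖g x - g y‖ ≤ C * (K' * ‖x - y‖) := mul_le_mul (hC x) (hK' x y) (norm_nonneg _) ((abs_nonneg _).trans (hC x))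
      _ = _ := by ring
  · calc ‖f x - f y‖ * ‖g y‖ ≤ (K * ‖x - y‖) * D := mul_le_mul (hK x y) (hD y) (norm_nonneg _) (by positivity)
      _ = _ := by ring

lemma Lip.sh {f : 𝓩 E → Y} (hf : Lip f) (h : ℝ) : Lip (sh h f) := by
  obtain ⟨K, hK0, hK⟩ := hf.norm
  exact Lip.of_norm K fun x y => by
    have := hK (x + (0,h)) (y + (0,h))
    rwa [add_sub_add_right_eq_sub] at this

lemma Lip.shbd {f : 𝓩 E → Y} (hf : Lip f) (h : ℝ) : ∃ D, ∀ z, ‖Rell.sh h f z - f z‖ ≤ D := by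
  obtain ⟨K, hK0, hK⟩ := hf.norm
  exact ⟨K * ‖((0:E),h)‖, fun z => by
    have := hK (z + (0,h)) z
    rwa [add_sub_cancel_left] at this⟩

lemma Lip.bfd {f : 𝓩 E → Y} (hf : Lip f) : Bdd (fun z => fderiv ℝ f z) := by
  obtain ⟨K, hK⟩ := hf; exact bdd_fderiv hK

lemma Lip.bdd {f : 𝓩 E → Y} (hf : Lip f) (D : ℝ) (hD : ∀ z, ‖f z‖ ≤ D) : Bdd f := by
  obtain ⟨K, hK⟩ := hf
  exact ⟨hK.continuous.aestronglyMeasurable, D, hD⟩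

lemma Lip.aed {f : 𝓩 E → Y} (hf : Lip f) : ∀ᵐ z, DifferentiableAt ℝ f z := by
  obtain ⟨K, hK⟩ := hf; exact hK.ae_differentiableAt

lemma ae_sh {P : 𝓩 E → Prop} (hP : ∀ᵐ z, P z) (h : ℝ) : ∀ᵐ z : 𝓩 E, P (z + (0,h)) :=
  (measurePreserving_add_right volume ((0:E), h)).quasiMeasurePreserving.ae hP

lemma ae_ne2 (c : ℝ) : ∀ᵐ z : 𝓩 E, z.2 ≠ c := by
  rw [Measure.volume_eq_prod]
  exact Measure.quasiMeasurePreserving_snd.ae (Measure.ae_ne volume c)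

lemma fderiv_prod_ae {χ : 𝓩 E → ℝ} {w : 𝓩 E → Y} (hχ : Lip χ) (hw : Lip w) :
    ∀ᵐ z, fderiv ℝ (fun z => χ z • w z) z = χ z • fderiv ℝ w z + (fderiv ℝ χ z).smulRight (w z) := by
  filter_upwards [hχ.aed, hw.aed] with z h1 h2
  exact fderiv_fun_smul h1 h2

lemma box_frontier (b lo hi : ℝ) : volume (frontier (box E b lo hi)) = 0 := by
  apply Convex.addHaar_frontier
  rw [box_eq]
  exact (convex_ball _ _).prod (convex_Ioo _ _)

lemma box_open (b lo hi : ℝ) : IsOpen (box E b lo hi) := by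
  rw [box_eq]; exact isOpen_ball.prod isOpen_Ioo

lemma fderiv_off_box {W : 𝓩 E → Y} (b lo hi : ℝ) (hW : ∀ z ∉ box E b lo hi, W z = 0) :
    ∀ᵐ z, z ∉ box E b lo hi → fderiv ℝ W z = 0 := by
  have : ∀ᵐ z : 𝓩 E, z ∉ frontier (box E b lo hi) := by
    rw [ae_iff]; simpa using box_frontier b lo hi
  filter_upwards [this] with z hz hz'
  have hz2 : z ∉ closure (box E b lo hi) := by
    intro h; apply hz; rw [frontier, (box_open b lo hi).interior_eq]; exact ⟨h, hz'⟩
  have : W =ᶠ[𝓝 z] fun _ => 0 := by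
    filter_upwards [isClosed_closure.isOpen_compl.mem_nhds hz2] with y hy
    exact hW y (fun h => hy (subset_closure h))
  rw [this.fderiv_eq]; simp

lemma fderiv_zero_of_nonneg {χ : 𝓩 E → ℝ} (h : ∀ z, 0 ≤ χ z) {z : 𝓩 E} (hz : χ z = 0) : fderiv ℝ χ z = 0 := by
  have : IsLocalMin χ z := Eventually.of_forall fun y => by rw [hz]; exact h y
  exact this.fderiv_eq_zero

lemma vol_box (b lo hi : ℝ) (h : lo ≤ hi) : volume.real (box E b lo hi) = volume.real (ball (0:E) b) * (hi - lo) := by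
  rw [box_eq, Measure.volume_eq_prod, measureReal_prod_prod]; simp [h]

lemma bdd_fst {F : Type*} [NormedAddCommGroup F] {f : E → F} (hf : Bdd f) : Bdd (fun z : 𝓩 E => f z.1) := by
  obtain ⟨C, hC⟩ := hf.2
  refine ⟨?_, C, fun z => hC _⟩
  rw [Measure.volume_eq_prod]
  exact hf.1.comp_fst

lemma slice_const {F0 : E → ℝ} (b δ : ℝ) (hδ : 0 ≤ δ) :
    ∫ z in box E b 0 δ, F0 z.1 = δ * ∫ x in ball (0:E) b, F0 x := by
  rw [box_eq, Measure.volume_eq_prod]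
  have := setIntegral_prod_mul (μ := (volume : Measure E)) (ν := (volume : Measure ℝ)) F0 (fun _ => (1:ℝ)) (ball (0:E) b) (Ioo 0 δ)
  simp only [mul_one] at this
  rw [this]; simp [hδ]; ring

lemma slice {F : 𝓩 E → ℝ} {F0 : E → ℝ} (hF : Bdd F) (hF0 : Bdd F0) (b δ K : ℝ) (hδ : 0 ≤ δ) (hK : 0 ≤ K)
    (h : ∀ x s, 0 < s → s < δ → |F (x,s) - F0 x| ≤ K * s) :
    |(∫ z in box E b 0 δ, F z) - δ * ∫ x in ball (0:E) b, F0 x| ≤ K * volume.real (ball (0:E) b) * δ^2 := by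
  rw [← slice_const b δ hδ, ← integral_sub (hF.intgOn (box_fin _ _ _)) ((bdd_fst hF0).intgOn (box_fin _ _ _)), ← Real.norm_eq_abs]
  refine (norm_setIntegral_le_of_norm_le_const (C := K * δ) (box_fin _ _ _) fun z hz => ?_).trans ?_
  · refine (h z.1 z.2 hz.2.1 hz.2.2).trans ?_
    have := hz.2.2
    gcongr
  · rw [vol_box _ _ _ hδ]; apply le_of_eq; ring

def clamp (t : ℝ) : ℝ := max 0 (min 1 t)
lemma clamp_nonneg (t : ℝ) : 0 ≤ clamp t := le_max_left _ _
lemma clamp_le (t : ℝ) : clamp t ≤ 1 := max_le zero_le_one (min_le_left _ _)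
lemma clamp_abs (t : ℝ) : |clamp t| ≤ 1 := by rw [abs_of_nonneg (clamp_nonneg t)]; exact clamp_le t
lemma clamp_lip (s t : ℝ) : |clamp s - clamp t| ≤ |s - t| := by
  simp only [clamp]
  calc _ ≤ |min 1 s - min 1 t| := (abs_max_sub_max_le_max _ _ _ _).trans (by simp)
    _ ≤ _ := (abs_min_sub_min_le_max _ _ _ _).trans (by simp)
lemma clamp_mono {s t : ℝ} (h : s ≤ t) : clamp s ≤ clamp t := by
  simp only [clamp]; gcongr
lemma clamp_one {t : ℝ} (h : 1 ≤ t) : clamp t = 1 := by simp [clamp, h]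
lemma clamp_zero {t : ℝ} (h : t ≤ 0) : clamp t = 0 := by simp [clamp, h]
lemma clamp_id {t : ℝ} (h : 0 ≤ t) (h1 : t ≤ 1) : clamp t = t := by simp [clamp, h, h1]

def eta (b ρ : ℝ) (x : E) : ℝ := clamp ((b - ‖x‖) / ρ)
lemma eta_lip (b ρ : ℝ) (hρ : 0 < ρ) (x y : E) : |eta b ρ x - eta b ρ y| ≤ (1/ρ) * ‖x - y‖ := by
  refine (clamp_lip _ _).trans ?_
  rw [← sub_div, abs_div, abs_of_pos hρ, div_eq_mul_one_div, mul_comm]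
  gcongr
  have : b - ‖x‖ - (b - ‖y‖) = ‖y‖ - ‖x‖ := by ring
  rw [this, norm_sub_rev]; exact abs_norm_sub_norm_le y x
lemma eta_zero {b ρ : ℝ} (hρ : 0 < ρ) {x : E} (h : b ≤ ‖x‖) : eta b ρ x = 0 :=
  clamp_zero (div_nonpos_of_nonpos_of_nonneg (by linarith) hρ.le)
lemma eta_one {b ρ : ℝ} (hρ : 0 < ρ) {x : E} (h : ‖x‖ ≤ b - ρ) : eta b ρ x = 1 :=
  clamp_one (by rw [le_div_iff₀ hρ]; linarith)

def cut (f : E → ℝ) (g : ℝ → ℝ) (z : 𝓩 E) : ℝ := f z.1 * g z.2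
lemma cut_lip {f : E → ℝ} {g : ℝ → ℝ} {K K' : ℝ} (hf : ∀ x, |f x| ≤ 1) (hg : ∀ s, |g s| ≤ 1)
    (hfl : ∀ x y, |f x - f y| ≤ K * ‖x - y‖) (hgl : ∀ s t, |g s - g t| ≤ K' * |s - t|) (hK : 0 ≤ K) (hK' : 0 ≤ K') (z z' : 𝓩 E) :
    |cut f g z - cut f g z'| ≤ (K + K') * ‖z - z'‖ := by
  have h1 : cut f g z - cut f g z' = (f z.1 - f z'.1) * g z.2 + f z'.1 * (g z.2 - g z'.2) := by simp only [cut]; ring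
  rw [h1]
  refine (abs_add_le _ _).trans ?_
  rw [abs_mul, abs_mul, add_mul]
  have h2 := norm_fst_le (z - z')
  have h3 := norm_snd_le (z - z')
  rw [Real.norm_eq_abs] at h3
  simp only [Prod.fst_sub, Prod.snd_sub] at h2 h3
  refine add_le_add ?_ ?_
  · calc _ ≤ (K * ‖z.1 - z'.1‖) * 1 := mul_le_mul (hfl _ _) (hg _) (abs_nonneg _) (by positivity)
      _ ≤ _ := by rw [mul_one]; gcongr
  · calc _ ≤ 1 * (K' * |z.2 - z'.2|) := mul_le_mul (hf _) (hgl _ _) (abs_nonneg _) zero_le_one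
      _ ≤ _ := by rw [one_mul]; gcongr

section
@[fun_prop]
def BL {F : Type*} [NormedAddCommGroup F] (f : 𝓩 E → F) : Prop :=
  Bdd f ∧ Bdd (fun x : E => f (x, 0)) ∧ ∃ K : ℝ, 0 ≤ K ∧ ∀ x s s', ‖f (x, s) - f (x, s')‖ ≤ K * |s - s'|

section BL
variable {F F' : Type*} [NormedAddCommGroup F] [NormedSpace ℝ F] [NormedAddCommGroup F'] [NormedSpace ℝ F']
lemma BL.bd {f : 𝓩 E → F} (h : BL f) : Bdd f := h.1
@[fun_prop] lemma BL.const (c : F) : BL (fun _ : 𝓩 E => c) := ⟨by fun_prop, by fun_prop, 0, le_rfl, by simp⟩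
@[fun_prop] lemma BL.bil {B : 𝓩 E → (F →L[ℝ] F')} {f : 𝓩 E → F}
    (hB : BL B) (hf : BL f) : BL (fun z => B z (f z)) := by
  obtain ⟨C, hC0, hC⟩ := hB.1.exC; obtain ⟨D, hD0, hD⟩ := hf.1.exC
  obtain ⟨hB1, hB2, K, hK0, hK⟩ := hB
  obtain ⟨hf1, hf2, K', hK0', hK'⟩ := hf
  refine ⟨hB1.bil hf1, hB2.bil hf2, K * D + C * K', by positivity, fun x s s' => ?_⟩
  have h1 : B (x,s) (f (x,s)) - B (x,s') (f (x,s')) = (B (x,s) - B (x,s')) (f (x,s)) + B (x,s') (f (x,s) - f (x,s')) := by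
    simp only [sub_apply, map_sub]; abel
  rw [h1]
  refine (norm_add_le _ _).trans ?_
  rw [add_mul]
  refine add_le_add ?_ ?_
  · refine (ContinuousLinearMap.le_opNorm _ _).trans ?_
    calc _ ≤ (K * |s - s'|) * D := mul_le_mul (hK _ _ _) (hD _) (norm_nonneg _) (by positivity)
      _ = _ := by ring
  · refine (ContinuousLinearMap.le_opNorm _ _).trans ?_
    calc _ ≤ C * (K' * |s - s'|) := mul_le_mul (hC _) (hK' _ _ _) (norm_nonneg _) (by positivity)
      _ = _ := by ring
@[fun_prop] lemma BL.mul {f g : 𝓩 E → ℝ}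
    (hf : BL f) (hg : BL g) : BL (fun z => f z * g z) := by
  have : BL (fun z => (ContinuousLinearMap.mul ℝ ℝ) (f z) (g z)) := by fun_prop
  exact this
@[fun_prop] lemma BL.add {f g : 𝓩 E → F}
    (hf : BL f) (hg : BL g) : BL (fun z => f z + g z) := by
  obtain ⟨hB1, hB2, K, hK0, hK⟩ := hf
  obtain ⟨hf1, hf2, K', hK0', hK'⟩ := hg
  refine ⟨hB1.add hf1, hB2.add hf2, K + K', by positivity, fun x s s' => ?_⟩
  rw [add_sub_add_comm, add_mul]
  exact (norm_add_le _ _).trans (add_le_add (hK _ _ _) (hK' _ _ _))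
lemma Lip.BL {f : 𝓩 E → F} (hf : Lip f) (D : ℝ) (hD : ∀ z, ‖f z‖ ≤ D) : BL f := by
  obtain ⟨K, hK0, hK⟩ := hf.norm
  obtain ⟨K', hK'⟩ := hf
  refine ⟨⟨hK'.continuous.aestronglyMeasurable, D, hD⟩, ⟨(hK'.continuous.comp (by fun_prop : Continuous (fun x : E => (x, (0:ℝ))))).aestronglyMeasurable, D, fun x => hD _⟩, K, hK0, fun x s s' => ?_⟩
  refine (hK _ _).trans (le_of_eq ?_)
  simp

lemma BL.at0 {f : 𝓩 E → F} (hf : BL f) : Bdd (fun x : E => f (x, 0)) := hf.2.1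

lemma BL.slice {f : 𝓩 E → ℝ} (hf : BL f) (b : ℝ) : ∃ K : ℝ, 0 ≤ K ∧ ∀ δ, 0 ≤ δ →
    |(∫ z in box E b 0 δ, f z) - δ * ∫ x in ball (0:E) b, f (x,0)| ≤ K * δ^2 := by
  obtain ⟨hf1, hf2, K, hK0, hK⟩ := hf
  refine ⟨K * volume.real (ball (0:E) b), by positivity, fun δ hδ => ?_⟩
  refine Rell.slice hf1 hf2 b δ K hδ hK0 fun x s h1 h2 => ?_
  have := hK x s 0
  rwa [sub_zero, abs_of_pos h1] at this
end BL

def dtL (E Y : Type*) [NormedAddCommGroup E] [NormedSpace ℝ E] [NormedAddCommGroup Y] [NormedSpace ℝ Y] :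
    Y →L[ℝ] 𝓛 E Y := ContinuousLinearMap.smulRightL ℝ 𝓩 E Y (ContinuousLinearMap.snd ℝ E ℝ)

lemma dtL_apply (y : Y) : dtL E Y y = (ContinuousLinearMap.snd ℝ E ℝ).smulRight y := rfl
lemma dtL_apply' (y : Y) (z : 𝓩 E) : dtL E Y y z = z.2 • y := rfl

structure Sys (c₀ c₁ τ lam r : ℝ) (B : 𝓩 E → 𝓑 E Y)
    (u : 𝓩 E → Y) (p : 𝓩 E → 𝓛 E Y) : Prop where
  hc0 : 0 < c₀
  hc1 : 0 < c₁
  ht : 0 < τ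
  hl : 0 < lam
  hl1 : lam < 1
  hr : 0 < r
  bB : BL B
  symm : ∀ z ξ η, B z ξ η = B z η ξ
  lower : ∀ z ξ, c₀ * ‖ξ‖^2 ≤ B z ξ ξ
  upper : ∀ z, ‖B z‖ ≤ c₁
  hold : ∀ x s s', ‖B (x,s) - B (x,s')‖ ≤ τ * |s - s'| ^ lam
  per : ∀ x s, B (x, s+1) = B (x, s)
  lu : Lip u
  bp : BL p
  der : ∀ᵐ x : E, ∀ s : ℝ, HasFDerivAt u (p (x,s)) (x,s)
  weak : ∀ W : 𝓩 E → Y, Lip W → (∀ z : 𝓩 E, (4*r ≤ ‖z.1‖ ∨ z.2 ≤ 0 ∨ r ≤ z.2) → W z = 0) →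
    ∫ z, B z (p z) (fderiv ℝ W z) = 0

section sys
variable {c₀ c₁ τ lam r : ℝ} {B : 𝓩 E → 𝓑 E Y}
    {u : 𝓩 E → Y} {p : 𝓩 E → 𝓛 E Y}

lemma Sys.up2 (S : Sys c₀ c₁ τ lam r B u p) (z ξ η) : |B z ξ η| ≤ c₁ * ‖ξ‖ * ‖η‖ := by
  rw [← Real.norm_eq_abs]
  refine (ContinuousLinearMap.le_opNorm₂ _ _ _).trans ?_
  gcongr
  exact S.upper z

lemma Sys.der' (S : Sys c₀ c₁ τ lam r B u p) : ∀ᵐ z : 𝓩 E, HasFDerivAt u (p z) z := by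
  rw [Measure.volume_eq_prod]
  have := (Measure.quasiMeasurePreserving_fst (μ := (volume : Measure E)) (ν := (volume : Measure ℝ))).ae S.der
  filter_upwards [this] with z hz
  exact hz z.2

lemma fderiv_ramp {δ : ℝ} (hδ : 0 < δ) (z : 𝓩 E) (h0 : z.2 ≠ 0) (h1 : z.2 ≠ δ) :
    HasFDerivAt (fun z : 𝓩 E => clamp (z.2 / δ))
      (if 0 < z.2 ∧ z.2 < δ then (1/δ) • ContinuousLinearMap.snd ℝ E ℝ else 0) z := by
  have hc : Continuous (fun z : 𝓩 E => z.2) := continuous_snd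
  split_ifs with h
  · have h3 : HasFDerivAt (fun z : 𝓩 E => (1/δ) • z.2) ((1/δ) • ContinuousLinearMap.snd ℝ E ℝ) z :=
      ((1/δ) • ContinuousLinearMap.snd ℝ E ℝ).hasFDerivAt
    refine h3.congr_of_eventuallyEq ?_
    filter_upwards [(isOpen_Ioo.preimage hc).mem_nhds (show z ∈ _ from ⟨h.1, h.2⟩)] with y hy
    simp only [mem_preimage, mem_Ioo] at hy
    rw [clamp_id (by have := hy.1; positivity) (by rw [div_le_one hδ]; exact hy.2.le), smul_eq_mul]; ring
  · rcases lt_or_gt_of_ne h0 with h2 | h2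
    · refine (hasFDerivAt_const (0:ℝ) z).congr_of_eventuallyEq ?_
      filter_upwards [(isOpen_Iio.preimage hc).mem_nhds (show z ∈ _ from h2)] with y hy
      exact clamp_zero (div_nonpos_of_nonpos_of_nonneg (le_of_lt hy) hδ.le)
    · have h4 : δ < z.2 := lt_of_le_of_ne (by by_contra h5; exact h ⟨h2, by linarith⟩) (Ne.symm h1)
      refine (hasFDerivAt_const (1:ℝ) z).congr_of_eventuallyEq ?_
      filter_upwards [(isOpen_Ioi.preimage hc).mem_nhds (show z ∈ _ from h4)] with y hy
      exact clamp_one (by rw [le_div_iff₀ hδ, one_mul]; exact le_of_lt hy)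

lemma ramp_lip {δ : ℝ} (hδ : 0 < δ) : Lip (fun z : 𝓩 E => clamp (z.2 / δ)) := by
  refine Lip.of_norm (1/δ) fun x y => ?_
  rw [Real.norm_eq_abs]
  refine (clamp_lip _ _).trans ?_
  rw [← sub_div, abs_div, abs_of_pos hδ, div_eq_mul_one_div, mul_comm]
  gcongr
  exact norm_snd_le (x - y)

lemma box_in {b : ℝ} {δ r : ℝ} (h : δ ≤ r) : box E b 0 δ ⊆ box E b 0 r := fun z hz => ⟨hz.1, hz.2.1, hz.2.2.trans_le h⟩

lemma Sys.wf (S : Sys c₀ c₁ τ lam r B u p) {W : 𝓩 E → Y} (hW : Lip W) (D : ℝ) (hD : ∀ z, ‖W z‖ ≤ D)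
    (h0 : ∀ z : 𝓩 E, (4*r ≤ ‖z.1‖ ∨ r ≤ z.2) → W z = 0) :
    ∫ z in box E (4*r) 0 r, B z (p z) (fderiv ℝ W z) = - ∫ x in ball (0:E) (4*r), B (x,0) (p (x,0)) (dtL E Y (W (x,0))) := by
  have hr := S.hr
  have hBp := S.bp
  have hBB := S.bB
  have hBp1 := hBp.bd
  have hBB1 := hBB.bd
  have hWb : BL W := hW.BL D hD
  have hWd := hW.bfd
  set f : 𝓩 E → ℝ := fun z => B z (p z) (dtL E Y (W z)) with hf
  have hfb : BL f := (hBB.bil hBp).bil ((BL.const (dtL E Y)).bil hWb)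
  set g : 𝓩 E → ℝ := fun z => B z (p z) (fderiv ℝ W z) with hg
  have hgb : Bdd g := (hBB1.bil hBp1).bil hWd
  obtain ⟨G, hG0, hG⟩ := hgb.exC
  obtain ⟨K, hK0, hK⟩ := hfb.slice (4*r)
  set v := volume.real (ball (0:E) (4*r))
  set I := ∫ z in box E (4*r) 0 r, g z
  set J := ∫ x in ball (0:E) (4*r), f (x,0)
  have key : ∀ δ, 0 < δ → δ < r → |I + J| ≤ (G * v + K) * δ := by
    intro δ hδ hδr
    set θ : 𝓩 E → ℝ := fun z => clamp (z.2 / δ) with hθ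
    have hθl : Lip θ := ramp_lip hδ
    have hθb : Bdd θ := hθl.bdd 1 fun z => clamp_abs _
    have hw := S.weak (fun z => θ z • W z) (hθl.smul hW 1 D (fun z => clamp_abs _) hD) (by
      rintro z (h | h | h)
      · simp [h0 z (Or.inl h)]
      · simp [hθ, clamp_zero (div_nonpos_of_nonpos_of_nonneg h hδ.le)]
      · simp [h0 z (Or.inr h)])
    have e1 : ∀ᵐ z : 𝓩 E, B z (p z) (fderiv ℝ (fun z => θ z • W z) z) =
        (box E (4*r) 0 r).indicator g z - (box E (4*r) 0 δ).indicator (fun z => (1 - θ z) * g z) z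
        + (1/δ) * (box E (4*r) 0 δ).indicator f z := by
      have hW0 : ∀ᵐ z : 𝓩 E, z ∉ box E (4*r) 0 r → fderiv ℝ (fun z => θ z • W z) z = 0 := by
        apply fderiv_off_box
        intro z hz
        simp only [box, mem_ofPred_eq, not_and_or, not_lt] at hz
        rcases hz with h | h | h
        · simp [h0 z (Or.inl h)]
        · simp [hθ, clamp_zero (div_nonpos_of_nonpos_of_nonneg h hδ.le)]
        · simp [h0 z (Or.inr h)]
      filter_upwards [hW0, fderiv_prod_ae hθl hW, ae_ne2 0, ae_ne2 δ] with z h1 h2 h3 h4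
      by_cases hz : z ∈ box E (4*r) 0 r
      · rw [h2, (fderiv_ramp hδ z h3 h4).fderiv, indicator_of_mem hz]
        by_cases hz2 : z ∈ box E (4*r) 0 δ
        · rw [indicator_of_mem hz2, indicator_of_mem hz2, if_pos hz2.2]
          simp only [map_add, map_smul, hg, hf, dtL_apply, smul_eq_mul]
          have : ((1/δ) • ContinuousLinearMap.snd ℝ E ℝ).smulRight (W z) = (1/δ) • (ContinuousLinearMap.snd ℝ E ℝ).smulRight (W z) := by
            ext y <;> simp
          rw [this, map_smul, smul_eq_mul]; ring
        · rw [indicator_of_notMem hz2, indicator_of_notMem hz2]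
          have : ¬ (0 < z.2 ∧ z.2 < δ) := fun h => hz2 ⟨hz.1, h⟩
          rw [if_neg this]
          have h5 : θ z = 1 := clamp_one (by rw [le_div_iff₀ hδ, one_mul]; by_contra h6; exact this ⟨hz.2.1, by linarith⟩)
          have h6 : (0 : 𝓩 E →L[ℝ] ℝ).smulRight (W z) = 0 := by ext <;> simp
          rw [h5, h6]; simp [hg]
      · rw [h1 hz, indicator_of_notMem hz, indicator_of_notMem (fun h => hz (box_in hδr.le h)), indicator_of_notMem (fun h => hz (box_in hδr.le h))]
        simp
    have hgI := hgb.intgOn (box_fin (E := E) (4*r) 0 r)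
    have hgI2 : IntegrableOn (fun z => (1 - θ z) * g z) (box E (4*r) 0 δ) := Bdd.intgOn (by fun_prop) (box_fin _ _ _)
    have hfI := hfb.bd.intgOn (box_fin (E := E) (4*r) 0 δ)
    rw [integral_congr_ae e1, integral_add, integral_sub, integral_const_mul, integral_indicator (box_meas _ _ _), integral_indicator (box_meas _ _ _), integral_indicator (box_meas _ _ _)] at hw
    rotate_left
    · exact hgI.integrable_indicator (box_meas _ _ _)
    · exact hgI2.integrable_indicator (box_meas _ _ _)
    · exact (hgI.integrable_indicator (box_meas _ _ _)).sub (hgI2.integrable_indicator (box_meas _ _ _))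
    · exact (hfI.integrable_indicator (box_meas _ _ _)).const_mul _
    have h5 : |∫ z in box E (4*r) 0 δ, (1 - θ z) * g z| ≤ G * (v * δ) := by
      rw [← Real.norm_eq_abs]
      refine (norm_setIntegral_le_of_norm_le_const (C := G) (box_fin _ _ _) fun z hz => ?_).trans ?_
      · rw [norm_mul]
        have : ‖1 - θ z‖ ≤ 1 := by
          rw [Real.norm_eq_abs, abs_le]
          have := clamp_nonneg (z.2/δ); have := clamp_le (z.2/δ)
          constructor <;> simp only [hθ] <;> linarith
        nlinarith [norm_nonneg (g z), hG z]
      · rw [vol_box _ _ _ hδ.le]; simp [v]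
    have h6 := hK δ hδ.le
    set X := ∫ z in box E (4*r) 0 δ, (1 - θ z) * g z
    set Z := ∫ z in box E (4*r) 0 δ, f z
    have h7 : I + J = X - (1/δ) * (Z - δ * J) := by
      have : (1/δ) * (Z - δ * J) = (1/δ) * Z - J := by field_simp
      rw [this]; linarith
    rw [h7]
    refine (abs_sub _ _).trans ?_
    rw [abs_mul, abs_of_pos (by positivity : 0 < 1/δ)]
    calc _ ≤ G * (v * δ) + (1/δ) * (K * δ^2) := by gcongr
      _ = _ := by field_simp
  have h8 : |I + J| ≤ 0 := by
    by_contra h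
    push Not at h
    set a := |I + J|
    have hv : 0 ≤ v := measureReal_nonneg
    have := key (min (r/2) (a / (2 * (G * v + K + 1)))) (by positivity) (by have := min_le_left (r/2) (a / (2 * (G * v + K + 1))); linarith)
    have h9 : (G * v + K) * min (r/2) (a / (2 * (G * v + K + 1))) ≤ (G * v + K) * (a / (2 * (G * v + K + 1))) := by
      gcongr; exact min_le_right _ _
    have h10 : (G * v + K) * (a / (2 * (G * v + K + 1))) ≤ a / 2 := by
      have : 0 ≤ G * v + K := by positivity
      rw [mul_div_assoc', div_le_div_iff₀ (by positivity) (by positivity)]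
      nlinarith
    linarith
  have := abs_nonpos_iff.1 h8
  linarith
end sys
attribute [simp] Bdd.bil Bdd.add Bdd.sub Bdd.mul Bdd.smul Bdd.pow Bdd.norm Bdd.sh Bdd.const Bdd.smulRight BL.bil BL.const BL.add BL.mul
end

section
variable {c₀ c₁ τ lam r : ℝ} {B : 𝓩 E → 𝓑 E Y}
    {u : 𝓩 E → Y} {p : 𝓩 E → 𝓛 E Y}

lemma Sys.test (S : Sys c₀ c₁ τ lam r B u p) {χ : 𝓩 E → ℝ} (hχ : Lip χ) (hχ0 : ∀ z, 0 ≤ χ z) (hχ1 : ∀ z, χ z ≤ 1)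
    {b t : ℝ} (hb : b ≤ 4 * r) (ht : t ≤ r) (hχs : ∀ z : 𝓩 E, (b ≤ ‖z.1‖ ∨ t ≤ z.2) → χ z = 0)
    {v : 𝓩 E → Y} (hv : Lip v) {P : 𝓩 E → 𝓛 E Y} (hP : Bdd P)
    (hvP : ∀ᵐ z, HasFDerivAt v (P z) z) (k : ℝ) :
    (∫ z in box E b 0 t, χ z * B z (p z) (sh k P z - P z)) +
      ∫ z in box E b 0 t, B z (p z) ((fderiv ℝ χ z).smulRight (sh k v z - v z)) =
    - ∫ x in ball (0:E) b, χ (x,0) * B (x,0) (p (x,0)) (dtL E Y (v (x,k) - v (x,0))) := by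
  have hBp := S.bp.bd
  have hBB := S.bB.bd
  obtain ⟨D, hD⟩ := hv.shbd k
  set w : 𝓩 E → Y := fun z => sh k v z - v z with hw
  have hwl : Lip w := (hv.sh k).sub hv
  have hχa : ∀ z, |χ z| ≤ 1 := fun z => by rw [abs_of_nonneg (hχ0 z)]; exact hχ1 z
  have hwb : Bdd w := hwl.bdd D hD
  have hχb : Bdd χ := hχ.bdd 1 hχa
  have hχd := hχ.bfd
  have hD0 : 0 ≤ D := (norm_nonneg _).trans (hD (0,0))
  have h1 := S.wf (W := fun z => χ z • w z) (hχ.smul hwl 1 D hχa hD) (1 * D) (fun z => by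
    rw [norm_smul]; exact mul_le_mul (hχa z) (hD z) (norm_nonneg _) zero_le_one) (by
    rintro z (h | h)
    · simp [hχs z (Or.inl (hb.trans h))]
    · simp [hχs z (Or.inr (ht.trans h))])
  have e1 : ∀ᵐ z : 𝓩 E, B z (p z) (fderiv ℝ (fun z => χ z • w z) z) = χ z * B z (p z) (sh k P z - P z) + B z (p z) ((fderiv ℝ χ z).smulRight (w z)) := by
    filter_upwards [fderiv_prod_ae hχ hwl, hvP, ae_sh hvP k] with z h2 h3 h4
    have h5 : HasFDerivAt w (sh k P z - P z) z := by
      have : HasFDerivAt (sh k v) (sh k P z) z := by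
        have := (h4 : HasFDerivAt v (P (z + (0,k))) (z + (0,k)))
        exact (hasFDerivAt_comp_add_right (𝕜 := ℝ) (f := v) ((0:E),k)).2 this
      exact this.sub h3
    rw [h2, h5.fderiv]; simp
  have hsub : box E b 0 t ⊆ box E (4*r) 0 r := fun z hz => ⟨hz.1.trans_le hb, hz.2.1, hz.2.2.trans_le ht⟩
  have e2 : ∫ z in box E (4*r) 0 r, B z (p z) (fderiv ℝ (fun z => χ z • w z) z) =
      ∫ z in box E b 0 t, (χ z * B z (p z) (sh k P z - P z) + B z (p z) ((fderiv ℝ χ z).smulRight (w z))) := by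
    rw [setIntegral_congr_ae (box_meas _ _ _) (e1.mono fun z hz _ => hz)]
    apply setIntegral_eq_of_subset_of_forall_sdiff_eq_zero (box_meas _ _ _) hsub
    intro z hz
    have : χ z = 0 := by
      apply hχs
      by_contra h
      push Not at h
      exact hz.2 ⟨h.1, hz.1.2.1, h.2⟩
    have h7 : (0 : 𝓩 E →L[ℝ] ℝ).smulRight (w z) = 0 := by ext <;> simp
    rw [this, fderiv_zero_of_nonneg hχ0 this, h7]; simp
  have e3 : ∫ x in ball (0:E) (4*r), B (x,0) (p (x,0)) (dtL E Y (χ (x,0) • w (x,0))) =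
      ∫ x in ball (0:E) b, χ (x,0) * B (x,0) (p (x,0)) (dtL E Y (v (x,k) - v (x,0))) := by
    symm
    rw [setIntegral_congr_fun (g := fun x => B (x,0) (p (x,0)) (dtL E Y (χ (x,0) • w (x,0)))) measurableSet_ball]
    · symm
      apply setIntegral_eq_of_subset_of_forall_sdiff_eq_zero measurableSet_ball (ball_subset_ball hb)
      intro x hx
      have : χ (x,0) = 0 := hχs _ (Or.inl (by simpa using hx.2))
      simp [this]
    · intro x hx
      simp [hw, sh_apply]
  rw [e2, e3, integral_add] at h1
  · exact h1
  · exact Bdd.intgOn (by simp (maxDischargeDepth := 12) [hBp, hBB, hχb, hP]) (box_fin _ _ _)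
  · exact Bdd.intgOn (by simp (maxDischargeDepth := 12) [hBp, hBB, hχd, hwb]) (box_fin _ _ _)

def chi (b ρ t ρ' : ℝ) : 𝓩 E → ℝ := cut (eta b ρ) (fun s => clamp ((t - s)/ρ'))

lemma chi_nonneg (b ρ t ρ' : ℝ) (z : 𝓩 E) : 0 ≤ chi b ρ t ρ' z := mul_nonneg (clamp_nonneg _) (clamp_nonneg _)
lemma chi_le (b ρ t ρ' : ℝ) (z : 𝓩 E) : chi b ρ t ρ' z ≤ 1 := mul_le_one₀ (clamp_le _) (clamp_nonneg _) (clamp_le _)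
lemma clamp_aff_lip {ρ' : ℝ} (t : ℝ) (h : 0 < ρ') (s s' : ℝ) : |clamp ((t - s)/ρ') - clamp ((t - s')/ρ')| ≤ 1/ρ' * |s - s'| := by
  refine (clamp_lip _ _).trans ?_
  rw [← sub_div, abs_div, abs_of_pos h, div_eq_mul_one_div, mul_comm]
  rw [abs_sub_comm s, show t - s - (t - s') = s' - s by ring]
lemma chi_lip' {b ρ t ρ' : ℝ} (h : 0 < ρ) (h' : 0 < ρ') (z z' : 𝓩 E) :
    |chi b ρ t ρ' z - chi b ρ t ρ' z'| ≤ (1/ρ + 1/ρ') * ‖z - z'‖ :=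
  cut_lip (fun x => clamp_abs _) (fun s => clamp_abs _) (eta_lip b ρ h) (clamp_aff_lip t h') (by positivity) (by positivity) z z'
lemma chi_lip {b ρ t ρ' : ℝ} (h : 0 < ρ) (h' : 0 < ρ') : Lip (chi (E := E) b ρ t ρ') :=
  Lip.of_norm _ (chi_lip' h h')
lemma chi_zero {b ρ t ρ' : ℝ} (h : 0 < ρ) (h' : 0 < ρ') (z : 𝓩 E) (hz : b ≤ ‖z.1‖ ∨ t ≤ z.2) : chi b ρ t ρ' z = 0 := by
  rcases hz with hz | hz
  · simp [chi, cut, eta_zero h hz]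
  · simp [chi, cut, clamp_zero (div_nonpos_of_nonpos_of_nonneg (sub_nonpos.2 hz) h'.le)]
lemma chi_low {b ρ t ρ' : ℝ} (h' : 0 < ρ') (z : 𝓩 E) (hz : z.2 ≤ t - ρ') : chi b ρ t ρ' z = eta b ρ z.1 := by
  simp only [chi, cut]
  rw [clamp_one (by rw [le_div_iff₀ h']; linarith), mul_one]
lemma chi_vert {b ρ t ρ' : ℝ} (h' : 0 < ρ') (x : E) (s s' : ℝ) :
    |chi b ρ t ρ' (x,s) - chi b ρ t ρ' (x,s')| ≤ 1/ρ' * |s - s'| := by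
  simp only [chi, cut]
  rw [← mul_sub, abs_mul]
  have := clamp_aff_lip t h' s s'
  calc _ ≤ 1 * |clamp ((t - s)/ρ') - clamp ((t - s')/ρ')| := by gcongr; exact clamp_abs _
    _ ≤ _ := by rw [one_mul]; exact this
lemma chi_anti {b ρ t ρ' : ℝ} (h' : 0 < ρ') (x : E) {s s' : ℝ} (h : s ≤ s') :
    chi b ρ t ρ' (x,s') ≤ chi b ρ t ρ' (x,s) := by
  simp only [chi, cut]
  apply mul_le_mul_of_nonneg_left _ (clamp_nonneg _)
  apply clamp_mono; gcongr

lemma fderiv_le {F : Type*} [NormedAddCommGroup F] [NormedSpace ℝ F] {χ : 𝓩 E → F} {Λ : ℝ} (hΛ : 0 ≤ Λ) (h : ∀ z z', ‖χ z - χ z'‖ ≤ Λ * ‖z - z'‖) (z) : ‖fderiv ℝ χ z‖ ≤ Λ := by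
  have : LipschitzWith Λ.toNNReal χ := LipschitzWith.of_dist_le_mul fun x y => by
    rw [dist_eq_norm, dist_eq_norm, Real.coe_toNNReal _ hΛ]; exact h x y
  simpa [Real.coe_toNNReal _ hΛ] using norm_fderiv_le_of_lipschitz ℝ this (x₀ := z)

lemma Sys.err (S : Sys c₀ c₁ τ lam r B u p) {χ : 𝓩 E → ℝ} {Λ h : ℝ} (hΛ : 0 ≤ Λ) (hh : 0 < h)
    (hχ : ∀ z, ‖fderiv ℝ χ z‖ ≤ Λ) (z : 𝓩 E) (ξ : 𝓛 E Y) (y : Y) :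
    |B z ξ ((fderiv ℝ χ z).smulRight y)| ≤ c₁ * Λ * (h/2 * ‖ξ‖^2 + 1/(2*h) * ‖y‖^2) := by
  have hc1 := S.hc1
  refine (S.up2 z _ _).trans ?_
  rw [ContinuousLinearMap.norm_smulRight_apply, mul_assoc, mul_assoc]
  refine mul_le_mul_of_nonneg_left ?_ hc1.le
  have h1 : ‖ξ‖ * ‖y‖ ≤ h/2 * ‖ξ‖^2 + 1/(2*h) * ‖y‖^2 := by
    have : h/2 * ‖ξ‖^2 + 1/(2*h) * ‖y‖^2 - ‖ξ‖ * ‖y‖ = (h * ‖ξ‖ - ‖y‖)^2/(2*h) := by field_simp; ring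
    have : 0 ≤ (h * ‖ξ‖ - ‖y‖)^2/(2*h) := by positivity
    linarith
  calc ‖ξ‖ * (‖fderiv ℝ χ z‖ * ‖y‖) = ‖fderiv ℝ χ z‖ * (‖ξ‖ * ‖y‖) := by ring
    _ ≤ Λ * (h/2 * ‖ξ‖^2 + 1/(2*h) * ‖y‖^2) := mul_le_mul (hχ z) h1 (by positivity) hΛ
end

section
variable {c₀ c₁ τ lam r : ℝ} {B : 𝓩 E → 𝓑 E Y}
    {u : 𝓩 E → Y} {p : 𝓩 E → 𝓛 E Y}

lemma box_shift {F : Type*} [NormedAddCommGroup F] [NormedSpace ℝ F] (b lo hi h : ℝ) (f : 𝓩 E → F) :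
    ∫ z in box E b lo hi, sh h f z = ∫ z in box E b (lo + h) (hi + h), f z := by
  rw [← integral_indicator (box_meas _ _ _), ← integral_indicator (box_meas _ _ _), ← integral_sh h ((box E b (lo+h) (hi+h)).indicator f)]
  congr 1; ext z
  have : z ∈ box E b lo hi ↔ z + (0,h) ∈ box E b (lo+h) (hi+h) := by
    simp [box]
  simp only [sh]
  by_cases hz : z ∈ box E b lo hi
  · rw [indicator_of_mem hz, indicator_of_mem (this.1 hz)]; rfl
  · rw [indicator_of_notMem hz, indicator_of_notMem (fun h => hz (this.2 h))]

lemma box_mono {b b' lo hi lo' hi' : ℝ} (hb : b ≤ b') (h1 : lo' ≤ lo) (h2 : hi ≤ hi') : box E b lo hi ⊆ box E b' lo' hi' :=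
  fun z hz => ⟨hz.1.trans_le hb, h1.trans_lt hz.2.1, hz.2.2.trans_le h2⟩

lemma int_mono {f g : 𝓩 E → ℝ} (hf : Bdd f) (hg : Bdd g) {R : Set 𝓩 E} (hm : MeasurableSet R) (hR : volume R < ⊤) (h : ∀ z ∈ R, f z ≤ g z) :
    ∫ z in R, f z ≤ ∫ z in R, g z :=
  setIntegral_mono_on (hf.intgOn hR) (hg.intgOn hR) hm h

lemma int_sub_mono {f : 𝓩 E → ℝ} (hf : Bdd f) {b b' lo hi lo' hi' : ℝ} (hb : b ≤ b') (h1 : lo' ≤ lo) (h2 : hi ≤ hi') (h : ∀ z, 0 ≤ f z) :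
    ∫ z in box E b lo hi, f z ≤ ∫ z in box E b' lo' hi', f z :=
  setIntegral_mono_set (hf.intgOn (box_fin _ _ _)) (Eventually.of_forall h) (LE.le.eventuallyLE (box_mono hb h1 h2))

lemma box_split {f : 𝓩 E → ℝ} (hf : Bdd f) (b : ℝ) {lo mid hi : ℝ} (h1 : lo ≤ mid) (h2 : mid ≤ hi) :
    ∫ z in box E b lo hi, f z = (∫ z in box E b lo mid, f z) + ∫ z in box E b mid hi, f z := by
  rw [← setIntegral_union]
  · apply setIntegral_congr_set
    filter_upwards [ae_ne2 mid] with z hz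
    apply propext
    change z ∈ box E b lo hi ↔ z ∈ box E b lo mid ∪ box E b mid hi
    simp only [box, mem_union, mem_ofPred_eq]
    constructor
    · rintro ⟨a, c, d⟩
      rcases lt_or_gt_of_ne hz with h | h
      · exact Or.inl ⟨a, c, h⟩
      · exact Or.inr ⟨a, h, d⟩
    · rintro (⟨a, c, d⟩ | ⟨a, c, d⟩)
      · exact ⟨a, c, d.trans_le h2⟩
      · exact ⟨a, h1.trans_lt c, d⟩
  · rw [Set.disjoint_left]
    intro z h1 h2
    exact absurd h1.2.2 (not_lt.2 h2.2.1.le)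
  · exact box_meas _ _ _
  · exact hf.intgOn (box_fin _ _ _)
  · exact hf.intgOn (box_fin _ _ _)

lemma norm_vert_le (q : 𝓛 E Y) : ‖q (0,1)‖ ≤ ‖q‖ := by
  refine (q.le_opNorm _).trans ?_
  rw [Prod.norm_def]; simp

lemma vd' {f : 𝓩 E → Y} (hf : Lip f) {P : 𝓩 E → 𝓛 E Y} (hP : Bdd P) (hfP : ∀ᵐ z, HasFDerivAt f (P z) z)
    {h b lo hi : ℝ} (hh : 0 ≤ h) :
    ∫ z in box E b lo hi, ‖sh h f z - f z‖^2 ≤ h^2 * ∫ z in box E b lo (hi+h), ‖P z‖^2 := by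
  have hfb := hf.bfd
  obtain ⟨K, hK⟩ := hf
  refine (vd hK h hh (box_meas _ _ _) (box_meas b lo (hi+h)) (box_fin _ _ _) (box_fin _ _ _) fun z hz σ h1 h2 => ⟨hz.1, by have := hz.2.1; simp; linarith, by have := hz.2.2; simp; linarith⟩).trans ?_
  gcongr ?_ * ?_
  apply setIntegral_mono_ae
  · exact Bdd.intgOn (by simp (maxDischargeDepth := 12) [hfb]) (box_fin _ _ _)
  · exact Bdd.intgOn (by simp (maxDischargeDepth := 12) [hP]) (box_fin _ _ _)
  · filter_upwards [hfP] with z hz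
    rw [hz.fderiv]
    gcongr
    exact norm_vert_le _

lemma vd'' {f : 𝓩 E → Y} (hf : Lip f) {P : 𝓩 E → 𝓛 E Y} (hP : Bdd P) (hfP : ∀ᵐ z, HasFDerivAt f (P z) z)
    {h b lo hi : ℝ} (hh : 0 ≤ h) :
    ∫ z in box E b lo hi, ‖sh (-h) f z - f z‖^2 ≤ h^2 * ∫ z in box E b (lo-h) hi, ‖P z‖^2 := by
  have h1 := vd' hf hP hfP (b := b) (lo := lo - h) (hi := hi - h) hh
  have h2 := box_shift b (lo - h) (hi - h) h (fun z => ‖sh (-h) f z - f z‖^2)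
  rw [sub_add_cancel, sub_add_cancel] at h2
  rw [sub_add_cancel] at h1
  rw [← h2]
  refine le_trans (le_of_eq ?_) h1
  congr 1; ext z
  simp only [sh]
  rw [norm_sub_rev]
  congr 3
  rw [add_assoc]; simp [show ((0:E),(0:ℝ)) = 0 from rfl]

lemma intE_mono {f g : E → ℝ} (hf : Bdd f) (hg : Bdd g) (b : ℝ) (h : ∀ x, f x ≤ g x) :
    ∫ x in ball (0:E) b, f x ≤ ∫ x in ball (0:E) b, g x :=
  setIntegral_mono (hf.intgOn measure_ball_lt_top) (hg.intgOn measure_ball_lt_top) h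

lemma Sys.bdry (S : Sys c₀ c₁ τ lam r B u p) {η : E → ℝ} (hη : Bdd η) (h0 : ∀ x, 0 ≤ η x) (b h : ℝ) (hh : 0 ≤ h) :
    ∫ x in ball (0:E) b, η x * ‖u (x,h) - u (x,0)‖^2 ≤ h * ∫ z in box E b 0 h, η z.1 * ‖p z‖^2 := by
  have hp := S.bp.bd
  have hη2 := bdd_fst hη
  obtain ⟨K, hK⟩ := S.lu
  have hb : Bdd (fun z : 𝓩 E => η z.1 * ‖p z‖^2) := by simp (maxDischargeDepth := 12) [hp, hη2]
  have hi : IntegrableOn (fun z : 𝓩 E => η z.1 * ‖p z‖^2) (ball (0:E) b ×ˢ Ioo 0 h) := by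
    rw [← box_eq]; exact hb.intgOn (box_fin _ _ _)
  rw [box_eq, Measure.volume_eq_prod, setIntegral_prod _ hi, ← integral_const_mul]
  have hi2 : IntegrableOn (fun z : 𝓩 E => η z.1 * ‖p z‖^2) (ball (0:E) b ×ˢ Ioo 0 h) (volume.prod volume) := hi
  rw [IntegrableOn, ← Measure.prod_restrict] at hi2
  apply integral_mono_of_nonneg
  · exact Eventually.of_forall fun x => mul_nonneg (h0 x) (by positivity)
  · exact hi2.integral_prod_left.const_mul _
  · apply ae_restrict_of_ae
    have h3 : ∀ᵐ x : E, ∀ᵐ t : ℝ, u (x,t) = u (x,t) := by simp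
    filter_upwards [S.der] with x hx
    have hd : ∀ t, HasDerivAt (fun t => u (x,t)) (p (x,t) (0,1)) t := by
      intro t
      have := (hx t).comp_hasDerivAt t ((hasDerivAt_const t x).prodMk (hasDerivAt_id t))
      exact this
    have hl : LipschitzWith K (fun t => u (x,t)) := by
      have := hK.comp (LipschitzWith.prodMk_left x)
      rw [mul_one] at this; exact this
    have h1 := vd_line (fun t => u (x,t)) hl 0 h hh
    simp only [zero_add] at h1
    have h2 := sq_int_le (fun t => ‖deriv (fun t => u (x,t)) t‖) (stronglyMeasurable_deriv _).norm K (fun t => by simpa using norm_deriv_le_of_lipschitz hl) h hh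
    have h4 : ‖u (x,h) - u (x,0)‖^2 ≤ h * ∫ t in Ioo 0 h, ‖p (x,t)‖^2 := by
      calc _ ≤ _ := pow_le_pow_left₀ (norm_nonneg _) h1 2
        _ ≤ _ := h2
        _ ≤ _ := by
          rw [intervalIntegral.integral_of_le hh, integral_Ioc_eq_integral_Ioo]
          gcongr ?_ * ?_
          obtain ⟨hp1, hp2, KK, hKK, hKl⟩ := S.bp
          have hc : Continuous fun t => p (x,t) := by
            have : LipschitzWith KK.toNNReal (fun t => p (x,t)) := LipschitzWith.of_dist_le_mul fun s t => by
              rw [dist_eq_norm, Real.dist_eq, Real.coe_toNNReal _ hKK]; exact hKl x s t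
            exact this.continuous
          apply integral_mono_of_nonneg
          · exact Eventually.of_forall fun x => by positivity
          · exact ((hc.norm.pow 2).integrableOn_Icc (a := 0) (b := h)).mono_set Ioo_subset_Icc_self
          · refine Eventually.of_forall fun t => ?_
            simp only
            rw [(hd t).deriv]
            gcongr
            exact norm_vert_le _
    simp only [integral_const_mul]
    calc _ ≤ η x * (h * ∫ t in Ioo 0 h, ‖p (x,t)‖^2) := mul_le_mul_of_nonneg_left h4 (h0 x)
      _ = _ := by ring
end

section
variable {c₀ c₁ τ lam r : ℝ} {B : 𝓩 E → 𝓑 E Y}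
    {u : 𝓩 E → Y} {p : 𝓩 E → 𝓛 E Y}

def nuB (B : 𝓩 E → 𝓑 E Y) (p : 𝓩 E → 𝓛 E Y) (x : E) : Y →L[ℝ] ℝ :=
  (B (x,0) (p (x,0))).comp (dtL E Y)

def eng (p : 𝓩 E → 𝓛 E Y) (b h : ℝ) : ℝ := ∫ z in box E b 0 h, ‖p z‖^2

lemma Sys.bn (S : Sys c₀ c₁ τ lam r B u p) : Bdd (nuB B p) := by
  have h1 := (S.bB.bil S.bp).at0
  obtain ⟨h2, C, hC⟩ := h1
  refine ⟨?_, C * ‖dtL E Y‖, fun x => (ContinuousLinearMap.opNorm_comp_le _ _).trans (by gcongr; exact hC x)⟩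
  exact ((ContinuousLinearMap.compL ℝ Y 𝓛 E Y ℝ).flip (dtL E Y)).continuous.comp_aestronglyMeasurable h2

lemma Sys.bp2 (S : Sys c₀ c₁ τ lam r B u p) : Bdd (fun z => ‖p z‖^2) := by simp [S.bp.bd]

lemma eng_mono (S : Sys c₀ c₁ τ lam r B u p) {b b' h h' : ℝ} (hb : b ≤ b') (hh : h ≤ h') : eng p b h ≤ eng p b' h' :=
  int_sub_mono S.bp2 hb le_rfl hh fun z => by positivity

lemma eng_nonneg (p : 𝓩 E → 𝓛 E Y) (b h : ℝ) : 0 ≤ eng p b h := by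
  unfold eng; positivity

lemma Sys.cs (S : Sys c₀ c₁ τ lam r B u p) (z) (ξ ζ : 𝓛 E Y) : 2 * B z ξ (ζ - ξ) ≤ B z ζ ζ - B z ξ ξ := by
  have h1 := S.lower z (ζ - ξ)
  have h2 : 0 ≤ c₀ * ‖ζ - ξ‖^2 := by have := S.hc0; positivity
  have h3 := S.symm z ζ ξ
  simp only [map_sub, sub_apply] at *
  linarith

lemma eng_eta (S : Sys c₀ c₁ τ lam r B u p) {a ρ h : ℝ} (hρ : 0 < ρ) :
    eng p a h ≤ ∫ z in box E (a+ρ) 0 h, eta (a+ρ) ρ z.1 * ‖p z‖^2 := by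
  have hp := S.bp.bd
  have hηl : Lip (fun z : 𝓩 E => eta (a+ρ) ρ z.1) := Lip.of_norm (1/ρ) fun x y => by
    refine (eta_lip _ _ hρ _ _).trans ?_
    gcongr; exact norm_fst_le (x - y)
  have hη : Bdd (fun z : 𝓩 E => eta (a+ρ) ρ z.1) := hηl.bdd 1 fun z => clamp_abs _
  have h1 : Bdd (fun z : 𝓩 E => eta (a+ρ) ρ z.1 * ‖p z‖^2) := by simp (maxDischargeDepth := 12) [hη, hp]
  calc eng p a h = ∫ z in box E a 0 h, eta (a+ρ) ρ z.1 * ‖p z‖^2 := by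
        apply setIntegral_congr_fun (box_meas _ _ _)
        intro z hz
        simp only
        rw [eta_one hρ (by have := hz.1; linarith), one_mul]
    _ ≤ _ := int_sub_mono h1 (by linarith) le_rfl le_rfl fun z => mul_nonneg (clamp_nonneg _) (by positivity)

lemma Sys.errI (S : Sys c₀ c₁ τ lam r B u p) {b ρ h : ℝ} (hρ : 0 < ρ) (hh : 0 < h) (hhρ : h ≤ ρ) {v : 𝓩 E → Y} {P : 𝓩 E → 𝓛 E Y}
    (k X : ℝ) (hv : Lip v) (h1 : ∫ z in box E b 0 (2*ρ), ‖sh k v z - v z‖^2 ≤ h^2 * X) (hX : eng p b (2*ρ) ≤ X) :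
    |2 * ∫ z in box E b 0 (2*ρ), B z (p z) ((fderiv ℝ (chi (E := E) b ρ (2*ρ) ρ) z).smulRight (sh k v z - v z))| ≤ 4 * c₁ * (h/ρ) * X := by
  have hc1 := S.hc1
  have hp := S.bp.bd
  have hB := S.bB.bd
  obtain ⟨D, hD⟩ := hv.shbd k
  have hw : Bdd (fun z => sh k v z - v z) := ((hv.sh k).sub hv).bdd D hD
  have hχd := fderiv_le (Λ := 1/ρ+1/ρ) (χ := chi (E := E) b ρ (2*ρ) ρ) (by positivity) (chi_lip' (E := E) (b := b) (t := 2*ρ) hρ hρ)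
  have hχ : Bdd (fun z => fderiv ℝ (chi (E := E) b ρ (2*ρ) ρ) z) := (chi_lip hρ hρ).bfd
  have e1 := S.err (h := h) (by positivity) hh hχd
  have hw2 : Bdd (fun z => ‖sh k v z - v z‖^2) := by simp [hw]
  have hfin := box_fin (E := E) b 0 (2*ρ)
  rw [abs_mul, abs_two]
  have : |∫ z in box E b 0 (2*ρ), B z (p z) ((fderiv ℝ (chi (E := E) b ρ (2*ρ) ρ) z).smulRight (sh k v z - v z))| ≤
      ∫ z in box E b 0 (2*ρ), (c₁ * (1/ρ+1/ρ)) * (h/2 * ‖p z‖^2 + 1/(2*h) * ‖sh k v z - v z‖^2) := by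
    rw [← Real.norm_eq_abs]
    apply norm_integral_le_of_norm_le
    · exact Bdd.intgOn (by simp (maxDischargeDepth := 12) [S.bp2, hw2]) hfin
    · exact Eventually.of_forall fun z => e1 z _ _
  rw [integral_const_mul, integral_add ((S.bp2.intgOn hfin).const_mul _) ((hw2.intgOn hfin).const_mul _), integral_const_mul, integral_const_mul] at this
  have h2 : h/2 * (∫ z in box E b 0 (2*ρ), ‖p z‖^2) + 1/(2*h) * ∫ z in box E b 0 (2*ρ), ‖sh k v z - v z‖^2 ≤ h * X := by
    calc _ ≤ h/2 * X + 1/(2*h) * (h^2 * X) := by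
          apply add_le_add <;> apply mul_le_mul_of_nonneg_left _ (by positivity)
          · exact hX
          · exact h1
      _ = _ := by field_simp; ring
  have h3 := mul_le_mul_of_nonneg_left h2 (show 0 ≤ c₁ * (1/ρ+1/ρ) by positivity)
  calc _ ≤ 2 * (c₁ * (1/ρ+1/ρ) * (h * X)) := by linarith
    _ = _ := by field_simp; ring

lemma Sys.starN (S : Sys c₀ c₁ τ lam r B u p) {a ρ h o : ℝ} (hρ : 0 < ρ) (hh : 0 < h) (hhρ : h ≤ ρ) (ha : a + ρ ≤ 4*r) (h2ρ : 2*ρ ≤ r)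
    (ho0 : 0 ≤ o) (ho : ∀ x s, ‖B (x,s+h) - B (x,s)‖ ≤ o) :
    c₀/2 * eng p a h ≤ (2*h/c₀) * (∫ x in ball (0:E) (a+ρ), ‖nuB B p x‖^2) + (5*c₁*(h/ρ)+o) * eng p (a+ρ) (3*ρ) := by
  have hc0 := S.hc0
  have hc1 := S.hc1
  have hp := S.bp.bd
  have hB := S.bB.bd
  set b := a + ρ with hb
  set χ := chi (E := E) b ρ (2*ρ) ρ with hχdef
  have hχl : Lip χ := chi_lip hρ hρ
  have hχ0 : ∀ z, 0 ≤ χ z := chi_nonneg _ _ _ _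
  have hχ1 : ∀ z, χ z ≤ 1 := chi_le _ _ _ _
  have hχb : Bdd χ := hχl.bdd 1 fun z => by rw [Real.norm_eq_abs, abs_of_nonneg (hχ0 z)]; exact hχ1 z
  have hχs : ∀ z : 𝓩 E, (b ≤ ‖z.1‖ ∨ 2*ρ ≤ z.2) → χ z = 0 := chi_zero hρ hρ
  have key := S.test hχl hχ0 hχ1 ha h2ρ hχs S.lu hp S.der' h
  set X1 := ∫ z in box E b 0 (2*ρ), χ z * B z (p z) (sh h p z - p z) with hX1
  set X2 := ∫ z in box E b 0 (2*ρ), B z (p z) ((fderiv ℝ χ z).smulRight (sh h u z - u z)) with hX2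
  set g : 𝓩 E → ℝ := fun z => B z (p z) (p z) with hg
  have hgb : Bdd g := (hB.bil hp).bil hp
  have hg0 : ∀ z, 0 ≤ g z := fun z => le_trans (by positivity) (S.lower z (p z))
  have hg1 : ∀ z, g z ≤ c₁ * ‖p z‖^2 := fun z => by
    have := (le_abs_self _).trans (S.up2 z (p z) (p z)); simp only [hg]; linarith
  have hfin := box_fin (E := E) b 0 (2*ρ)
  have hL3 : ∫ z in box E b h (2*ρ+h), ‖p z‖^2 ≤ eng p b (3*ρ) :=
    int_sub_mono S.bp2 le_rfl hh.le (by linarith) fun z => by positivity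
  -- X1
  have b1 : 2 * X1 ≤ - (c₀ * ∫ z in box E b 0 h, eta b ρ z.1 * ‖p z‖^2) + (c₁*(h/ρ) + o) * eng p b (3*ρ) := by
    have t1 : 2 * X1 ≤ ∫ z in box E b 0 (2*ρ), (sh h (fun z => χ z * g z + (h/ρ*c₁ + o) * ‖p z‖^2) z - χ z * g z) := by
      rw [hX1, ← integral_const_mul]
      apply int_mono _ _ (box_meas _ _ _) hfin
      · rintro ⟨x,s⟩ -
        have q1 := S.cs (x,s) (p (x,s)) (p (x,s+h))
        have q2 : B (x,s) (p (x,s+h)) (p (x,s+h)) ≤ g (x,s+h) + o * ‖p (x,s+h)‖^2 := by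
          have := (B (x,s+h) - B (x,s)).le_opNorm₂ (p (x,s+h)) (p (x,s+h))
          rw [Real.norm_eq_abs] at this
          have h4 := (neg_le_abs _).trans this
          have h5 : ‖B (x,s+h) - B (x,s)‖ * ‖p (x,s+h)‖ * ‖p (x,s+h)‖ ≤ o * ‖p (x,s+h)‖ * ‖p (x,s+h)‖ := by
            gcongr; exact ho x s
          simp only [sub_apply] at h4
          simp only [hg]
          linarith
        have q3 : χ (x,s) ≤ χ (x,s+h) + h/ρ := by
          have := chi_vert (E := E) (b := b) (ρ := ρ) (t := 2*ρ) hρ x s (s+h)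
          have h6 := (le_abs_self _).trans this
          rw [show s - (s+h) = -h by ring, abs_neg, abs_of_pos hh] at h6
          have : 1/ρ*h = h/ρ := by ring
          simp only [hχdef]; linarith
        have e : ((x,s):𝓩 E) + (0,h) = (x,s+h) := by simp
        simp only [sh, e]
        have q4 : χ (x,s) * (2 * B (x,s) (p (x,s)) (p (x,s+h) - p (x,s))) ≤ χ (x,s) * (g (x,s+h) + o * ‖p (x,s+h)‖^2 - g (x,s)) :=
          mul_le_mul_of_nonneg_left (by simp only [hg] at *; linarith) (hχ0 _)
        have q5 : χ (x,s) * g (x,s+h) ≤ (χ (x,s+h) + h/ρ) * g (x,s+h) := mul_le_mul_of_nonneg_right q3 (hg0 _)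
        have q6 : h/ρ * g (x,s+h) ≤ h/ρ * (c₁ * ‖p (x,s+h)‖^2) := mul_le_mul_of_nonneg_left (hg1 _) (by positivity)
        have q7 : χ (x,s) * (o * ‖p (x,s+h)‖^2) ≤ 1 * (o * ‖p (x,s+h)‖^2) := mul_le_mul_of_nonneg_right (hχ1 _) (by positivity)
        linarith
      · simp (maxDischargeDepth := 12) [hχb, hB, hp]
      · simp (maxDischargeDepth := 12) [hχb, hgb, hp]
    have hbig : Bdd (fun z => χ z * g z + (h/ρ*c₁ + o) * ‖p z‖^2) := by simp (maxDischargeDepth := 12) [hχb, hgb, hp]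
    have hcg : Bdd (fun z => χ z * g z) := by simp (maxDischargeDepth := 12) [hχb, hgb]
    rw [integral_sub ((hbig.sh h).intgOn hfin) (hcg.intgOn hfin), box_shift, zero_add,
      integral_add (hcg.intgOn (box_fin _ _ _)) ((S.bp2.intgOn (box_fin _ _ _)).const_mul _), integral_const_mul] at t1
    rw [box_split hcg b (lo := h) (mid := 2*ρ) (by linarith) (by linarith), box_split hcg b (lo := 0) (mid := h) (hi := 2*ρ) hh.le (by linarith)] at t1
    have t2 : ∫ z in box E b (2*ρ) (2*ρ+h), χ z * g z = 0 := by
      apply setIntegral_eq_zero_of_forall_eq_zero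
      intro z hz
      rw [hχs z (Or.inr hz.2.1.le), zero_mul]
    have t3 : c₀ * ∫ z in box E b 0 h, eta b ρ z.1 * ‖p z‖^2 ≤ ∫ z in box E b 0 h, χ z * g z := by
      rw [← integral_const_mul]
      have hηl : Lip (fun z : 𝓩 E => eta b ρ z.1) := Lip.of_norm (1/ρ) fun x y => by
        refine (eta_lip _ _ hρ _ _).trans ?_
        gcongr; exact norm_fst_le (x - y)
      have hη : Bdd (fun z : 𝓩 E => eta b ρ z.1) := hηl.bdd 1 fun z => clamp_abs _
      apply int_mono (by simp (maxDischargeDepth := 12) [hη, hp]) hcg (box_meas _ _ _) (box_fin _ _ _)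
      intro z hz
      rw [hχdef, chi_low hρ z (by have := hz.2.2; linarith)]
      have : eta b ρ z.1 * (c₀ * ‖p z‖^2) ≤ eta b ρ z.1 * g z := mul_le_mul_of_nonneg_left (S.lower z (p z)) (clamp_nonneg _)
      linarith
    have t4 := mul_le_mul_of_nonneg_left hL3 (show 0 ≤ h/ρ*c₁ + o by positivity)
    linarith
  have b2 : |2 * X2| ≤ 4 * c₁ * (h/ρ) * eng p b (3*ρ) := by
    apply S.errI hρ hh hhρ h _ S.lu _ (eng_mono S le_rfl (by linarith)) (P := p)
    refine (vd' S.lu hp S.der' hh.le).trans ?_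
    gcongr
    exact eng_mono S le_rfl (by linarith)
  -- boundary term
  set X3 := ∫ x in ball (0:E) b, χ (x,0) * B (x,0) (p (x,0)) (dtL E Y (u (x,h) - u (x,0))) with hX3
  have b3 : 2 * |X3| ≤ (2*h/c₀) * (∫ x in ball (0:E) b, ‖nuB B p x‖^2) + c₀/2 * ∫ z in box E b 0 h, eta b ρ z.1 * ‖p z‖^2 := by
    have hη0 : Bdd (fun x : E => eta b ρ x) := by
      have : Continuous (fun x : E => eta b ρ x) := by
        have : Lip (fun x : E => eta b ρ x) := Lip.of_norm (1/ρ) fun x y => eta_lip _ _ hρ _ _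
        obtain ⟨K, hK⟩ := this; exact hK.continuous
      exact ⟨this.aestronglyMeasurable, 1, fun x => clamp_abs _⟩
    have hw0 : Bdd (fun x : E => u (x,h) - u (x,0)) := by
      obtain ⟨K, hK⟩ := S.lu
      refine ⟨?_, K * |h|, fun x => ?_⟩
      · have := hK.continuous
        exact Continuous.aestronglyMeasurable (by fun_prop)
      · have := hK.dist_le_mul (x,h) (x,0)
        rw [dist_eq_norm] at this
        simpa [Prod.dist_eq] using this
    have t1 := S.bdry hη0 (fun x => clamp_nonneg _) b h hh.le
    have hw2 : Bdd (fun x : E => eta b ρ x * ‖u (x,h) - u (x,0)‖^2) := by simp (maxDischargeDepth := 12) [hη0, hw0]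
    have hn := S.bn
    have hn2 : Bdd (fun x => ‖nuB B p x‖^2) := by simp [hn]
    have hbf : volume (ball (0:E) b) < ⊤ := measure_ball_lt_top
    have t2 : |X3| ≤ ∫ x in ball (0:E) b, (h/c₀ * ‖nuB B p x‖^2 + c₀/(4*h) * (eta b ρ x * ‖u (x,h) - u (x,0)‖^2)) := by
      rw [← Real.norm_eq_abs]
      apply norm_integral_le_of_norm_le
      · exact ((hn2.intgOn hbf).const_mul _).add ((hw2.intgOn hbf).const_mul _)
      · refine Eventually.of_forall fun x => ?_
        rw [hχdef, chi_low hρ _ (by simp; linarith), Real.norm_eq_abs, abs_mul, abs_of_nonneg (show 0 ≤ eta b ρ ((x,(0:ℝ)):E×ℝ).1 from clamp_nonneg _)]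
        have e1 : |B (x,0) (p (x,0)) (dtL E Y (u (x,h) - u (x,0)))| ≤ ‖nuB B p x‖ * ‖u (x,h) - u (x,0)‖ :=
          (nuB B p x).le_opNorm _
        set A := ‖nuB B p x‖
        set W := ‖u (x,h) - u (x,0)‖
        have e2 : A * W ≤ h/c₀ * A^2 + c₀/(4*h) * W^2 := by
          have : 0 ≤ (h/c₀) * (A - c₀/(2*h) * W)^2 := by positivity
          have e : (h/c₀) * (A - c₀/(2*h) * W)^2 = h/c₀ * A^2 - A * W + c₀/(4*h) * W^2 := by field_simp; ring
          linarith
        have h0 : 0 ≤ eta b ρ x := clamp_nonneg _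
        have h1 : eta b ρ x ≤ 1 := clamp_le _
        calc _ ≤ eta b ρ x * (A*W) := mul_le_mul_of_nonneg_left e1 h0
          _ ≤ eta b ρ x * (h/c₀ * A^2 + c₀/(4*h) * W^2) := mul_le_mul_of_nonneg_left e2 h0
          _ = eta b ρ x * (h/c₀ * A^2) + c₀/(4*h) * (eta b ρ x * W^2) := by ring
          _ ≤ 1 * (h/c₀ * A^2) + c₀/(4*h) * (eta b ρ x * W^2) := by gcongr
          _ = _ := by ring
    rw [integral_add ((hn2.intgOn hbf).const_mul _) ((hw2.intgOn hbf).const_mul _), integral_const_mul, integral_const_mul] at t2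
    have t3 := mul_le_mul_of_nonneg_left t1 (show 0 ≤ c₀/(4*h) by positivity)
    have e5 : c₀/(4*h) * (h * ∫ z in box E b 0 h, eta b ρ z.1 * ‖p z‖^2) = c₀/4 * ∫ z in box E b 0 h, eta b ρ z.1 * ‖p z‖^2 := by
      field_simp
    have e6 : 2 * h/c₀ * (∫ x in ball (0:E) b, ‖nuB B p x‖^2) = 2 * (h/c₀ * (∫ x in ball (0:E) b, ‖nuB B p x‖^2)) := by ring
    rw [e5] at t3
    rw [e6]
    linarith
  have b4 : c₀/2 * eng p a h ≤ c₀/2 * ∫ z in box E b 0 h, eta b ρ z.1 * ‖p z‖^2 :=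
    mul_le_mul_of_nonneg_left (eng_eta S hρ) (by positivity)
  have b5 := le_abs_self (2*X2)
  have b6 := le_abs_self X3
  linarith
end

section
variable {c₀ c₁ τ lam r : ℝ} {B : 𝓩 E → 𝓑 E Y}
    {u : 𝓩 E → Y} {p : 𝓩 E → 𝓛 E Y}

def tanP (E : Type*) [NormedAddCommGroup E] [NormedSpace ℝ E] : 𝓩 E →L[ℝ] 𝓩 E := (ContinuousLinearMap.inl ℝ E ℝ).comp (ContinuousLinearMap.fst ℝ E ℝ)

def tanT (p : 𝓩 E → 𝓛 E Y) (x : E) : 𝓛 E Y := (p (x,0)).comp (tanP E)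

def uhat (u : 𝓩 E → Y) (z : 𝓩 E) : Y := u (z.1, max z.2 0)
open Classical in
def phat (p : 𝓩 E → 𝓛 E Y) (z : 𝓩 E) : 𝓛 E Y := if 0 < z.2 then p z else tanT p z.1

lemma Sys.bT (S : Sys c₀ c₁ τ lam r B u p) : Bdd (tanT p) := by
  obtain ⟨h2, C, hC⟩ := S.bp.at0
  refine ⟨?_, C * ‖tanP E‖, fun x => (ContinuousLinearMap.opNorm_comp_le _ _).trans (by gcongr; exact hC x)⟩
  exact ((ContinuousLinearMap.compL ℝ 𝓩 E 𝓩 E Y).flip (tanP E)).continuous.comp_aestronglyMeasurable h2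

lemma Sys.bphat (S : Sys c₀ c₁ τ lam r B u p) : Bdd (phat p) := by
  have hm : MeasurableSet {z : 𝓩 E | 0 < z.2} := measurableSet_lt measurable_const measurable_snd
  have h1 := S.bp.bd.ind hm
  have h2 := (bdd_fst S.bT).ind hm.compl
  refine (h1.add h2).congr fun z => ?_
  by_cases hz : 0 < z.2
  · simp [phat, hz, indicator]
  · simp [phat, hz, indicator]

lemma Sys.luhat (S : Sys c₀ c₁ τ lam r B u p) : Lip (uhat u) := by
  obtain ⟨K, hK0, hK⟩ := S.lu.norm
  refine Lip.of_norm K fun z z' => (hK _ _).trans ?_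
  gcongr
  rw [Prod.norm_def, Prod.norm_def]
  refine max_le_max le_rfl ?_
  simp only [Prod.snd_sub, Real.norm_eq_abs]
  exact (abs_max_sub_max_le_max _ _ _ _).trans (by simp)

lemma Sys.dhat (S : Sys c₀ c₁ τ lam r B u p) : ∀ᵐ z : 𝓩 E, HasFDerivAt (uhat u) (phat p z) z := by
  have h1 : ∀ᵐ z : 𝓩 E, ∀ s, HasFDerivAt u (p (z.1,s)) (z.1,s) := by
    rw [Measure.volume_eq_prod]
    exact (Measure.quasiMeasurePreserving_fst (μ := (volume : Measure E)) (ν := (volume : Measure ℝ))).ae S.der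
  filter_upwards [h1, ae_ne2 0] with z hz h0
  rcases lt_or_gt_of_ne h0 with h | h
  · have e : phat p z = (p (z.1,0)).comp (tanP E) := by simp [phat, not_lt.2 h.le, tanT]
    rw [e]
    have h2 : HasFDerivAt (fun z : 𝓩 E => (z.1, (0:ℝ))) (tanP E) z := (tanP E).hasFDerivAt
    refine (HasFDerivAt.comp z (hz 0) h2).congr_of_eventuallyEq ?_
    have : ∀ᶠ y : 𝓩 E in 𝓝 z, y.2 < 0 := (isOpen_lt continuous_snd continuous_const).mem_nhds h
    filter_upwards [this] with y hy
    simp [uhat, hy.le]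
  · have e : phat p z = p z := by simp [phat, h]
    rw [e]
    refine (hz z.2).congr_of_eventuallyEq ?_
    have : ∀ᶠ y : 𝓩 E in 𝓝 z, 0 < y.2 := (isOpen_lt continuous_const continuous_snd).mem_nhds h
    filter_upwards [this] with y hy
    simp [uhat, hy.le]

lemma Sys.starD (S : Sys c₀ c₁ τ lam r B u p) {a ρ h o : ℝ} (hρ : 0 < ρ) (hh : 0 < h) (hhρ : h ≤ ρ) (ha : a + ρ ≤ 4*r) (h2ρ : 2*ρ ≤ r)
    (ho0 : 0 ≤ o) (ho : ∀ x s, ‖B (x,s+h) - B (x,s)‖ ≤ o) :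
    c₀/2 * eng p a h ≤ ((5*c₁+c₀)*h) * (∫ x in ball (0:E) (a+ρ), ‖tanT p x‖^2) + (5*c₁*(h/ρ)+o) * eng p (a+ρ) (3*ρ) := by
  have hc0 := S.hc0
  have hc1 := S.hc1
  have hp := S.bp.bd
  have hB := S.bB.bd
  have hT := S.bT
  have hph := S.bphat
  set b := a + ρ with hb
  set χ := chi (E := E) b ρ (2*ρ) ρ with hχdef
  have hχl : Lip χ := chi_lip hρ hρ
  have hχ0 : ∀ z, 0 ≤ χ z := chi_nonneg _ _ _ _
  have hχ1 : ∀ z, χ z ≤ 1 := chi_le _ _ _ _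
  have hχb : Bdd χ := hχl.bdd 1 fun z => by rw [Real.norm_eq_abs, abs_of_nonneg (hχ0 z)]; exact hχ1 z
  have hχs : ∀ z : 𝓩 E, (b ≤ ‖z.1‖ ∨ 2*ρ ≤ z.2) → χ z = 0 := chi_zero hρ hρ
  have key := S.test hχl hχ0 hχ1 ha h2ρ hχs S.luhat S.bphat S.dhat (-h)
  have e0 : ∫ x in ball (0:E) b, χ (x,0) * B (x,0) (p (x,0)) (dtL E Y (uhat u (x,-h) - uhat u (x,0))) = 0 := by
    rw [show (fun x : E => χ (x,0) * B (x,0) (p (x,0)) (dtL E Y (uhat u (x,-h) - uhat u (x,0)))) = fun _ => 0 from ?_, integral_zero]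
    ext x
    simp [uhat, hh.le]
  rw [e0, neg_zero] at key
  set X1 := ∫ z in box E b 0 (2*ρ), χ z * B z (p z) (sh (-h) (phat p) z - phat p z) with hX1
  set X2 := ∫ z in box E b 0 (2*ρ), B z (p z) ((fderiv ℝ χ z).smulRight (sh (-h) (uhat u) z - uhat u z)) with hX2
  set g : 𝓩 E → ℝ := fun z => B z (p z) (p z) with hg
  have hgb : Bdd g := (hB.bil hp).bil hp
  have hg0 : ∀ z, 0 ≤ g z := fun z => le_trans (by positivity) (S.lower z (p z))
  have hfin := box_fin (E := E) b 0 (2*ρ)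
  set NT := ∫ x in ball (0:E) b, ‖tanT p x‖^2 with hNT
  have hNT0 : 0 ≤ NT := by positivity
  have hT2 : Bdd (fun x => ‖tanT p x‖^2) := by simp [hT]
  have hT3 : Bdd (fun z : 𝓩 E => ‖tanT p z.1‖^2) := bdd_fst hT2
  set pt := sh (-h) (phat p) with hpt
  have hptb : Bdd pt := hph.sh _
  have esh : ∀ x s, pt (x,s) = phat p (x,s-h) := fun x s => by simp [hpt, sh, sub_eq_add_neg]
  have hE0 := eng_nonneg p b (2*ρ)
  -- the quadratic term
  set Q := ∫ z in box E b 0 (2*ρ), χ z * ‖pt z - p z‖^2 with hQ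
  have hQb : Bdd (fun z => χ z * ‖pt z - p z‖^2) := by simp (maxDischargeDepth := 12) [hχb, hptb, hp]
  have hcg : Bdd (fun z => χ z * g z) := by simp (maxDischargeDepth := 12) [hχb, hgb]
  have hcp : Bdd (fun z => χ z * B z (pt z) (pt z)) := by simp (maxDischargeDepth := 12) [hχb, hB, hptb]
  have b1 : c₀ * Q + 2 * X1 ≤ (∫ z in box E b 0 (2*ρ), χ z * B z (pt z) (pt z)) - ∫ z in box E b 0 (2*ρ), χ z * g z := by
    have hX1b : Bdd (fun z => χ z * B z (p z) (pt z - phat p z)) := by simp (maxDischargeDepth := 12) [hχb, hB, hptb, hp, hph]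
    rw [← integral_sub (hcp.intgOn hfin) (hcg.intgOn hfin), hQ, hX1, ← integral_const_mul, ← integral_const_mul,
      ← integral_add ((hQb.intgOn hfin).const_mul _) ((hX1b.intgOn hfin).const_mul _)]
    apply int_mono _ _ (box_meas _ _ _) hfin
    · intro z hz
      have e1 : phat p z = p z := by simp [phat, hz.2.1]
      rw [e1]
      have h1 := S.lower z (pt z - p z)
      have h3 := S.symm z (pt z) (p z)
      simp only [map_sub, sub_apply] at *
      have h4 : χ z * (c₀ * ‖pt z - p z‖ ^ 2) ≤ χ z * (B z (pt z) (pt z) - B z (pt z) (p z) - (B z (p z) (pt z) - B z (p z) (p z))) :=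
        mul_le_mul_of_nonneg_left (by linarith) (hχ0 z)
      rw [h3] at h4
      simp only [hg]
      linarith
    · simp (maxDischargeDepth := 12) [hχb, hB, hptb, hp, hph, hQb]
    · simp (maxDischargeDepth := 12) [hcp, hcg]
  have b2 : ∫ z in box E b 0 (2*ρ), χ z * B z (pt z) (pt z) ≤ c₁ * (h * NT) + ((∫ z in box E b 0 (2*ρ), χ z * g z) + o * eng p b (2*ρ)) := by
    rw [box_split hcp b (lo := 0) (mid := h) (hi := 2*ρ) hh.le (by linarith)]
    apply add_le_add
    · rw [hNT, ← slice_const b h hh.le, ← integral_const_mul]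
      apply int_mono hcp (by simp (maxDischargeDepth := 12) [hT3]) (box_meas _ _ _) (box_fin _ _ _)
      rintro ⟨x,s⟩ hz
      have e1 : pt (x,s) = tanT p x := by
        have := hz.2.2
        simp only at this
        rw [esh]; simp [phat, this.le]
      rw [e1]
      have h1 := (le_abs_self _).trans (S.up2 (x,s) (tanT p x) (tanT p x))
      have h2 : 0 ≤ B (x,s) (tanT p x) (tanT p x) := le_trans (by positivity) (S.lower (x,s) (tanT p x))
      calc _ ≤ 1 * B (x,s) (tanT p x) (tanT p x) := mul_le_mul_of_nonneg_right (hχ1 _) h2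
        _ ≤ _ := by simp only; linarith
    · have hbig : Bdd (fun z => χ z * g z + o * ‖p z‖^2) := by simp (maxDischargeDepth := 12) [hcg, hp]
      have t1 : ∫ z in box E b h (2*ρ), χ z * B z (pt z) (pt z) ≤ ∫ z in box E b h (2*ρ), sh (-h) (fun z => χ z * g z + o * ‖p z‖^2) z := by
        apply int_mono hcp (hbig.sh _) (box_meas _ _ _) (box_fin _ _ _)
        rintro ⟨x,s⟩ hz
        have hs : h < s := hz.2.1
        have e1 : pt (x,s) = p (x,s-h) := by
          rw [esh]; simp [phat, hs]
        have e2 : ((x,s):𝓩 E) + (0,-h) = (x,s-h) := by simp [sub_eq_add_neg]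
        rw [e1, sh, e2]
        have q2 : B (x,s) (p (x,s-h)) (p (x,s-h)) ≤ g (x,s-h) + o * ‖p (x,s-h)‖^2 := by
          have := (B (x,s) - B (x,s-h)).le_opNorm₂ (p (x,s-h)) (p (x,s-h))
          rw [Real.norm_eq_abs] at this
          have h4 := (le_abs_self _).trans this
          have h6 := ho x (s-h)
          rw [sub_add_cancel] at h6
          have h5 : ‖B (x,s) - B (x,s-h)‖ * ‖p (x,s-h)‖ * ‖p (x,s-h)‖ ≤ o * ‖p (x,s-h)‖ * ‖p (x,s-h)‖ := by gcongr
          simp only [sub_apply] at h4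
          simp only [hg]
          linarith
        have q3 : χ (x,s) ≤ χ (x,s-h) := chi_anti hρ x (by linarith)
        have q4 := mul_le_mul_of_nonneg_left q2 (hχ0 (x,s))
        have q5 := mul_le_mul_of_nonneg_right q3 (hg0 (x,s-h))
        have q7 : χ (x,s) * (o * ‖p (x,s-h)‖^2) ≤ 1 * (o * ‖p (x,s-h)‖^2) := mul_le_mul_of_nonneg_right (hχ1 _) (by positivity)
        linarith
      refine t1.trans ?_
      rw [box_shift, add_neg_cancel]
      refine (int_sub_mono hbig (b' := b) (lo' := 0) (hi' := 2*ρ) le_rfl le_rfl (by linarith) fun z => add_nonneg (mul_nonneg (hχ0 z) (hg0 z)) (by positivity)).trans ?_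
      rw [integral_add (hcg.intgOn hfin) ((S.bp2.intgOn hfin).const_mul _), integral_const_mul]; rfl
  have b3 : |2 * X2| ≤ 4 * c₁ * (h/ρ) * (h * NT + eng p b (2*ρ)) := by
    apply S.errI hρ hh hhρ (-h) _ S.luhat _ (by have := mul_nonneg hh.le hNT0; linarith) (P := p)
    refine (vd'' S.luhat hph S.dhat hh.le).trans ?_
    have hph2 : Bdd (fun z => ‖phat p z‖^2) := by simp [hph]
    apply mul_le_mul_of_nonneg_left _ (by positivity)
    rw [box_split hph2 b (lo := 0 - h) (mid := 0) (by linarith) (by linarith)]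
    apply add_le_add
    · have t2 : ∫ z in box E b (0-h) 0, ‖phat p z‖^2 = ∫ z in box E b (0-h) 0, ‖tanT p z.1‖^2 := by
        apply setIntegral_congr_fun (box_meas _ _ _)
        intro z hz
        have hz2 : ¬ (0 < z.2) := not_lt.2 hz.2.2.le
        simp [phat, hz2]
      have t3 := box_shift b (0-h) 0 h (fun z : 𝓩 E => ‖tanT p z.1‖^2)
      rw [sub_add_cancel, zero_add, slice_const (F0 := fun x => ‖tanT p x‖^2) b h hh.le] at t3
      rw [t2, hNT, ← t3]
      simp [sh]
    · apply le_of_eq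
      apply setIntegral_congr_fun (box_meas _ _ _)
      intro z hz
      simp [phat, hz.2.1]
  have b4 : eng p a h ≤ 2 * Q + 2 * (h * NT) := by
    refine (eng_eta S hρ).trans ?_
    have hηl : Lip (fun z : 𝓩 E => eta b ρ z.1) := Lip.of_norm (1/ρ) fun x y => by
      refine (eta_lip _ _ hρ _ _).trans ?_
      gcongr; exact norm_fst_le (x - y)
    have hη : Bdd (fun z : 𝓩 E => eta b ρ z.1) := hηl.bdd 1 fun z => clamp_abs _
    have t1 : ∫ z in box E b 0 h, eta b ρ z.1 * ‖p z‖^2 ≤ ∫ z in box E b 0 h, (2 * (χ z * ‖pt z - p z‖^2) + 2 * ‖tanT p z.1‖^2) := by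
      apply int_mono (by simp (maxDischargeDepth := 12) [hη, hp]) (by simp (maxDischargeDepth := 12) [hQb, hT3]) (box_meas _ _ _) (box_fin _ _ _)
      rintro ⟨x,s⟩ hz
      have hs : s < h := hz.2.2
      have e1 : pt (x,s) = tanT p x := by rw [esh]; simp [phat, hs.le]
      rw [e1, hχdef, chi_low hρ _ (by simp only; linarith)]
      simp only
      have h0 : 0 ≤ eta b ρ x := clamp_nonneg _
      have h1 : eta b ρ x ≤ 1 := clamp_le _
      have n1 : ‖p (x,s)‖ ≤ ‖tanT p x - p (x,s)‖ + ‖tanT p x‖ := by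
        have := norm_sub_norm_le (p (x,s)) (tanT p x)
        rw [norm_sub_rev] at this; linarith
      have n2 : ‖p (x,s)‖^2 ≤ 2 * ‖tanT p x - p (x,s)‖^2 + 2 * ‖tanT p x‖^2 := by
        nlinarith [sq_nonneg (‖tanT p x - p (x,s)‖ - ‖tanT p x‖), norm_nonneg (p (x,s)), norm_nonneg (tanT p x), norm_nonneg (tanT p x - p (x,s))]
      have n3 := mul_le_mul_of_nonneg_left n2 h0
      have n4 : eta b ρ x * (2 * ‖tanT p x‖^2) ≤ 1 * (2 * ‖tanT p x‖^2) := mul_le_mul_of_nonneg_right h1 (by positivity)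
      linarith
    refine t1.trans ?_
    rw [integral_add ((hQb.intgOn (box_fin _ _ _)).const_mul _) ((hT3.intgOn (box_fin _ _ _)).const_mul _), integral_const_mul, integral_const_mul]
    rw [slice_const (F0 := fun x => ‖tanT p x‖^2) b h hh.le]
    have := int_sub_mono hQb (b := b) (b' := b) (lo := 0) (hi := h) (hi' := 2*ρ) le_rfl le_rfl (by linarith) fun z => mul_nonneg (hχ0 z) (by positivity)
    linarith
  have b5 := le_abs_self (2*X2)
  have b6 : eng p b (2*ρ) ≤ eng p b (3*ρ) := eng_mono S le_rfl (by linarith)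
  have b7 : c₀/2 * eng p a h ≤ c₀ * Q + c₀ * (h * NT) := by
    have := mul_le_mul_of_nonneg_left b4 (show 0 ≤ c₀/2 by positivity); linarith
  have hr1 : h/ρ ≤ 1 := (div_le_one hρ).2 hhρ
  have b8 : 4 * c₁ * (h/ρ) * (h*NT) ≤ 4 * c₁ * 1 * (h*NT) := by
    have := mul_nonneg hh.le hNT0
    gcongr
  have b9 : (4 * c₁ * (h/ρ) + o) * eng p b (2*ρ) ≤ (5 * c₁ * (h/ρ) + o) * eng p b (3*ρ) := by
    apply mul_le_mul _ b6 hE0 (by positivity)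
    have : 0 ≤ c₁ * (h/ρ) := by positivity
    linarith
  linarith
end

section
variable {c₀ c₁ τ lam r : ℝ} {B : 𝓩 E → 𝓑 E Y}
    {u : 𝓩 E → Y} {p : 𝓩 E → 𝓛 E Y}

structure Star (L : ℝ → ℝ → ℝ) (N D τ lam r : ℝ) : Prop where
  hD : 1 ≤ D
  hN : 0 ≤ N
  ht : 0 < τ
  hl : 0 < lam
  hl1 : lam < 1
  hr : 0 < r
  mono : ∀ a b h h', a ≤ b → h ≤ h' → L a h ≤ L b h'
  nn : ∀ a h, 0 ≤ L a h
  star : ∀ a ρ h, 0 < ρ → 0 < h → h ≤ ρ → a + ρ ≤ 4*r → 2*ρ ≤ r → L a h ≤ D * h * N + D * (h/ρ + τ * h^lam) * L (a+ρ) (3*ρ)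
  perd : ∀ a ρ, 1 ≤ ρ → a + ρ ≤ 4*r → 2*ρ ≤ r → L a 1 ≤ D * N + D / ρ * L (a+ρ) (3*ρ)

lemma Sys.star_of {N : ℝ} (S : Sys c₀ c₁ τ lam r B u p) {D : ℝ} {F : E → ℝ} (hF : Bdd F) (hF0 : ∀ x, 0 ≤ F x) {D0 : ℝ} (hD0 : 0 ≤ D0)
    (hN : N = ∫ x in ball (0:E) (4*r), F x) (hD : D = 1 + 2*D0/c₀ + 10*c₁/c₀ + 2/c₀)
    (h : ∀ a ρ h o : ℝ, 0 < ρ → 0 < h → h ≤ ρ → a + ρ ≤ 4*r → 2*ρ ≤ r → 0 ≤ o → (∀ x s, ‖B (x,s+h) - B (x,s)‖ ≤ o) →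
      c₀/2 * eng p a h ≤ (D0*h) * (∫ x in ball (0:E) (a+ρ), F x) + (5*c₁*(h/ρ)+o) * eng p (a+ρ) (3*ρ)) :
    Star (eng p) N D τ lam r := by
  have hc0 := S.hc0
  have hc1 := S.hc1
  have hN0 : 0 ≤ N := by rw [hN]; exact integral_nonneg hF0
  have hD1 : 1 ≤ D := by
    have : 0 ≤ 2*D0/c₀ + 10*c₁/c₀ + 2/c₀ := by positivity
    linarith
  have hDa : 2*D0/c₀ ≤ D := by
    have : 0 ≤ 10*c₁/c₀ + 2/c₀ := by positivity
    linarith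
  have hDb : 10*c₁/c₀ ≤ D := by
    have : 0 ≤ 2*D0/c₀ + 2/c₀ := by positivity
    linarith
  have hDc : 2/c₀ ≤ D := by
    have : 0 ≤ 2*D0/c₀ + 10*c₁/c₀ := by positivity
    linarith
  have key : ∀ a ρ h o : ℝ, 0 < ρ → 0 < h → h ≤ ρ → a + ρ ≤ 4*r → 2*ρ ≤ r → 0 ≤ o → (∀ x s, ‖B (x,s+h) - B (x,s)‖ ≤ o) →
      eng p a h ≤ D * h * N + D * (h/ρ + o) * eng p (a+ρ) (3*ρ) := by
    intro a ρ h' o h1 h2 h3 h4 h5 h6 h7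
    have k := h a ρ h' o h1 h2 h3 h4 h5 h6 h7
    have kN : (∫ x in ball (0:E) (a+ρ), F x) ≤ N := by
      rw [hN]
      apply setIntegral_mono_set (hF.intgOn measure_ball_lt_top) (ae_of_all _ hF0)
      exact (ball_subset_ball h4).eventuallyLE
    have e0 := eng_nonneg p (a+ρ) (3*ρ)
    have k2 := mul_le_mul_of_nonneg_left kN (mul_nonneg hD0 h2.le)
    have k3 : eng p a h' = (2/c₀) * (c₀/2 * eng p a h') := by field_simp
    rw [k3]
    have k4 := mul_le_mul_of_nonneg_left (k.trans (add_le_add k2 le_rfl)) (show 0 ≤ 2/c₀ by positivity)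
    refine k4.trans ?_
    have k5 : 2/c₀ * (D0 * h' * N + (5*c₁*(h'/ρ)+o) * eng p (a+ρ) (3*ρ)) = 2*D0/c₀ * (h' * N) + (10*c₁/c₀ * (h'/ρ * eng p (a+ρ) (3*ρ)) + 2/c₀*(o * eng p (a+ρ) (3*ρ))) := by
      field_simp; ring
    have k6 := mul_le_mul_of_nonneg_right hDa (mul_nonneg h2.le hN0)
    have k7 := mul_le_mul_of_nonneg_right hDb (show 0 ≤ h'/ρ * eng p (a+ρ) (3*ρ) by positivity)
    have k8 := mul_le_mul_of_nonneg_right hDc (show 0 ≤ o * eng p (a+ρ) (3*ρ) by positivity)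
    rw [k5]
    calc _ ≤ D * (h' * N) + (D * (h'/ρ * eng p (a+ρ) (3*ρ)) + D * (o * eng p (a+ρ) (3*ρ))) := add_le_add k6 (add_le_add k7 k8)
      _ = _ := by ring
  refine ⟨hD1, hN0, S.ht, S.hl, S.hl1, S.hr, fun a b h h' h1 h2 => eng_mono S h1 h2, fun a h => eng_nonneg p a h, ?_, ?_⟩
  · intro a ρ h' h1 h2 h3 h4 h5
    have ht := S.ht
    refine key a ρ h' _ h1 h2 h3 h4 h5 (by positivity) fun x s => ?_
    have := S.hold x (s+h') s
    rwa [add_sub_cancel_left, abs_of_pos h2] at this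
  · intro a ρ h1 h4 h5
    have := key a ρ 1 0 (by linarith) one_pos h1 h4 h5 le_rfl fun x s => by rw [S.per]; simp
    simpa [div_eq_mul_inv] using this

lemma Sys.starN' (S : Sys c₀ c₁ τ lam r B u p) : Star (eng p) (∫ x in ball (0:E) (4*r), ‖nuB B p x‖^2) (1 + 2*(2/c₀)/c₀ + 10*c₁/c₀ + 2/c₀) τ lam r := by
  have hc0 := S.hc0
  refine S.star_of (F := fun x => ‖nuB B p x‖^2) (D0 := 2/c₀) (by have := S.bn; simp [this]) (fun x => by positivity) (by positivity) rfl rfl ?_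
  intro a ρ h o h1 h2 h3 h4 h5 h6 h7
  have := S.starN h1 h2 h3 h4 h5 h6 h7
  rwa [show 2*h/c₀ = 2/c₀*h by ring] at this

lemma Sys.starD' (S : Sys c₀ c₁ τ lam r B u p) : Star (eng p) (∫ x in ball (0:E) (4*r), ‖tanT p x‖^2) (1 + 2*(5*c₁+c₀)/c₀ + 10*c₁/c₀ + 2/c₀) τ lam r := by
  have hc0 := S.hc0
  have hc1 := S.hc1
  exact S.star_of (F := fun x => ‖tanT p x‖^2) (D0 := 5*c₁+c₀) (by have := S.bT; simp [this]) (fun x => by positivity) (by positivity) rfl rfl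
    fun a ρ h o h1 h2 h3 h4 h5 h6 h7 => S.starD h1 h2 h3 h4 h5 h6 h7

structure Scale (D τ lam r q H : ℝ) : Prop where
  hq : 3 ≤ q
  qD : 12 * D ≤ q ^ (lam/4)
  hH : 0 < H
  Hr : H ≤ r
  HD : D * τ * H^lam ≤ 1/4 * q ^ (-(1-lam/4))

lemma Scale.pow {D τ lam r q H : ℝ} (P : Scale D τ lam r q H) : 0 < q := by have := P.hq; linarith

lemma Star.piece2 {L : ℝ → ℝ → ℝ} {N D q H : ℝ} (S : Star L N D τ lam r) (P : Scale D τ lam r q H) (k : ℕ) :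
    ∀ a, a + (H - H/q^k) ≤ 4*r → L a (H/q^k) ≤ (q ^ (-(1-lam/4)))^k * (2*D*H*N + L (a + (H - H/q^k)) H) := by
  have hD := S.hD
  have hN := S.hN
  have ht := S.ht
  have hl := S.hl
  have hl1 := S.hl1
  have hr := S.hr
  have hq3 := P.hq
  have hH := P.hH
  have hHr := P.Hr
  have hq := P.pow
  set y := q ^ (-(1-lam/4)) with hy
  have hy0 : 0 < y := Real.rpow_pos_of_pos hq _
  have hyq : 1/q ≤ y := by
    rw [one_div, ← Real.rpow_neg_one]
    exact Real.rpow_le_rpow_of_exponent_le (by linarith) (by linarith)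
  have hDq : D * (3/q) ≤ 1/4 * y := by
    have : y = q^(lam/4) / q := by
      rw [hy, show -(1-lam/4) = lam/4 - 1 by ring, Real.rpow_sub_one hq.ne']
    rw [this]
    have := P.qD
    rw [mul_div_assoc', mul_div_assoc']
    exact div_le_div_of_nonneg_right (by linarith) hq.le
  induction k with
  | zero =>
    intro a ha
    simp only [pow_zero, div_one, sub_self, add_zero, one_mul]
    have : 0 ≤ 2*D*H*N := by positivity
    linarith
  | succ k ih =>
    intro a ha
    set t := H/q^k with htk
    have htpos : 0 < t := by positivity
    have htH : t ≤ H := div_le_self hH.le (one_le_pow₀ (by linarith))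
    have e1 : H/q^(k+1) = t/q := by rw [htk, pow_succ]; field_simp
    rw [e1] at ha ⊢
    have e2 : t/q ≤ t/3 := div_le_div_of_nonneg_left htpos.le (by norm_num) hq3
    have htq : 0 < t/q := by positivity
    have s1 := S.star a (t/3) (t/q) (by positivity) htq e2 (by linarith) (by linarith)
    rw [show 3*(t/3) = t by ring, show t/q/(t/3) = 3/q by field_simp] at s1
    have s2 := ih (a + t/3) (by linarith)
    have s3 : L (a + t/3 + (H - t)) H ≤ L (a + (H - t/q)) H := S.mono _ _ _ _ (by linarith) le_rfl
    have hX := S.nn (a + (H - t/q)) H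
    set X := L (a + (H - t/q)) H
    have s4 : D * (3/q + τ * (t/q)^lam) ≤ 1/2 * y := by
      have : D * (τ * (t/q)^lam) ≤ D * (τ * H^lam) := by
        gcongr
        exact (div_le_self htpos.le (by linarith)).trans htH
      have := P.HD
      rw [← hy] at this
      linarith
    have hyk : 0 < y^k := by positivity
    have s5 : L (a + t/3) t ≤ y^k * (2*D*H*N + X) := s2.trans (mul_le_mul_of_nonneg_left (by linarith) hyk.le)
    have s6 : D * (3/q + τ * (t/q)^lam) * L (a + t/3) t ≤ 1/2 * y * (y^k * (2*D*H*N + X)) :=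
      mul_le_mul s4 s5 (S.nn _ _) (by positivity)
    have s7 : D * (t/q) * N ≤ D * (H * y^(k+1)) * N := by
      gcongr
      rw [← e1, div_eq_mul_inv, ← inv_pow, ← one_div]
      gcongr
    rw [pow_succ]
    rw [pow_succ] at s7
    have : 0 ≤ y^k * y * X := by positivity
    linarith
end

section
variable {c₀ c₁ τ lam r : ℝ} {B : 𝓩 E → 𝓑 E Y}
    {u : 𝓩 E → Y} {p : 𝓩 E → 𝓛 E Y}

lemma null_image {V : Type*} [NormedAddCommGroup V] [NormedSpace ℝ V] [FiniteDimensional ℝ V] [MeasureSpace V] [BorelSpace V]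
    [(volume : Measure V).IsAddHaarMeasure] {f : V → V} (hf : Lip f) {s : Set V} (hs : volume s = 0) : volume (f '' s) = 0 := by
  obtain ⟨K, hK⟩ := hf
  have a1 : μH[(Module.finrank ℝ V : ℝ)] s = 0 :=
    Measure.absolutelyContinuous_isAddHaarMeasure (μH[(Module.finrank ℝ V : ℝ)]) (volume : Measure V) hs
  have a2 : μH[(Module.finrank ℝ V : ℝ)] (f '' s) = 0 := by
    have := hK.hausdorffMeasure_image_le (d := (Module.finrank ℝ V : ℝ)) (by positivity) s
    rw [a1, mul_zero] at this
    exact le_antisymm this zero_le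
  exact Measure.absolutelyContinuous_isAddHaarMeasure (volume : Measure V) (μH[(Module.finrank ℝ V : ℝ)]) a2

def flow (χ : 𝓩 E → ℝ) (h : ℝ) (z : 𝓩 E) : 𝓩 E := z + (h * χ z) • ((0:E),(1:ℝ))

lemma norm_e : ‖((0:E),(1:ℝ))‖ = 1 := by simp [Prod.norm_def]

lemma flow_homeo {χ : 𝓩 E → ℝ} {Λ h : ℝ} (hχ : ∀ z z', |χ z - χ z'| ≤ Λ * ‖z - z'‖) (hh : |h| * Λ ≤ 1/2) :
    ∃ Ψ : 𝓩 E → 𝓩 E, Lip Ψ ∧ (∀ z, flow χ h (Ψ z) = z) ∧ (∀ z, Ψ (flow χ h z) = z) := by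
  have hd : ∀ z z', ‖(h * χ z) • ((0:E),(1:ℝ)) - (h * χ z') • ((0:E),(1:ℝ))‖ ≤ 1/2 * ‖z - z'‖ := by
    intro z z'
    rw [← sub_smul, norm_smul, norm_e, mul_one, ← mul_sub, Real.norm_eq_abs, abs_mul]
    calc _ ≤ |h| * (Λ * ‖z - z'‖) := by gcongr; exact hχ z z'
      _ = (|h| * Λ) * ‖z - z'‖ := by ring
      _ ≤ _ := by gcongr
  have hA : ApproximatesLinearOn (flow χ h) ((ContinuousLinearEquiv.refl ℝ 𝓩 E : 𝓩 E ≃L[ℝ] 𝓩 E) : 𝓩 E →L[ℝ] 𝓩 E) univ (1/2 : ℝ≥0) := by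
    intro z _ z' _
    have := hd z z'
    have e1 : flow χ h z - flow χ h z' - (ContinuousLinearEquiv.refl ℝ 𝓩 E : 𝓩 E →L[ℝ] 𝓩 E) (z - z') = (h * χ z) • ((0:E),(1:ℝ)) - (h * χ z') • ((0:E),(1:ℝ)) := by
      change flow χ h z - flow χ h z' - (z - z') = _
      simp only [flow]; abel
    rw [e1]
    simpa using this
  have hc : (1/2 : ℝ≥0) < ‖(((ContinuousLinearEquiv.refl ℝ 𝓩 E).symm : 𝓩 E ≃L[ℝ] 𝓩 E) : 𝓩 E →L[ℝ] 𝓩 E)‖₊⁻¹ := by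
    have : ‖(((ContinuousLinearEquiv.refl ℝ 𝓩 E).symm : 𝓩 E ≃L[ℝ] 𝓩 E) : 𝓩 E →L[ℝ] 𝓩 E)‖₊ = 1 := by
      apply NNReal.eq
      simp only [coe_nnnorm, ContinuousLinearEquiv.refl_symm, ContinuousLinearEquiv.coe_refl]
      exact ContinuousLinearMap.norm_id
    rw [this]
    norm_num
  let e := hA.toHomeomorph _ (Or.inr hc)
  have he : ∀ z, e z = flow χ h z := fun z => rfl
  have h1 : ∀ z, flow χ h (e.symm z) = z := fun z => by rw [← he]; simp
  refine ⟨e.symm, Lip.of_norm 2 fun z z' => ?_, h1, fun z => by rw [← he]; simp⟩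
  have a1 := hd (e.symm z) (e.symm z')
  have a2 : z - z' = (e.symm z - e.symm z') + ((h * χ (e.symm z)) • ((0:E),(1:ℝ)) - (h * χ (e.symm z')) • ((0:E),(1:ℝ))) := by
    conv_lhs => rw [← h1 z, ← h1 z']
    simp only [flow]; abel
  have a3 : ‖e.symm z - e.symm z'‖ ≤ ‖z - z'‖ + 1/2 * ‖e.symm z - e.symm z'‖ := by
    calc _ = ‖(z - z') - ((h * χ (e.symm z)) • ((0:E),(1:ℝ)) - (h * χ (e.symm z')) • ((0:E),(1:ℝ)))‖ := by rw [a2]; congr 1; abel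
      _ ≤ _ := (norm_sub_le _ _).trans (by linarith)
  linarith

lemma l_vert (l : 𝓩 E →L[ℝ] ℝ) (c : ℝ) : l (0, c) = c * l (0,1) := by
  have : ((0:E), c) = c • ((0:E),(1:ℝ)) := by simp
  rw [this, map_smul, smul_eq_mul]

def flowL (l : 𝓩 E →L[ℝ] ℝ) (h : ℝ) (hj : 1 + h * l (0,1) ≠ 0) : 𝓩 E ≃L[ℝ] 𝓩 E :=
  ContinuousLinearEquiv.equivOfInverse (ContinuousLinearMap.id ℝ 𝓩 E + (h • l).smulRight ((0:E),(1:ℝ)))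
    (ContinuousLinearMap.id ℝ 𝓩 E - ((h/(1 + h * l (0,1))) • l).smulRight ((0:E),(1:ℝ)))
    (fun z => by
      ext
      · simp
      · simp [l_vert l (h * l z)]; field_simp; ring)
    (fun z => by
      ext
      · simp
      · simp [l_vert l (h / (1 + h * l (0,1)) * l z)]; field_simp; ring)

lemma flow_fd {χ : 𝓩 E → ℝ} {l : 𝓩 E →L[ℝ] ℝ} {z : 𝓩 E} (hχ : HasFDerivAt χ l z) (h : ℝ) (hj : 1 + h * l (0,1) ≠ 0) :
    HasFDerivAt (flow χ h) (flowL l h hj : 𝓩 E →L[ℝ] 𝓩 E) z := by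
  have := (hasFDerivAt_id z).add ((hχ.const_mul h).smul_const ((0:E),(1:ℝ)))
  exact this

lemma flow_det (l : 𝓩 E →L[ℝ] ℝ) (h : ℝ) (hj : 1 + h * l (0,1) ≠ 0) :
    (flowL l h hj : 𝓩 E →L[ℝ] 𝓩 E).det = 1 + h * l (0,1) := by
  have := LinearMap.transvection.det (V := 𝓩 E) (R := ℝ) (h • (l : 𝓩 E →ₗ[ℝ] ℝ)) ((0:E),(1:ℝ))
  simp only [LinearMap.smul_apply, ContinuousLinearMap.coe_coe, smul_eq_mul] at this
  rw [← this, ContinuousLinearMap.det]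
  congr 1

lemma flow_inv (l : 𝓩 E →L[ℝ] ℝ) (h : ℝ) (hj : 1 + h * l (0,1) ≠ 0) (ξ : 𝓛 E Y) :
    ξ.comp ((flowL l h hj).symm : 𝓩 E →L[ℝ] 𝓩 E) = ξ - (h/(1 + h * l (0,1))) • l.smulRight (ξ (0,1)) := by
  apply ContinuousLinearMap.ext
  intro z
  have : (flowL l h hj).symm z = z - ((h/(1 + h * l (0,1))) * l z) • ((0:E),(1:ℝ)) := rfl
  rw [ContinuousLinearMap.comp_apply, ContinuousLinearEquiv.coe_coe, this, map_sub, map_smul]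
  simp [mul_smul]
end

section
variable {c₀ c₁ τ lam r : ℝ} {B : 𝓩 E → 𝓑 E Y}
    {u : 𝓩 E → Y} {p : 𝓩 E → 𝓛 E Y}

def Ikr (B : 𝓩 E → 𝓑 E Y) (p : 𝓩 E → 𝓛 E Y) (χ : 𝓩 E → ℝ) (z : 𝓩 E) : ℝ :=
  fderiv ℝ χ z (0,1) * B z (p z) (p z) - 2 * B z (p z) ((fderiv ℝ χ z).smulRight (p z (0,1)))

lemma Sys.bIkr (S : Sys c₀ c₁ τ lam r B u p) {χ : 𝓩 E → ℝ} (hχ : Lip χ) : Bdd (Ikr B p χ) := by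
  have h1 := hχ.bfd
  have hp := S.bp.bd
  have hB := S.bB.bd
  unfold Ikr
  simp (maxDischargeDepth := 12) [h1, hp, hB]

lemma Ikr_le (S : Sys c₀ c₁ τ lam r B u p) {χ : 𝓩 E → ℝ} {Λ : ℝ} {z : 𝓩 E} (h : ‖fderiv ℝ χ z‖ ≤ Λ) : |Ikr B p χ z| ≤ 3 * c₁ * Λ * ‖p z‖^2 := by
  have hc1 := S.hc1
  have h1 := S.up2 z (p z) (p z)
  have h2 := S.up2 z (p z) ((fderiv ℝ χ z).smulRight (p z (0,1)))
  rw [ContinuousLinearMap.norm_smulRight_apply] at h2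
  have h3 : |fderiv ℝ χ z (0,1)| ≤ Λ := (norm_vert_le (fderiv ℝ χ z)).trans h
  have h4 := norm_vert_le (p z)
  have hΛ : 0 ≤ Λ := (norm_nonneg _).trans h
  have h5 : c₁ * ‖p z‖ * (‖fderiv ℝ χ z‖ * ‖p z (0,1)‖) ≤ c₁ * ‖p z‖ * (Λ * ‖p z‖) := by gcongr
  have h6 : |fderiv ℝ χ z (0,1)| * |B z (p z) (p z)| ≤ Λ * (c₁ * ‖p z‖ * ‖p z‖) := by gcongr
  unfold Ikr
  refine (abs_sub _ _).trans ?_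
  rw [abs_mul, abs_mul, abs_two]
  linarith

lemma flow_alg (S : Sys c₀ c₁ τ lam r B u p) {ε Λ h : ℝ} (hε : 0 ≤ ε) {l : 𝓩 E →L[ℝ] ℝ} (hl : ‖l‖ ≤ Λ) (hh : |h| * Λ ≤ 1/2) (z z' : 𝓩 E) (hz : ‖B z' - B z‖ ≤ ε) (ξ : 𝓛 E Y) {ζ : 𝓛 E Y}
    (hζ : ζ = ξ - (h/(1 + h * l (0,1))) • l.smulRight (ξ (0,1))) :
    |1 + h * l (0,1)| * B z' ζ ζ ≤ B z ξ ξ + h * (l (0,1) * B z ξ ξ - 2 * B z ξ (l.smulRight (ξ (0,1)))) + (2*c₁*h^2*Λ^2 + 6*ε) * ‖ξ‖^2 := by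
  have hc1 := S.hc1
  set R := l.smulRight (ξ (0,1)) with hR
  set j := 1 + h * l (0,1) with hj
  have hΛ : 0 ≤ Λ := (norm_nonneg _).trans hl
  have hls : |l (0,1)| ≤ Λ := (norm_vert_le l).trans hl
  have hhl : |h * l (0,1)| ≤ 1/2 := by
    rw [abs_mul]
    exact (mul_le_mul_of_nonneg_left hls (abs_nonneg _)).trans hh
  obtain ⟨j1, j2⟩ := abs_le.1 hhl
  have hj1 : 1/2 ≤ j := by linarith
  have hj2 : j ≤ 3/2 := by linarith
  have hj0 : 0 < j := by linarith
  rw [abs_of_pos hj0]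
  have hRn : ‖R‖ ≤ Λ * ‖ξ‖ := by
    rw [hR, ContinuousLinearMap.norm_smulRight_apply]
    have := norm_vert_le ξ
    gcongr
  have hζn : ‖ζ‖ ≤ 2 * ‖ξ‖ := by
    rw [hζ]
    refine (norm_sub_le _ _).trans ?_
    rw [norm_smul, norm_div, Real.norm_eq_abs, Real.norm_eq_abs, abs_of_pos hj0, div_mul_eq_mul_div]
    have : |h| * ‖R‖ / j ≤ ‖ξ‖ := by
      rw [div_le_iff₀ hj0]
      calc |h| * ‖R‖ ≤ |h| * (Λ * ‖ξ‖) := by gcongr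
        _ = (|h| * Λ) * ‖ξ‖ := by ring
        _ ≤ 1/2 * ‖ξ‖ := by gcongr
        _ ≤ j * ‖ξ‖ := by gcongr
        _ = _ := by ring
    linarith
  have a1 : B z' ζ ζ ≤ B z ζ ζ + ε * (4 * ‖ξ‖^2) := by
    have := (B z' - B z).le_opNorm₂ ζ ζ
    rw [Real.norm_eq_abs] at this
    have h4 := (le_abs_self _).trans this
    simp only [sub_apply] at h4
    have h5 : ‖B z' - B z‖ * ‖ζ‖ * ‖ζ‖ ≤ ε * (2*‖ξ‖) * (2*‖ξ‖) := by gcongr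
    linarith
  have a2 : j * B z ζ ζ = j * B z ξ ξ - 2 * h * B z ξ R + h^2/j * B z R R := by
    have := S.symm z R ξ
    rw [hζ]
    simp only [map_sub, map_smul, sub_apply, smul_apply, smul_eq_mul, this]
    field_simp
    ring
  have a3 : h^2/j * B z R R ≤ 2*c₁*h^2*Λ^2*‖ξ‖^2 := by
    have b1 := (le_abs_self _).trans (S.up2 z R R)
    have b2 : c₁ * ‖R‖ * ‖R‖ ≤ c₁ * (Λ * ‖ξ‖) * (Λ * ‖ξ‖) := by gcongr
    have b3 : h^2/j ≤ 2 * h^2 := by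
      rw [div_le_iff₀ hj0]
      nlinarith [sq_nonneg h]
    calc _ ≤ h^2/j * (c₁ * (Λ * ‖ξ‖) * (Λ * ‖ξ‖)) := by
            apply mul_le_mul_of_nonneg_left (b1.trans b2) (by positivity)
      _ ≤ 2*h^2 * (c₁ * (Λ * ‖ξ‖) * (Λ * ‖ξ‖)) := by
            apply mul_le_mul_of_nonneg_right b3 (by positivity)
      _ = _ := by ring
  have a4 := mul_le_mul_of_nonneg_left a1 hj0.le
  have a5 : j * (ε * (4 * ‖ξ‖^2)) ≤ 3/2 * (ε * (4 * ‖ξ‖^2)) := by gcongr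
  have a6 : j * B z ξ ξ = B z ξ ξ + h * (l (0,1) * B z ξ ξ) := by rw [hj]; ring
  linarith

lemma Sys.sl0 (S : Sys c₀ c₁ τ lam r B u p) {χ : 𝓩 E → ℝ} {Λ h b hi : ℝ} (hΛ : 0 ≤ Λ) (hχ : ∀ z z', |χ z - χ z'| ≤ Λ * ‖z - z'‖)
    (hh : |h| * Λ ≤ 1/2) (hhi : 0 < hi) (hb : b ≤ 4*r) (hir : hi ≤ r) (h0 : ∀ z ∉ box E b 0 hi, χ z = 0) :
    0 ≤ h * (∫ z in box E b 0 hi, Ikr B p χ z) + (2*c₁*h^2*Λ^2 + 6*(τ * hi^lam)) * eng p b hi := by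
  obtain ⟨Ψ, hΨ, hΦΨ, hΨΦ⟩ := flow_homeo hχ hh
  set O := box E b 0 hi with hO
  set Φ := flow χ h with hΦ
  have hfin : volume O < ⊤ := box_fin _ _ _
  have hOm : MeasurableSet O := box_meas _ _ _
  have hp := S.bp.bd
  have hB := S.bB.bd
  have ht := S.ht
  have hχL : Lip χ := Lip.of_norm Λ hχ
  have hΦL : Lip Φ := by
    refine Lip.of_norm (1 + |h| * Λ) fun z z' => ?_
    have : Φ z - Φ z' = (z - z') + (h * (χ z - χ z')) • ((0:E),(1:ℝ)) := by
      simp only [hΦ, flow, mul_sub, sub_smul]; abel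
    rw [this]
    refine (norm_add_le _ _).trans ?_
    rw [norm_smul, norm_e, mul_one, Real.norm_eq_abs, abs_mul]
    have := mul_le_mul_of_nonneg_left (hχ z z') (abs_nonneg h)
    linarith
  have hinj : Function.Injective Φ := Function.LeftInverse.injective hΨΦ
  have hoff : ∀ z ∉ O, Φ z = z := fun z hz => by simp [hΦ, flow, h0 z hz]
  have hΨoff : ∀ z ∉ O, Ψ z = z := fun z hz => by
    have := hΨΦ z
    rwa [hoff z hz] at this
  have hmaps : ∀ z ∈ O, Φ z ∈ O := by
    intro z hz
    by_contra hc
    have := hinj (hoff _ hc)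
    rw [this] at hc
    exact hc hz
  have hmaps' : ∀ z ∈ O, Ψ z ∈ O := by
    intro z hz
    by_contra hc
    have := hoff _ hc
    rw [hΦΨ] at this
    rw [← this] at hc
    exact hc hz
  set v : 𝓩 E → Y := fun z => u (Ψ z) with hv
  have hvL : Lip v := by
    obtain ⟨K, hK⟩ := hΨ
    obtain ⟨K', hK'⟩ := S.lu
    exact ⟨_, hK'.comp hK⟩
  set W : 𝓩 E → Y := fun z => v z - u z with hW
  have hWL : Lip W := hvL.sub S.lu
  have hW0 : ∀ z ∉ O, W z = 0 := fun z hz => by simp [hW, hv, hΨoff z hz]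
  have hweak := S.weak W hWL fun z hz => hW0 z fun hc => by
    obtain ⟨c1, c2, c3⟩ := hc
    rcases hz with hz | hz | hz <;> linarith
  have hDv := hvL.bfd
  have hDW := hWL.bfd
  -- first inequality
  have hQb : Bdd (fun z => B z (fderiv ℝ v z) (fderiv ℝ v z)) := by simp (maxDischargeDepth := 12) [hB, hDv]
  have hgb : Bdd (fun z => B z (p z) (p z)) := by simp (maxDischargeDepth := 12) [hB, hp]
  have s1 : ∫ z in O, B z (p z) (p z) ≤ ∫ z in O, B z (fderiv ℝ v z) (fderiv ℝ v z) := by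
    have w1 : ∫ z in O, B z (p z) (fderiv ℝ W z) = 0 := by
      rw [← hweak]
      apply setIntegral_eq_integral_of_ae_compl_eq_zero
      filter_upwards [fderiv_off_box b 0 hi hW0] with z hz hzO
      rw [hz hzO]; simp
    have w2 : ∀ᵐ z ∂(volume.restrict O), 2 * B z (p z) (fderiv ℝ W z) ≤ B z (fderiv ℝ v z) (fderiv ℝ v z) - B z (p z) (p z) := by
      apply ae_restrict_of_ae
      filter_upwards [S.der', hvL.aed] with z h1 h2
      have : fderiv ℝ W z = fderiv ℝ v z - p z := (h2.hasFDerivAt.sub h1).fderiv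
      rw [this]
      exact S.cs z (p z) (fderiv ℝ v z)
    have hWb : Bdd (fun z => 2 * B z (p z) (fderiv ℝ W z)) := by simp (maxDischargeDepth := 12) [hB, hp, hDW]
    have w3 := integral_mono_ae (hWb.intgOn hfin) ((hQb.intgOn hfin).sub (hgb.intgOn hfin)) w2
    rw [integral_const_mul, w1, integral_sub' (hQb.intgOn hfin) (hgb.intgOn hfin)] at w3
    linarith
  -- change of variables
  have hfd : ∀ z, ‖fderiv ℝ χ z‖ ≤ Λ := fun z => fderiv_le (χ := χ) hΛ hχ z
  have hjne : ∀ z, 1 + h * fderiv ℝ χ z (0,1) ≠ 0 := by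
    intro z
    have hls : |fderiv ℝ χ z (0,1)| ≤ Λ := (norm_vert_le _).trans (hfd z)
    have hhl : |h * fderiv ℝ χ z (0,1)| ≤ 1/2 := by
      rw [abs_mul]
      exact (mul_le_mul_of_nonneg_left hls (abs_nonneg _)).trans hh
    have := (abs_le.1 hhl).1
    intro hc
    linarith
  have hae : ∀ᵐ z : 𝓩 E, DifferentiableAt ℝ χ z ∧ HasFDerivAt u (p z) z := hχL.aed.and S.der'
  obtain ⟨T, hT1, hTm, hT0⟩ := exists_measurable_superset_of_null hae
  have hgood : ∀ z ∉ T, DifferentiableAt ℝ χ z ∧ HasFDerivAt u (p z) z := fun z hz => by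
    by_contra hc
    exact hz (hT1 hc)
  have him : Φ '' (O \ T) =ᵐ[volume] O := by
    have e1 : Φ '' (O \ T) = O \ (Φ '' T) := by
      rw [image_sdiff hinj]
      congr 1
      apply Subset.antisymm
      · rintro _ ⟨z, hz, rfl⟩; exact hmaps z hz
      · intro z hz; exact ⟨Ψ z, hmaps' z hz, hΦΨ z⟩
    rw [e1]
    exact sdiff_null_ae_eq_self (null_image hΦL hT0)
  have s2 : ∫ z in O, B z (fderiv ℝ v z) (fderiv ℝ v z) = ∫ z in O \ T, |1 + h * fderiv ℝ χ z (0,1)| * B (Φ z) (fderiv ℝ v (Φ z)) (fderiv ℝ v (Φ z)) := by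
    rw [← setIntegral_congr_set him, integral_image_eq_integral_abs_det_fderiv_smul volume (hOm.diff hTm)
      (f' := fun z => (flowL (fderiv ℝ χ z) h (hjne z) : 𝓩 E →L[ℝ] 𝓩 E)) (fun z hz => (flow_fd (hgood z hz.2).1.hasFDerivAt h (hjne z)).hasFDerivWithinAt) hinj.injOn]
    simp_rw [flow_det, smul_eq_mul]
    rfl
  have s3 : ∫ z in O \ T, |1 + h * fderiv ℝ χ z (0,1)| * B (Φ z) (fderiv ℝ v (Φ z)) (fderiv ℝ v (Φ z)) ≤
      ∫ z in O \ T, (B z (p z) (p z) + h * Ikr B p χ z + (2*c₁*h^2*Λ^2 + 6*(τ * hi^lam)) * ‖p z‖^2) := by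
    have hRb : Bdd (fun z => B z (p z) (p z) + h * Ikr B p χ z + (2*c₁*h^2*Λ^2 + 6*(τ * hi^lam)) * ‖p z‖^2) := by
      have := S.bIkr hχL
      simp (maxDischargeDepth := 12) [hgb, this, hp]
    apply integral_mono_of_nonneg
    · exact ae_of_all _ fun z => mul_nonneg (abs_nonneg _) (le_trans (mul_nonneg S.hc0.le (by positivity)) (S.lower _ _))
    · exact (hRb.intgOn hfin).mono_set sdiff_subset
    · refine (ae_restrict_iff' (hOm.diff hTm)).2 (ae_of_all _ fun z hz => ?_)
      have hvd : HasFDerivAt v ((p z).comp ((flowL (fderiv ℝ χ z) h (hjne z)).symm : 𝓩 E →L[ℝ] 𝓩 E)) (Φ z) := by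
        have k1 : HasFDerivAt Ψ ((flowL (fderiv ℝ χ z) h (hjne z)).symm : 𝓩 E →L[ℝ] 𝓩 E) (Φ z) := by
          apply HasFDerivAt.of_local_left_inverse (f := Φ)
          · obtain ⟨K, hK⟩ := hΨ
            exact hK.continuous.continuousAt
          · rw [hΨΦ]
            exact flow_fd (hgood z hz.2).1.hasFDerivAt h (hjne z)
          · exact Eventually.of_forall hΦΨ
        have k2 : HasFDerivAt u (p z) (Ψ (Φ z)) := by rw [hΨΦ]; exact (hgood z hz.2).2
        exact k2.comp (Φ z) k1
      rw [flow_inv] at hvd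
      simp only [hvd.fderiv]
      refine flow_alg S (by positivity) (hfd z) hh z (Φ z) ?_ (p z) rfl
      have m1 := hmaps z hz.1
      have m2 := hz.1
      have e1 : Φ z = (z.1, z.2 + h * χ z) := by ext <;> simp [hΦ, flow]
      rw [e1] at m1 ⊢
      obtain ⟨_, m3, m4⟩ := m1
      obtain ⟨_, m5, m6⟩ := m2
      refine (S.hold z.1 (z.2 + h * χ z) z.2).trans ?_
      apply mul_le_mul_of_nonneg_left _ ht.le
      apply Real.rpow_le_rpow (abs_nonneg _) _ S.hl.le
      simp only at m3 m4
      rw [abs_le]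
      constructor <;> linarith
  have hOT : (O \ T : Set 𝓩 E) =ᵐ[volume] O := sdiff_null_ae_eq_self hT0
  rw [setIntegral_congr_set hOT (f := fun z => (B z (p z) (p z) + h * Ikr B p χ z + (2*c₁*h^2*Λ^2 + 6*(τ * hi^lam)) * ‖p z‖^2))] at s3
  have i1 := (S.bIkr hχL).intgOn hfin
  have i2 := S.bp2.intgOn hfin
  have s4 : ∫ z in O, (B z (p z) (p z) + h * Ikr B p χ z + (2*c₁*h^2*Λ^2 + 6*(τ * hi^lam)) * ‖p z‖^2) =
      (∫ z in O, B z (p z) (p z)) + h * (∫ z in O, Ikr B p χ z) + (2*c₁*h^2*Λ^2 + 6*(τ * hi^lam)) * eng p b hi := by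
    have i3 : IntegrableOn (fun z => B z (p z) (p z) + h * Ikr B p χ z) O := (hgb.intgOn hfin).add (i1.const_mul _)
    rw [integral_add i3 (i2.const_mul _), integral_add (hgb.intgOn hfin) (i1.const_mul _), integral_const_mul, integral_const_mul]
    rfl
  linarith

lemma Sys.sl (S : Sys c₀ c₁ τ lam r B u p) {χ : 𝓩 E → ℝ} {Λ b hi : ℝ} (hΛ : 0 < Λ) (hχ : ∀ z z', |χ z - χ z'| ≤ Λ * ‖z - z'‖)
    (hhi : 0 < hi) (hb : b ≤ 4*r) (hir : hi ≤ r) (h0 : ∀ z ∉ box E b 0 hi, χ z = 0) (hε : τ * hi^lam ≤ 1/4) :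
    |∫ z in box E b 0 hi, Ikr B p χ z| ≤ (2*c₁+6) * Λ * √(τ * hi^lam) * eng p b hi := by
  have ht := S.ht
  have hε0 : 0 < τ * hi^lam := by positivity
  set ε := τ * hi^lam
  have hs0 : 0 < √ε := Real.sqrt_pos.2 hε0
  have hs1 : √ε ≤ 1/2 := by
    rw [Real.sqrt_le_left (by norm_num)]; linarith
  have hss : √ε * √ε = ε := Real.mul_self_sqrt hε0.le
  have key : ∀ σ : ℝ, |σ| = 1 → 0 ≤ σ * (∫ z in box E b 0 hi, Ikr B p χ z) + (2*c₁+6) * Λ * √ε * eng p b hi := by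
    intro σ hσ
    have hσ2 : σ^2 = 1 := by rw [← sq_abs, hσ]; norm_num
    have := S.sl0 (h := σ * (√ε/Λ)) hΛ.le hχ (by rw [abs_mul, hσ, abs_of_pos (by positivity)]; field_simp; linarith) hhi hb hir h0
    have e1 : 2*c₁*(σ * (√ε/Λ))^2*Λ^2 + 6*ε = (2*c₁+6)*(√ε * √ε) := by
      rw [mul_pow, hσ2]; field_simp; rw [Real.sq_sqrt hε0.le]; ring
    rw [e1] at this
    have h2 : 0 ≤ (√ε/Λ) * (σ * (∫ z in box E b 0 hi, Ikr B p χ z) + (2*c₁+6) * Λ * √ε * eng p b hi) := by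
      refine this.trans (le_of_eq ?_)
      field_simp
    exact nonneg_of_mul_nonneg_right h2 (by positivity)
  rw [abs_le]
  have k1 := key 1 (by simp)
  have k2 := key (-1) (by simp)
  constructor <;> linarith
end

section
variable {c₀ c₁ τ lam r : ℝ} {B : 𝓩 E → 𝓑 E Y}
    {u : 𝓩 E → Y} {p : 𝓩 E → 𝓛 E Y}

def Fb (B : 𝓩 E → 𝓑 E Y) (p : 𝓩 E → 𝓛 E Y) (z : 𝓩 E) : ℝ :=
  B z (p z) (p z) - 2 * B z (p z) (dtL E Y (p z (0,1)))

lemma BL.vert {p : 𝓩 E → 𝓛 E Y} (hp : BL p) : BL (fun z => p z (0,1)) := hp.bil (BL.const _)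

lemma Sys.blF (S : Sys c₀ c₁ τ lam r B u p) : BL (Fb B p) := by
  have hp := S.bp
  have hB := S.bB
  have h1 : BL (fun z => B z (p z) (p z)) := (hB.bil hp).bil hp
  have h2 : BL (fun z => B z (p z) (dtL E Y (p z (0,1)))) := (hB.bil hp).bil ((BL.const (dtL E Y)).bil hp.vert)
  have h3 := h1.add ((BL.const (E := E) (-2:ℝ)).mul h2)
  convert h3 using 2 with z
  simp only [Fb]; ring

lemma Sys.I_small (S : Sys c₀ c₁ τ lam r B u p) : ∃ K : ℝ, ∀ t, 0 < t →
    |(∫ z in box E (2*r) 0 t, Ikr B p (chi (2*r) r t t) z) + ∫ x in ball (0:E) (2*r), eta (2*r) r x * Fb B p (x,0)| ≤ K * t := by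
  have hr := S.hr
  have hc1 := S.hc1
  have hηl : Lip (fun z : 𝓩 E => eta (2*r) r z.1) := Lip.of_norm (1/r) fun x y => by
    refine (eta_lip _ _ hr _ _).trans ?_
    gcongr; exact norm_fst_le (x - y)
  have hη1 : ∀ z : 𝓩 E, ‖eta (2*r) r z.1‖ ≤ 1 := fun z => clamp_abs _
  have hf : BL (fun z : 𝓩 E => eta (2*r) r z.1 * Fb B p z) := (hηl.BL 1 hη1).mul S.blF
  obtain ⟨K, hK0, hK⟩ := hf.slice (2*r)
  obtain ⟨P, hP0, hP⟩ := S.bp2.exC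
  refine ⟨K + 3*c₁*(1/r) * (P * volume.real (ball (0:E) (2*r))), fun t ht => ?_⟩
  have hO := box_meas (E := E) (2*r) 0 t
  have hfin := box_fin (E := E) (2*r) 0 t
  have hgl : Lip (fun z : 𝓩 E => clamp ((t - z.2)/t)) := Lip.of_norm (1/t) fun x y => by
    refine (clamp_aff_lip t ht _ _).trans ?_
    gcongr; exact norm_snd_le (x - y)
  have hfdη : ∀ z : 𝓩 E, ‖fderiv ℝ (fun z : 𝓩 E => eta (2*r) r z.1) z‖ ≤ 1/r := fun z =>
    fderiv_le (χ := fun z : 𝓩 E => eta (2*r) r z.1) (by positivity) (fun x y => by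
      refine (eta_lip _ _ hr _ _).trans ?_
      gcongr; exact norm_fst_le (x - y)) z
  have key : ∀ᵐ z : 𝓩 E, z ∈ box E (2*r) 0 t → |Ikr B p (chi (2*r) r t t) z + (1/t) * (eta (2*r) r z.1 * Fb B p z)| ≤ 3*c₁*(1/r)*‖p z‖^2 := by
    filter_upwards [fderiv_prod_ae hηl hgl] with z hz hzO
    have e1 : fderiv ℝ (fun z : 𝓩 E => clamp ((t - z.2)/t)) z = -(1/t) • ContinuousLinearMap.snd ℝ E ℝ := by
      have h3 : HasFDerivAt (fun z : 𝓩 E => 1 + (-(1/t) • ContinuousLinearMap.snd ℝ E ℝ) z) (-(1/t) • ContinuousLinearMap.snd ℝ E ℝ) z :=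
        (-(1/t) • ContinuousLinearMap.snd ℝ E ℝ).hasFDerivAt.const_add 1
      refine HasFDerivAt.fderiv (h3.congr_of_eventuallyEq ?_)
      filter_upwards [(isOpen_Ioo.preimage continuous_snd).mem_nhds (show z ∈ Prod.snd ⁻¹' (Ioo 0 t) from ⟨hzO.2.1, hzO.2.2⟩)] with y hy
      simp only [mem_preimage, mem_Ioo] at hy
      rw [clamp_id (by apply div_nonneg _ ht.le; linarith [hy.2]) (by rw [div_le_one ht]; linarith [hy.1])]
      simp
      field_simp
      ring
    set l := fderiv ℝ (fun z : 𝓩 E => eta (2*r) r z.1) z with hl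
    set θ := clamp ((t - z.2)/t) with hθ
    have hθ0 : 0 ≤ θ := clamp_nonneg _
    have hθ1 : θ ≤ 1 := clamp_le _
    have e2 : fderiv ℝ (chi (2*r) r t t) z = eta (2*r) r z.1 • (-(1/t) • ContinuousLinearMap.snd ℝ E ℝ) + θ • l := by
      have : chi (E := E) (2*r) r t t = fun z => eta (2*r) r z.1 • clamp ((t - z.2)/t) := rfl
      rw [this, hz, e1]
      congr 1
      ext <;> simp [mul_comm]
    have e3 : (fderiv ℝ (chi (2*r) r t t) z).smulRight (p z (0,1)) = (-(eta (2*r) r z.1/t)) • dtL E Y (p z (0,1)) + θ • l.smulRight (p z (0,1)) := by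
      rw [e2]
      apply ContinuousLinearMap.ext
      intro w
      simp [dtL_apply', smul_smul, add_smul, sub_smul, div_eq_mul_inv]
    have e4 : fderiv ℝ (chi (2*r) r t t) z (0,1) = -(eta (2*r) r z.1/t) + θ * l (0,1) := by
      rw [e2]; simp [div_eq_mul_inv]
    have e5 : Ikr B p (chi (2*r) r t t) z + (1/t) * (eta (2*r) r z.1 * Fb B p z) = θ * Ikr B p (fun z : 𝓩 E => eta (2*r) r z.1) z := by
      unfold Ikr Fb
      rw [e3, e4, ← hl]
      simp only [map_add, map_smul, smul_eq_mul]
      ring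
    rw [e5, abs_mul, abs_of_nonneg hθ0]
    have := Ikr_le S (hfdη z)
    have h2 := mul_le_mul_of_nonneg_right hθ1 (abs_nonneg (Ikr B p (fun z : 𝓩 E => eta (2*r) r z.1) z))
    linarith
  have hIb := S.bIkr (chi_lip (E := E) (b := 2*r) (ρ := r) (t := t) (ρ' := t) hr ht)
  have i1 := hIb.intgOn hfin
  have i2 := hf.bd.intgOn hfin
  have i3 := S.bp2.intgOn hfin
  have k1 : |(∫ z in box E (2*r) 0 t, Ikr B p (chi (2*r) r t t) z) + (1/t) * ∫ z in box E (2*r) 0 t, eta (2*r) r z.1 * Fb B p z| ≤ 3*c₁*(1/r) * (P * (volume.real (ball (0:E) (2*r)) * t)) := by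
    rw [← integral_const_mul, ← integral_add i1 (i2.const_mul _)]
    have h1 := norm_integral_le_of_norm_le (f := fun z => Ikr B p (chi (2*r) r t t) z + 1/t * (eta (2*r) r z.1 * Fb B p z)) (i3.const_mul (3*c₁*(1/r))) ((ae_restrict_iff' hO).2 key)
    rw [Real.norm_eq_abs] at h1
    refine h1.trans ?_
    rw [integral_const_mul]
    apply mul_le_mul_of_nonneg_left _ (by positivity)
    have h2 := norm_setIntegral_le_of_norm_le_const hfin (f := fun z => ‖p z‖^2) (C := P) fun z _ => hP z
    rw [vol_box _ _ _ ht.le, sub_zero] at h2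
    exact (le_abs_self _).trans h2
  have k2 := hK t ht.le
  have k3 : |(1/t) * (∫ z in box E (2*r) 0 t, eta (2*r) r z.1 * Fb B p z) - ∫ x in ball (0:E) (2*r), eta (2*r) r x * Fb B p (x,0)| ≤ K * t := by
    have : (1/t) * (∫ z in box E (2*r) 0 t, eta (2*r) r z.1 * Fb B p z) - (∫ x in ball (0:E) (2*r), eta (2*r) r x * Fb B p (x,0)) =
        (1/t) * ((∫ z in box E (2*r) 0 t, eta (2*r) r z.1 * Fb B p z) - t * ∫ x in ball (0:E) (2*r), eta (2*r) r x * Fb B p (x,0)) := by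
      field_simp
    rw [this, abs_mul, abs_of_pos (by positivity)]
    calc _ ≤ (1/t) * (K * t^2) := by
          apply mul_le_mul_of_nonneg_left k2 (by positivity)
      _ = _ := by field_simp
  rw [abs_le] at *
  constructor <;> linarith [k1.1, k1.2, k3.1, k3.2]

lemma Sys.I_cut (S : Sys c₀ c₁ τ lam r B u p) {χ : 𝓩 E → ℝ} {b h h' : ℝ} (hh : h' ≤ h) (h0 : ∀ z, 0 < z.2 → z ∉ box E b 0 h' → χ z = 0) (hχ : Lip χ) :
    ∫ z in box E b 0 h, Ikr B p χ z = ∫ z in box E b 0 h', Ikr B p χ z := by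
  apply setIntegral_eq_of_subset_of_ae_sdiff_eq_zero (box_meas _ _ _).nullMeasurableSet (box_mono le_rfl le_rfl hh)
  filter_upwards [ae_ne2 (E := E) h'] with z hne hz
  have : fderiv ℝ χ z = 0 := by
    have hz2 : h' < z.2 := by
      by_contra hc
      exact hz.2 ⟨hz.1.1, hz.1.2.1, lt_of_le_of_ne (not_lt.1 hc) hne⟩
    have hpos := hz.1.2.1
    have : χ =ᶠ[𝓝 z] fun _ => 0 := by
      filter_upwards [(isOpen_Ioi.preimage continuous_snd).mem_nhds (show z ∈ Prod.snd ⁻¹' (Ioi h') from hz2), (isOpen_Ioi.preimage continuous_snd).mem_nhds (show z ∈ Prod.snd ⁻¹' (Ioi 0) from hpos)] with y hy hy0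
      exact h0 y hy0 fun hc => by
        have := hc.2.2
        simp only [mem_preimage, mem_Ioi] at hy
        linarith
    rw [this.fderiv_eq]; simp
  simp [Ikr, this]

lemma Sys.I_sub (S : Sys c₀ c₁ τ lam r B u p) {χ χ' : 𝓩 E → ℝ} {b h : ℝ} (hχ : Lip χ) (hχ' : Lip χ') :
    ∫ z in box E b 0 h, Ikr B p (fun z => χ z - χ' z) z = (∫ z in box E b 0 h, Ikr B p χ z) - ∫ z in box E b 0 h, Ikr B p χ' z := by
  rw [← integral_sub ((S.bIkr hχ).intgOn (box_fin _ _ _)) ((S.bIkr hχ').intgOn (box_fin _ _ _))]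
  apply integral_congr_ae
  apply ae_restrict_of_ae
  filter_upwards [hχ.aed, hχ'.aed] with z h1 h2
  have e1 : fderiv ℝ (fun z => χ z - χ' z) z = fderiv ℝ χ z - fderiv ℝ χ' z := (h1.hasFDerivAt.sub h2.hasFDerivAt).fderiv
  have e2 : (fderiv ℝ (fun z => χ z - χ' z) z).smulRight (p z (0,1)) = (fderiv ℝ χ z).smulRight (p z (0,1)) - (fderiv ℝ χ' z).smulRight (p z (0,1)) := by
    rw [e1]
    apply ContinuousLinearMap.ext
    intro w
    simp [sub_smul]
  unfold Ikr
  rw [e2, e1]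
  simp only [map_sub, sub_apply]
  ring
end

section
variable {c₀ c₁ τ lam r : ℝ} {B : 𝓩 E → 𝓑 E Y}
    {u : 𝓩 E → Y} {p : 𝓩 E → 𝓛 E Y}

lemma chi_diff0 {r t t' : ℝ} (hr : 0 < r) (ht' : 0 < t') (htt : t' ≤ t) (z : 𝓩 E) (hz : z ∉ box E (2*r) 0 t) :
    chi (2*r) r t t z - chi (2*r) r t' t' z = 0 := by
  have ht : 0 < t := ht'.trans_le htt
  by_cases h1 : 2*r ≤ ‖z.1‖
  · rw [chi_zero hr ht z (Or.inl h1), chi_zero hr ht' z (Or.inl h1), sub_zero]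
  by_cases h2 : t ≤ z.2
  · rw [chi_zero hr ht z (Or.inr h2), chi_zero hr ht' z (Or.inr (htt.trans h2)), sub_zero]
  by_cases h3 : z.2 ≤ 0
  · rw [chi_low ht z (by linarith), chi_low ht' z (by linarith), sub_self]
  · exact absurd ⟨not_le.1 h1, not_le.1 h3, not_le.1 h2⟩ hz

lemma Sys.rel1 (S : Sys c₀ c₁ τ lam r B u p) {N D q H : ℝ} (T : Star (eng p) N D τ lam r) (P : Scale D τ lam r q H) :
    |∫ x in ball (0:E) (2*r), eta (2*r) r x * Fb B p (x,0)| ≤ (15*c₁+18) * (q/H) * (2*D*H*N + eng p (3*r) H) := by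
  have hr := S.hr
  have hc1 := S.hc1
  have ht := S.ht
  have hl := S.hl
  have hl1 := S.hl1
  have hD := T.hD
  have hN := T.hN
  have hq3 := P.hq
  have hq := P.pow
  have hH := P.hH
  have hHr := P.Hr
  set X := 2*D*H*N + eng p (3*r) H with hX
  have hX0 : 0 ≤ X := by
    have := T.nn (3*r) H
    positivity
  set t : ℕ → ℝ := fun k => H/q^k with htk
  have tpos : ∀ k, 0 < t k := fun k => by positivity
  have tle : ∀ k, t k ≤ H := fun k => div_le_self hH.le (one_le_pow₀ (by linarith))
  have tsucc : ∀ k, t (k+1) = t k / q := fun k => by simp only [htk, pow_succ]; field_simp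
  have tsle : ∀ k, t (k+1) ≤ t k := fun k => by rw [tsucc]; exact div_le_self (tpos k).le (by linarith)
  set y := q ^ (-(1-lam/4)) with hy
  set zz := q ^ (-(lam/2)) with hzz
  set w := q ^ (-(lam/4)) with hw
  have hy0 : 0 < y := by positivity
  have hz0 : 0 < zz := by positivity
  have hw0 : 0 < w := by positivity
  have hyw : q * y * zz = w := by
    rw [hy, hzz, hw]
    conv_lhs => rw [← Real.rpow_one q]
    simp only [Real.rpow_one]
    nth_rw 1 [← Real.rpow_one q]
    rw [← Real.rpow_add hq, ← Real.rpow_add hq]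
    congr 1; ring
  have hw2 : w ≤ 1/2 := by
    have h1 := P.qD
    rw [hw, Real.rpow_neg hq.le]
    rw [inv_eq_one_div]
    apply one_div_le_one_div_of_le (by norm_num)
    linarith
  have hy1 : y ≤ 1 := Real.rpow_le_one_of_one_le_of_nonpos (by linarith) (by linarith)
  have hHl : 0 < H^lam := by positivity
  have hτH : τ * H^lam ≤ 1/4 := by
    have h1 := P.HD
    have h2 : τ * H^lam ≤ D * τ * H^lam := by
      rw [mul_assoc]; exact le_mul_of_one_le_left (by positivity) hD
    linarith
  have hτk : ∀ k, τ * (t k)^lam ≤ 1/4 := fun k =>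
    (mul_le_mul_of_nonneg_left (Real.rpow_le_rpow (tpos k).le (tle k) hl.le) ht.le).trans hτH
  have hsq : ∀ k, √(τ * (t k)^lam) ≤ 1/2 * zz^k := fun k => by
    rw [Real.sqrt_le_left (by positivity)]
    have e1 : (t k)^lam = H^lam * (zz^k)^2 := by
      simp only [htk]
      rw [Real.div_rpow hH.le (by positivity), div_eq_mul_inv]
      congr 1
      rw [hzz, ← Real.rpow_natCast, ← Real.rpow_natCast, ← Real.rpow_natCast, ← Real.rpow_mul hq.le, ← Real.rpow_mul hq.le, ← Real.rpow_mul hq.le, ← Real.rpow_neg hq.le]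
      congr 1; push_cast; ring
    rw [e1, mul_pow]
    have : τ * (H^lam * (zz^k)^2) = (τ * H^lam) * (zz^k)^2 := by ring
    rw [this]
    apply mul_le_mul_of_nonneg_right _ (by positivity)
    linarith
  have heng : ∀ k, eng p (2*r) (t k) ≤ y^k * X := fun k => by
    have h1 := T.piece2 P k (2*r) (by have := tpos k; simp only [htk] at this; linarith)
    refine h1.trans (mul_le_mul_of_nonneg_left ?_ (by positivity))
    have h2 := T.mono (2*r + (H - H/q^k)) (3*r) H H (by have := tpos k; simp only [htk] at this; linarith) le_rfl
    linarith
  have hLip : ∀ k, Lip (chi (E := E) (2*r) r (t k) (t k)) := fun k => chi_lip hr (tpos k)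
  set I : ℕ → ℝ := fun k => ∫ z in box E (2*r) 0 H, Ikr B p (chi (2*r) r (t k) (t k)) z with hI
  have hrt : ∀ k, 1/r ≤ 1/t k := fun k => one_div_le_one_div_of_le (tpos k) ((tle k).trans hHr)
  have step : ∀ k, |I k - I (k+1)| ≤ (3*c₁+9) * (q/H) * w^k * X := fun k => by
    simp only [hI]
    rw [← S.I_sub (hLip k) (hLip (k+1))]
    rw [S.I_cut (tle k) (fun z _ hz => chi_diff0 hr (tpos (k+1)) (tsle k) z hz) ((hLip k).sub (hLip (k+1)))]
    have hΛ : ∀ z z' : 𝓩 E, |(chi (2*r) r (t k) (t k) z - chi (2*r) r (t (k+1)) (t (k+1)) z) - (chi (2*r) r (t k) (t k) z' - chi (2*r) r (t (k+1)) (t (k+1)) z')| ≤ (3*q/t k) * ‖z - z'‖ := fun z z' => by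
      have h1 := chi_lip' (E := E) (b := 2*r) (t := t k) hr (tpos k) z z'
      have h2 := chi_lip' (E := E) (b := 2*r) (t := t (k+1)) hr (tpos (k+1)) z z'
      have h3 : (1/r + 1/t k) + (1/r + 1/t (k+1)) ≤ 3*q/t k := by
        have e : 1/t (k+1) = q * (1/t k) := by rw [tsucc]; field_simp
        have e2 : 3*q/t k = 3*q*(1/t k) := by ring
        rw [e, e2]
        have := hrt k
        have h0 : 0 < 1/t k := by have := tpos k; positivity
        nlinarith
      calc _ ≤ |chi (2*r) r (t k) (t k) z - chi (2*r) r (t k) (t k) z'| + |chi (2*r) r (t (k+1)) (t (k+1)) z - chi (2*r) r (t (k+1)) (t (k+1)) z'| := by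
            rw [show ∀ a b c d : ℝ, (a - b) - (c - d) = (a - c) - (b - d) by intros; ring]
            exact abs_sub _ _
        _ ≤ _ := by
            refine (add_le_add h1 h2).trans ?_
            rw [← add_mul]
            exact mul_le_mul_of_nonneg_right h3 (norm_nonneg _)
    have h1 := S.sl (b := 2*r) (hi := t k) (by have := tpos k; positivity) hΛ (tpos k) (by linarith) ((tle k).trans hHr)
      (fun z hz => chi_diff0 hr (tpos (k+1)) (tsle k) z hz) (hτk k)
    refine h1.trans ?_
    have hp0 := tpos k
    calc _ ≤ (2*c₁+6) * (3*q/t k) * (1/2 * zz^k) * (y^k * X) := by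
          apply mul_le_mul _ (heng k) (T.nn _ _) (by positivity)
          exact mul_le_mul_of_nonneg_left (hsq k) (by positivity)
      _ = _ := by
          rw [← hyw, mul_pow, mul_pow]
          simp only [htk]
          field_simp
          ring
  have base : |I 0| ≤ 9*c₁ * (q/H) * X := by
    have ht0 : t 0 = H := by simp [htk]
    have h1 : ∀ z : 𝓩 E, |Ikr B p (chi (2*r) r (t 0) (t 0)) z| ≤ 3*c₁*(q/H) * ‖p z‖^2 := fun z => by
      apply Ikr_le S
      refine (fderiv_le (by rw [ht0]; positivity) (chi_lip' hr (tpos 0)) z).trans ?_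
      have := hrt 0
      rw [ht0] at this ⊢
      have e2 : q/H = q*(1/H) := by ring
      have h0 : 0 < 1/H := by positivity
      rw [e2]; nlinarith
    have h2 := norm_integral_le_of_norm_le (f := Ikr B p (chi (2*r) r (t 0) (t 0))) ((S.bp2.intgOn (box_fin (2*r) 0 H)).const_mul (3*c₁*(q/H))) (Eventually.of_forall h1)
    rw [integral_const_mul] at h2
    have h3 : eng p (2*r) H ≤ X := by simpa [htk] using heng 0
    have h4 : |I 0| ≤ 3*c₁*(q/H) * eng p (2*r) H := h2
    have h5 : 3*c₁*(q/H) * eng p (2*r) H ≤ 3*c₁*(q/H) * X := mul_le_mul_of_nonneg_left h3 (by positivity)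
    have h6 : 0 ≤ c₁ * (q/H) * X := by positivity
    linarith
  have all : ∀ k, |I k| ≤ (9*c₁ + (3*c₁+9)*2*(1 - w^k)) * (q/H) * X := fun k => by
    induction k with
    | zero => simpa using base
    | succ k ih =>
      have h1 := step k
      have h2 : |I (k+1)| ≤ |I k| + |I k - I (k+1)| := by
        have := abs_sub (I k) (I k - I (k+1))
        simpa using this
      have h3 : 0 ≤ (3*c₁+9) * (q/H) * X := by positivity
      have h4 : w^k ≤ 2 * (w^k - w^(k+1)) := by
        rw [pow_succ]
        have : 0 < w^k := by positivity
        nlinarith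
      have h5 := mul_le_mul_of_nonneg_left h4 h3
      nlinarith
  obtain ⟨K, hK⟩ := S.I_small
  have fin : ∀ k, |∫ x in ball (0:E) (2*r), eta (2*r) r x * Fb B p (x,0)| ≤ (15*c₁+18) * (q/H) * X + K * t k := fun k => by
    have h1 := hK (t k) (tpos k)
    rw [← S.I_cut (tle k) (fun z h0 hz => ?_) (hLip k)] at h1
    · have h2 := all k
      have h3 : |∫ x in ball (0:E) (2*r), eta (2*r) r x * Fb B p (x,0)| ≤ |I k| + K * t k := by
        have := abs_sub (I k + ∫ x in ball (0:E) (2*r), eta (2*r) r x * Fb B p (x,0)) (I k)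
        simp only [add_sub_cancel_left] at this
        linarith
      have h4 : 0 ≤ (3*c₁+9) * 2 * w^k * ((q/H) * X) := by positivity
      nlinarith
    · by_cases h1 : 2*r ≤ ‖z.1‖
      · exact chi_zero hr (tpos k) z (Or.inl h1)
      · exact chi_zero hr (tpos k) z (Or.inr (by
          by_contra hc
          exact hz ⟨not_le.1 h1, h0, not_le.1 hc⟩))
  have tl : Tendsto (fun k => (15*c₁+18) * (q/H) * X + K * t k) atTop (𝓝 ((15*c₁+18) * (q/H) * X + K * 0)) := by
    apply Tendsto.const_add
    apply Tendsto.const_mul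
    simp only [htk]
    have := (tendsto_pow_atTop_nhds_zero_of_lt_one (r := 1/q) (by positivity) (by rw [div_lt_one hq]; linarith)).const_mul H
    simpa [div_eq_mul_inv] using this
  have := ge_of_tendsto' tl fin
  simpa using this

lemma Sys.rel2 (S : Sys c₀ c₁ τ lam r B u p) {N D q H : ℝ} (T : Star (eng p) N D τ lam r) (P : Scale D τ lam r q H)
    {f : E → ℝ} (hf : Bdd f) (hf0 : ∀ x, 0 ≤ f x) (hfN : N = ∫ x in ball (0:E) (4*r), f x) {σ Kf : ℝ} (hσ : |σ| ≤ 1) (hK : 0 ≤ Kf)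
    (h : ∀ x, c₀/2 * ‖p (x,0)‖^2 ≤ σ * Fb B p (x,0) + Kf * f x) :
    c₀/2 * ∫ x in ball (0:E) r, ‖p (x,0)‖^2 ≤ Kf * N + (15*c₁+18) * (q/H) * (2*D*H*N + eng p (3*r) H) := by
  have hr := S.hr
  have hc0 := S.hc0
  have h1 := S.rel1 T P
  have hp2 : Bdd (fun x : E => ‖p (x,0)‖^2) := by have := S.bp.at0; simp [this]
  have hη : Bdd (eta (E := E) (2*r) r) := by
    refine ⟨?_, 1, fun x => clamp_abs _⟩
    have : Lip (eta (E := E) (2*r) r) := Lip.of_norm (1/r) fun x y => eta_lip _ _ hr x y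
    obtain ⟨K, hK⟩ := this
    exact hK.continuous.aestronglyMeasurable
  have hF : Bdd (fun x : E => Fb B p (x,0)) := S.blF.at0
  have m1 : ∫ x in ball (0:E) r, ‖p (x,0)‖^2 ≤ ∫ x in ball (0:E) (2*r), eta (2*r) r x * ‖p (x,0)‖^2 := by
    calc _ = ∫ x in ball (0:E) r, eta (2*r) r x * ‖p (x,0)‖^2 := by
          apply setIntegral_congr_fun measurableSet_ball
          intro x hx
          simp only
          rw [eta_one hr, one_mul]
          rw [mem_ball_zero_iff] at hx; linarith
      _ ≤ _ := by
          apply setIntegral_mono_set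
          · have : Bdd (fun x : E => eta (2*r) r x * ‖p (x,0)‖^2) := by simp [hη, hp2]
            exact this.intgOn measure_ball_lt_top
          · exact Eventually.of_forall fun x => mul_nonneg (clamp_nonneg _) (by positivity)
          · exact LE.le.eventuallyLE (ball_subset_ball (by linarith))
  have b1 : Bdd (fun x : E => c₀/2 * (eta (2*r) r x * ‖p (x,0)‖^2)) := by simp [hη, hp2]
  have b2 : Bdd (fun x : E => eta (2*r) r x * Fb B p (x,0)) := by simp [hη, hF]
  have b4 : Bdd (fun x : E => σ * (eta (2*r) r x * Fb B p (x,0)) + Kf * f x) := ((Bdd.const σ).mul b2).add ((Bdd.const Kf).mul hf)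
  have m2 := intE_mono b1 b4 (2*r) fun x => by
    have e0 := clamp_nonneg ((2*r - ‖x‖)/r)
    have e1 := clamp_le ((2*r - ‖x‖)/r)
    have := mul_le_mul_of_nonneg_left (h x) e0
    have e2 : eta (2*r) r x * (Kf * f x) ≤ 1 * (Kf * f x) := mul_le_mul_of_nonneg_right e1 (mul_nonneg hK (hf0 x))
    change eta (2*r) r x * _ ≤ eta (2*r) r x * _ at this
    nlinarith
  rw [integral_const_mul, integral_add ((b2.intgOn measure_ball_lt_top).const_mul _) ((hf.intgOn measure_ball_lt_top).const_mul _), integral_const_mul, integral_const_mul] at m2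
  have m3 : ∫ x in ball (0:E) (2*r), f x ≤ N := by
    rw [hfN]
    exact setIntegral_mono_set (hf.intgOn measure_ball_lt_top) (Eventually.of_forall hf0) (LE.le.eventuallyLE (ball_subset_ball (by linarith)))
  have m4 : σ * (∫ x in ball (0:E) (2*r), eta (2*r) r x * Fb B p (x,0)) ≤ |∫ x in ball (0:E) (2*r), eta (2*r) r x * Fb B p (x,0)| := by
    refine (le_abs_self _).trans ?_
    rw [abs_mul]
    exact mul_le_of_le_one_left (abs_nonneg _) hσ
  have m5 := mul_le_mul_of_nonneg_left m3 hK
  have m6 := mul_le_mul_of_nonneg_left m1 (show 0 ≤ c₀/2 by positivity)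
  linarith
end

section
variable {c₀ c₁ τ lam r : ℝ} {B : 𝓩 E → 𝓑 E Y}
    {u : 𝓩 E → Y} {p : 𝓩 E → 𝓛 E Y}

lemma scale_ex {D τ lam : ℝ} (hD : 1 ≤ D) (ht : 0 < τ) (hl : 0 < lam) :
    ∃ q h0 : ℝ, 0 < h0 ∧ h0 ≤ 1 ∧ 0 < q ∧ ∀ r, 0 < r → Scale D τ lam r q (min r h0) := by
  set q := max 3 ((12*D)^(4/lam)) with hq
  have hq3 : 3 ≤ q := le_max_left _ _
  have hq0 : 0 < q := by linarith
  set h0 := min 1 ((q ^ (-(1-lam/4)) / (4*D*τ))^(1/lam)) with hh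
  have h00 : 0 < h0 := by
    have : 0 < (q ^ (-(1-lam/4)) / (4*D*τ))^(1/lam) := by positivity
    exact lt_min one_pos this
  refine ⟨q, h0, h00, min_le_left _ _, hq0, fun r hr => ⟨hq3, ?_, lt_min hr h00, min_le_left _ _, ?_⟩⟩
  · have h1 : (12*D)^(4/lam) ≤ q := le_max_right _ _
    have h2 := Real.rpow_le_rpow (by positivity) h1 (show 0 ≤ lam/4 by positivity)
    rw [← Real.rpow_mul (by positivity)] at h2
    have : 4/lam * (lam/4) = 1 := by field_simp
    rwa [this, Real.rpow_one] at h2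
  · have h1 : min r h0 ≤ (q ^ (-(1-lam/4)) / (4*D*τ))^(1/lam) := (min_le_right _ _).trans (min_le_right _ _)
    have h2 := Real.rpow_le_rpow (lt_min hr h00).le h1 hl.le
    rw [← Real.rpow_mul (by positivity)] at h2
    have : 1/lam * lam = 1 := by field_simp
    rw [this, Real.rpow_one] at h2
    calc _ ≤ D * τ * (q ^ (-(1-lam/4)) / (4*D*τ)) := mul_le_mul_of_nonneg_left h2 (by positivity)
      _ = _ := by field_simp

lemma Sys.rel3 (S : Sys c₀ c₁ τ lam r B u p) {N D q h0 : ℝ} (T : Star (eng p) N D τ lam r) (hh : 0 < h0) (hh1 : h0 ≤ 1) (hq : 0 < q)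
    (P : Scale D τ lam r q (min r h0))
    {f : E → ℝ} (hf : Bdd f) (hf0 : ∀ x, 0 ≤ f x) (hfN : N = ∫ x in ball (0:E) (4*r), f x) {σ Kf : ℝ} (hσ : |σ| ≤ 1) (hK : 0 ≤ Kf)
    (h : ∀ x, c₀/2 * ‖p (x,0)‖^2 ≤ σ * Fb B p (x,0) + Kf * f x) :
    ∫ x in ball (0:E) r, ‖p (x,0)‖^2 ≤ ((2/c₀)*(Kf + (15*c₁+18)*(2*q*D + 2*q*D/h0))) * N + ((2/c₀)*(Kf + (15*c₁+18)*(2*q*D + 2*q*D/h0)))/r * eng p (4*r) (2*r) := by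
  have hr := S.hr
  have hc0 := S.hc0
  have hc1 := S.hc1
  have hD := T.hD
  have hN := T.hN
  have h1 := S.rel2 T P hf hf0 hfN hσ hK h
  have he := T.nn (4*r) (2*r)
  set H := min r h0 with hHd
  have hH := P.hH
  have key : (q/H) * eng p (3*r) H ≤ (q/h0) * (D*N + 2*D/r * eng p (4*r) (2*r)) := by
    rcases le_or_gt r 2 with hr2 | hr2
    · have a1 : h0/2*r ≤ H := le_min (by nlinarith) (by nlinarith)
      have a2 : q/H ≤ q/h0 * (2/r) := by
        calc q/H ≤ q/(h0/2*r) := div_le_div_of_nonneg_left hq.le (by positivity) a1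
          _ = _ := by field_simp
      have a3 := T.mono (3*r) (4*r) H (2*r) (by linarith) (by have := P.Hr; linarith)
      calc _ ≤ (q/h0 * (2/r)) * eng p (4*r) (2*r) := mul_le_mul a2 a3 (T.nn _ _) (by positivity)
        _ = (q/h0) * (2/r * eng p (4*r) (2*r)) := by ring
        _ ≤ _ := by
          apply mul_le_mul_of_nonneg_left _ (by positivity)
          have : 2/r * eng p (4*r) (2*r) ≤ D * (2/r * eng p (4*r) (2*r)) := le_mul_of_one_le_left (by positivity) hD
          have e : 2*D/r * eng p (4*r) (2*r) = D * (2/r * eng p (4*r) (2*r)) := by ring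
          have : 0 ≤ D * N := by positivity
          linarith
    · have a0 : H = h0 := min_eq_right (by linarith)
      rw [a0]
      apply mul_le_mul_of_nonneg_left _ (by positivity)
      have a1 := T.mono (3*r) (3*r) h0 1 le_rfl hh1
      have a2 := T.perd (3*r) (r/2) (by linarith) (by linarith) (by linarith)
      have a3 := T.mono (3*r+r/2) (4*r) (3*(r/2)) (2*r) (by linarith) (by linarith)
      have a4 := mul_le_mul_of_nonneg_left a3 (show 0 ≤ D/(r/2) by positivity)
      have e : D/(r/2) = 2*D/r := by field_simp
      rw [e] at a2 a4
      linarith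
  have e1 : (15*c₁+18) * (q/H) * (2*D*H*N + eng p (3*r) H) = (15*c₁+18) * (2*q*D*N + (q/H) * eng p (3*r) H) := by
    field_simp
  rw [e1] at h1
  have h2 := mul_le_mul_of_nonneg_left key (show 0 ≤ 15*c₁+18 by positivity)
  set e := eng p (4*r) (2*r)
  have h3 : c₀/2 * (∫ x in ball (0:E) r, ‖p (x,0)‖^2) ≤ (Kf + (15*c₁+18)*(2*q*D + 2*q*D/h0)) * N + (Kf + (15*c₁+18)*(2*q*D + 2*q*D/h0))/r * e := by
    have x1 : 0 ≤ (15*c₁+18) * (q*D/h0) * N := by positivity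
    have x2 : 0 ≤ Kf / r * e := by positivity
    have x3 : 0 ≤ (15*c₁+18)*(2*q*D)/r * e := by positivity
    have : (Kf + (15*c₁+18)*(2*q*D + 2*q*D/h0)) * N + (Kf + (15*c₁+18)*(2*q*D + 2*q*D/h0))/r * e =
      Kf * N + (15*c₁+18) * (2*q*D*N) + (15*c₁+18) * ((q/h0) * (D*N + 2*D/r*e)) + (15*c₁+18) * (q*D/h0) * N + Kf/r*e + (15*c₁+18)*(2*q*D)/r*e := by
      field_simp
      ring
    linarith
  have h4 := mul_le_mul_of_nonneg_left h3 (show 0 ≤ 2/c₀ by positivity)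
  have e5 : 2/c₀ * (c₀/2 * (∫ x in ball (0:E) r, ‖p (x,0)‖^2)) = ∫ x in ball (0:E) r, ‖p (x,0)‖^2 := by field_simp
  rw [e5] at h4
  refine h4.trans (le_of_eq ?_)
  ring

lemma Sys.ptN (S : Sys c₀ c₁ τ lam r B u p) (x : E) : c₀/2 * ‖p (x,0)‖^2 ≤ 1 * Fb B p (x,0) + (2/c₀) * ‖nuB B p x‖^2 := by
  have hc0 := S.hc0
  have h1 := S.lower (x,0) (p (x,0))
  have h2 : |B (x,0) (p (x,0)) (dtL E Y (p (x,0) (0,1)))| ≤ ‖nuB B p x‖ * ‖p (x,0) (0,1)‖ := (nuB B p x).le_opNorm _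
  have h3 := norm_vert_le (p (x,0))
  have h4 := mul_le_mul_of_nonneg_left h3 (norm_nonneg (nuB B p x))
  have h5 := (le_abs_self _).trans h2
  unfold Fb
  set a := ‖nuB B p x‖
  set b := ‖p (x,0)‖
  have : 2*(a*b) ≤ c₀/2*b^2 + 2/c₀*a^2 := by
    have : 0 ≤ (c₀*b - 2*a)^2/(2*c₀) := by positivity
    have e : (c₀*b - 2*a)^2/(2*c₀) = c₀/2*b^2 + 2/c₀*a^2 - 2*(a*b) := by field_simp; ring
    linarith
  linarith

lemma Sys.ptD (S : Sys c₀ c₁ τ lam r B u p) (x : E) : c₀/2 * ‖p (x,0)‖^2 ≤ (-1) * Fb B p (x,0) + (2*c₁^2/c₀) * ‖tanT p x‖^2 := by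
  have hc0 := S.hc0
  have hc1 := S.hc1
  have h1 := S.lower (x,0) (p (x,0))
  have h2 := S.up2 (x,0) (p (x,0)) (tanT p x)
  have h3 : dtL E Y (p (x,0) (0,1)) = p (x,0) - tanT p x := by
    apply ContinuousLinearMap.ext
    rintro ⟨v, s⟩
    rw [dtL_apply']
    simp only [tanT, tanP, sub_apply, ContinuousLinearMap.comp_apply, ContinuousLinearMap.coe_fst', ContinuousLinearMap.inl_apply]
    rw [← map_smul, ← map_sub]; simp
  unfold Fb
  rw [h3, map_sub]
  have h5 := (le_abs_self _).trans h2
  set a := ‖tanT p x‖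
  set b := ‖p (x,0)‖
  have : 2*(c₁*b*a) ≤ c₀/2*b^2 + 2*c₁^2/c₀*a^2 := by
    have : 0 ≤ (c₀*b - 2*c₁*a)^2/(2*c₀) := by positivity
    have e : (c₀*b - 2*c₁*a)^2/(2*c₀) = c₀/2*b^2 + 2*c₁^2/c₀*a^2 - 2*(c₁*b*a) := by field_simp; ring
    linarith
  linarith

theorem core (E Y : Type*) [NormedAddCommGroup E] [NormedSpace ℝ E] [FiniteDimensional ℝ E]
  [MeasureSpace E] [BorelSpace E] [(volume : Measure E).IsAddHaarMeasure]
  [NormedAddCommGroup Y] [NormedSpace ℝ Y] [FiniteDimensional ℝ Y] {c₀ c₁ τ lam : ℝ} (hc0 : 0 < c₀) (hc1 : 0 < c₁) (ht : 0 < τ) (hl : 0 < lam) :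
    ∃ C : ℝ, 0 < C ∧ ∀ (r : ℝ) (B : 𝓩 E → 𝓑 E Y)
      (u : 𝓩 E → Y) (p : 𝓩 E → 𝓛 E Y), Sys c₀ c₁ τ lam r B u p →
      ((∫ x in ball (0:E) r, ‖p (x,0)‖^2) ≤ C * (∫ x in ball (0:E) (4*r), ‖nuB B p x‖^2) + C/r * eng p (4*r) (2*r)) ∧
      ((∫ x in ball (0:E) r, ‖p (x,0)‖^2) ≤ C * (∫ x in ball (0:E) (4*r), ‖tanT p x‖^2) + C/r * eng p (4*r) (2*r)) := by
  obtain ⟨q, h0, a1, a2, a3, a4⟩ := scale_ex (D := 1 + 2*(2/c₀)/c₀ + 10*c₁/c₀ + 2/c₀) (by linarith [show 0 ≤ 2*(2/c₀)/c₀ + 10*c₁/c₀ + 2/c₀ by positivity]) ht hl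
  obtain ⟨q', h0', b1, b2, b3, b4⟩ := scale_ex (D := 1 + 2*(5*c₁+c₀)/c₀ + 10*c₁/c₀ + 2/c₀) (by linarith [show 0 ≤ 2*(5*c₁+c₀)/c₀ + 10*c₁/c₀ + 2/c₀ by positivity]) ht hl
  set D := 1 + 2*(2/c₀)/c₀ + 10*c₁/c₀ + 2/c₀ with hD
  set D' := 1 + 2*(5*c₁+c₀)/c₀ + 10*c₁/c₀ + 2/c₀ with hD'
  set C1 := (2/c₀)*((2/c₀) + (15*c₁+18)*(2*q*D + 2*q*D/h0)) with hC1
  set C2 := (2/c₀)*((2*c₁^2/c₀) + (15*c₁+18)*(2*q'*D' + 2*q'*D'/h0')) with hC2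
  have p1 : 0 < C1 := by positivity
  have p2 : 0 < C2 := by positivity
  refine ⟨C1 + C2, by positivity, fun r B u p S => ?_⟩
  have hr := S.hr
  have s1 := S.rel3 S.starN' a1 a2 a3 (a4 r S.hr) (f := fun x => ‖nuB B p x‖^2) (by have := S.bn; simp [this]) (fun x => by positivity) rfl (σ := 1) (by simp) (by positivity) S.ptN
  have s2 := S.rel3 S.starD' b1 b2 b3 (b4 r S.hr) (f := fun x => ‖tanT p x‖^2) (by have := S.bT; simp [this]) (fun x => by positivity) rfl (σ := -1) (by simp) (by positivity) S.ptD
  have n1 := S.starN'.hN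
  have n2 := S.starD'.hN
  have n3 := S.starN'.nn (4*r) (2*r)
  constructor
  · refine s1.trans (add_le_add (mul_le_mul_of_nonneg_right (by linarith) n1) (mul_le_mul_of_nonneg_right (div_le_div_of_nonneg_right (by linarith) hr.le) n3))
  · refine s2.trans (add_le_add (mul_le_mul_of_nonneg_right (by linarith) n2) (mul_le_mul_of_nonneg_right (div_le_div_of_nonneg_right (by linarith) hr.le) n3))
end
end core

abbrev EE (e : ℕ) := EuclideanSpace ℝ (Fin e)
local notation:max "ℰ" e:max => EE (e+1)
local notation:max "ℬ" e:max => ball (0:EE e)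
section


def io (e : ℕ) : (EE e × ℝ) ≃L[ℝ] ℰ e :=
  LinearEquiv.toContinuousLinearEquiv
  { toFun := fun z => WithLp.toLp 2 (Fin.snoc (α := fun _ => ℝ) (fun i => z.1 i) z.2)
    invFun := fun X => (projLast e X, X (Fin.last e))
    map_add' := fun z w => by
      ext i
      refine Fin.lastCases ?_ (fun j => ?_) i <;> simp
    map_smul' := fun c z => by
      ext i
      refine Fin.lastCases ?_ (fun j => ?_) i <;> simp
    left_inv := fun z => by
      ext i <;> simp [projLast]
    right_inv := fun X => by
      ext i
      refine Fin.lastCases ?_ (fun j => ?_) i <;> simp [projLast] }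

variable {e : ℕ}

lemma io_apply (z : EE e × ℝ) : io e z = WithLp.toLp 2 (Fin.snoc (α := fun _ => ℝ) (fun i => z.1 i) z.2) := rfl
@[simp] lemma io_last (z : EE e × ℝ) : io e z (Fin.last e) = z.2 := by simp [io_apply]
@[simp] lemma io_cast (z : EE e × ℝ) (i : Fin e) : io e z i.castSucc = z.1 i := by simp [io_apply]
@[simp] lemma proj_io (z : EE e × ℝ) : projLast e (io e z) = z.1 := by ext i; simp [projLast]
lemma io_symm (X : ℰ e) : (io e).symm X = (projLast e X, X (Fin.last e)) := rfl
lemma io_proj (X : ℰ e) : io e (projLast e X, X (Fin.last e)) = X := (io e).right_inv X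

lemma io_normsq (z : EE e × ℝ) : ‖io e z‖^2 = ‖z.1‖^2 + z.2^2 := by
  rw [EuclideanSpace.norm_sq_eq, EuclideanSpace.norm_sq_eq, Fin.sum_univ_castSucc]
  simp

lemma io_norm_le (z : EE e × ℝ) : ‖io e z‖ ≤ ‖z.1‖ + |z.2| := by
  have h := io_normsq z
  have h1 := norm_nonneg z.1
  have h2 := abs_nonneg z.2
  apply abs_le_of_sq_le_sq' _ (by positivity) |>.2
  rw [h, ← sq_abs z.2]; nlinarith

lemma proj_norm_le (X : ℰ e) : ‖projLast e X‖ ≤ ‖X‖ := by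
  have h := io_normsq (projLast e X, X (Fin.last e))
  rw [io_proj] at h
  simp only at h
  exact abs_le_of_sq_le_sq' (by nlinarith [sq_nonneg (X (Fin.last e))]) (norm_nonneg _) |>.2
lemma last_abs_le (X : ℰ e) : |X (Fin.last e)| ≤ ‖X‖ := by
  have h := io_normsq (projLast e X, X (Fin.last e))
  rw [io_proj] at h
  simp only at h
  exact abs_le_of_sq_le_sq (by nlinarith [sq_nonneg ‖projLast e X‖]) (norm_nonneg _)

lemma io_mp : MeasurePreserving (io e) := by
  have h1 := (volume_preserving_piFinSuccAbove (fun _ : Fin (e+1) => ℝ) (Fin.last e)).comp (PiLp.volume_preserving_ofLp (Fin (e+1)))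
  have h2 : MeasurePreserving (fun z : ℝ × (Fin e → ℝ) => ((WithLp.toLp 2 z.2 : EE e), z.1)) := by
    have a := (MeasurePreserving.prod (MeasurePreserving.id (volume : Measure ℝ)) (PiLp.volume_preserving_toLp (Fin e)))
    have b := (Measure.measurePreserving_swap (μ := (volume : Measure ℝ)) (ν := (volume : Measure (EE e))))
    exact b.comp a
  have h3 := h2.comp h1
  have h4 : MeasurePreserving ((io e).symm.toHomeomorph.toMeasurableEquiv) := by
    convert h3 using 1
    ext X i
    · simp [io_symm, projLast, MeasurableEquiv.piFinSuccAbove, Fin.insertNthEquiv, Fin.removeNth]; rfl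
    · simp [io_symm, projLast, MeasurableEquiv.piFinSuccAbove, Fin.insertNthEquiv, Fin.removeNth]
  exact h4.symm

def St (ψ : EE e → ℝ) (z : EE e × ℝ) : ℰ e := io e (z.1, ψ z.1 + z.2)

lemma St_mp {ψ : EE e → ℝ} (hψ : Continuous ψ) : MeasurePreserving (St ψ) := by
  have : MeasurePreserving (fun z : EE e × ℝ => (z.1, ψ z.1 + z.2)) (volume.prod volume) (volume.prod volume) :=
    (MeasurePreserving.id (volume : Measure (EE e))).skew_product (g := fun x s => ψ x + s) (by fun_prop)
      (Eventually.of_forall fun x => (measurePreserving_add_left volume (ψ x)).map_eq)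
  exact io_mp.comp this

lemma St_cont {ψ : EE e → ℝ} (hψ : Continuous ψ) : Continuous (St ψ) := by
  unfold St; fun_prop

def Sth (ψ : EE e → ℝ) (hψ : Continuous ψ) : EE e × ℝ ≃ₜ ℰ e where
  toFun := St ψ
  invFun X := (projLast e X, X (Fin.last e) - ψ (projLast e X))
  left_inv z := by simp [St]
  right_inv X := by simp [St, io_proj]
  continuous_toFun := St_cont hψ
  continuous_invFun := by
    have h1 : Continuous (projLast e) := (continuous_fst.comp (io e).symm.continuous)
    have h2 : Continuous (fun X : ℰ e => X (Fin.last e)) := (continuous_snd.comp (io e).symm.continuous)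
    exact h1.prodMk (h2.sub (hψ.comp h1))

lemma St_me {ψ : EE e → ℝ} (hψ : Continuous ψ) : MeasurableEmbedding (St ψ) := (Sth ψ hψ).measurableEmbedding

lemma St_inv (ψ : EE e → ℝ) (X : ℰ e) : St ψ (projLast e X, X (Fin.last e) - ψ (projLast e X)) = X := by
  simp [St, io_proj]

lemma proj_St (ψ : EE e → ℝ) (z : EE e × ℝ) : projLast e (St ψ z) = z.1 := by simp [St]
lemma last_St (ψ : EE e → ℝ) (z : EE e × ℝ) : St ψ z (Fin.last e) = ψ z.1 + z.2 := by simp [St]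

lemma St_dist {ψ : EE e → ℝ} {M : ℝ} (hM : 0 ≤ M) (hψ : LipschitzWith M.toNNReal ψ) (x y : EE e) (s t : ℝ) :
    dist (St ψ (x,s)) (St ψ (y,t)) ≤ (1+M) * dist x y + |s - t| := by
  have h := hψ.dist_le_mul x y
  rw [Real.coe_toNNReal _ hM, Real.dist_eq] at h
  rw [dist_eq_norm]
  unfold St
  rw [← map_sub]
  refine (io_norm_le _).trans ?_
  simp only [Prod.fst_sub, Prod.snd_sub]
  rw [← dist_eq_norm]
  have : |ψ x + s - (ψ y + t)| ≤ |ψ x - ψ y| + |s - t| := by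
    rw [show ψ x + s - (ψ y + t) = (ψ x - ψ y) + (s - t) by ring]; exact abs_add_le _ _
  linarith

lemma frontier_eq {ψ : EE e → ℝ} (hψ : Continuous ψ) : frontier (graphDomain e ψ) = range (fun x => St ψ (x,0)) := by
  have h1 : graphDomain e ψ = (Sth ψ hψ).symm ⁻¹' (univ ×ˢ Ioi 0) := by
    ext X
    simp [graphDomain, Sth]
  rw [h1, ← Homeomorph.preimage_frontier, frontier_univ_prod_eq]
  rw [frontier_Ioi]
  ext X
  constructor
  · intro hX
    have : X (Fin.last e) - ψ (projLast e X) = 0 := hX.2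
    refine ⟨projLast e X, ?_⟩
    have h := St_inv ψ X
    rw [this] at h; exact h
  · rintro ⟨x, rfl⟩
    refine ⟨mem_univ _, ?_⟩
    show St ψ (x,0) (Fin.last e) - ψ (projLast e (St ψ (x,0))) = 0
    rw [proj_St, last_St]; simp

end

section
variable {e : ℕ}

lemma dl_lower {ψ : EE e → ℝ} {M : ℝ} (hM : 0 ≤ M) (hψ : LipschitzWith M.toNNReal ψ) (x : EE e) (s : ℝ) :
    s ≤ (1+M) * infDist (St ψ (x,s)) (frontier (graphDomain e ψ)) := by
  rw [frontier_eq hψ.continuous, ← div_le_iff₀' (by positivity)]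
  refine (le_infDist (range_nonempty _)).2 ?_
  rintro _ ⟨z, rfl⟩
  rw [div_le_iff₀' (by positivity)]
  have h1 : dist x z ≤ dist (St ψ (x,s)) (St ψ (z,0)) := by
    rw [dist_eq_norm, dist_eq_norm]
    have := proj_norm_le (St ψ (x,s) - St ψ (z,0))
    have h2 : projLast e (St ψ (x,s) - St ψ (z,0)) = x - z := by
      ext i; simp [projLast, St]
    rwa [h2] at this
  have h2 : |ψ x + s - ψ z| ≤ dist (St ψ (x,s)) (St ψ (z,0)) := by
    rw [dist_eq_norm]
    have := last_abs_le (St ψ (x,s) - St ψ (z,0))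
    simpa [St] using this
  have h := hψ.dist_le_mul x z
  rw [Real.coe_toNNReal _ hM, Real.dist_eq] at h
  have := abs_le.1 h
  have := abs_le.1 h2
  nlinarith

lemma cone_ball {ψ : EE e → ℝ} {M C₀ : ℝ} (hM : 0 ≤ M) (hC : 1 < C₀) (hψ : LipschitzWith M.toNNReal ψ) (x : EE e) {s : ℝ}
    (hs : 0 < s) : ∃ y, dist y x ≤ C₀ * s ∧ ∀ z, dist z y < (C₀-1)/(2*(1+M)^2) * s →
      dist (St ψ (x,s)) (St ψ (z,0)) < C₀ * infDist (St ψ (x,s)) (frontier (graphDomain e ψ)) := by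
  set δ := infDist (St ψ (x,s)) (frontier (graphDomain e ψ)) with hδ
  have h1 := dl_lower hM hψ x s
  rw [← hδ] at h1
  have hd : 0 < δ := by
    by_contra h
    push Not at h
    nlinarith
  have h2 : δ ≤ s := by
    have : dist (St ψ (x,s)) (St ψ (x,0)) ≤ s := by
      have := St_dist hM hψ x x s 0
      simpa [abs_of_pos hs] using this
    refine le_trans ?_ this
    apply infDist_le_dist_of_mem
    rw [frontier_eq hψ.continuous]; exact ⟨x, rfl⟩
  have h3 : δ < (1+C₀)/2 * δ := by nlinarith
  rw [hδ, frontier_eq hψ.continuous, infDist_lt_iff (range_nonempty _)] at h3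
  obtain ⟨_, ⟨y, rfl⟩, hy⟩ := h3
  rw [← frontier_eq hψ.continuous, ← hδ] at hy
  have h4 : dist x y ≤ dist (St ψ (x,s)) (St ψ (y,0)) := by
    rw [dist_eq_norm, dist_eq_norm]
    have := proj_norm_le (St ψ (x,s) - St ψ (y,0))
    have h2 : projLast e (St ψ (x,s) - St ψ (y,0)) = x - y := by
      ext i; simp [projLast, St]
    rwa [h2] at this
  refine ⟨y, ?_, fun z hz => ?_⟩
  · rw [dist_comm]; nlinarith
  · have h5 := St_dist hM hψ y z 0 0
    simp only [sub_self, abs_zero, add_zero] at h5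
    have h6 := dist_triangle (St ψ (x,s)) (St ψ (y,0)) (St ψ (z,0))
    have h7 : (1+M) * dist y z ≤ (C₀-1)/2 * δ := by
      rw [dist_comm] at hz
      calc (1+M) * dist y z ≤ (1+M) * ((C₀-1)/(2*(1+M)^2) * s) := by gcongr
        _ ≤ (1+M) * ((C₀-1)/(2*(1+M)^2) * ((1+M)*δ)) := by
            have : 0 ≤ C₀ - 1 := by linarith
            gcongr
        _ = (C₀-1)/2 * δ := by field_simp
    linarith

lemma avg {F h : EE e → ℝ≥0∞} (hh : Measurable h) {a C₀ κ t : ℝ} (hC : 0 < C₀) (hκ : 0 < κ) (ht : 0 < t)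
    (H : ∀ x ∈ ℬ e a, ∃ y, dist y x ≤ C₀ * t ∧ ∀ z, dist z y < κ * t → F x ≤ h z) :
    ∫⁻ x in ℬ e a, F x ≤ ENNReal.ofReal (((C₀+κ)/κ)^e) * ∫⁻ z in ℬ e (a + (C₀+κ)*t), h z := by
  have hv : volume (ℬ e 1) ≠ 0 := (measure_ball_pos _ _ one_pos).ne'
  have hv' : volume (ℬ e 1) ≠ ∞ := measure_ball_lt_top.ne
  set v := volume (ℬ e 1)
  have hb : ∀ (x : EE e) {ρ : ℝ}, 0 < ρ → volume (ball x ρ) = ENNReal.ofReal (ρ^e) * v := by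
    intro x ρ hρ
    have := Measure.addHaar_ball_of_pos volume x hρ
    simpa using this
  set ρ := (C₀+κ)*t with hρd
  have hρ : 0 < ρ := by positivity
  have hk : 0 < κ * t := by positivity
  have hm : Measurable (fun q : EE e × EE e => (if dist q.1 q.2 < ρ then h q.2 else 0)) :=
    Measurable.ite (measurableSet_lt (by fun_prop) (by fun_prop)) (by fun_prop) measurable_const
  have h1 : ∀ x ∈ ℬ e a, F x * (ENNReal.ofReal ((κ*t)^e) * v) ≤
      ∫⁻ z in ℬ e (a + ρ), (if dist x z < ρ then h z else 0) := by
    intro x hx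
    obtain ⟨y, hy, hz⟩ := H x hx
    rw [← hb y hk, ← setLIntegral_const]
    have hsub : ∀ z ∈ ball y (κ*t), dist x z < ρ := by
      intro z hz
      have := dist_triangle_right x z y
      rw [mem_ball] at hz
      rw [dist_comm] at hy
      rw [hρd]; nlinarith
    have hsub2 : ball y (κ*t) ⊆ ball 0 (a+ρ) := by
      intro z hz
      have h1 := hsub z hz
      rw [mem_ball] at hx ⊢
      have := dist_triangle_left z 0 x
      linarith
    refine le_trans ?_ (lintegral_mono_set hsub2)
    refine setLIntegral_mono' measurableSet_ball fun z hz' => ?_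
    rw [if_pos (hsub z hz')]
    exact hz z hz'
  have h2 : (∫⁻ x in ℬ e a, F x) * (ENNReal.ofReal ((κ*t)^e) * v) ≤
      (ENNReal.ofReal (ρ^e) * v) * ∫⁻ z in ℬ e (a + ρ), h z := by
    calc _ ≤ ∫⁻ x in ℬ e a, F x * (ENNReal.ofReal ((κ*t)^e) * v) := lintegral_mul_const_le _ _
      _ ≤ ∫⁻ x in ℬ e a, ∫⁻ z in ℬ e (a + ρ), (if dist x z < ρ then h z else 0) :=
          setLIntegral_mono' measurableSet_ball h1
      _ = ∫⁻ z in ℬ e (a + ρ), ∫⁻ x in ℬ e a, (if dist x z < ρ then h z else 0) :=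
          lintegral_lintegral_swap hm.aemeasurable
      _ ≤ ∫⁻ z in ℬ e (a + ρ), (ENNReal.ofReal (ρ^e) * v) * h z := by
          refine lintegral_mono fun z => ?_
          refine (setLIntegral_le_lintegral _ _).trans ?_
          have : (fun x : EE e => (if dist x z < ρ then h z else 0)) = (ball z ρ).indicator (fun _ => h z) := by
            ext x; simp [indicator, mem_ball]
          rw [this, lintegral_indicator measurableSet_ball, setLIntegral_const, hb z hρ, mul_comm]
      _ = _ := lintegral_const_mul _ hh
  have h3 : ENNReal.ofReal (ρ^e) * v = ENNReal.ofReal (((C₀+κ)/κ)^e) * (ENNReal.ofReal ((κ*t)^e) * v) := by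
    rw [← mul_assoc, ← ENNReal.ofReal_mul (by positivity), ← mul_pow]
    congr 3
    rw [hρd]; field_simp
  rw [h3, mul_right_comm] at h2
  refine (ENNReal.mul_le_mul_iff_left ?_ ?_).1 h2
  · exact mul_ne_zero (by simpa using by positivity) hv
  · exact ENNReal.mul_ne_top ENNReal.ofReal_ne_top hv'

lemma lsc_meas {ι : Type*} (U : ι → Set (EE e)) (hU : ∀ i, IsOpen (U i)) (c : ι → ℝ≥0∞) :
    Measurable (fun z => ⨆ i, ⨆ (_ : z ∈ U i), c i) := by
  refine measurable_of_Ioi fun a => ?_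
  have : (fun z => ⨆ i, ⨆ (_ : z ∈ U i), c i) ⁻¹' Ioi a = ⋃ i, ⋃ (_ : a < c i), U i := by
    ext z
    simp [lt_iSup_iff, and_comm]
  rw [this]
  exact (isOpen_iUnion fun i => isOpen_iUnion fun _ => hU i).measurableSet

end

section
variable {e : ℕ}

lemma density_hit (S : Set (EE e)) {C₀ κ : ℝ} (hC : 0 < C₀) (hκ : 0 < κ) :
    ∀ᵐ x : EE e, x ∈ S → ∀ y : ℝ → EE e, (∀ᶠ s in 𝓝[>] (0:ℝ), dist (y s) x ≤ C₀ * s) →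
      ∀ᶠ s in 𝓝[>] (0:ℝ), ∃ z ∈ S, dist z (y s) < κ * s := by
  have h := ae_imp_of_ae_restrict (IsUnifLocDoublingMeasure.ae_tendsto_measure_inter_div (volume : Measure (EE e)) S (2*C₀/κ))
  filter_upwards [h] with x hx hxS y hy
  have h1 : Tendsto (fun s : ℝ => κ/2 * s) (𝓝[>] 0) (𝓝[>] 0) := by
    refine tendsto_nhdsWithin_iff.2 ⟨?_, ?_⟩
    · have : Tendsto (fun s : ℝ => κ/2 * s) (𝓝 0) (𝓝 (κ/2 * 0)) := (continuous_const.mul continuous_id).tendsto _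
      rw [mul_zero] at this
      exact this.mono_left nhdsWithin_le_nhds
    · filter_upwards [self_mem_nhdsWithin] with s hs
      have : (0:ℝ) < s := hs
      exact mul_pos (by positivity) this
  have h2 := hx hxS y _ h1 (by
    filter_upwards [hy] with s hs
    rw [mem_closedBall, dist_comm]
    refine hs.trans (le_of_eq ?_)
    field_simp)
  have h3 := h2.eventually (lt_mem_nhds (show (0:ℝ≥0∞) < 1 by simp))
  filter_upwards [h3, self_mem_nhdsWithin] with s hs hs0
  have hs0 : (0:ℝ) < s := hs0
  by_contra hcon
  push Not at hcon
  have : S ∩ closedBall (y s) (κ/2 * s) = ∅ := by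
    ext z
    simp only [mem_inter_iff, mem_closedBall, mem_empty_iff_false, iff_false, not_and]
    intro hz hz'
    have := hcon z hz
    nlinarith [mul_pos hκ hs0]
  rw [this] at hs
  simp at hs

lemma nt_conv {F : Type*} [NormedAddCommGroup F] [SecondCountableTopology F] {f : EE e → ℝ → F} {g : EE e → F}
    {T : Set (EE e)} {R : EE e → ℝ → EE e → Prop} {C₀ κ s0 : ℝ} (hC : 0 < C₀) (hκ : 0 < κ) (hs0 : 0 < s0)
    (hcone : ∀ x ∈ T, ∀ s, 0 < s → s < s0 → ∃ y, dist y x ≤ C₀ * s ∧ ∀ z, dist z y < κ * s → R x s z)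
    (hlim : ∀ᵐ z, z ∈ T → ∀ η > 0, ∃ ρ > 0, ∀ x s, 0 < s → s < ρ → R x s z → ‖f x s - g z‖ ≤ η) :
    ∀ᵐ x, x ∈ T → Tendsto (fun s => f x s) (𝓝[>] 0) (𝓝 (g x)) := by
  let c := TopologicalSpace.denseSeq F
  let K : ℕ → ℕ → ℕ → Set (EE e) := fun k j q => {z | z ∈ T ∧ ‖g z - c q‖ ≤ 1/((k:ℝ)+1) ∧
    ∀ x s, 0 < s → s < 1/((j:ℝ)+1) → R x s z → ‖f x s - c q‖ ≤ 1/((k:ℝ)+1)}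
  have hd : ∀ᵐ x : EE e, ∀ k j q, x ∈ K k j q → ∀ y : ℝ → EE e, (∀ᶠ s in 𝓝[>] (0:ℝ), dist (y s) x ≤ C₀ * s) →
      ∀ᶠ s in 𝓝[>] (0:ℝ), ∃ z ∈ K k j q, dist z (y s) < κ * s :=
    ae_all_iff.2 fun k => ae_all_iff.2 fun j => ae_all_iff.2 fun q => density_hit _ hC hκ
  filter_upwards [hd, hlim] with x h1 h2 hxT
  have hK : ∀ k, ∃ j q, x ∈ K k j q := by
    intro k
    have hk : (0:ℝ) < 1/((k:ℝ)+1) := by positivity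
    obtain ⟨ρ, hρ, h3⟩ := h2 hxT (1/((k:ℝ)+1)/2) (by positivity)
    obtain ⟨j, hj⟩ := exists_nat_one_div_lt hρ
    obtain ⟨q, hq⟩ := (TopologicalSpace.denseRange_denseSeq F).exists_dist_lt (g x) (half_pos hk)
    rw [dist_eq_norm] at hq
    refine ⟨j, q, hxT, by linarith, fun x' s hs hs' hR => ?_⟩
    have h4 := h3 x' s hs (hs'.trans hj) hR
    have := norm_sub_le_norm_sub_add_norm_sub (f x' s) (g x) (c q)
    linarith
  rw [Metric.tendsto_nhds]
  intro η hη
  obtain ⟨k, hk⟩ := exists_nat_one_div_lt (half_pos hη)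
  obtain ⟨j, q, hx⟩ := hK k
  choose! y hy1 hy2 using hcone x hxT
  have hlt : ∀ δ : ℝ, 0 < δ → ∀ᶠ s in 𝓝[>] (0:ℝ), s < δ := fun δ hδ =>
    (eventually_lt_nhds hδ).filter_mono nhdsWithin_le_nhds
  have h3 := h1 k j q hx y (by
    filter_upwards [hlt s0 hs0, self_mem_nhdsWithin] with s hs hs'
    exact hy1 s hs' hs)
  filter_upwards [h3, hlt s0 hs0, hlt (1/((j:ℝ)+1)) (by positivity), self_mem_nhdsWithin] with s hs hsa hsb hsc
  obtain ⟨z, hz, hz'⟩ := hs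
  have h4 := hz.2.2 x s hsc hsb (hy2 s hsc hsa z hz')
  have h5 := hx.2.1
  rw [dist_eq_norm]
  have := norm_sub_le_norm_sub_add_norm_sub (f x s) (c q) (g x)
  rw [norm_sub_rev (c q)] at this
  linarith

lemma ui_limit {F : Type*} [NormedAddCommGroup F] {f : ℕ → EE e → F} {N : EE e → ℝ≥0∞} (hN : Measurable N)
    {a b C₀ κ : ℝ} {t : ℕ → ℝ} (hC : 0 < C₀) (hκ : 0 < κ) (ht : ∀ n, 0 < t n) (htb : ∀ n, a + (C₀+κ)*t n ≤ b)
    (hNb : ∫⁻ z in ℬ e b, N z ^ 2 ≠ ∞)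
    (H : ∀ n, ∀ x ∈ ℬ e a, ∃ y, dist y x ≤ C₀ * t n ∧ ∀ z, dist z y < κ * t n → ‖f n x‖ₑ ≤ N z)
    {h : ℕ → EE e → ℝ≥0∞} {h0 : EE e → ℝ≥0∞} {K : ℝ≥0∞} (hK : K ≠ ∞)
    (hm : ∀ n, AEMeasurable (h n) (volume.restrict (ball 0 a)))
    (hb : ∀ n, ∀ x ∈ ℬ e a, h n x ≤ K * ‖f n x‖ₑ ^ 2)
    (hl : ∀ᵐ x, x ∈ ℬ e a → Tendsto (fun n => h n x) atTop (𝓝 (h0 x)))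
    {η : ℝ≥0∞} (hη : 0 < η) :
    ∀ᶠ n in atTop, ∫⁻ x in ℬ e a, h n x ≤ (∫⁻ x in ℬ e a, h0 x) + η := by
  set K' := ENNReal.ofReal (((C₀+κ)/κ)^e)
  -- choice of truncation level
  have hNm : ∀ l : ℕ, Measurable (fun z => if (l:ℝ≥0∞) < N z then N z ^ 2 else 0) := fun l =>
    Measurable.ite (measurableSet_lt measurable_const hN) (hN.pow_const 2) measurable_const
  have h1 : Tendsto (fun l : ℕ => ∫⁻ z in ℬ e b, (if (l:ℝ≥0∞) < N z then N z ^ 2 else 0)) atTop (𝓝 (∫⁻ z in ℬ e b, 0)) := by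
    refine tendsto_lintegral_of_dominated_convergence (fun z => N z ^ 2) hNm ?_ hNb ?_
    · intro l; filter_upwards with z
      split_ifs <;> simp
    · filter_upwards [ae_lt_top (hN.pow_const 2) hNb] with z hz
      have hz' : N z ≠ ∞ := by
        intro h; rw [h] at hz; simp at hz
      obtain ⟨l0, hl0⟩ := ENNReal.exists_nat_gt hz'
      refine tendsto_const_nhds.congr' ?_
      filter_upwards [eventually_ge_atTop l0] with l hl
      rw [if_neg]
      push Not
      exact hl0.le.trans (by exact_mod_cast hl)
  rw [lintegral_zero] at h1
  have h2 : Tendsto (fun l : ℕ => K * (K' * ∫⁻ z in ℬ e b, (if (l:ℝ≥0∞) < N z then N z ^ 2 else 0))) atTop (𝓝 0) := by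
    have := ENNReal.Tendsto.const_mul (ENNReal.Tendsto.const_mul h1 (Or.inr (show K' ≠ ∞ from ENNReal.ofReal_ne_top))) (Or.inr hK)
    simpa using this
  have hη2 : 0 < η/2 := ENNReal.half_pos hη.ne'
  obtain ⟨l, hl'⟩ := (h2.eventually (ge_mem_nhds hη2)).exists
  have h3 : Tendsto (fun n => ∫⁻ x in ℬ e a, min (h n x) (K * (l:ℝ≥0∞)^2)) atTop
      (𝓝 (∫⁻ x in ℬ e a, min (h0 x) (K * (l:ℝ≥0∞)^2))) := by
    refine tendsto_lintegral_of_dominated_convergence' (fun _ => K * (l:ℝ≥0∞)^2) (fun n => (hm n).min aemeasurable_const) ?_ ?_ ?_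
    · intro n; filter_upwards with x using min_le_right _ _
    · rw [setLIntegral_const]
      exact ENNReal.mul_ne_top (ENNReal.mul_ne_top hK (by simp)) measure_ball_lt_top.ne
    · rw [ae_restrict_iff' measurableSet_ball]
      filter_upwards [hl] with x hx hxa
      exact (hx hxa).min tendsto_const_nhds
  have h4 : ∀ᶠ n in atTop, ∫⁻ x in ℬ e a, min (h n x) (K * (l:ℝ≥0∞)^2) ≤ (∫⁻ x in ℬ e a, h0 x) + η/2 := by
    have hle : ∫⁻ x in ℬ e a, min (h0 x) (K * (l:ℝ≥0∞)^2) ≤ ∫⁻ x in ℬ e a, h0 x :=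
      lintegral_mono fun x => min_le_left _ _
    have hfin : ∫⁻ x in ℬ e a, min (h0 x) (K * (l:ℝ≥0∞)^2) ≠ ∞ := by
      refine ne_top_of_le_ne_top ?_ (lintegral_mono fun x => min_le_right _ _)
      rw [setLIntegral_const]
      exact ENNReal.mul_ne_top (ENNReal.mul_ne_top hK (by simp)) measure_ball_lt_top.ne
    filter_upwards [h3.eventually (ge_mem_nhds (ENNReal.lt_add_right hfin hη2.ne'))] with n hn
    exact hn.trans (by gcongr)
  filter_upwards [h4] with n hn
  have h5 : ∫⁻ x in ℬ e a, (if (l:ℝ≥0∞) < ‖f n x‖ₑ then ‖f n x‖ₑ^2 else 0) ≤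
      K' * ∫⁻ z in ℬ e b, (if (l:ℝ≥0∞) < N z then N z ^ 2 else 0) := by
    refine (avg (hNm l) hC hκ (ht n) ?_).trans ?_
    · intro x hx
      obtain ⟨y, hy, hz⟩ := H n x hx
      refine ⟨y, hy, fun z hzy => ?_⟩
      have := hz z hzy
      split_ifs with c1 c2 c2
      · gcongr
      · exact absurd (c1.trans_le this) c2
      · simp
      · simp
    · gcongr; exact htb n
  calc ∫⁻ x in ℬ e a, h n x
      ≤ ∫⁻ x in ℬ e a, (min (h n x) (K * (l:ℝ≥0∞)^2) + K * (if (l:ℝ≥0∞) < ‖f n x‖ₑ then ‖f n x‖ₑ^2 else 0)) := by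
        refine setLIntegral_mono' measurableSet_ball fun x hx => ?_
        split_ifs with c
        · exact (hb n x hx).trans le_add_self
        · push Not at c
          have : h n x ≤ K * (l:ℝ≥0∞)^2 := (hb n x hx).trans (by gcongr)
          rw [min_eq_left this]; simp
    _ = (∫⁻ x in ℬ e a, min (h n x) (K * (l:ℝ≥0∞)^2)) + ∫⁻ x in ℬ e a, K * (if (l:ℝ≥0∞) < ‖f n x‖ₑ then ‖f n x‖ₑ^2 else 0) :=
        lintegral_add_left' ((hm n).min aemeasurable_const) _
    _ = (∫⁻ x in ℬ e a, min (h n x) (K * (l:ℝ≥0∞)^2)) + K * ∫⁻ x in ℬ e a, (if (l:ℝ≥0∞) < ‖f n x‖ₑ then ‖f n x‖ₑ^2 else 0) := by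
        rw [lintegral_const_mul' _ _ hK]
    _ ≤ ((∫⁻ x in ℬ e a, h0 x) + η/2) + η/2 := by
        refine add_le_add hn (le_trans ?_ hl')
        gcongr
    _ = _ := by rw [add_assoc, ENNReal.add_halves]

end

section
abbrev YY (m : ℕ) := Fin m → ℝ
abbrev GG (d m : ℕ) := EE d →L[ℝ] YY m

variable {d m : ℕ}

def evl (i : Fin d) (α : Fin m) : GG d m →L[ℝ] ℝ :=
  (ContinuousLinearMap.proj (R := ℝ) (φ := fun _ : Fin m => ℝ) α).comp (ContinuousLinearMap.apply ℝ (YY m) (EuclideanSpace.single i (1:ℝ)))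

@[simp] lemma evl_apply (i : Fin d) (α : Fin m) (L : GG d m) : evl i α L = L (EuclideanSpace.single i 1) α := rfl

lemma evl_norm (i : Fin d) (α : Fin m) : ‖(evl i α : GG d m →L[ℝ] ℝ)‖ ≤ 1 := by
  refine ContinuousLinearMap.opNorm_le_bound _ zero_le_one fun L => ?_
  rw [evl_apply, one_mul]
  refine (norm_le_pi_norm _ α).trans ?_
  simpa using L.le_opNorm (EuclideanSpace.single i 1)

def Ab (A : Coeff d m) (X : EE d) : GG d m →L[ℝ] GG d m →L[ℝ] ℝ :=
  ∑ i, ∑ j, ∑ α, ∑ β, A X i j α β • (evl j β).smulRight (evl i α)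

lemma Ab_apply (A : Coeff d m) (X : EE d) (L L' : GG d m) : Ab A X L L' =
    ∑ i, ∑ j, ∑ α, ∑ β, A X i j α β * L (EuclideanSpace.single j 1) β * L' (EuclideanSpace.single i 1) α := by
  simp [Ab, mul_assoc, sum_apply]

lemma ent_le (L : GG d m) (α : Fin m) (i : Fin d) : |gradEntry L α i| ≤ ‖L‖ := by
  have := (evl i α).le_opNorm L
  rw [evl_apply, Real.norm_eq_abs] at this
  refine this.trans ?_
  nlinarith [evl_norm i α, norm_nonneg L]

lemma gn_le (L : GG d m) : gradNormSq L ≤ (d*m:ℝ) * ‖L‖^2 := by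
  unfold gradNormSq
  have : ∀ α i, gradEntry L α i ^ 2 ≤ ‖L‖^2 := fun α i => by
    rw [← sq_abs]; have := ent_le L α i; gcongr
  calc _ ≤ ∑ α : Fin m, ∑ i : Fin d, ‖L‖^2 := Finset.sum_le_sum fun α _ => Finset.sum_le_sum fun i _ => this α i
    _ = _ := by simp; ring

lemma vec_sum (L : GG d m) (v : EE d) (α : Fin m) : L v α = ∑ i, v i * gradEntry L α i := by
  have : v = ∑ i, v i • EuclideanSpace.single i (1:ℝ) := by
    ext k; simp [Finset.sum_apply, Pi.single_apply]
  conv_lhs => rw [this]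
  rw [map_sum]
  simp [gradEntry]

lemma le_gn (L : GG d m) : ‖L‖^2 ≤ gradNormSq L := by
  have h0 : 0 ≤ gradNormSq L := by unfold gradNormSq; positivity
  have : ‖L‖ ≤ Real.sqrt (gradNormSq L) := by
    refine ContinuousLinearMap.opNorm_le_bound _ (Real.sqrt_nonneg _) fun v => ?_
    refine (pi_norm_le_iff_of_nonneg (by positivity)).2 fun α => ?_
    rw [vec_sum, Real.norm_eq_abs]
    have h1 := Finset.sum_mul_sq_le_sq_mul_sq Finset.univ (fun i => v i) (fun i => gradEntry L α i)
    have h2 : ∑ i, (v i)^2 = ‖v‖^2 := by rw [EuclideanSpace.norm_sq_eq]; simp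
    have h3 : ∑ i, gradEntry L α i^2 ≤ gradNormSq L :=
      Finset.single_le_sum (f := fun α => ∑ i, gradEntry L α i^2) (fun α _ => by positivity) (Finset.mem_univ α)
    apply abs_le_of_sq_le_sq _ (by positivity)
    rw [mul_pow, Real.sq_sqrt h0]
    rw [h2] at h1
    nlinarith [sq_nonneg ‖v‖]
  calc _ ≤ Real.sqrt (gradNormSq L)^2 := by gcongr
    _ = _ := Real.sq_sqrt h0

lemma Ab_symm {A : Coeff d m} (hA : IsSymmCoeff A) (X : EE d) (L L' : GG d m) : Ab A X L L' = Ab A X L' L := by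
  rw [Ab_apply, Ab_apply, Finset.sum_comm]
  refine Finset.sum_congr rfl fun i _ => Finset.sum_congr rfl fun j _ => ?_
  rw [Finset.sum_comm]
  refine Finset.sum_congr rfl fun α _ => Finset.sum_congr rfl fun β _ => ?_
  rw [hA X j i β α]; ring

lemma Ab_self (A : Coeff d m) (X : EE d) (L : GG d m) : Ab A X L L =
   ∑ i, ∑ j, ∑ α, ∑ β, A X i j α β * (fun i α => gradEntry L α i) i α * (fun i α => gradEntry L α i) j β := by
  rw [Ab_apply]
  refine Finset.sum_congr rfl fun i _ => Finset.sum_congr rfl fun j _ => Finset.sum_congr rfl fun α _ => Finset.sum_congr rfl fun β _ => ?_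
  simp only [gradEntry]; ring

lemma Ab_ell {μ : ℝ} {A : Coeff d m} (hA : IsElliptic μ A) (X : EE d) (L : GG d m) :
    μ * gradNormSq L ≤ Ab A X L L ∧ Ab A X L L ≤ μ⁻¹ * gradNormSq L := by
  have h := hA X (fun i α => gradEntry L α i)
  rw [← Ab_self] at h
  have h2 : (∑ i, ∑ α, (fun i α => gradEntry L α i) i α^2) = gradNormSq L := by
    unfold gradNormSq; rw [Finset.sum_comm]
  rwa [h2] at h

lemma bil_bound {F : Type*} [NormedAddCommGroup F] [NormedSpace ℝ F] (b : F →L[ℝ] F →L[ℝ] ℝ) {K : ℝ} (hK : 0 ≤ K)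
    (hs : ∀ x y, b x y = b y x) (h0 : ∀ x, 0 ≤ b x x) (h1 : ∀ x, b x x ≤ K * ‖x‖^2) : ‖b‖ ≤ K := by
  refine ContinuousLinearMap.opNorm_le_of_unit_norm hK fun x hx => ?_
  refine ContinuousLinearMap.opNorm_le_of_unit_norm hK fun y hy => ?_
  have a1 := h0 (x+y)
  have a2 := h0 (x-y)
  have a3 := h1 x
  have a4 := h1 y
  simp only [map_add, map_sub, add_apply, sub_apply] at a1 a2
  rw [hs y x] at a1 a2
  rw [hx] at a3; rw [hy] at a4
  rw [Real.norm_eq_abs, abs_le]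
  constructor <;> linarith

lemma Ab_upper {μ : ℝ} (hμ : 0 < μ) {A : Coeff d m} (hA : IsElliptic μ A) (hs : IsSymmCoeff A) (X : EE d) :
    ‖Ab A X‖ ≤ μ⁻¹ * (d*m) := by
  refine bil_bound _ (by positivity) (Ab_symm hs X) (fun L => ?_) fun L => ?_
  · refine le_trans ?_ (Ab_ell hA X L).1
    have : 0 ≤ gradNormSq L := (sq_nonneg _).trans (le_gn L)
    positivity
  · refine (Ab_ell hA X L).2.trans ?_
    rw [mul_assoc]
    have := gn_le L
    gcongr

lemma sm_norm (i j : Fin d) (α β : Fin m) : ‖(evl j β).smulRight (evl i α : GG d m →L[ℝ] ℝ)‖ ≤ 1 := by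
  rw [ContinuousLinearMap.norm_smulRight_apply]
  exact mul_le_one₀ (evl_norm j β) (norm_nonneg _) (evl_norm i α)

lemma sum4_norm {F : Type*} [NormedAddCommGroup F] [NormedSpace ℝ F] (T : Fin d → Fin d → Fin m → Fin m → F)
    (a a' : Fin d → Fin d → Fin m → Fin m → ℝ) {K : ℝ} (hT : ∀ i j α β, ‖T i j α β‖ ≤ 1)
    (ha : ∀ i j α β, |a i j α β - a' i j α β| ≤ K) :
    ‖(∑ i, ∑ j, ∑ α, ∑ β, a i j α β • T i j α β) - ∑ i, ∑ j, ∑ α, ∑ β, a' i j α β • T i j α β‖ ≤ (d*m)^2 * K := by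
  simp only [← Finset.sum_sub_distrib, ← sub_smul]
  have : ∀ i j α β, ‖(a i j α β - a' i j α β) • T i j α β‖ ≤ K := by
    intro i j α β
    rw [norm_smul, Real.norm_eq_abs]
    have h1 := ha i j α β
    have h2 := hT i j α β
    calc _ ≤ |a i j α β - a' i j α β| * 1 := by gcongr
      _ ≤ _ := by linarith
  calc _ ≤ ∑ i : Fin d, ∑ j : Fin d, ∑ α : Fin m, ∑ β : Fin m, K :=
        norm_sum_le_of_le _ fun i _ => norm_sum_le_of_le _ fun j _ => norm_sum_le_of_le _ fun α _ => norm_sum_le_of_le _ fun β _ => this i j α β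
    _ = _ := by simp; ring

lemma Ab_hold {lam τ : ℝ} {A : Coeff d m} (hA : IsHolderCoeff lam τ A) (X X' : EE d) :
    ‖Ab A X - Ab A X'‖ ≤ (d*m)^2 * (τ * ‖X - X'‖^lam) :=
  sum4_norm (fun i j α β => (evl j β).smulRight (evl i α : GG d m →L[ℝ] ℝ)) (A X) (A X') sm_norm (hA X X')

lemma Ab_per {A : Coeff d m} (hA : IsPeriodicCoeff A) (X Z : EE d) (hZ : ∀ i, ∃ k : ℤ, Z i = (k:ℝ)) : Ab A (X+Z) = Ab A X := by
  unfold Ab; rw [hA X Z hZ]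

lemma Ab_diff {A : Coeff d m} (hA : ∀ i j α β, ContDiff ℝ 2 (fun Z => A Z i j α β)) : ContDiff ℝ 2 (Ab A) := by
  unfold Ab
  refine ContDiff.sum fun i _ => ContDiff.sum fun j _ => ContDiff.sum fun α _ => ContDiff.sum fun β _ => ?_
  exact (hA i j α β).smul contDiff_const

lemma per_bdd {F : Type*} [NormedAddCommGroup F] {f : EE d → F} (hf : Continuous f)
    (hp : ∀ X Z : EE d, (∀ i, ∃ k : ℤ, Z i = (k:ℝ)) → f (X+Z) = f X) : ∃ K, ∀ X, ‖f X‖ ≤ K := by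
  obtain ⟨K, hK⟩ := (isCompact_closedBall (0:EE d) (Real.sqrt d)).exists_bound_of_continuousOn hf.continuousOn
  refine ⟨K, fun X => ?_⟩
  set Y : EE d := WithLp.toLp 2 (fun i => Int.fract (X i)) with hY
  have h1 : X = Y + WithLp.toLp 2 (fun i => ((⌊X i⌋ : ℤ) : ℝ)) := by
    ext i; simp [hY, Int.fract_add_floor]
  rw [h1, hp]
  · apply hK
    rw [mem_closedBall_zero_iff, EuclideanSpace.norm_eq]
    apply Real.sqrt_le_sqrt
    calc ∑ i, ‖Y i‖^2 ≤ ∑ i : Fin d, (1:ℝ) := by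
          refine Finset.sum_le_sum fun i _ => ?_
          have h2 : Y i = Int.fract (X i) := rfl
          rw [h2, Real.norm_eq_abs, sq_abs]
          nlinarith [Int.fract_nonneg (X i), Int.fract_lt_one (X i)]
      _ = d := by simp
  · intro i; exact ⟨⌊X i⌋, rfl⟩

lemma Ab_lip {A : Coeff d m} (hA : ∀ i j α β, ContDiff ℝ 2 (fun Z => A Z i j α β)) (hp : IsPeriodicCoeff A) :
    ∃ K, LipschitzWith K (Ab A) := by
  have h := Ab_diff hA
  obtain ⟨K, hK⟩ := per_bdd (f := fderiv ℝ (Ab A)) (h.continuous_fderiv (by norm_num)) (by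
    intro X Z hZ
    have : (fun W => Ab A (W + Z)) = Ab A := funext fun W => Ab_per hp W Z hZ
    rw [← fderiv_comp_add_right, this])
  refine ⟨K.toNNReal, lipschitzWith_of_nnnorm_fderiv_le (h.differentiable (by norm_num)) fun X => ?_⟩
  rw [← NNReal.coe_le_coe, coe_nnnorm]
  exact (hK X).trans (Real.le_coe_toNNReal K)

end

section
variable {d m : ℕ}

def Lu (i : Fin d) (α : Fin m) : GG d m := (PiLp.proj (𝕜 := ℝ) 2 (fun _ : Fin d => ℝ) i).smulRight (Pi.single α (1:ℝ))

lemma Lu_sum (L : GG d m) : L = ∑ i, ∑ α, L (EuclideanSpace.single i 1) α • Lu i α := by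
  ext v β
  rw [vec_sum]
  simp [sum_apply, Lu, Finset.sum_apply, Pi.single_apply, gradEntry]
  exact Finset.sum_congr rfl fun i _ => mul_comm _ _

lemma fun_sum (b : GG d m →L[ℝ] ℝ) (L : GG d m) : b L = ∑ i, ∑ α, L (EuclideanSpace.single i 1) α * b (Lu i α) := by
  conv_lhs => rw [Lu_sum L]
  simp [map_sum]

def Fx (A : Coeff d m) (v : EE d → YY m) (i : Fin d) (α : Fin m) (X : EE d) : ℝ := Ab A X (fderiv ℝ v X) (Lu i α)
def dvF (A : Coeff d m) (v : EE d → YY m) (α : Fin m) (X : EE d) : ℝ := ∑ i, fderiv ℝ (Fx A v i α) X (EuclideanSpace.single i 1)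

lemma Fx_diff {A : Coeff d m} (hA : ∀ i j α β, ContDiff ℝ 2 (fun Z => A Z i j α β)) {v : EE d → YY m} (hv : ContDiff ℝ 2 v)
    (i : Fin d) (α : Fin m) : ContDiff ℝ 1 (Fx A v i α) := by
  have h1 : ContDiff ℝ 1 (Ab A) := (Ab_diff hA).of_le (by norm_num)
  have h2 : ContDiff ℝ 1 (fderiv ℝ v) := hv.fderiv_right (by norm_num)
  unfold Fx
  exact (h1.clm_apply h2).clm_apply contDiff_const

lemma Fx_supp {A : Coeff d m} {v : EE d → YY m} (hc : HasCompactSupport v) (i : Fin d) (α : Fin m) : HasCompactSupport (Fx A v i α) := by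
  refine (hc.fderiv ℝ).mono fun X hX => ?_
  simp only [Function.mem_support] at hX ⊢
  intro h; apply hX; simp [Fx, h]

lemma dvF_cont {A : Coeff d m} (hA : ∀ i j α β, ContDiff ℝ 2 (fun Z => A Z i j α β)) {v : EE d → YY m} (hv : ContDiff ℝ 2 v)
    (α : Fin m) : Continuous (dvF A v α) := by
  unfold dvF
  refine continuous_finsetSum _ fun i _ => ?_
  exact ((Fx_diff hA hv i α).continuous_fderiv (by norm_num)).clm_apply continuous_const

lemma ibp {A : Coeff d m} (hA : ∀ i j α β, ContDiff ℝ 2 (fun Z => A Z i j α β)) {v : EE d → YY m} (hv : ContDiff ℝ 2 v)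
    (hc : HasCompactSupport v) {w : EE d → YY m} {K : ℝ≥0} (hw : LipschitzWith K w) :
    ∫ X, Ab A X (fderiv ℝ v X) (fderiv ℝ w X) = - ∫ X, ∑ α, dvF A v α X * w X α := by
  have hwa : ∀ α, LipschitzWith K (fun X => w X α) := fun α => by
    have := (LipschitzWith.eval (α := fun _ : Fin m => ℝ) α).comp hw
    rw [one_mul] at this; exact this
  have hFl : ∀ i α, ∃ D, LipschitzWith D (Fx A v i α) := fun i α =>
    (Fx_diff hA hv i α).lipschitzWith_of_hasCompactSupport (Fx_supp hc i α) (by norm_num)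
  have hdw : ∀ᵐ X : EE d, DifferentiableAt ℝ w X := hw.ae_differentiableAt
  have hF : ∀ i α, Integrable (fun X => lineDeriv ℝ (fun X => w X α) X (EuclideanSpace.single i 1) * Fx A v i α X) := by
    intro i α
    have h1 : Integrable (Fx A v i α) := (Fx_diff hA hv i α).continuous.integrable_of_hasCompactSupport (Fx_supp hc i α)
    refine h1.bdd_mul (c := K * ‖(EuclideanSpace.single i 1 : EE d)‖) ?_ ?_
    · exact (measurable_lineDeriv (hwa α).continuous).aestronglyMeasurable
    · exact Eventually.of_forall fun X => norm_lineDeriv_le_of_lipschitz ℝ (hwa α)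
  have hG : ∀ i α, Integrable (fun X => fderiv ℝ (Fx A v i α) X (EuclideanSpace.single i 1) * w X α) := by
    intro i α
    refine Continuous.integrable_of_hasCompactSupport ?_ ?_
    · exact (((Fx_diff hA hv i α).continuous_fderiv (by norm_num)).clm_apply continuous_const).mul (hwa α).continuous
    · refine HasCompactSupport.mul_right ?_
      exact ((Fx_supp hc i α).fderiv_apply ℝ _)
  have e1 : ∫ X, Ab A X (fderiv ℝ v X) (fderiv ℝ w X) = ∫ X, ∑ i, ∑ α, lineDeriv ℝ (fun X => w X α) X (EuclideanSpace.single i 1) * Fx A v i α X := by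
    refine integral_congr_ae ?_
    filter_upwards [hdw] with X hX
    rw [fun_sum]
    refine Finset.sum_congr rfl fun i _ => Finset.sum_congr rfl fun α _ => ?_
    have : HasFDerivAt (fun X => w X α) ((ContinuousLinearMap.proj (R := ℝ) (φ := fun _ : Fin m => ℝ) α).comp (fderiv ℝ w X)) X :=
      (ContinuousLinearMap.proj (R := ℝ) (φ := fun _ : Fin m => ℝ) α).hasFDerivAt.comp X hX.hasFDerivAt
    rw [(this.hasLineDerivAt _).lineDeriv]; rfl
  rw [e1, integral_finsetSum _ fun i _ => integrable_finsetSum _ fun α _ => hF i α]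
  have e2 : ∀ i α, ∫ X, lineDeriv ℝ (fun X => w X α) X (EuclideanSpace.single i 1) * Fx A v i α X =
      - ∫ X, fderiv ℝ (Fx A v i α) X (EuclideanSpace.single i 1) * w X α := by
    intro i α
    obtain ⟨D, hD⟩ := hFl i α
    rw [LipschitzWith.integral_lineDeriv_mul_eq (hwa α) hD (Fx_supp hc i α), ← integral_neg]
    refine integral_congr_ae (Eventually.of_forall fun X => ?_)
    have h1 := ((Fx_diff hA hv i α).differentiable (by norm_num) X).hasFDerivAt.hasLineDerivAt (-(EuclideanSpace.single i 1))
    simp only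
    rw [h1.lineDeriv]; simp
  have e3 : ∫ X, ∑ α, dvF A v α X * w X α = ∑ i, ∑ α, ∫ X, fderiv ℝ (Fx A v i α) X (EuclideanSpace.single i 1) * w X α := by
    unfold dvF
    simp only [Finset.sum_mul]
    rw [integral_finsetSum _ fun α _ => integrable_finsetSum _ fun i _ => hG i α, Finset.sum_comm]
    exact Finset.sum_congr rfl fun α _ => integral_finsetSum _ fun i _ => hG i α
  rw [e3, ← Finset.sum_neg_distrib]
  refine Finset.sum_congr rfl fun i _ => ?_
  rw [integral_finsetSum _ fun α _ => hF i α, ← Finset.sum_neg_distrib]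
  exact Finset.sum_congr rfl fun α _ => e2 i α

lemma div_zero' {A : Coeff d m} (hA : ∀ i j α β, ContDiff ℝ 2 (fun Z => A Z i j α β)) {v : EE d → YY m} (hv : ContDiff ℝ 2 v)
    (hc : HasCompactSupport v) {O O' : Set (EE d)} (hO : MeasurableSet O) (hO' : IsOpen O') (hOO : O' ⊆ O) {u : EE d → YY m}
    (hu : IsWeakSolution A O u) (huv : EqOn u v O') (α : Fin m) : ∀ᵐ X : EE d, X ∈ O' → dvF A v α X = 0 := by
  refine hO'.ae_eq_zero_of_integral_contDiff_smul_eq_zero ((dvF_cont hA hv α).locallyIntegrable.locallyIntegrableOn _) fun g hg hgc hgs => ?_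
  set φ : EE d → YY m := fun X => g X • Pi.single α (1:ℝ) with hφ
  have hφd : ContDiff ℝ (⊤:ℕ∞) φ := hg.smul contDiff_const
  have hφc : HasCompactSupport φ := hgc.smul_right
  have hφs : tsupport φ ⊆ O' := (closure_mono fun X hX => by
    simp only [Function.mem_support] at hX ⊢
    intro h; apply hX; simp [hφ, h]).trans hgs
  have h1 := hu.2 φ hφd hφc (hφs.trans hOO)
  obtain ⟨K, hK⟩ := hφd.lipschitzWith_of_hasCompactSupport hφc (by simp)
  have h2 := ibp hA hv hc hK
  have h3 : ∫ X, Ab A X (fderiv ℝ v X) (fderiv ℝ φ X) = 0 := by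
    rw [← h1, ← setIntegral_eq_integral_of_forall_compl_eq_zero (s := O)]
    · refine setIntegral_congr_fun hO fun X hX => ?_
      rw [← Ab_apply]
      by_cases hX' : X ∈ O'
      · rw [(huv.eventuallyEq_of_mem (hO'.mem_nhds hX')).fderiv_eq]
      · have : fderiv ℝ φ X = 0 := by
          by_contra h
          exact hX' (hφs (support_fderiv_subset ℝ h))
        rw [this]; simp
    · intro X hX
      have : fderiv ℝ φ X = 0 := by
        by_contra h
        exact hX (hOO (hφs (support_fderiv_subset ℝ h)))
      rw [this]; simp
  rw [h3] at h2
  have h4 : ∫ X, ∑ β, dvF A v β X * φ X β = 0 := by linarith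
  rw [← h4]
  refine integral_congr_ae (Eventually.of_forall fun X => ?_)
  simp [hφ, Pi.single_apply, mul_comm]

lemma weak_lip {A : Coeff d m} (hA : ∀ i j α β, ContDiff ℝ 2 (fun Z => A Z i j α β)) {v : EE d → YY m} (hv : ContDiff ℝ 2 v)
    (hc : HasCompactSupport v) {O O' : Set (EE d)} (hO : MeasurableSet O) (hO' : IsOpen O') (hOO : O' ⊆ O) {u : EE d → YY m}
    (hu : IsWeakSolution A O u) (huv : EqOn u v O') {w : EE d → YY m} {K : ℝ≥0} (hw : LipschitzWith K w)
    (hw0 : ∀ X ∉ O', w X = 0) : ∫ X, Ab A X (fderiv ℝ v X) (fderiv ℝ w X) = 0 := by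
  rw [ibp hA hv hc hw, neg_eq_zero]
  refine integral_eq_zero_of_ae ?_
  filter_upwards [ae_all_iff.2 (div_zero' hA hv hc hO hO' hOO hu huv)] with X hX
  by_cases h : X ∈ O'
  · simp [hX _ h]
  · simp [hw0 X h]

end

section
variable {e m : ℕ}

def Sd (l : EE e →L[ℝ] ℝ) : (EE e × ℝ) →L[ℝ] ℰ e :=
  (io e : (EE e × ℝ) →L[ℝ] ℰ e).comp ((ContinuousLinearMap.fst ℝ (EE e) ℝ).prod (l.comp (ContinuousLinearMap.fst ℝ (EE e) ℝ) + ContinuousLinearMap.snd ℝ (EE e) ℝ))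
def Rd (l : EE e →L[ℝ] ℝ) : ℰ e →L[ℝ] (EE e × ℝ) :=
  ((ContinuousLinearMap.fst ℝ (EE e) ℝ).prod (ContinuousLinearMap.snd ℝ (EE e) ℝ - l.comp (ContinuousLinearMap.fst ℝ (EE e) ℝ))).comp ((io e).symm : ℰ e →L[ℝ] (EE e × ℝ))

lemma Sd_apply (l : EE e →L[ℝ] ℝ) (z : EE e × ℝ) : Sd l z = io e (z.1, l z.1 + z.2) := rfl
lemma Rd_apply (l : EE e →L[ℝ] ℝ) (X : ℰ e) : Rd l X = (projLast e X, X (Fin.last e) - l (projLast e X)) := rfl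
lemma Rd_Sd (l : EE e →L[ℝ] ℝ) : (Rd l).comp (Sd l) = ContinuousLinearMap.id ℝ _ := by
  ext z <;> simp [Rd_apply, Sd_apply]
lemma Sd_Rd (l : EE e →L[ℝ] ℝ) : (Sd l).comp (Rd l) = ContinuousLinearMap.id ℝ _ := by
  refine ContinuousLinearMap.ext fun X => ?_
  simp [Rd_apply, Sd_apply, io_proj]

lemma Sd_norm {M : ℝ} (hM : 0 ≤ M) {l : EE e →L[ℝ] ℝ} (hl : ‖l‖ ≤ M) : ‖Sd l‖ ≤ 2 + M := by
  refine ContinuousLinearMap.opNorm_le_bound _ (by positivity) fun z => ?_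
  rw [Sd_apply]
  refine (io_norm_le _).trans ?_
  have h1 := l.le_opNorm z.1
  have h2 := norm_fst_le z
  have h3 := norm_snd_le z
  have h4 := norm_add_le (l z.1) z.2
  simp only [Real.norm_eq_abs] at *
  have h5 : ‖l‖ * ‖z.1‖ ≤ M * ‖z‖ := by gcongr
  nlinarith

lemma Rd_norm {M : ℝ} (hM : 0 ≤ M) {l : EE e →L[ℝ] ℝ} (hl : ‖l‖ ≤ M) : ‖Rd l‖ ≤ 1 + M := by
  refine ContinuousLinearMap.opNorm_le_bound _ (by positivity) fun X => ?_
  rw [Rd_apply]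
  have h1 := l.le_opNorm (projLast e X)
  have h2 := proj_norm_le X
  have h3 := last_abs_le X
  have h4 := norm_sub_le (X (Fin.last e)) (l (projLast e X))
  have h5 : ‖l‖ * ‖projLast e X‖ ≤ M * ‖X‖ := by gcongr
  have h6 : 0 ≤ M * ‖X‖ := by positivity
  refine norm_prod_le_iff.2 ⟨?_, ?_⟩ <;> simp only [Real.norm_eq_abs] at * <;> nlinarith

lemma Sd_cont : Continuous (Sd (e := e)) := by
  have h : (Sd (e := e)) = fun l => Sd 0 + ((io e : (EE e × ℝ) →L[ℝ] ℰ e).comp (ContinuousLinearMap.inr ℝ (EE e) ℝ)).comp (l.comp (ContinuousLinearMap.fst ℝ (EE e) ℝ)) := by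
    funext l
    refine ContinuousLinearMap.ext fun z => ?_
    simp only [add_apply, Sd_apply, ContinuousLinearMap.comp_apply, ContinuousLinearMap.inr_apply, ContinuousLinearMap.coe_fst', ContinuousLinearEquiv.coe_coe]
    rw [← map_add]
    congr 1
    ext <;> simp [add_comm]
  rw [h]; fun_prop
lemma Rd_cont : Continuous (Rd (e := e)) := by
  have h : (Rd (e := e)) = fun l => Rd 0 - ((ContinuousLinearMap.inr ℝ (EE e) ℝ).comp l).comp ((ContinuousLinearMap.fst ℝ (EE e) ℝ).comp ((io e).symm : ℰ e →L[ℝ] (EE e × ℝ))) := by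
    funext l
    refine ContinuousLinearMap.ext fun X => ?_
    simp [Rd_apply, io_symm]
  rw [h]; fun_prop

def Tc (m : ℕ) (R : ℰ e →L[ℝ] (EE e × ℝ)) : ((EE e × ℝ) →L[ℝ] YY m) →L[ℝ] GG (e+1) m :=
  (ContinuousLinearMap.compL ℝ ℰ e (EE e × ℝ) (YY m)).flip R

@[simp] lemma Tc_apply (R : ℰ e →L[ℝ] (EE e × ℝ)) (ξ : (EE e × ℝ) →L[ℝ] YY m) : Tc m R ξ = ξ.comp R := rfl

def pull (R : ℰ e →L[ℝ] (EE e × ℝ)) (b : GG (e+1) m →L[ℝ] GG (e+1) m →L[ℝ] ℝ) :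
    ((EE e × ℝ) →L[ℝ] YY m) →L[ℝ] ((EE e × ℝ) →L[ℝ] YY m) →L[ℝ] ℝ :=
  ((ContinuousLinearMap.compL ℝ ((EE e × ℝ) →L[ℝ] YY m) (GG (e+1) m) ℝ).flip (Tc m R)).comp (b.comp (Tc m R))

lemma pull_apply (R : ℰ e →L[ℝ] (EE e × ℝ)) (b : GG (e+1) m →L[ℝ] GG (e+1) m →L[ℝ] ℝ) (ξ η) :
    pull R b ξ η = b (ξ.comp R) (η.comp R) := rfl

lemma pull_norm (R : ℰ e →L[ℝ] (EE e × ℝ)) (b : GG (e+1) m →L[ℝ] GG (e+1) m →L[ℝ] ℝ) : ‖pull R b‖ ≤ ‖b‖ * ‖R‖^2 := by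
  refine ContinuousLinearMap.opNorm_le_bound₂ _ (by positivity) fun ξ η => ?_
  rw [pull_apply]
  refine (b.le_opNorm₂ _ _).trans ?_
  have h1 := ContinuousLinearMap.opNorm_comp_le ξ R
  have h2 := ContinuousLinearMap.opNorm_comp_le η R
  calc _ ≤ ‖b‖ * (‖ξ‖*‖R‖) * (‖η‖*‖R‖) := by gcongr
    _ = _ := by ring

lemma pull_sub (R : ℰ e →L[ℝ] (EE e × ℝ)) (b b' : GG (e+1) m →L[ℝ] GG (e+1) m →L[ℝ] ℝ) : pull R b - pull R b' = pull R (b - b') := by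
  ext ξ η; simp [pull_apply]

def Bf (A : Coeff (e+1) m) (ψ : EE e → ℝ) (z : EE e × ℝ) := pull (Rd (fderiv ℝ ψ z.1)) (Ab A (St ψ z))
def pf (v : ℰ e → YY m) (ψ : EE e → ℝ) (z : EE e × ℝ) : (EE e × ℝ) →L[ℝ] YY m :=
  (fderiv ℝ v (St ψ z)).comp (Sd (fderiv ℝ ψ z.1))

lemma St_dist_v (ψ : EE e → ℝ) (x : EE e) (s s' : ℝ) : ‖St ψ (x,s) - St ψ (x,s')‖ ≤ |s - s'| := by
  unfold St
  rw [← map_sub]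
  refine (io_norm_le _).trans ?_
  simp

lemma BL_of {F : Type*} [NormedAddCommGroup F] {ψ : EE e → ℝ} {M : ℝ} (hM : 0 ≤ M) (hψ : LipschitzWith M.toNNReal ψ)
    (Φ : (EE e →L[ℝ] ℝ) × ℰ e → F) (hΦ : Continuous Φ) {C K : ℝ} (hK : 0 ≤ K) (hC : ∀ l X, ‖l‖ ≤ M → ‖Φ (l,X)‖ ≤ C)
    (hL : ∀ l X X', ‖l‖ ≤ M → ‖Φ (l,X) - Φ (l,X')‖ ≤ K * ‖X - X'‖) :
    BL (fun z : EE e × ℝ => Φ (fderiv ℝ ψ z.1, St ψ z)) := by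
  have hl : ∀ x, ‖fderiv ℝ ψ x‖ ≤ M := fun x => by
    have := norm_fderiv_le_of_lipschitz ℝ hψ (x₀ := x)
    rwa [Real.coe_toNNReal _ hM] at this
  have hc := St_cont hψ.continuous
  refine ⟨⟨?_, C, fun z => hC _ _ (hl _)⟩, ⟨?_, C, fun z => hC _ _ (hl _)⟩, K, hK, fun x s s' => ?_⟩
  · refine hΦ.comp_aestronglyMeasurable (AEStronglyMeasurable.prodMk ?_ hc.aestronglyMeasurable)
    exact ((measurable_fderiv ℝ ψ).comp measurable_fst).aestronglyMeasurable
  · refine hΦ.comp_aestronglyMeasurable (AEStronglyMeasurable.prodMk ?_ (hc.comp (by fun_prop)).aestronglyMeasurable)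
    exact (measurable_fderiv ℝ ψ).aestronglyMeasurable
  · refine (hL _ _ _ (hl _)).trans ?_
    gcongr
    exact St_dist_v ψ x s s'

lemma St_der {ψ : EE e → ℝ} {x : EE e} (h : DifferentiableAt ℝ ψ x) (s : ℝ) : HasFDerivAt (St ψ) (Sd (fderiv ℝ ψ x)) (x,s) := by
  have h1 : HasFDerivAt (fun z : EE e × ℝ => (z.1, ψ z.1 + z.2)) ((ContinuousLinearMap.fst ℝ (EE e) ℝ).prod ((fderiv ℝ ψ x).comp (ContinuousLinearMap.fst ℝ (EE e) ℝ) + ContinuousLinearMap.snd ℝ (EE e) ℝ)) (x,s) := by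
    refine hasFDerivAt_fst.prodMk (HasFDerivAt.add ?_ hasFDerivAt_snd)
    exact HasFDerivAt.comp (x,s) (f := Prod.fst) h.hasFDerivAt hasFDerivAt_fst
  exact (io e).hasFDerivAt.comp _ h1

def Si (ψ : EE e → ℝ) (X : ℰ e) : EE e × ℝ := (projLast e X, X (Fin.last e) - ψ (projLast e X))

lemma Si_St (ψ : EE e → ℝ) (z : EE e × ℝ) : Si ψ (St ψ z) = z := by simp [Si, St]
lemma St_Si (ψ : EE e → ℝ) (X : ℰ e) : St ψ (Si ψ X) = X := St_inv ψ X

lemma Si_der {ψ : EE e → ℝ} {X : ℰ e} (h : DifferentiableAt ℝ ψ (projLast e X)) : HasFDerivAt (Si ψ) (Rd (fderiv ℝ ψ (projLast e X))) X := by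
  have h1 : HasFDerivAt (fun z : EE e × ℝ => (z.1, z.2 - ψ z.1)) ((ContinuousLinearMap.fst ℝ (EE e) ℝ).prod (ContinuousLinearMap.snd ℝ (EE e) ℝ - (fderiv ℝ ψ (projLast e X)).comp (ContinuousLinearMap.fst ℝ (EE e) ℝ))) ((io e).symm X) := by
    refine hasFDerivAt_fst.prodMk (HasFDerivAt.sub hasFDerivAt_snd ?_)
    exact HasFDerivAt.comp _ (f := Prod.fst) h.hasFDerivAt hasFDerivAt_fst
  exact h1.comp X (io e).symm.hasFDerivAt

lemma Si_lip {ψ : EE e → ℝ} {M : ℝ} (hM : 0 ≤ M) (hψ : LipschitzWith M.toNNReal ψ) : LipschitzWith (1+M).toNNReal (Si ψ) := by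
  refine LipschitzWith.of_dist_le_mul fun X Y => ?_
  rw [Real.coe_toNNReal _ (by positivity), Prod.dist_eq]
  have h1 := proj_norm_le (X - Y)
  have h2 := last_abs_le (X - Y)
  have h3 : projLast e (X - Y) = projLast e X - projLast e Y := by ext i; simp [projLast]
  rw [h3, ← dist_eq_norm, ← dist_eq_norm] at h1
  rw [← dist_eq_norm] at h2
  have h := hψ.dist_le_mul (projLast e X) (projLast e Y)
  rw [Real.coe_toNNReal _ hM, Real.dist_eq] at h
  have h5 : M * dist (projLast e X) (projLast e Y) ≤ M * dist X Y := by gcongr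
  have h6 : 0 ≤ M * dist X Y := by positivity
  refine max_le ?_ ?_
  · show dist (projLast e X) (projLast e Y) ≤ _
    linarith
  · show dist (X (Fin.last e) - ψ (projLast e X)) (Y (Fin.last e) - ψ (projLast e Y)) ≤ _
    rw [Real.dist_eq]
    have h7 := abs_sub (X (Fin.last e) - Y (Fin.last e)) (ψ (projLast e X) - ψ (projLast e Y))
    simp only [PiLp.sub_apply] at h2
    rw [show X (Fin.last e) - ψ (projLast e X) - (Y (Fin.last e) - ψ (projLast e Y)) = X (Fin.last e) - Y (Fin.last e) - (ψ (projLast e X) - ψ (projLast e Y)) by ring]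
    linarith

lemma St_lip {ψ : EE e → ℝ} {M : ℝ} (hM : 0 ≤ M) (hψ : LipschitzWith M.toNNReal ψ) : LipschitzWith (2+M).toNNReal (St ψ) := by
  refine LipschitzWith.of_dist_le_mul fun z w => ?_
  rw [Real.coe_toNNReal _ (by positivity)]
  have h := St_dist hM hψ z.1 w.1 z.2 w.2
  rw [← Real.dist_eq] at h
  have h1 : dist z.1 w.1 ≤ dist z w := le_max_left _ _
  have h2 : dist z.2 w.2 ≤ dist z w := le_max_right _ _
  have h5 : (1+M) * dist z.1 w.1 ≤ (1+M) * dist z w := by gcongr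
  have : dist (St ψ z) (St ψ w) ≤ (1 + M) * dist z.1 w.1 + dist z.2 w.2 := h
  linarith

end

section
variable {e m : ℕ}

lemma cutoff {V F : Type*} [NormedAddCommGroup V] [NormedSpace ℝ V] [FiniteDimensional ℝ V] [NormedAddCommGroup F] [NormedSpace ℝ F]
    {O K : Set V} (hO : IsOpen O) (hK : IsCompact K) (hKO : K ⊆ O) {u : V → F} (hu : ContDiffOn ℝ 2 u O) :
    ∃ v : V → F, ContDiff ℝ 2 v ∧ HasCompactSupport v ∧ ∃ W, IsOpen W ∧ K ⊆ W ∧ EqOn u v W := by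
  obtain ⟨L1, h1, h2, h3⟩ := exists_compact_between hK hO hKO
  obtain ⟨L2, h4, h5, h6⟩ := exists_compact_between h1 hO h3
  obtain ⟨f, f1, -, f3, f4⟩ := exists_contMDiff_support_eq_eq_one_iff (modelWithCornersSelf ℝ V) (n := 2) isOpen_interior h1.isClosed h5
  have f1' : ContDiff ℝ 2 f := f1.contDiff
  have hts : tsupport f ⊆ L2 := by
    unfold tsupport
    rw [f3]
    exact closure_minimal interior_subset h4.isClosed
  refine ⟨fun x => f x • u x, ?_, ?_, interior L1, isOpen_interior, h2, ?_⟩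
  · rw [contDiff_iff_contDiffAt]
    intro x
    by_cases hx : x ∈ O
    · exact f1'.contDiffAt.smul (hu.contDiffAt (hO.mem_nhds hx))
    · have : x ∉ tsupport f := fun h => hx (h6 (hts h))
      refine (contDiffAt_const (c := (0:F))).congr_of_eventuallyEq ?_
      filter_upwards [(isClosed_tsupport f).isOpen_compl.mem_nhds this] with y hy
      rw [image_eq_zero_of_notMem_tsupport hy, zero_smul]
  · have hf : HasCompactSupport f := h4.of_isClosed_subset (isClosed_tsupport f) hts
    exact hf.smul_right
  · intro x hx
    simp [(f4 x).1 (interior_subset hx)]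

def k0 (μ M : ℝ) : ℝ := μ/(2+M)^2
def k1 (e m : ℕ) (μ M : ℝ) : ℝ := μ⁻¹ * ((e+1:ℕ)*m) * (1+M)^2
def k2 (e m : ℕ) (τ M : ℝ) : ℝ := ((e+1:ℕ)*m)^2 * τ * (1+M)^2 + 1

lemma k0_pos {μ M : ℝ} (hμ : 0 < μ) (hM : 0 ≤ M) : 0 < k0 μ M := by unfold k0; positivity
lemma k1_pos {μ M : ℝ} (hm : 1 ≤ m) (hμ : 0 < μ) (hM : 0 ≤ M) : 0 < k1 e m μ M := by
  have : (0:ℝ) < m := by exact_mod_cast hm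
  unfold k1; positivity
lemma k2_pos {τ M : ℝ} (hτ : 0 ≤ τ) (hM : 0 ≤ M) : 0 < k2 e m τ M := by unfold k2; positivity

lemma fd_bd {M : ℝ} (hM : 0 ≤ M) {ψ : EE e → ℝ} (hψ : LipschitzWith M.toNNReal ψ) (x : EE e) : ‖fderiv ℝ ψ x‖ ≤ M := by
  have := norm_fderiv_le_of_lipschitz ℝ hψ (x₀ := x)
  rwa [Real.coe_toNNReal _ hM] at this

lemma St_one (ψ : EE e → ℝ) (x : EE e) (s : ℝ) : St ψ (x, s+1) = St ψ (x,s) + io e (0,1) := by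
  unfold St; rw [← map_add]; congr 1; ext <;> simp; ring

lemma Bf_cont {A : Coeff (e + 1) m} (hA2 : ∀ i j α β, ContDiff ℝ 2 (fun Z => A Z i j α β)) :
    Continuous (fun q : (EE e →L[ℝ] ℝ) × ℰ e => pull (Rd q.1) (Ab A q.2)) := by
  have h1 : Continuous (fun q : (EE e →L[ℝ] ℝ) × ℰ e => Ab A q.2) := (Ab_diff hA2).continuous.comp continuous_snd
  have h2 : Continuous (fun q : (EE e →L[ℝ] ℝ) × ℰ e => Rd q.1) := Rd_cont.comp continuous_fst
  unfold pull Tc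
  fun_prop

lemma pull_R {M : ℝ} (hM : 0 ≤ M) {l : EE e →L[ℝ] ℝ} (hl : ‖l‖ ≤ M) (b : GG (e+1) m →L[ℝ] GG (e+1) m →L[ℝ] ℝ) :
    ‖pull (Rd l) b‖ ≤ ‖b‖ * (1+M)^2 := by
  refine (pull_norm _ _).trans ?_
  have := Rd_norm hM hl
  gcongr

lemma Bf_BL {M : ℝ} (hM : 0 ≤ M) {ψ : EE e → ℝ} (hψ : LipschitzWith M.toNNReal ψ) {A : Coeff (e + 1) m}
    (hA2 : ∀ i j α β, ContDiff ℝ 2 (fun Z => A Z i j α β)) {C : ℝ} (hup : ∀ (l : EE e →L[ℝ] ℝ) X, ‖l‖ ≤ M → ‖pull (Rd l) (Ab A X)‖ ≤ C)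
    {KA : ℝ≥0} (hKA : LipschitzWith KA (Ab A)) : BL (Bf A ψ) := by
  refine BL_of hM hψ (fun q => pull (Rd q.1) (Ab A q.2)) (Bf_cont hA2) (C := C) (K := KA * (1+M)^2) (by positivity) hup ?_
  intro l X X' hl
  show ‖pull (Rd l) (Ab A X) - pull (Rd l) (Ab A X')‖ ≤ _
  rw [pull_sub]
  refine (pull_R hM hl _).trans ?_
  have := hKA.dist_le_mul X X'
  rw [dist_eq_norm, dist_eq_norm] at this
  calc _ ≤ (KA * ‖X - X'‖) * (1+M)^2 := mul_le_mul_of_nonneg_right this (by positivity)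
    _ = _ := by ring

lemma pf_BL {M : ℝ} (hM : 0 ≤ M) {ψ : EE e → ℝ} (hψ : LipschitzWith M.toNNReal ψ) {v : ℰ e → YY m} (hv : ContDiff ℝ 2 v) (hvc : HasCompactSupport v) :
    BL (pf v ψ) := by
  obtain ⟨Kv, hKv⟩ := hv.lipschitzWith_of_hasCompactSupport hvc (by norm_num)
  have hv' : ContDiff ℝ 1 (fderiv ℝ v) := hv.fderiv_right (by norm_num)
  have hv'c : HasCompactSupport (fderiv ℝ v) := hvc.fderiv ℝ
  obtain ⟨Kv', hKv'⟩ := hv'.lipschitzWith_of_hasCompactSupport hv'c (by norm_num)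
  refine BL_of hM hψ (fun q => (fderiv ℝ v q.2).comp (Sd q.1)) ?_ (C := Kv * (2+M)) (K := Kv' * (2+M)) (by positivity) ?_ ?_
  · exact ((hv'.continuous.comp continuous_snd).clm_comp (Sd_cont.comp continuous_fst))
  · intro l X hl
    refine (ContinuousLinearMap.opNorm_comp_le _ _).trans ?_
    have h1 := Sd_norm hM hl
    have h2 := norm_fderiv_le_of_lipschitz ℝ hKv (x₀ := X)
    exact mul_le_mul h2 h1 (norm_nonneg _) (by positivity)
  · intro l X X' hl
    simp only
    rw [← ContinuousLinearMap.sub_comp]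
    refine (ContinuousLinearMap.opNorm_comp_le _ _).trans ?_
    have h1 := Sd_norm hM hl
    have h2 := hKv'.dist_le_mul X X'
    rw [dist_eq_norm, dist_eq_norm] at h2
    calc _ ≤ (Kv' * ‖X - X'‖) * (2+M) := mul_le_mul h2 h1 (norm_nonneg _) (by positivity)
      _ = _ := by ring

lemma sys_of (hm : 1 ≤ m) {μ lam τ M : ℝ} (hμ : 0 < μ) (hlam : lam ∈ Set.Ioo (0 : ℝ) 1) (hτ : 0 ≤ τ) (hM : 0 ≤ M)
    {ψ : EE e → ℝ} (hψ : LipschitzWith M.toNNReal ψ) {A : Coeff (e + 1) m} (hA : MemLambdaClass μ lam τ A) (hs : IsSymmCoeff A)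
    (hA2 : ∀ i j α β, ContDiff ℝ 2 (fun Z => A Z i j α β)) {r : ℝ} (hr : 0 < r) {O : Set ℰ e} (hO : MeasurableSet O)
    {u v : ℰ e → YY m} (hu : IsWeakSolution A O u) (hv : ContDiff ℝ 2 v) (hvc : HasCompactSupport v)
    (hOO : ∀ x s, ‖x‖ < 4*r → 0 < s → s < r → St ψ (x,s) ∈ O ∧ u (St ψ (x,s)) = v (St ψ (x,s))) :
    Sys (k0 μ M) (k1 e m μ M) (k2 e m τ M) lam r (Bf A ψ) (fun z => v (St ψ z)) (pf v ψ) := by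
  obtain ⟨hE, hP, hH⟩ := hA
  obtain ⟨KA, hKA⟩ := Ab_lip hA2 hP
  have hfb := fd_bd hM hψ
  obtain ⟨Kv, hKv⟩ := hv.lipschitzWith_of_hasCompactSupport hvc (by norm_num)
  have hup : ∀ l X, ‖l‖ ≤ M → ‖pull (Rd l) (Ab A X)‖ ≤ k1 e m μ M := fun l X hl => by
    refine (pull_R hM hl _).trans ?_
    unfold k1
    have := Ab_upper hμ hE hs X
    gcongr
  refine ⟨k0_pos hμ hM, k1_pos hm hμ hM, k2_pos hτ hM, hlam.1, hlam.2, hr, ?_, ?_, ?_, ?_, ?_, ?_, ?_, ?_, ?_, ?_⟩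
  · exact Bf_BL hM hψ hA2 hup hKA
  · intro z ξ η
    simp only [Bf, pull_apply]
    exact Ab_symm hs _ _ _
  · intro z ξ
    simp only [Bf, pull_apply]
    refine le_trans ?_ (Ab_ell hE _ _).1
    have h1 := le_gn (ξ.comp (Rd (fderiv ℝ ψ z.1)))
    have h2 : ‖ξ‖ ≤ ‖ξ.comp (Rd (fderiv ℝ ψ z.1))‖ * (2+M) := by
      have h3 : ξ = (ξ.comp (Rd (fderiv ℝ ψ z.1))).comp (Sd (fderiv ℝ ψ z.1)) := by
        rw [ContinuousLinearMap.comp_assoc, Rd_Sd, ContinuousLinearMap.comp_id]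
      have h4 := Sd_norm hM (hfb z.1)
      calc ‖ξ‖ = ‖(ξ.comp (Rd (fderiv ℝ ψ z.1))).comp (Sd (fderiv ℝ ψ z.1))‖ := by rw [← h3]
        _ ≤ _ := ContinuousLinearMap.opNorm_comp_le _ _
        _ ≤ _ := by gcongr
    have h5 : ‖ξ‖^2 ≤ (‖ξ.comp (Rd (fderiv ℝ ψ z.1))‖ * (2+M))^2 := by gcongr
    unfold k0
    rw [div_mul_eq_mul_div, div_le_iff₀ (by positivity)]
    calc μ * ‖ξ‖^2 ≤ μ * (‖ξ.comp (Rd (fderiv ℝ ψ z.1))‖ * (2+M))^2 := by gcongr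
      _ = μ * ‖ξ.comp (Rd (fderiv ℝ ψ z.1))‖^2 * (2+M)^2 := by ring
      _ ≤ _ := by gcongr
  · intro z
    exact hup _ _ (hfb _)
  · intro x s s'
    simp only [Bf]
    rw [pull_sub]
    refine (pull_R hM (hfb _) _).trans ?_
    have h1 := Ab_hold hH (St ψ (x,s)) (St ψ (x,s'))
    have h2 := St_dist_v ψ x s s'
    have h3 : ‖St ψ (x,s) - St ψ (x,s')‖^lam ≤ |s-s'|^lam := Real.rpow_le_rpow (norm_nonneg _) h2 hlam.1.le
    have h4 : 0 ≤ |s-s'|^lam := by positivity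
    calc _ ≤ (((e+1:ℕ)*m)^2 * (τ * |s-s'|^lam)) * (1+M)^2 := by
          refine mul_le_mul_of_nonneg_right (h1.trans ?_) (by positivity)
          gcongr
      _ ≤ _ := by unfold k2; linarith
  · intro x s
    simp only [Bf]
    rw [St_one, Ab_per hP]
    intro i
    refine Fin.lastCases ⟨1, by simp⟩ (fun j => ⟨0, by simp⟩) i
  · exact ⟨_, hKv.comp (St_lip hM hψ)⟩
  · exact pf_BL hM hψ hv hvc
  · filter_upwards [hψ.ae_differentiableAt] with x hx s
    exact ((hv.differentiable (by norm_num)) _).hasFDerivAt.comp _ (St_der hx s)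
  · rintro W ⟨KW, hW⟩ hW0
    have hψc := hψ.continuous
    set O' : Set ℰ e := (Si ψ) ⁻¹' {z | ‖z.1‖ < 4*r ∧ 0 < z.2 ∧ z.2 < r} with hO'
    have hSic : Continuous (Si ψ) := (Si_lip hM hψ).continuous
    have hop : IsOpen O' := by
      refine IsOpen.preimage hSic ?_
      have a1 : IsOpen {z : EE e × ℝ | ‖z.1‖ < 4*r} := isOpen_lt (by fun_prop) (by fun_prop)
      have a2 : IsOpen {z : EE e × ℝ | 0 < z.2} := isOpen_lt (by fun_prop) (by fun_prop)
      have a3 : IsOpen {z : EE e × ℝ | z.2 < r} := isOpen_lt (by fun_prop) (by fun_prop)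
      exact a1.inter (a2.inter a3)
    have hin : ∀ X ∈ O', X ∈ O ∧ u X = v X := by
      rintro X ⟨h1, h2, h3⟩
      have := hOO _ _ h1 h2 h3
      rwa [Prod.mk.eta, St_Si] at this
    have key := weak_lip hA2 hv hvc hO hop (fun X hX => (hin X hX).1) hu (fun X hX => (hin X hX).2)
      (w := fun X => W (Si ψ X)) (hW.comp (Si_lip hM hψ)) (by
        intro X hX
        apply hW0
        simp only [hO', mem_preimage, mem_ofPred_eq, not_and_or, not_lt] at hX
        exact hX)
    rw [← (St_mp hψc).integral_comp (St_me hψc)] at key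
    rw [← key]
    refine integral_congr_ae ?_
    have hWd : ∀ᵐ z : EE e × ℝ, DifferentiableAt ℝ W z := hW.ae_differentiableAt
    have hpd : ∀ᵐ z : EE e × ℝ, DifferentiableAt ℝ ψ z.1 :=
      (Measure.quasiMeasurePreserving_fst (μ := (volume : Measure (EE e))) (ν := (volume : Measure ℝ))).ae hψ.ae_differentiableAt
    filter_upwards [hWd, hpd] with z hz1 hz2
    simp only [Bf, pf, pull_apply]
    congr 1
    · rw [ContinuousLinearMap.comp_assoc, Sd_Rd, ContinuousLinearMap.comp_id]
    · symm
      have h1 : HasFDerivAt W (fderiv ℝ W z) (Si ψ (St ψ z)) := by rw [Si_St]; exact hz1.hasFDerivAt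
      have h2 := Si_der (ψ := ψ) (X := St ψ z) (by rw [proj_St]; exact hz2)
      rw [proj_St] at h2
      exact (h1.comp _ h2).fderiv

end

section
variable {e m : ℕ}

lemma St_shift (ψ : EE e → ℝ) (ε : ℝ) (z : EE e × ℝ) : St (fun x => ψ x + ε) z = St ψ (z.1, z.2+ε) := by
  unfold St; congr 2; ring
lemma fd_shift (ψ : EE e → ℝ) (ε : ℝ) (x : EE e) : fderiv ℝ (fun x => ψ x + ε) x = fderiv ℝ ψ x := by
  rw [fderiv_add_const]

def nuF (A : Coeff (e+1) m) (ψ : EE e → ℝ) (u : ℰ e → YY m) (s : ℝ) (x : EE e) : YY m →L[ℝ] ℝ :=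
  (Bf A ψ (x,s) (pf u ψ (x,s))).comp (dtL (EE e) (YY m))
def taF (ψ : EE e → ℝ) (u : ℰ e → YY m) (s : ℝ) (x : EE e) : (EE e × ℝ) →L[ℝ] YY m :=
  (pf u ψ (x,s)).comp (tanP (EE e))

lemma graphD_open {M : ℝ} {ψ : EE e → ℝ} (hψ : Continuous ψ) (r : ℝ) : IsOpen (graphD e M ψ r) := by
  have h1 : Continuous (projLast e) := (continuous_fst.comp (io e).symm.continuous)
  have h2 : Continuous (fun X : ℰ e => X (Fin.last e)) := (continuous_snd.comp (io e).symm.continuous)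
  have a1 : IsOpen {X : ℰ e | ‖projLast e X‖ < r} := isOpen_lt (by fun_prop) (by fun_prop)
  have a2 : IsOpen {X : ℰ e | ψ (projLast e X) < X (Fin.last e)} := isOpen_lt (by fun_prop) (by fun_prop)
  have a3 : IsOpen {X : ℰ e | X (Fin.last e) < 10 * Real.sqrt (e + 1) * (M + 1) * r} := isOpen_lt (by fun_prop) (by fun_prop)
  exact a1.inter (a2.inter a3)

lemma St_mem {M : ℝ} (hM : 0 ≤ M) {ψ : EE e → ℝ} (hψ : LipschitzWith M.toNNReal ψ) (h0 : ψ 0 = 0) {R : ℝ} {x : EE e} {s : ℝ}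
    (hx : ‖x‖ < R) (hs : 0 < s) (hs2 : s ≤ 9 * R) : St ψ (x,s) ∈ graphD e M ψ R := by
  have hR : 0 < R := (norm_nonneg x).trans_lt hx
  refine ⟨by rwa [proj_St], by rw [proj_St, last_St]; simpa using hs, ?_⟩
  rw [last_St]
  have h1 := hψ.dist_le_mul x 0
  rw [Real.coe_toNNReal _ hM, Real.dist_eq, h0, dist_zero_right, sub_zero] at h1
  have h2 := le_abs_self (ψ x)
  have h3 : M * ‖x‖ ≤ M * R := by gcongr
  have h4 : 1 ≤ Real.sqrt (e+1) := by
    rw [Real.one_le_sqrt]; linarith [(Nat.cast_nonneg e : (0:ℝ) ≤ e)]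
  have h5 : 1 * ((M+1)*R) ≤ Real.sqrt (e+1) * ((M+1)*R) := by gcongr
  simp only
  nlinarith [mul_nonneg hM hR.le]

lemma core_eps (hm : 1 ≤ m) {μ lam τ M : ℝ} (hμ : 0 < μ) (hlam : lam ∈ Set.Ioo (0 : ℝ) 1) (hτ : 0 ≤ τ) (hM : 0 ≤ M) :
    ∃ C, 0 < C ∧ ∀ ψ : EE e → ℝ, LipschitzWith M.toNNReal ψ → ψ 0 = 0 → ∀ A : Coeff (e + 1) m, MemLambdaClass μ lam τ A → IsSymmCoeff A →
    (∀ i j α β, ContDiff ℝ 2 (fun Z => A Z i j α β)) → ∀ r : ℝ, 0 < r → ∀ u : ℰ e → YY m, ContDiffOn ℝ 2 u (graphD e M ψ (8 * r)) →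
    IsWeakSolution A (graphD e M ψ (8 * r)) u → IntegrableOn (gradSq u) (graphD e M ψ (4*r)) → ∀ ε, 0 < ε → ε < r →
    ((∫ x in ℬ e r, ‖pf u ψ (x,ε)‖^2) ≤ C * (∫ x in ℬ e (4*r), ‖nuF A ψ u ε x‖^2) + C/r * ∫ X in graphD e M ψ (4*r), gradSq u X) ∧
    ((∫ x in ℬ e r, ‖pf u ψ (x,ε)‖^2) ≤ C * (∫ x in ℬ e (4*r), ‖taF ψ u ε x‖^2) + C/r * ∫ X in graphD e M ψ (4*r), gradSq u X) := by
  obtain ⟨C, hC, H⟩ := core (EE e) (YY m) (k0_pos hμ hM) (k1_pos (e := e) hm hμ hM) (k2_pos (e := e) (m := m) hτ hM) hlam.1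
  refine ⟨C * (2+M)^2, by positivity, ?_⟩
  intro ψ hψ h0 A hA hs hA2 r hr u hu hw hint ε hε hεr
  set φ : EE e → ℝ := fun x => ψ x + ε with hφ
  have hφl : LipschitzWith M.toNNReal φ := by
    have := hψ.add (LipschitzWith.const ε)
    simpa using this
  have hopen := graphD_open (M := M) hψ.continuous (8*r)
  have hKc : IsCompact (St φ '' (closedBall 0 (4*r) ×ˢ Icc 0 (2*r))) :=
    ((isCompact_closedBall _ _).prod isCompact_Icc).image (St_cont hφl.continuous)
  obtain ⟨v, hv, hvc, W, hWo, hKW, huv⟩ := cutoff hopen hKc (by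
    rintro _ ⟨⟨x,s⟩, ⟨hx, hs⟩, rfl⟩
    rw [St_shift]
    simp only [mem_closedBall, dist_zero_right, mem_Icc] at hx hs
    exact St_mem hM hψ h0 (by linarith) (by linarith) (by simp only; linarith)) hu
  have hin : ∀ x s, ‖x‖ ≤ 4*r → 0 ≤ s → s ≤ 2*r → St φ (x,s) ∈ W := fun x s hx h1 h2 =>
    hKW ⟨(x,s), ⟨by simpa using hx, h1, h2⟩, rfl⟩
  have hfd : ∀ x s, ‖x‖ ≤ 4*r → 0 ≤ s → s ≤ 2*r → pf v φ (x,s) = pf u ψ (x,s+ε) := fun x s hx h1 h2 => by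
    unfold pf
    rw [fd_shift, St_shift]
    congr 1
    have h3 := hin x s hx h1 h2
    rw [St_shift] at h3
    exact ((huv.eventuallyEq_of_mem (hWo.mem_nhds h3)).fderiv_eq).symm
  have S := sys_of hm hμ hlam hτ hM hφl hA hs hA2 hr hopen.measurableSet hw hv hvc (fun x s hx h1 h2 => ⟨by
    rw [St_shift]
    exact St_mem hM hψ h0 (by linarith) (by simp only; linarith) (by simp only; linarith), huv (hin x s hx.le h1.le (by linarith))⟩)
  have HH := H r _ _ _ S
  have hL : (∫ x in ℬ e r, ‖pf v φ (x,0)‖^2) = ∫ x in ℬ e r, ‖pf u ψ (x,ε)‖^2 := by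
    refine setIntegral_congr_fun measurableSet_ball fun x hx => ?_
    have hx' : ‖x‖ < r := by simpa using hx
    rw [hfd x 0 (by linarith) le_rfl (by linarith), zero_add]
  have hn : (∫ x in ℬ e (4*r), ‖nuB (Bf A φ) (pf v φ) x‖^2) = ∫ x in ℬ e (4*r), ‖nuF A ψ u ε x‖^2 := by
    refine setIntegral_congr_fun measurableSet_ball fun x hx => ?_
    have hx' : ‖x‖ < 4*r := by simpa using hx
    simp only [nuB, nuF, Bf]
    rw [hfd x 0 (by linarith) le_rfl (by linarith), fd_shift, St_shift, zero_add]
  have ht : (∫ x in ℬ e (4*r), ‖tanT (pf v φ) x‖^2) = ∫ x in ℬ e (4*r), ‖taF ψ u ε x‖^2 := by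
    refine setIntegral_congr_fun measurableSet_ball fun x hx => ?_
    have hx' : ‖x‖ < 4*r := by simpa using hx
    simp only [tanT, taF]
    rw [hfd x 0 (by linarith) le_rfl (by linarith), zero_add]
  have he : eng (pf v φ) (4*r) (2*r) ≤ (2+M)^2 * ∫ X in graphD e M ψ (4*r), gradSq u X := by
    have hsub : (Si φ) ⁻¹' (box (EE e) (4*r) 0 (2*r)) ⊆ graphD e M ψ (4*r) := by
      rintro X ⟨h1, h2, h3⟩
      have h := St_Si φ X
      rw [St_shift] at h
      rw [← h]
      exact St_mem hM hψ h0 h1 (by linarith) (by linarith)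
    have hbm : MeasurableSet (box (EE e) (4*r) 0 (2*r)) := by
      have a1 : IsOpen {z : EE e × ℝ | ‖z.1‖ < 4*r} := isOpen_lt (by fun_prop) (by fun_prop)
      have a2 : IsOpen {z : EE e × ℝ | 0 < z.2} := isOpen_lt (by fun_prop) (by fun_prop)
      have a3 : IsOpen {z : EE e × ℝ | z.2 < 2*r} := isOpen_lt (by fun_prop) (by fun_prop)
      exact (a1.inter (a2.inter a3)).measurableSet
    have hpre : St φ ⁻¹' ((Si φ) ⁻¹' (box (EE e) (4*r) 0 (2*r))) = box (EE e) (4*r) 0 (2*r) := by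
      ext z; simp [Si_St]
    have hmp := St_mp hφl.continuous
    have hI : IntegrableOn (gradSq u) ((Si φ) ⁻¹' (box (EE e) (4*r) 0 (2*r))) := hint.mono_set hsub
    have h1 : IntegrableOn (fun z => gradSq u (St φ z)) (box (EE e) (4*r) 0 (2*r)) := by
      have := (hmp.integrableOn_comp_preimage (St_me hφl.continuous)).2 hI
      rwa [hpre] at this
    have h2 := hmp.setIntegral_preimage_emb (St_me hφl.continuous) (gradSq u) ((Si φ) ⁻¹' (box (EE e) (4*r) 0 (2*r)))
    rw [hpre] at h2
    have hnn : ∀ X, 0 ≤ gradSq u X := fun X => by unfold gradSq; positivity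
    calc eng (pf v φ) (4*r) (2*r) ≤ ∫ z in box (EE e) (4*r) 0 (2*r), (2+M)^2 * gradSq u (St φ z) := by
          refine integral_mono_of_nonneg (Eventually.of_forall fun z => by positivity) (h1.const_mul _) ?_
          filter_upwards [ae_restrict_mem hbm] with z hz
          obtain ⟨h3, h4, h5⟩ := hz
          have h6 := hfd z.1 z.2 h3.le h4.le h5.le
          simp only [Prod.mk.eta] at h6
          rw [h6]
          unfold pf
          have h7 := ContinuousLinearMap.opNorm_comp_le (fderiv ℝ u (St ψ (z.1, z.2+ε))) (Sd (fderiv ℝ ψ z.1))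
          have h8 := Sd_norm hM (fd_bd hM hψ z.1)
          have h9 := le_gn (fderiv ℝ u (St ψ (z.1, z.2+ε)))
          have h10 : gradSq u (St φ z) = gradNormSq (fderiv ℝ u (St ψ (z.1, z.2+ε))) := by rw [St_shift]; rfl
          rw [h10]
          calc _ ≤ (‖fderiv ℝ u (St ψ (z.1, z.2+ε))‖ * (2+M))^2 := by
                gcongr
                exact h7.trans (mul_le_mul_of_nonneg_left h8 (norm_nonneg _))
            _ = (2+M)^2 * ‖fderiv ℝ u (St ψ (z.1, z.2+ε))‖^2 := by ring
            _ ≤ _ := by gcongr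
      _ = (2+M)^2 * ∫ X in (Si φ) ⁻¹' (box (EE e) (4*r) 0 (2*r)), gradSq u X := by rw [integral_const_mul, h2]
      _ ≤ _ := by
        refine mul_le_mul_of_nonneg_left ?_ (by positivity)
        exact setIntegral_mono_set hint (Eventually.of_forall hnn) hsub.eventuallyLE
  rw [hL, hn, ht] at HH
  have hC2 : C ≤ C*(2+M)^2 := by nlinarith [sq_nonneg M]
  have he' : C / r * eng (pf v φ) (4*r) (2*r) ≤ C * (2+M)^2 / r * ∫ X in graphD e M ψ (4*r), gradSq u X := by
    calc _ ≤ C / r * ((2+M)^2 * ∫ X in graphD e M ψ (4*r), gradSq u X) := by gcongr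
      _ = _ := by ring
  refine ⟨HH.1.trans (add_le_add (mul_le_mul_of_nonneg_right hC2 (by positivity)) he'), HH.2.trans (add_le_add (mul_le_mul_of_nonneg_right hC2 (by positivity)) he')⟩

end

section
variable {e m : ℕ}

def NN (C₀ M : ℝ) (ψ : EE e → ℝ) (r : ℝ) (u : ℰ e → YY m) (z : EE e) : ℝ≥0∞ :=
  ntMax C₀ (graphD e M ψ (8 * r)) (frontier (graphDomain e ψ)) (fun X => fderiv ℝ u X) (St ψ (z,0))

def kap (C₀ M : ℝ) : ℝ := (C₀-1)/(2*(1+M)^2)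
lemma kap_pos {C₀ M : ℝ} (hC : 1 < C₀) (hM : 0 ≤ M) : 0 < kap C₀ M := by
  unfold kap; have : 0 < C₀ - 1 := by linarith
  positivity

structure Fl (C₀ M : ℝ) (ψ : EE e → ℝ) (r : ℝ) (u : ℰ e → YY m) (G : ℰ e → GG (e+1) m) : Prop where
  hM : 0 ≤ M
  hC : 1 < C₀
  hψ : LipschitzWith M.toNNReal ψ
  h0 : ψ 0 = 0
  hr : 0 < r
  hu : ContDiffOn ℝ 2 u (graphD e M ψ (8 * r))
  hN : ∫⁻ z in ℬ e (6*r), NN C₀ M ψ r u z ^ 2 ≠ ∞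
  hG : ∀ᵐ z : EE e, z ∈ ℬ e (6*r) → NTLim C₀ (graphD e M ψ (8 * r)) (frontier (graphDomain e ψ)) (fun X => fderiv ℝ u X) (St ψ (z,0)) (G (St ψ (z,0)))

section fl
variable {C₀ M r : ℝ} {ψ : EE e → ℝ} {u : ℰ e → YY m} {G : ℰ e → GG (e+1) m}

lemma Fl.Nm (S : Fl C₀ M ψ r u G) : Measurable (NN C₀ M ψ r u) := by
  have := lsc_meas (fun X : ℰ e => {z : EE e | St ψ (z,0) ∈ {P | X ∈ ntRegion C₀ (graphD e M ψ (8 * r)) (frontier (graphDomain e ψ)) P}}) (fun X => by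
    have hc := (St_cont S.hψ.continuous)
    by_cases hX : X ∈ graphD e M ψ (8*r)
    · simp only [ntRegion, mem_ofPred_eq, hX, true_and]
      exact isOpen_lt (by fun_prop) (by fun_prop)
    · simp [ntRegion, mem_ofPred_eq, hX]) (fun X => (‖fderiv ℝ u X‖₊ : ℝ≥0∞))
  exact this

lemma Fl.le_N {x z : EE e} {s : ℝ} (h : St ψ (x,s) ∈ ntRegion C₀ (graphD e M ψ (8 * r)) (frontier (graphDomain e ψ)) (St ψ (z,0))) :
    ‖fderiv ℝ u (St ψ (x,s))‖ₑ ≤ NN C₀ M ψ r u z :=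
  le_iSup₂ (f := fun X (_ : X ∈ ntRegion C₀ (graphD e M ψ (8 * r)) (frontier (graphDomain e ψ)) (St ψ (z,0))) => (‖fderiv ℝ u X‖₊ : ℝ≥0∞)) _ h

lemma Fl.cone (S : Fl C₀ M ψ r u G) {x : EE e} (hx : x ∈ ℬ e (6*r)) {s : ℝ} (hs : 0 < s) (hs2 : s < 9*r) :
    ∃ y, dist y x ≤ C₀ * s ∧ ∀ z, dist z y < kap C₀ M * s → St ψ (x,s) ∈ ntRegion C₀ (graphD e M ψ (8 * r)) (frontier (graphDomain e ψ)) (St ψ (z,0)) := by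
  obtain ⟨y, h1, h2⟩ := cone_ball S.hM S.hC S.hψ x hs
  have hr := S.hr
  refine ⟨y, h1, fun z hz => ⟨St_mem S.hM S.hψ S.h0 ?_ hs ?_, h2 z hz⟩⟩
  · have : ‖x‖ < 6*r := by simpa using hx
    linarith
  · linarith

instance sct : SecondCountableTopology (GG (e+1) m) := by
  have : ProperSpace (GG (e+1) m) := FiniteDimensional.proper_real _
  infer_instance

lemma Fl.conv (S : Fl C₀ M ψ r u G) :
    ∀ᵐ x : EE e, x ∈ ℬ e (6*r) → Tendsto (fun s => fderiv ℝ u (St ψ (x,s))) (𝓝[>] 0) (𝓝 (G (St ψ (x,0)))) := by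
  have hC0 : 0 < C₀ := by linarith [S.hC]
  refine nt_conv (f := fun x s => fderiv ℝ u (St ψ (x,s))) (g := fun x => G (St ψ (x,0)))
    (R := fun x s z => St ψ (x,s) ∈ ntRegion C₀ (graphD e M ψ (8 * r)) (frontier (graphDomain e ψ)) (St ψ (z,0))) hC0 (kap_pos S.hC S.hM) (s0 := 9*r) (by linarith [S.hr])
    (fun x hx s h1 h2 => S.cone hx h1 h2) ?_
  filter_upwards [S.hG] with z hz hzT η hη
  have h := hz hzT
  unfold NTLim at h
  rw [Metric.tendsto_nhdsWithin_nhds] at h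
  obtain ⟨δ, hδ, h⟩ := h η hη
  refine ⟨δ/C₀, by positivity, fun x s hs hs2 hR => ?_⟩
  rw [← dist_eq_norm]
  refine (h hR ?_).le
  refine hR.2.trans_le ?_
  have h1 : infDist (St ψ (x,s)) (frontier (graphDomain e ψ)) ≤ s := by
    refine (infDist_le_dist_of_mem (y := St ψ (x,0)) ?_).trans ?_
    · rw [frontier_eq S.hψ.continuous]; exact ⟨x, rfl⟩
    · rw [dist_eq_norm]
      refine (St_dist_v ψ x s 0).trans ?_
      rw [sub_zero, abs_of_pos hs]
  calc C₀ * infDist (St ψ (x,s)) (frontier (graphDomain e ψ)) ≤ C₀ * s := by gcongr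
    _ ≤ C₀ * (δ/C₀) := by gcongr
    _ = δ := by field_simp

lemma Fl.fc (S : Fl C₀ M ψ r u G) : ContinuousOn (fderiv ℝ u) (graphD e M ψ (8*r)) :=
  S.hu.continuousOn_fderiv_of_isOpen (graphD_open S.hψ.continuous _) (by norm_num)

lemma Fl.slc (S : Fl C₀ M ψ r u G) {s : ℝ} (hs : 0 < s) (hs2 : s < 9*r) :
    ContinuousOn (fun x => fderiv ℝ u (St ψ (x,s))) (ℬ e (6*r)) := by
  refine S.fc.comp (((St_cont S.hψ.continuous).comp (by fun_prop : Continuous fun x : EE e => (x,s))).continuousOn) fun x hx => ?_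
  have hr := S.hr
  have : ‖x‖ < 6*r := by simpa using hx
  exact St_mem S.hM S.hψ S.h0 (by linarith) hs (by linarith)

def kav (e : ℕ) (C₀ M : ℝ) : ℝ≥0∞ := ENNReal.ofReal (((C₀+kap C₀ M)/kap C₀ M)^e)

lemma Fl.slice (S : Fl C₀ M ψ r u G) {s : ℝ} (hs : 0 < s) (hs2 : (C₀ + kap C₀ M) * s ≤ 2*r) :
    ∫⁻ x in ℬ e (4*r), ‖fderiv ℝ u (St ψ (x,s))‖ₑ^2 ≤ kav e C₀ M * ∫⁻ z in ℬ e (6*r), NN C₀ M ψ r u z ^ 2 := by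
  have hk := kap_pos S.hC S.hM
  have hr := S.hr
  have hC := S.hC
  have hs3 : s < 9*r := by nlinarith
  refine (avg (S.Nm.pow_const 2) (C₀ := C₀) (κ := kap C₀ M) (t := s) (by linarith) hk hs (a := 4*r) ?_).trans ?_
  · intro x hx
    obtain ⟨y, h1, h2⟩ := S.cone (ball_subset_ball (by linarith) hx) hs hs3
    refine ⟨y, h1, fun z hz => ?_⟩
    have := Fl.le_N (u := u) (h2 z hz)
    gcongr
  · unfold kav
    gcongr
    linarith

lemma gs_le (L : GG (e+1) m) : ‖gradNormSq L‖ₑ ≤ ENNReal.ofReal ((e+1:ℕ)*m) * ‖L‖ₑ^2 := by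
  have h0 : 0 ≤ gradNormSq L := by unfold gradNormSq; positivity
  rw [Real.enorm_eq_ofReal h0]
  refine (ENNReal.ofReal_le_ofReal (gn_le L)).trans ?_
  rw [ENNReal.ofReal_mul (by positivity), ENNReal.ofReal_pow (norm_nonneg _), ofReal_norm]

lemma gn_cont : Continuous (fun L : GG (e+1) m => gradNormSq L) := by
  unfold gradNormSq gradEntry; fun_prop

lemma Fl.energy (S : Fl C₀ M ψ r u G) : IntegrableOn (gradSq u) (graphD e M ψ (4*r)) := by
  have hk := kap_pos S.hC S.hM
  have hr := S.hr
  have hC := S.hC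
  have hM := S.hM
  have hgc : ContinuousOn (gradSq u) (graphD e M ψ (8*r)) := gn_cont.comp_continuousOn S.fc
  set s0 := 2*r/(C₀ + kap C₀ M) with hs0
  have hs0p : 0 < s0 := by positivity
  have hs0e : (C₀ + kap C₀ M) * s0 = 2*r := by rw [hs0]; field_simp
  have hs0l : s0 < 9*r := by nlinarith
  have hψc := S.hψ.continuous
  set q := 10 * Real.sqrt (e+1) * (M+1) with hq
  have hqp : 0 < q := by positivity
  have h1 : Continuous (projLast e) := (continuous_fst.comp (io e).symm.continuous)
  have h2 : Continuous (fun X : ℰ e => X (Fin.last e)) := (continuous_snd.comp (io e).symm.continuous)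
  set P2 : Set ℰ e := St ψ '' (closedBall 0 (4*r) ×ˢ Icc s0 (q*(4*r) + M*(4*r))) ∩ {X | X (Fin.last e) ≤ q*(4*r)} with hP2
  have hP2c : IsCompact P2 := (((isCompact_closedBall _ _).prod isCompact_Icc).image (St_cont hψc)).inter_right (isClosed_le h2 continuous_const)
  have hP2s : P2 ⊆ graphD e M ψ (8*r) := by
    rintro _ ⟨⟨⟨x,s⟩, ⟨hx, hs⟩, rfl⟩, hl⟩
    have hx' : ‖x‖ ≤ 4*r := by simpa using hx
    have hs' : s0 ≤ s := hs.1
    refine ⟨by rw [proj_St]; simp only; linarith, by rw [proj_St, last_St]; simp only; linarith, ?_⟩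
    have : St ψ (x,s) (Fin.last e) ≤ q*(4*r) := hl
    rw [← hq]
    nlinarith
  set P1 : Set ℰ e := Si ψ ⁻¹' (ball 0 (4*r) ×ˢ Ioo 0 s0) with hP1
  have hpre : St ψ ⁻¹' P1 = ball 0 (4*r) ×ˢ Ioo 0 s0 := by ext z; simp [hP1, Si_St]
  have hcov : graphD e M ψ (4*r) ⊆ P1 ∪ P2 := by
    rintro X ⟨a1, a2, a3⟩
    by_cases h : X (Fin.last e) - ψ (projLast e X) < s0
    · left
      exact ⟨by simpa [Si] using a1, by simpa [Si] using a2, h⟩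
    · right
      push Not at h
      have hb := S.hψ.dist_le_mul (projLast e X) 0
      rw [Real.coe_toNNReal _ hM, Real.dist_eq, S.h0, dist_zero_right, sub_zero] at hb
      have hb2 := neg_abs_le (ψ (projLast e X))
      have hb3 : M * ‖projLast e X‖ ≤ M * (4*r) := by gcongr
      exact ⟨⟨Si ψ X, ⟨by simpa [Si] using a1.le, h, by simp only [Si]; rw [← hq] at a3; linarith⟩, St_Si ψ X⟩, a3.le⟩
  refine IntegrableOn.mono_set ?_ hcov
  refine IntegrableOn.union ?_ ((hgc.mono hP2s).integrableOn_compact hP2c)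
  rw [← (St_mp hψc).integrableOn_comp_preimage (St_me hψc), hpre]
  have hmap : MapsTo (St ψ) (ball 0 (4*r) ×ˢ Ioo 0 s0) (graphD e M ψ (8*r)) := by
    rintro ⟨x,s⟩ ⟨hx, hs⟩
    have hx' : ‖x‖ < 4*r := by simpa using hx
    exact St_mem hM S.hψ S.h0 (by linarith) hs.1 (by linarith [hs.2])
  have hms : MeasurableSet ((ℬ e (4*r)) ×ˢ Ioo 0 s0) := measurableSet_ball.prod measurableSet_Ioo
  have hgs : AEStronglyMeasurable (gradSq u ∘ St ψ) (volume.restrict (ℬ e (4*r) ×ˢ Ioo 0 s0)) :=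
    (hgc.comp (St_cont hψc).continuousOn hmap).aestronglyMeasurable hms
  refine ⟨hgs, ?_⟩
  unfold HasFiniteIntegral
  rw [Measure.volume_eq_prod, ← Measure.prod_restrict, lintegral_prod_symm _ (by rw [Measure.prod_restrict]; exact hgs.enorm)]
  set Q := ENNReal.ofReal ((e+1:ℕ)*m) * (kav e C₀ M * ∫⁻ z in ℬ e (6*r), NN C₀ M ψ r u z ^ 2) with hQ
  have hQf : Q ≠ ∞ := ENNReal.mul_ne_top ENNReal.ofReal_ne_top (ENNReal.mul_ne_top ENNReal.ofReal_ne_top S.hN)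
  calc _ ≤ ∫⁻ s in Ioo 0 s0, Q := by
        refine setLIntegral_mono measurable_const fun s hs => ?_
        have h3 := S.slice hs.1 (by nlinarith [hs.2] : (C₀ + kap C₀ M) * s ≤ 2*r)
        calc _ ≤ ∫⁻ x in ℬ e (4*r), ENNReal.ofReal ((e+1:ℕ)*m) * ‖fderiv ℝ u (St ψ (x,s))‖ₑ^2 :=
              lintegral_mono fun x => gs_le _
          _ = ENNReal.ofReal ((e+1:ℕ)*m) * ∫⁻ x in ℬ e (4*r), ‖fderiv ℝ u (St ψ (x,s))‖ₑ^2 :=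
              lintegral_const_mul' _ _ ENNReal.ofReal_ne_top
          _ ≤ _ := by rw [hQ]; gcongr
    _ < ∞ := by
      rw [lintegral_const]
      refine ENNReal.mul_lt_top hQf.lt_top ?_
      simp

end fl
end

section
variable {e m : ℕ}

section fl
variable {C₀ M r : ℝ} {ψ : EE e → ℝ} {u : ℰ e → YY m} {G : ℰ e → GG (e+1) m}

def tn (C₀ M r : ℝ) (n : ℕ) : ℝ := r/(C₀+kap C₀ M)/(n+1)

lemma Fl.tn_pos (S : Fl C₀ M ψ r u G) (n : ℕ) : 0 < tn C₀ M r n := by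
  have := kap_pos S.hC S.hM
  have := S.hr
  have := S.hC
  unfold tn; positivity
lemma Fl.tn_le (S : Fl C₀ M ψ r u G) (n : ℕ) : (C₀+kap C₀ M)*tn C₀ M r n ≤ r := by
  have h1 := kap_pos S.hC S.hM
  have h2 := S.hr
  have h3 := S.hC
  unfold tn
  rw [div_div, mul_div_assoc', div_le_iff₀ (by positivity)]
  have : 0 ≤ (C₀+kap C₀ M) * r * n := by positivity
  linarith
lemma Fl.tn_lt (S : Fl C₀ M ψ r u G) (n : ℕ) : tn C₀ M r n < r := by
  have h1 := kap_pos S.hC S.hM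
  have h3 := S.hC
  have h4 := S.tn_pos n
  have h5 := S.tn_le n
  nlinarith
lemma Fl.tn_lim (S : Fl C₀ M ψ r u G) : Tendsto (tn C₀ M r) atTop (𝓝[>] 0) := by
  refine tendsto_nhdsWithin_iff.2 ⟨?_, Eventually.of_forall S.tn_pos⟩
  unfold tn
  have := (tendsto_one_div_add_atTop_nhds_zero_nat (𝕜 := ℝ)).const_mul (r/(C₀+kap C₀ M))
  simp only [mul_zero, mul_one_div] at this
  exact this

def gI {F : Type*} (Ψ : (EE e →L[ℝ] ℝ) × ℰ e × GG (e+1) m → F) (ψ : EE e → ℝ) (f : ℰ e → GG (e+1) m) (s : ℝ) (x : EE e) : F :=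
  Ψ (fderiv ℝ ψ x, St ψ (x,s), f (St ψ (x,s)))

variable {F : Type*} [NormedAddCommGroup F] {Ψ : (EE e →L[ℝ] ℝ) × ℰ e × GG (e+1) m → F}

lemma Fl.g_meas (S : Fl C₀ M ψ r u G) : AEStronglyMeasurable (fun x => G (St ψ (x,0))) (volume.restrict (ℬ e (4*r))) := by
  refine aestronglyMeasurable_of_tendsto_ae (u := atTop) (f := fun n x => fderiv ℝ u (St ψ (x, tn C₀ M r n))) ?_ ?_
  · intro n
    have hr := S.hr
    refine ((S.slc (S.tn_pos n) (by linarith [S.tn_lt n])).mono (ball_subset_ball (by linarith))).aestronglyMeasurable measurableSet_ball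
  · filter_upwards [ae_restrict_of_ae S.conv, ae_restrict_mem measurableSet_ball] with x hx hx2
    have hr := S.hr
    exact (hx (ball_subset_ball (by linarith) hx2)).comp S.tn_lim

lemma Fl.gen_meas (S : Fl C₀ M ψ r u G) (hΨ : Continuous Ψ) {s : ℝ} {f : ℰ e → GG (e+1) m}
    (hf : AEStronglyMeasurable (fun x => f (St ψ (x,s))) (volume.restrict (ℬ e (4*r)))) :
    AEStronglyMeasurable (gI Ψ ψ f s) (volume.restrict (ℬ e (4*r))) := by
  refine hΨ.comp_aestronglyMeasurable (AEStronglyMeasurable.prodMk ?_ (AEStronglyMeasurable.prodMk ?_ hf))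
  · exact (measurable_fderiv ℝ ψ).aestronglyMeasurable
  · exact ((St_cont S.hψ.continuous).comp (by fun_prop : Continuous fun x : EE e => (x,s))).aestronglyMeasurable

lemma Fl.gen_meas' (S : Fl C₀ M ψ r u G) (hΨ : Continuous Ψ) (n : ℕ) :
    AEStronglyMeasurable (gI Ψ ψ (fderiv ℝ u) (tn C₀ M r n)) (volume.restrict (ℬ e (4*r))) := by
  refine S.gen_meas hΨ ?_
  have hr := S.hr
  exact ((S.slc (S.tn_pos n) (by linarith [S.tn_lt n])).mono (ball_subset_ball (by linarith))).aestronglyMeasurable measurableSet_ball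

lemma Fl.gen_lim (S : Fl C₀ M ψ r u G) (hΨ : Continuous Ψ) : ∀ᵐ x : EE e, x ∈ ℬ e (4*r) →
    Tendsto (fun n => ‖gI Ψ ψ (fderiv ℝ u) (tn C₀ M r n) x‖ₑ^2) atTop (𝓝 (‖gI Ψ ψ G 0 x‖ₑ^2)) := by
  filter_upwards [S.conv] with x hx hx2
  have hr := S.hr
  have h1 := (hx (ball_subset_ball (by linarith) hx2)).comp S.tn_lim
  have h2 : Tendsto (fun n => St ψ (x, tn C₀ M r n)) atTop (𝓝 (St ψ (x,0))) := by
    have h3 : Continuous (fun s : ℝ => St ψ (x,s)) := (St_cont S.hψ.continuous).comp (by fun_prop)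
    exact (h3.tendsto 0).comp (S.tn_lim.mono_right nhdsWithin_le_nhds)
  have h4 : Tendsto (fun n => gI Ψ ψ (fderiv ℝ u) (tn C₀ M r n) x) atTop (𝓝 (gI Ψ ψ G 0 x)) :=
    (hΨ.tendsto _).comp (tendsto_const_nhds.prodMk_nhds (h2.prodMk_nhds h1))
  exact (ENNReal.continuous_pow 2).tendsto _ |>.comp h4.enorm

lemma Fl.gen_bd (S : Fl C₀ M ψ r u G) {K : ℝ} (hK : 0 ≤ K) (hb : ∀ l X L, ‖l‖ ≤ M → ‖Ψ (l,X,L)‖ ≤ K * ‖L‖) (f : ℰ e → GG (e+1) m) (s : ℝ) (x : EE e) :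
    ‖gI Ψ ψ f s x‖ₑ^2 ≤ ENNReal.ofReal (K^2) * ‖f (St ψ (x,s))‖ₑ^2 := by
  have h1 := hb (fderiv ℝ ψ x) (St ψ (x,s)) (f (St ψ (x,s))) (fd_bd S.hM S.hψ x)
  have h2 := ENNReal.ofReal_le_ofReal h1
  rw [ENNReal.ofReal_mul hK, ofReal_norm, ofReal_norm] at h2
  rw [ENNReal.ofReal_pow hK, ← mul_pow]
  exact pow_le_pow_left' h2 2

lemma Fl.gen_fin (S : Fl C₀ M ψ r u G) {K : ℝ} (hK : 0 ≤ K) (hb : ∀ l X L, ‖l‖ ≤ M → ‖Ψ (l,X,L)‖ ≤ K * ‖L‖) (n : ℕ) :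
    ∫⁻ x in ℬ e (4*r), ‖gI Ψ ψ (fderiv ℝ u) (tn C₀ M r n) x‖ₑ^2 ≤ ENNReal.ofReal (K^2) * (kav e C₀ M * ∫⁻ z in ℬ e (6*r), NN C₀ M ψ r u z ^ 2) := by
  have hr := S.hr
  calc _ ≤ ∫⁻ x in ℬ e (4*r), ENNReal.ofReal (K^2) * ‖fderiv ℝ u (St ψ (x, tn C₀ M r n))‖ₑ^2 :=
        lintegral_mono fun x => S.gen_bd hK hb _ _ x
    _ = ENNReal.ofReal (K^2) * ∫⁻ x in ℬ e (4*r), ‖fderiv ℝ u (St ψ (x, tn C₀ M r n))‖ₑ^2 := lintegral_const_mul' _ _ ENNReal.ofReal_ne_top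
    _ ≤ _ := by
      have := S.slice (S.tn_pos n) (by linarith [S.tn_le n])
      gcongr

lemma Fl.rhs_fin (S : Fl C₀ M ψ r u G) (K : ℝ) : ENNReal.ofReal (K^2) * (kav e C₀ M * ∫⁻ z in ℬ e (6*r), NN C₀ M ψ r u z ^ 2) ≠ ∞ :=
  ENNReal.mul_ne_top ENNReal.ofReal_ne_top (ENNReal.mul_ne_top ENNReal.ofReal_ne_top S.hN)

lemma Fl.gen_int (S : Fl C₀ M ψ r u G) (hΨ : Continuous Ψ) {K : ℝ} (hK : 0 ≤ K) (hb : ∀ l X L, ‖l‖ ≤ M → ‖Ψ (l,X,L)‖ ≤ K * ‖L‖) (n : ℕ) :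
    IntegrableOn (fun x => ‖gI Ψ ψ (fderiv ℝ u) (tn C₀ M r n) x‖^2) (ℬ e (4*r)) := by
  refine ⟨((S.gen_meas' hΨ n).norm.pow 2), ?_⟩
  unfold HasFiniteIntegral
  refine lt_of_le_of_lt ?_ ((S.gen_fin hK hb n).trans_lt (S.rhs_fin K).lt_top)
  refine lintegral_mono fun x => ?_
  simp

lemma Fl.g_fin (S : Fl C₀ M ψ r u G) : ∫⁻ x in ℬ e (4*r), ‖G (St ψ (x,0))‖ₑ^2 ≠ ∞ := by
  have hΨ : Continuous (fun q : (EE e →L[ℝ] ℝ) × ℰ e × GG (e+1) m => q.2.2) := by fun_prop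
  have hb : ∀ (l : EE e →L[ℝ] ℝ) (X : ℰ e) (L : GG (e+1) m), ‖l‖ ≤ M → ‖(fun q : (EE e →L[ℝ] ℝ) × ℰ e × GG (e+1) m => q.2.2) (l,X,L)‖ ≤ 1 * ‖L‖ := fun l X L _ => by simp
  have h1 : ∫⁻ x in ℬ e (4*r), ‖G (St ψ (x,0))‖ₑ^2 ≤ liminf (fun n => ∫⁻ x in ℬ e (4*r), ‖gI (fun q : (EE e →L[ℝ] ℝ) × ℰ e × GG (e+1) m => q.2.2) ψ (fderiv ℝ u) (tn C₀ M r n) x‖ₑ^2) atTop := by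
    calc _ = ∫⁻ x in ℬ e (4*r), liminf (fun n => ‖gI (fun q : (EE e →L[ℝ] ℝ) × ℰ e × GG (e+1) m => q.2.2) ψ (fderiv ℝ u) (tn C₀ M r n) x‖ₑ^2) atTop := by
          refine lintegral_congr_ae ?_
          filter_upwards [ae_restrict_of_ae (S.gen_lim hΨ), ae_restrict_mem measurableSet_ball] with x hx hx2
          exact ((hx hx2).liminf_eq).symm
      _ ≤ _ := lintegral_liminf_le' fun n => (S.gen_meas' hΨ n).enorm.pow_const 2
  refine ne_top_of_le_ne_top (S.rhs_fin 1) (h1.trans ?_)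
  refine liminf_le_of_le (by isBoundedDefault) fun b hb' => ?_
  obtain ⟨n, hn⟩ := hb'.exists
  exact hn.trans (S.gen_fin zero_le_one hb n)

lemma sq_conv {F : Type*} [NormedAddCommGroup F] (a : EE e → F) (s : Set (EE e)) (h : IntegrableOn (fun x => ‖a x‖^2) s) :
    ∫⁻ x in s, ‖a x‖ₑ^2 = ENNReal.ofReal (∫ x in s, ‖a x‖^2) := by
  rw [ofReal_integral_eq_lintegral_ofReal h (Eventually.of_forall fun x => by positivity)]
  refine lintegral_congr fun x => ?_
  rw [ENNReal.ofReal_pow (norm_nonneg _), ofReal_norm]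

lemma Fl.pass (S : Fl C₀ M ψ r u G) {F' : Type*} [NormedAddCommGroup F'] {Φ : (EE e →L[ℝ] ℝ) × ℰ e × GG (e+1) m → F'}
    (hΦ : Continuous Φ) {K' : ℝ} (hK' : 0 ≤ K') (hb' : ∀ l X L, ‖l‖ ≤ M → ‖Φ (l,X,L)‖ ≤ K' * ‖L‖)
    (hΨ : Continuous Ψ) {K : ℝ} (hK : 0 ≤ K) (hb : ∀ l X L, ‖l‖ ≤ M → ‖Ψ (l,X,L)‖ ≤ K * ‖L‖) {C E : ℝ} (hC : 0 < C) (hE : 0 ≤ E)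
    (H : ∀ ε, 0 < ε → ε < r → (∫ x in ℬ e r, ‖gI Φ ψ (fderiv ℝ u) ε x‖^2) ≤ C * (∫ x in ℬ e (4*r), ‖gI Ψ ψ (fderiv ℝ u) ε x‖^2) + E) :
    ∫⁻ x in ℬ e r, ‖gI Φ ψ G 0 x‖ₑ^2 ≤ ENNReal.ofReal C * (∫⁻ x in ℬ e (4*r), ‖gI Ψ ψ G 0 x‖ₑ^2) + ENNReal.ofReal E := by
  have hr := S.hr
  have hsub : ℬ e r ⊆ ball 0 (4*r) := ball_subset_ball (by linarith)
  have hn : ∀ n, ∫⁻ x in ℬ e r, ‖gI Φ ψ (fderiv ℝ u) (tn C₀ M r n) x‖ₑ^2 ≤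
      ENNReal.ofReal C * (∫⁻ x in ℬ e (4*r), ‖gI Ψ ψ (fderiv ℝ u) (tn C₀ M r n) x‖ₑ^2) + ENNReal.ofReal E := by
    intro n
    have e1 := sq_conv (gI Ψ ψ (fderiv ℝ u) (tn C₀ M r n)) (ℬ e (4*r)) (S.gen_int hΨ hK hb n)
    have e2 := sq_conv (gI Φ ψ (fderiv ℝ u) (tn C₀ M r n)) (ℬ e r) ((S.gen_int hΦ hK' hb' n).mono_set hsub)
    have p1 : 0 ≤ ∫ x in ℬ e (4*r), ‖gI Ψ ψ (fderiv ℝ u) (tn C₀ M r n) x‖^2 := integral_nonneg fun x => by positivity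
    rw [e1, e2, ← ENNReal.ofReal_mul hC.le, ← ENNReal.ofReal_add (mul_nonneg hC.le p1) hE]
    exact ENNReal.ofReal_le_ofReal (H _ (S.tn_pos n) (S.tn_lt n))
  have h1 : ∫⁻ x in ℬ e r, ‖gI Φ ψ G 0 x‖ₑ^2 ≤ liminf (fun n => ∫⁻ x in ℬ e r, ‖gI Φ ψ (fderiv ℝ u) (tn C₀ M r n) x‖ₑ^2) atTop := by
    calc _ = ∫⁻ x in ℬ e r, liminf (fun n => ‖gI Φ ψ (fderiv ℝ u) (tn C₀ M r n) x‖ₑ^2) atTop := by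
          refine lintegral_congr_ae ?_
          filter_upwards [ae_restrict_of_ae (S.gen_lim hΦ), ae_restrict_mem measurableSet_ball] with x hx hx2
          exact ((hx (hsub hx2)).liminf_eq).symm
      _ ≤ _ := lintegral_liminf_le' fun n => ((S.gen_meas' hΦ n).enorm.pow_const 2).mono_measure (Measure.restrict_mono hsub le_rfl)
  refine ENNReal.le_of_forall_pos_le_add fun η hη _ => ?_
  have hη' : (0:ℝ≥0∞) < (ENNReal.ofReal C)⁻¹ * η := by
    refine ENNReal.mul_pos ?_ (by simpa using hη.ne')
    simp
  have h2 := ui_limit (f := fun n x => fderiv ℝ u (St ψ (x, tn C₀ M r n))) S.Nm (a := 4*r) (b := 6*r) (C₀ := C₀) (κ := kap C₀ M) (t := tn C₀ M r)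
    (by linarith [S.hC]) (kap_pos S.hC S.hM) S.tn_pos (fun n => by linarith [S.tn_le n]) S.hN (by
      intro n x hx
      obtain ⟨y, h1, h2⟩ := S.cone (ball_subset_ball (by linarith) hx) (S.tn_pos n) (by linarith [S.tn_lt n])
      exact ⟨y, h1, fun z hz => Fl.le_N (u := u) (h2 z hz)⟩)
    (h := fun n x => ‖gI Ψ ψ (fderiv ℝ u) (tn C₀ M r n) x‖ₑ^2) (h0 := fun x => ‖gI Ψ ψ G 0 x‖ₑ^2) (K := ENNReal.ofReal (K^2)) ENNReal.ofReal_ne_top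
    (fun n => (S.gen_meas' hΨ n).enorm.pow_const 2) (fun n x _ => S.gen_bd hK hb _ _ x) (S.gen_lim hΨ) hη'
  refine h1.trans ?_
  refine liminf_le_of_le (by isBoundedDefault) fun b hbb => ?_
  obtain ⟨n, h3, h4⟩ := (hbb.and h2).exists
  calc b ≤ _ := h3
    _ ≤ _ := hn n
    _ ≤ ENNReal.ofReal C * ((∫⁻ x in ℬ e (4*r), ‖gI Ψ ψ G 0 x‖ₑ^2) + (ENNReal.ofReal C)⁻¹ * η) + ENNReal.ofReal E := by gcongr
    _ = _ := by
      rw [mul_add, ← mul_assoc, ENNReal.mul_inv_cancel (by simpa using hC) ENNReal.ofReal_ne_top, one_mul]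
      ring

end fl
end

section
variable {e m : ℕ}

def Pp (q : (EE e →L[ℝ] ℝ) × ℰ e × GG (e+1) m) : (EE e × ℝ) →L[ℝ] YY m := q.2.2.comp (Sd q.1)
def Pn (A : Coeff (e+1) m) (q : (EE e →L[ℝ] ℝ) × ℰ e × GG (e+1) m) : YY m →L[ℝ] ℝ :=
  (pull (Rd q.1) (Ab A q.2.1) (Pp q)).comp (dtL (EE e) (YY m))
def Pt (q : (EE e →L[ℝ] ℝ) × ℰ e × GG (e+1) m) : (EE e × ℝ) →L[ℝ] YY m := (Pp q).comp (tanP (EE e))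

lemma Pp_cont : Continuous (Pp (e := e) (m := m)) := by
  have h1 : Continuous (fun q : (EE e →L[ℝ] ℝ) × ℰ e × GG (e+1) m => Sd q.1) := Sd_cont.comp continuous_fst
  have h2 : Continuous (fun q : (EE e →L[ℝ] ℝ) × ℰ e × GG (e+1) m => q.2.2) := by fun_prop
  exact h2.clm_comp h1

lemma Pt_cont : Continuous (Pt (e := e) (m := m)) := Pp_cont.clm_comp continuous_const

lemma Pn_cont {A : Coeff (e + 1) m} (hA2 : ∀ i j α β, ContDiff ℝ 2 (fun Z => A Z i j α β)) : Continuous (Pn A) := by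
  have h1 : Continuous (fun q : (EE e →L[ℝ] ℝ) × ℰ e × GG (e+1) m => pull (Rd q.1) (Ab A q.2.1)) :=
    (Bf_cont hA2).comp (f := fun q : (EE e →L[ℝ] ℝ) × ℰ e × GG (e+1) m => (q.1, q.2.1)) (by fun_prop)
  exact (h1.clm_apply Pp_cont).clm_comp continuous_const

lemma Pp_bd {M : ℝ} (hM : 0 ≤ M) (l : EE e →L[ℝ] ℝ) (X : ℰ e) (L : GG (e+1) m) (hl : ‖l‖ ≤ M) : ‖Pp (l,X,L)‖ ≤ (2+M) * ‖L‖ := by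
  calc _ ≤ ‖L‖ * ‖Sd l‖ := ContinuousLinearMap.opNorm_comp_le _ _
    _ ≤ ‖L‖ * (2+M) := by gcongr; exact Sd_norm hM hl
    _ = _ := by ring

lemma Pt_bd {M : ℝ} (hM : 0 ≤ M) (l : EE e →L[ℝ] ℝ) (X : ℰ e) (L : GG (e+1) m) (hl : ‖l‖ ≤ M) : ‖Pt (l,X,L)‖ ≤ ((2+M) * ‖tanP (EE e)‖) * ‖L‖ := by
  calc _ ≤ ‖Pp (l,X,L)‖ * ‖tanP (EE e)‖ := ContinuousLinearMap.opNorm_comp_le _ _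
    _ ≤ ((2+M) * ‖L‖) * ‖tanP (EE e)‖ := by gcongr; exact Pp_bd hM l X L hl
    _ = _ := by ring

lemma Pn_bd {μ M : ℝ} (hμ : 0 < μ) (hM : 0 ≤ M) {A : Coeff (e + 1) m} (hA : IsElliptic μ A) (hs : IsSymmCoeff A)
    (l : EE e →L[ℝ] ℝ) (X : ℰ e) (L : GG (e+1) m) (hl : ‖l‖ ≤ M) :
    ‖Pn A (l,X,L)‖ ≤ ((μ⁻¹*((e+1:ℕ)*m))*(1+M)^2*(2+M) * ‖dtL (EE e) (YY m)‖) * ‖L‖ := by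
  have h1 : ‖pull (Rd l) (Ab A X)‖ ≤ (μ⁻¹*((e+1:ℕ)*m))*(1+M)^2 := (pull_R hM hl _).trans (by
    gcongr; exact Ab_upper hμ hA hs X)
  have h2 : ‖pull (Rd l) (Ab A X) (Pp (l,X,L))‖ ≤ ((μ⁻¹*((e+1:ℕ)*m))*(1+M)^2) * ((2+M) * ‖L‖) :=
    (ContinuousLinearMap.le_opNorm _ _).trans (mul_le_mul h1 (Pp_bd hM l X L hl) (norm_nonneg _) ((norm_nonneg _).trans h1))
  calc _ ≤ ‖pull (Rd l) (Ab A X) (Pp (l,X,L))‖ * ‖dtL (EE e) (YY m)‖ := ContinuousLinearMap.opNorm_comp_le _ _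
    _ ≤ (((μ⁻¹*((e+1:ℕ)*m))*(1+M)^2) * ((2+M) * ‖L‖)) * ‖dtL (EE e) (YY m)‖ := mul_le_mul_of_nonneg_right h2 (norm_nonneg _)
    _ = _ := by ring

lemma gs_nn (u : ℰ e → YY m) (X) : 0 ≤ gradSq u X := by unfold gradSq; positivity

lemma core_lim (hm : 1 ≤ m) {μ lam τ M : ℝ} (hμ : 0 < μ) (hlam : lam ∈ Set.Ioo (0 : ℝ) 1) (hτ : 0 ≤ τ) (hM : 0 ≤ M) :
    ∃ C, 0 < C ∧ ∀ ψ : EE e → ℝ, ∀ A : Coeff (e + 1) m, MemLambdaClass μ lam τ A → IsSymmCoeff A →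
    (∀ i j α β, ContDiff ℝ 2 (fun Z => A Z i j α β)) → ∀ (C₀ r : ℝ) (u : ℰ e → YY m) (G : ℰ e → GG (e+1) m), Fl C₀ M ψ r u G →
    IsWeakSolution A (graphD e M ψ (8 * r)) u →
    (∫⁻ x in ℬ e r, ‖gI Pp ψ G 0 x‖ₑ^2 ≤ ENNReal.ofReal C * (∫⁻ x in ℬ e (4*r), ‖gI (Pn A) ψ G 0 x‖ₑ^2) + ENNReal.ofReal (C/r * ∫ X in graphD e M ψ (4*r), gradSq u X)) ∧
    (∫⁻ x in ℬ e r, ‖gI Pp ψ G 0 x‖ₑ^2 ≤ ENNReal.ofReal C * (∫⁻ x in ℬ e (4*r), ‖gI Pt ψ G 0 x‖ₑ^2) + ENNReal.ofReal (C/r * ∫ X in graphD e M ψ (4*r), gradSq u X)) := by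
  obtain ⟨C, hC, H⟩ := core_eps (e := e) hm hμ hlam hτ hM
  refine ⟨C, hC, ?_⟩
  intro ψ A hA hs hA2 C₀ r u G S hw
  have hr := S.hr
  have HH := H ψ S.hψ S.h0 A hA hs hA2 r hr u S.hu hw S.energy
  have hE : 0 ≤ C/r * ∫ X in graphD e M ψ (4*r), gradSq u X := mul_nonneg (by positivity) (integral_nonneg fun X => gs_nn u X)
  constructor
  · exact S.pass Pp_cont (by positivity) (Pp_bd hM) (Pn_cont hA2) (by positivity) (Pn_bd hμ hM hA.1 hs) hC hE (fun ε h1 h2 => (HH ε h1 h2).1)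
  · exact S.pass Pp_cont (by positivity) (Pp_bd hM) Pt_cont (by positivity) (Pt_bd hM) hC hE (fun ε h1 h2 => (HH ε h1 h2).2)

end

section
variable {e m : ℕ}

lemma Sh_emb {ψ : EE e → ℝ} (hψ : Continuous ψ) (s : ℝ) : Topology.IsClosedEmbedding (fun x : EE e => St ψ (x,s)) := by
  refine Function.LeftInverse.isClosedEmbedding (f := fun X : ℰ e => projLast e X) (fun x => by simp [proj_St]) ?_ ?_
  · exact continuous_fst.comp (io e).symm.continuous
  · exact (St_cont hψ).comp (by fun_prop)

section gg
variable {ψ : EE e → ℝ} {M : ℝ} {f : ℰ e → ℝ}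

lemma gg_x (hM : 0 ≤ M) (hψ : LipschitzWith M.toNNReal ψ) (hf : ContDiff ℝ 1 f) (hc : HasCompactSupport f) (a : EE e) (s : ℝ) :
    ∫ x : EE e, fderiv ℝ f (St ψ (x,s)) (io e (a, fderiv ℝ ψ x a)) = 0 := by
  obtain ⟨K, hK⟩ := hf.lipschitzWith_of_hasCompactSupport hc one_ne_zero
  have hl : LipschitzWith (K * ((2+M).toNNReal * 1)) (fun x : EE e => f (St ψ (x,s))) := hK.comp ((St_lip hM hψ).comp (LipschitzWith.prodMk_right s))
  have hcs : HasCompactSupport (fun x : EE e => f (St ψ (x,s))) := hc.comp_isClosedEmbedding (Sh_emb hψ.continuous s)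
  have h1 := (LipschitzWith.const (α := EE e) (1:ℝ)).integral_lineDeriv_mul_eq (μ := volume) hl hcs (-a)
  simp only [neg_neg, mul_one] at h1
  have h2 : ∫ x : EE e, lineDeriv ℝ (fun x : EE e => f (St ψ (x,s))) x a = 0 := by
    rw [← h1]
    simp [lineDeriv]
  rw [← h2]
  refine integral_congr_ae ?_
  filter_upwards [hψ.ae_differentiableAt (μ := volume)] with x hx
  have h3 : HasFDerivAt (fun x : EE e => f (St ψ (x,s))) ((fderiv ℝ f (St ψ (x,s))).comp ((Sd (fderiv ℝ ψ x)).comp (ContinuousLinearMap.inl ℝ (EE e) ℝ))) x := by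
    have h4 : HasFDerivAt (fun x : EE e => (x,s)) (ContinuousLinearMap.inl ℝ (EE e) ℝ) x := hasFDerivAt_prodMk_left x s
    have h5 : HasFDerivAt (fun x : EE e => St ψ (x,s)) ((Sd (fderiv ℝ ψ x)).comp (ContinuousLinearMap.inl ℝ (EE e) ℝ)) x := HasFDerivAt.comp (g := St ψ) (f := fun x : EE e => (x,s)) x (St_der hx s) h4
    exact ((hf.differentiable one_ne_zero _).hasFDerivAt).comp x h5
  rw [h3.hasLineDerivAt a |>.lineDeriv]
  simp [Sd_apply]

lemma gg_s (hψ : Continuous ψ) (hf : ContDiff ℝ 1 f) (hc : HasCompactSupport f) (x : EE e) :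
    ∫ s in Ioi (0:ℝ), fderiv ℝ f (St ψ (x,s)) (io e (0,1)) = - f (St ψ (x,0)) := by
  have hd : ∀ s : ℝ, HasDerivAt (fun s : ℝ => St ψ (x,s)) (io e (0,1)) s := by
    intro s
    have h1 : HasDerivAt (fun s : ℝ => ((x, ψ x + s) : EE e × ℝ)) (0,1) s := (hasDerivAt_const s x).prodMk ((hasDerivAt_id s).const_add (ψ x))
    exact (io e).toContinuousLinearMap.hasFDerivAt.comp_hasDerivAt s h1
  have hcd : ContDiff ℝ 1 (fun s : ℝ => f (St ψ (x,s))) := by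
    refine hf.comp ?_
    have h1 : ContDiff ℝ 1 (fun s : ℝ => ((x, ψ x + s) : EE e × ℝ)) := contDiff_const.prodMk (contDiff_const.add contDiff_id)
    exact (io e).contDiff.comp h1
  have hcs : HasCompactSupport (fun s : ℝ => f (St ψ (x,s))) := by
    refine hc.comp_isClosedEmbedding (g := fun s : ℝ => St ψ (x,s)) ?_
    refine Function.LeftInverse.isClosedEmbedding (f := fun X : ℰ e => (Si ψ X).2) (fun s => by simp [Si_St]) ?_ ((St_cont hψ).comp (by fun_prop))
    have h1 : Continuous (fun X : ℰ e => projLast e X) := continuous_fst.comp (io e).symm.continuous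
    have h2 : Continuous (fun X : ℰ e => X (Fin.last e)) := by fun_prop
    exact h2.sub (hψ.comp h1)
  rw [← hcs.integral_Ioi_deriv_eq hcd 0]
  refine setIntegral_congr_fun measurableSet_Ioi fun s _ => ?_
  exact (((hf.differentiable one_ne_zero _).hasFDerivAt).comp_hasDerivAt s (hd s)).deriv.symm

lemma gg_int (hψ : Continuous ψ) (hf : ContDiff ℝ 1 f) (hc : HasCompactSupport f) (v : ℰ e) :
    Integrable (fun z : EE e × ℝ => fderiv ℝ f (St ψ z) v) := by
  have h1 : Continuous (fun z : EE e × ℝ => fderiv ℝ f (St ψ z) v) := ((hf.continuous_fderiv one_ne_zero).comp (St_cont hψ)).clm_apply continuous_const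
  refine h1.integrable_of_hasCompactSupport ?_
  have h2 : HasCompactSupport (fun X => fderiv ℝ f X v) := hc.fderiv_apply (𝕜 := ℝ) v
  exact h2.comp_homeomorph (Sth ψ hψ)

lemma gg (hM : 0 ≤ M) (hψ : LipschitzWith M.toNNReal ψ) (hf : ContDiff ℝ 1 f) (hc : HasCompactSupport f) (a : EE e) (b : ℝ) :
    ∫ X in graphDomain e ψ, fderiv ℝ f X (io e (a,b)) = ∫ x : EE e, f (St ψ (x,0)) * (fderiv ℝ ψ x a - b) := by
  have hψc := hψ.continuous
  rw [← (St_mp hψc).setIntegral_preimage_emb (St_me hψc)]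
  have hpre : St ψ ⁻¹' (graphDomain e ψ) = univ ×ˢ Ioi (0:ℝ) := by
    ext z; simp [graphDomain, proj_St, last_St]
  rw [hpre]
  set c : EE e → ℝ := fun x => b - fderiv ℝ ψ x a with hcd
  have cm : Measurable c := measurable_const.sub (measurable_fderiv_apply_const ℝ ψ a)
  have i1 := gg_int hψc hf hc (io e (a,b))
  have i2 : Integrable (fun z : EE e × ℝ => c z.1 * fderiv ℝ f (St ψ z) (io e (0,1))) := by
    refine (gg_int hψc hf hc (io e (0,1))).bdd_mul (c := |b| + M*‖a‖) (cm.comp measurable_fst).aestronglyMeasurable (Eventually.of_forall fun z => ?_)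
    rw [hcd, Real.norm_eq_abs]
    refine (abs_sub _ _).trans ?_
    have h3 : ‖fderiv ℝ ψ z.1 a‖ ≤ M*‖a‖ := (ContinuousLinearMap.le_opNorm _ _).trans (mul_le_mul_of_nonneg_right (fd_bd hM hψ _) (norm_nonneg _))
    rw [Real.norm_eq_abs] at h3
    linarith
  have hsp : ∀ z : EE e × ℝ, fderiv ℝ f (St ψ z) (io e (a,b)) = fderiv ℝ f (St ψ z) (io e (a, fderiv ℝ ψ z.1 a)) + c z.1 * fderiv ℝ f (St ψ z) (io e (0,1)) := by
    intro z
    rw [← smul_eq_mul (c z.1), ← map_smul, ← map_add, ← map_smul, ← map_add]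
    simp [hcd]
  have i3 : Integrable (fun z : EE e × ℝ => fderiv ℝ f (St ψ z) (io e (a, fderiv ℝ ψ z.1 a))) := by
    refine (i1.sub i2).congr (Eventually.of_forall fun z => ?_)
    simp only [Pi.sub_apply]; rw [hsp z]; ring
  simp_rw [hsp]
  rw [integral_add i3.integrableOn i2.integrableOn, Measure.volume_eq_prod, ← Measure.prod_restrict, Measure.restrict_univ]
  rw [Measure.volume_eq_prod] at i2 i3
  have i2' : Integrable (fun z : EE e × ℝ => c z.1 * fderiv ℝ f (St ψ z) (io e (0,1))) (volume.prod (volume.restrict (Ioi 0))) :=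
    i2.mono_measure (Measure.prod_mono le_rfl Measure.restrict_le_self)
  have i3' : Integrable (fun z : EE e × ℝ => fderiv ℝ f (St ψ z) (io e (a, fderiv ℝ ψ z.1 a))) (volume.prod (volume.restrict (Ioi 0))) :=
    i3.mono_measure (Measure.prod_mono le_rfl Measure.restrict_le_self)
  rw [integral_prod_symm _ i3', integral_prod _ i2']
  simp_rw [gg_x hM hψ hf hc a, integral_const_mul, gg_s hψc hf hc]
  simp only [integral_zero, zero_add]
  refine integral_congr_ae (Eventually.of_forall fun x => ?_)
  simp only [hcd]; ring

end gg
end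

section
variable {e m : ℕ}

lemma haus_ac : (μH[(e:ℝ)] : Measure (EE e)) ≪ volume := by
  haveI : Measure.IsAddHaarMeasure (μH[(e:ℝ)] : Measure (EE e)) := by
    have := isAddHaarMeasure_hausdorffMeasure (E := EE e)
    simpa using this
  rw [Measure.isAddLeftInvariant_eq_smul (μH[(e:ℝ)] : Measure (EE e)) volume]
  exact Measure.smul_absolutelyContinuous

lemma surf_J {ψ : EE e → ℝ} {M : ℝ} (hM : 0 ≤ M) (hψ : LipschitzWith M.toNNReal ψ) :
    ∃ J : EE e → ℝ≥0, Measurable J ∧ surfMeasure (e+1) (graphDomain e ψ) = ((volume : Measure (EE e)).withDensity (fun x => (J x : ℝ≥0∞))).map (fun x => St ψ (x,0)) := by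
  have hemb := (Sh_emb hψ.continuous 0).measurableEmbedding
  set S0 : EE e → ℰ e := fun x => St ψ (x,0) with hS0
  set σ := surfMeasure (e+1) (graphDomain e ψ) with hσ
  have hσ2 : σ = (μH[(e:ℝ)]).restrict (range S0) := by
    rw [hσ, surfMeasure, frontier_eq hψ.continuous]
    congr 2
    push_cast; ring
  have hl : LipschitzWith ((2+M).toNNReal * 1) S0 := (St_lip hM hψ).comp (LipschitzWith.prodMk_right 0)
  haveI : Measure.IsAddHaarMeasure (μH[(e:ℝ)] : Measure (EE e)) := by
    have := isAddHaarMeasure_hausdorffMeasure (E := EE e)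
    simpa using this
  set K : ℝ≥0∞ := (((2+M).toNNReal * 1 : ℝ≥0) : ℝ≥0∞)^(e:ℝ) with hK
  have hKt : K ≠ ∞ := by
    rw [hK]; exact ENNReal.rpow_ne_top_of_nonneg (by positivity) ENNReal.coe_ne_top
  have hle : σ.comap S0 ≤ K.toNNReal • (μH[(e:ℝ)] : Measure (EE e)) := by
    refine Measure.le_iff.2 fun s hs => ?_
    rw [hemb.comap_apply, hσ2]
    refine (Measure.restrict_apply_le _ _).trans ?_
    refine (hl.hausdorffMeasure_image_le (by positivity) s).trans ?_
    rw [Measure.smul_apply, ENNReal.smul_def, ENNReal.coe_toNNReal hKt, smul_eq_mul]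
  haveI : SigmaFinite (σ.comap S0) := by
    refine (Measure.sigmaFinite_of_le _ hle)
  have hac : σ.comap S0 ≪ volume := (Measure.absolutelyContinuous_of_le hle).trans (Measure.smul_absolutelyContinuous.trans haus_ac)
  refine ⟨fun x => ((σ.comap S0).rnDeriv volume x).toNNReal, (Measure.measurable_rnDeriv _ _).ennreal_toNNReal, ?_⟩
  have h1 : (volume : Measure (EE e)).withDensity (fun x => ((((σ.comap S0).rnDeriv volume x).toNNReal : ℝ≥0) : ℝ≥0∞)) = σ.comap S0 := by
    rw [← Measure.withDensity_rnDeriv_eq _ _ hac]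
    refine withDensity_congr_ae ?_
    rw [Measure.withDensity_rnDeriv_eq _ _ hac]
    filter_upwards [Measure.rnDeriv_lt_top (σ.comap S0) volume] with x hx
    exact ENNReal.coe_toNNReal hx.ne
  rw [h1, hemb.map_comap, hσ2, Measure.restrict_restrict hemb.measurableSet_range, inter_self]

end

section
variable {e m : ℕ}

lemma proj_cd {k : WithTop ℕ∞} : ContDiff ℝ k (fun X : ℰ e => projLast e X) :=
  contDiff_fst.comp (io e).symm.contDiff

lemma big_bump {K : Set ℰ e} (hK : IsCompact K) : ∃ f : ℰ e → ℝ, ContDiff ℝ (⊤:ℕ∞) f ∧ HasCompactSupport f ∧ (∀ X, 0 ≤ f X) ∧ ∀ X ∈ K, f X = 1 := by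
  obtain ⟨R, hR⟩ := hK.isBounded.subset_closedBall (0 : ℰ e)
  let b : ContDiffBump (0 : ℰ e) := ⟨max R 1, max R 1 + 1, by positivity, by linarith⟩
  refine ⟨b, b.contDiff, b.hasCompactSupport, fun X => b.nonneg, fun X hX => b.one_of_mem_closedBall ?_⟩
  exact closedBall_subset_closedBall (le_max_left _ _) (hR hX)

section nrm
variable {ψ : EE e → ℝ} {M : ℝ} {n : ℰ e → ℰ e} {J : EE e → ℝ≥0}

def hv (J : EE e → ℝ≥0) (ψ : EE e → ℝ) (n : ℰ e → ℰ e) (v : ℰ e) (x : EE e) : ℝ := J x * ∑ i, v i * n (St ψ (x,0)) i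

lemma nrm_test (hM : 0 ≤ M) (hψ : LipschitzWith M.toNNReal ψ) (hJm : Measurable J)
    (hJ : surfMeasure (e+1) (graphDomain e ψ) = ((volume : Measure (EE e)).withDensity (fun x => (J x : ℝ≥0∞))).map (fun x => St ψ (x,0)))
    (hn : IsOutwardNormal (graphDomain e ψ) n) {f : ℰ e → ℝ} (hf : ContDiff ℝ (⊤:ℕ∞) f) (hc : HasCompactSupport f) (a : EE e) (b : ℝ) :
    ∫ x : EE e, f (St ψ (x,0)) * hv J ψ n (io e (a,b)) x = ∫ x : EE e, f (St ψ (x,0)) * (fderiv ℝ ψ x a - b) := by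
  have hf1 : ContDiff ℝ 1 f := hf.of_le (by exact_mod_cast le_top)
  rw [← gg hM hψ hf1 hc]
  set v := io e (a,b) with hv'
  have h1 := hn.2 (fun X => f X • v) (hf.smul contDiff_const) (hc.smul_right)
  have hemb := (Sh_emb hψ.continuous 0).measurableEmbedding
  rw [hJ, hemb.integral_map, integral_withDensity_eq_integral_smul hJm] at h1
  have h2 : ∀ X, ∑ i, fderiv ℝ (fun X => f X • v) X (EuclideanSpace.single i 1) i = fderiv ℝ f X v := by
    intro X
    have h3 : HasFDerivAt (fun X => f X • v) ((fderiv ℝ f X).smulRight v) X := ((hf1.differentiable one_ne_zero X).hasFDerivAt).smul_const v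
    rw [h3.fderiv]
    have h4 : v = ∑ i, v i • EuclideanSpace.single i (1:ℝ) := by
      ext j; simp [Finset.sum_apply, Pi.single_apply]
    conv_rhs => rw [h4, map_sum]
    refine Finset.sum_congr rfl fun i _ => ?_
    simp [mul_comm]
  simp_rw [h2] at h1
  rw [h1]
  refine integral_congr_ae (Eventually.of_forall fun x => ?_)
  simp only [hv, PiLp.smul_apply, smul_eq_mul, NNReal.smul_def, Finset.mul_sum]
  refine Finset.sum_congr rfl fun i _ => ?_
  ring

lemma nrm_li (hM : 0 ≤ M) (hψ : LipschitzWith M.toNNReal ψ) (hJm : Measurable J)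
    (hJ : surfMeasure (e+1) (graphDomain e ψ) = ((volume : Measure (EE e)).withDensity (fun x => (J x : ℝ≥0∞))).map (fun x => St ψ (x,0)))
    (hn : IsOutwardNormal (graphDomain e ψ) n) (a : EE e) : LocallyIntegrable (hv J ψ n (io e (a, M*‖a‖+1))) := by
  rw [locallyIntegrable_iff]
  intro K hK
  have hemb := Sh_emb hψ.continuous 0
  obtain ⟨f, hf, hc, hf0, hf1⟩ := big_bump (e := e) (K := (fun x => St ψ (x,0)) '' (K ∪ closedBall 0 1)) ((hK.union (isCompact_closedBall 0 1)).image hemb.continuous)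
  have h1 := nrm_test hM hψ hJm hJ hn hf hc a (M*‖a‖+1)
  have fc : Continuous (fun x : EE e => f (St ψ (x,0))) := hf.continuous.comp hemb.continuous
  have fs : HasCompactSupport (fun x : EE e => f (St ψ (x,0))) := hc.comp_isClosedEmbedding hemb
  have fi : Integrable (fun x : EE e => f (St ψ (x,0))) := fc.integrable_of_hasCompactSupport fs
  have hbd : ∀ x, |fderiv ℝ ψ x a| ≤ M*‖a‖ := fun x => by
    have := (ContinuousLinearMap.le_opNorm (fderiv ℝ ψ x) a).trans (mul_le_mul_of_nonneg_right (fd_bd hM hψ x) (norm_nonneg a))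
    rwa [Real.norm_eq_abs] at this
  have gi : Integrable (fun x : EE e => f (St ψ (x,0)) * (fderiv ℝ ψ x a - (M*‖a‖+1))) := by
    refine fi.mul_bdd (c := M*‖a‖ + (M*‖a‖+1)) ((measurable_fderiv_apply_const ℝ ψ a).sub measurable_const).aestronglyMeasurable (Eventually.of_forall fun x => ?_)
    rw [Real.norm_eq_abs]
    have h2 := hbd x
    rw [abs_le] at h2 ⊢
    constructor <;> nlinarith [h2.1, h2.2]
  have hne : ∫ x : EE e, f (St ψ (x,0)) * (fderiv ℝ ψ x a - (M*‖a‖+1)) < 0 := by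
    have h2 : ∫ x : EE e, f (St ψ (x,0)) * (fderiv ℝ ψ x a - (M*‖a‖+1)) ≤ ∫ x : EE e, -f (St ψ (x,0)) := by
      refine integral_mono gi fi.neg fun x => ?_
      have h3 := (abs_le.1 (hbd x)).2
      have := hf0 (St ψ (x,0))
      simp only
      nlinarith
    have h3 : 0 < ∫ x : EE e, f (St ψ (x,0)) := by
      refine (integral_pos_iff_support_of_nonneg (fun x => hf0 _) fi).2 ?_
      refine lt_of_lt_of_le (measure_ball_pos volume (0:EE e) one_pos) (measure_mono fun x hx => ?_)
      rw [Function.mem_support, hf1 _ (mem_image_of_mem _ (Or.inr (ball_subset_closedBall hx)))]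
      exact one_ne_zero
    rw [integral_neg] at h2
    linarith
  have hi : Integrable (fun x => f (St ψ (x,0)) * hv J ψ n (io e (a, M*‖a‖+1)) x) := by
    by_contra hcon
    rw [integral_undef hcon] at h1
    linarith
  refine hi.integrableOn.congr_fun (s := K) (fun x hx => ?_) hK.measurableSet
  simp only
  rw [hf1 _ (mem_image_of_mem _ (Or.inl hx)), one_mul]

lemma nrm_ae (hM : 0 ≤ M) (hψ : LipschitzWith M.toNNReal ψ) (hJm : Measurable J)
    (hJ : surfMeasure (e+1) (graphDomain e ψ) = ((volume : Measure (EE e)).withDensity (fun x => (J x : ℝ≥0∞))).map (fun x => St ψ (x,0)))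
    (hn : IsOutwardNormal (graphDomain e ψ) n) (a : EE e) : ∀ᵐ x : EE e, hv J ψ n (io e (a, M*‖a‖+1)) x = fderiv ℝ ψ x a - (M*‖a‖+1) := by
  have hemb := Sh_emb hψ.continuous 0
  refine ae_eq_of_integral_contDiff_smul_eq (nrm_li hM hψ hJm hJ hn a) ?_ ?_
  · have h1 : LocallyIntegrable (fun x => fderiv ℝ ψ x a) := by
      have h2 := hψ.locallyIntegrable_lineDeriv (μ := volume) a
      refine h2.congr ?_
      filter_upwards [hψ.ae_differentiableAt (μ := volume)] with x hx
      exact hx.lineDeriv_eq_fderiv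
    exact h1.sub (locallyIntegrable_const _)
  · intro g hg hgc
    obtain ⟨f, hf, hc, hf0, hf1⟩ := big_bump (e := e) (K := (fun x => St ψ (x,0)) '' (tsupport g)) (hgc.isCompact.image hemb.continuous)
    have h1 := nrm_test hM hψ hJm hJ hn (f := fun X => f X * g (projLast e X)) (hf.mul (hg.comp proj_cd)) hc.mul_right a (M*‖a‖+1)
    have h2 : ∀ x, f (St ψ (x,0)) * g x = g x := by
      intro x
      by_cases hx : x ∈ tsupport g
      · rw [hf1 _ (mem_image_of_mem _ hx), one_mul]
      · rw [image_eq_zero_of_notMem_tsupport hx, mul_zero]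
    simpa only [proj_St, h2, smul_eq_mul] using h1

end nrm
end

section
variable {e m : ℕ}

structure Gd (M : ℝ) (l : EE e →L[ℝ] ℝ) (N : ℰ e) (J : ℝ≥0) : Prop where
  h1 : ‖N‖ = 1
  h2 : ∀ a b, (J:ℝ) * ∑ i, io e (a,b) i * N i = l a - b
  h3 : 1 ≤ (J:ℝ)
  h4 : (J:ℝ) ≤ 1 + M

structure Bd (M : ℝ) (ψ : EE e → ℝ) (n : ℰ e → ℰ e) (J : EE e → ℝ≥0) : Prop where
  hM : 0 ≤ M
  hψ : LipschitzWith M.toNNReal ψ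
  hJm : Measurable J
  hJ : surfMeasure (e+1) (graphDomain e ψ) = ((volume : Measure (EE e)).withDensity (fun x => (J x : ℝ≥0∞))).map (fun x => St ψ (x,0))
  hn : IsOutwardNormal (graphDomain e ψ) n

variable {ψ : EE e → ℝ} {M : ℝ} {n : ℰ e → ℰ e} {J : EE e → ℝ≥0}

lemma Bd.ae_of (B : Bd M ψ n J) {p : ℰ e → Prop} (a : ℝ) (h : ∀ᵐ P ∂((surfMeasure (e+1) (graphDomain e ψ)).restrict (graphDelta e ψ a)), p P) :
    ∀ᵐ x : EE e, x ∈ ℬ e a → J x ≠ 0 → p (St ψ (x,0)) := by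
  have hemb := (Sh_emb B.hψ.continuous 0).measurableEmbedding
  have hpre : (fun x => St ψ (x,0)) ⁻¹' (graphDelta e ψ a) = ℬ e a := by
    ext x; simp [graphDelta, proj_St, last_St]
  rw [B.hJ, hemb.restrict_map, hpre, hemb.ae_map_iff, restrict_withDensity measurableSet_ball, ae_withDensity_iff B.hJm.coe_nnreal_ennreal,
    ae_restrict_iff' measurableSet_ball] at h
  filter_upwards [h] with x hx h1 h2
  exact hx h1 (by simpa using h2)

lemma Bd.ae_of' (B : Bd M ψ n J) {p : ℰ e → Prop} (h : ∀ᵐ P ∂(surfMeasure (e+1) (graphDomain e ψ)), p P) :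
    ∀ᵐ x : EE e, J x ≠ 0 → p (St ψ (x,0)) := by
  have hemb := (Sh_emb B.hψ.continuous 0).measurableEmbedding
  rw [B.hJ, hemb.ae_map_iff, ae_withDensity_iff B.hJm.coe_nnreal_ennreal] at h
  filter_upwards [h] with x hx h2
  exact hx (by simpa using h2)

lemma Bd.lint (B : Bd M ψ n J) (f : ℰ e → ℝ≥0∞) (a : ℝ) :
    ∫⁻ P in graphDelta e ψ a, f P ∂(surfMeasure (e+1) (graphDomain e ψ)) = ∫⁻ x in ℬ e a, J x * f (St ψ (x,0)) := by
  have hemb := (Sh_emb B.hψ.continuous 0).measurableEmbedding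
  have hpre : (fun x => St ψ (x,0)) ⁻¹' (graphDelta e ψ a) = ℬ e a := by
    ext x; simp [graphDelta, proj_St, last_St]
  rw [B.hJ, hemb.restrict_map, hpre, hemb.lintegral_map, restrict_withDensity measurableSet_ball,
    lintegral_withDensity_eq_lintegral_mul_non_measurable _ B.hJm.coe_nnreal_ennreal (Eventually.of_forall fun x => ENNReal.coe_lt_top)]
  rfl

lemma Bd.int (B : Bd M ψ n J) (f : ℰ e → ℝ) (a : ℝ) (h : IntegrableOn (fun x => (J x:ℝ) * f (St ψ (x,0))) (ℬ e a)) :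
    IntegrableOn f (graphDelta e ψ a) (surfMeasure (e+1) (graphDomain e ψ)) := by
  have hemb := (Sh_emb B.hψ.continuous 0).measurableEmbedding
  have hpre : (fun x => St ψ (x,0)) ⁻¹' (graphDelta e ψ a) = ℬ e a := by
    ext x; simp [graphDelta, proj_St, last_St]
  rw [IntegrableOn, B.hJ, hemb.restrict_map, hpre, hemb.integrable_map_iff, restrict_withDensity measurableSet_ball,
    integrable_withDensity_iff_integrable_smul B.hJm]
  exact h

lemma gd_of (hM : 0 ≤ M) {l : EE e →L[ℝ] ℝ} (hl : ‖l‖ ≤ M) {N : ℰ e} {j : ℝ≥0} (hN : j ≠ 0 → ‖N‖ = 1)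
    (h0 : (j:ℝ) * ∑ i, io e (0, M*‖(0:EE e)‖+1) i * N i = l 0 - (M*‖(0:EE e)‖+1))
    (hk : ∀ k, (j:ℝ) * ∑ i, io e (EuclideanSpace.single k 1, M*‖(EuclideanSpace.single k 1 : EE e)‖+1) i * N i = l (EuclideanSpace.single k 1) - (M*‖(EuclideanSpace.single k 1 : EE e)‖+1)) :
    Gd M l N j := by
  have hin : ∀ v : ℰ e, ∑ i, v i * N i = inner ℝ N v := fun v => by simp [PiLp.inner_apply]
  simp only [hin] at h0 hk
  let T : EE e × ℝ →ₗ[ℝ] ℝ := (j:ℝ) • ((innerSL ℝ N).toLinearMap ∘ₗ (io e).toLinearEquiv.toLinearMap) - l.toLinearMap ∘ₗ LinearMap.fst ℝ _ _ + LinearMap.snd ℝ _ _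
  have hT : ∀ a b, T (a,b) = (j:ℝ) * inner ℝ N (io e (a,b)) - l a + b := fun a b => by simp [T]
  have t0 : T (0,1) = 0 := by rw [hT]; simp at h0; simp; linarith
  have tb : ∀ b, T (0,b) = 0 := fun b => by
    have : ((0,b) : EE e × ℝ) = b • (0,1) := by simp
    rw [this, map_smul, t0, smul_zero]
  have tk : ∀ k, T (EuclideanSpace.single k 1, 0) = 0 := fun k => by
    have h5 : ((EuclideanSpace.single k 1, 0) : EE e × ℝ) = (EuclideanSpace.single k 1, M*‖(EuclideanSpace.single k 1 : EE e)‖+1) - (0, M*‖(EuclideanSpace.single k 1 : EE e)‖+1) := by simp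
    rw [h5, map_sub, tb, sub_zero, hT, hk k]; ring
  have ta : ∀ a, T (a,0) = 0 := fun a => by
    have h6 : a = ∑ k, a k • EuclideanSpace.single k (1:ℝ) := by
      ext j; simp [Finset.sum_apply, Pi.single_apply]
    have h7 : T ∘ₗ LinearMap.inl ℝ (EE e) ℝ = 0 := by
      ext a
      have : a = ∑ k, a k • EuclideanSpace.single k (1:ℝ) := by
        ext j; simp [Finset.sum_apply, Pi.single_apply]
      rw [this, map_sum]
      simp only [map_smul, LinearMap.comp_apply, LinearMap.inl_apply, tk, smul_zero, Finset.sum_const_zero, LinearMap.zero_apply]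
    exact LinearMap.congr_fun h7 a
  have tt : ∀ a b, T (a,b) = 0 := fun a b => by
    have : ((a,b) : EE e × ℝ) = (a,0) + (0,b) := by simp
    rw [this, map_add, ta, tb, add_zero]
  have g2 : ∀ a b, (j:ℝ) * inner ℝ N (io e (a,b)) = l a - b := fun a b => by
    have := tt a b; rw [hT] at this; linarith
  have hj0 : j ≠ 0 := by
    rintro rfl
    have := g2 0 1
    simp at this
  have n1 := hN hj0
  have hjp : (0:ℝ) ≤ j := j.2
  refine ⟨n1, fun a b => by rw [hin]; exact g2 a b, ?_, ?_⟩
  · have h5 := g2 0 (-1)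
    have h6 : inner ℝ N (io e (0,-1)) ≤ ‖N‖ * ‖io e ((0:EE e),(-1:ℝ))‖ := real_inner_le_norm _ _
    have h7 : ‖io e ((0:EE e),(-1:ℝ))‖ ≤ 1 := (io_norm_le _).trans (by simp)
    rw [n1, one_mul] at h6
    simp only [map_zero, zero_sub, neg_neg] at h5
    nlinarith
  · have h5 := g2 (projLast e N) (N (Fin.last e))
    rw [io_proj, real_inner_self_eq_norm_sq, n1] at h5
    have h6 := (ContinuousLinearMap.le_opNorm l (projLast e N))
    rw [Real.norm_eq_abs] at h6
    have h7 := proj_norm_le N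
    have h8 := last_abs_le N
    rw [n1] at h7 h8
    have h9 := abs_le.1 h8
    have h10 := le_abs_self (l (projLast e N))
    have h11 : ‖l‖ * ‖projLast e N‖ ≤ M * 1 := mul_le_mul hl h7 (norm_nonneg _) hM
    linarith [h9.1, h9.2]

lemma Bd.gd (B : Bd M ψ n J) : ∀ᵐ x : EE e, Gd M (fderiv ℝ ψ x) (n (St ψ (x,0))) (J x) := by
  have hk : ∀ᵐ x : EE e, ∀ k : Fin e, hv J ψ n (io e (EuclideanSpace.single k 1, M*‖(EuclideanSpace.single k 1 : EE e)‖+1)) x = fderiv ℝ ψ x (EuclideanSpace.single k 1) - (M*‖(EuclideanSpace.single k 1 : EE e)‖+1) :=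
    ae_all_iff.2 fun k => nrm_ae B.hM B.hψ B.hJm B.hJ B.hn _
  filter_upwards [hk, nrm_ae B.hM B.hψ B.hJm B.hJ B.hn 0, B.ae_of' B.hn.1] with x h1 h2 h3
  exact gd_of B.hM (fd_bd B.hM B.hψ x) h3 h2 h1

lemma Bd.nm (B : Bd M ψ n J) (i : Fin (e+1)) : AEMeasurable (fun x : EE e => n (St ψ (x,0)) i) := by
  refine AEMeasurable.congr (f := fun x : EE e => (J x : ℝ)⁻¹ * (fderiv ℝ ψ x (projLast e (EuclideanSpace.single i 1)) - (EuclideanSpace.single i 1 : ℰ e) (Fin.last e))) ?_ ?_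
  · have := B.hJm
    exact (B.hJm.coe_nnreal_real.inv.mul ((measurable_fderiv_apply_const ℝ ψ _).sub measurable_const)).aemeasurable
  · filter_upwards [B.gd] with x hx
    rw [← hx.h2, io_proj, ← mul_assoc, inv_mul_cancel₀ (by linarith [hx.h3]), one_mul]
    simp [Pi.single_apply]

end

section
variable {e m : ℕ}
variable {M : ℝ} {l : EE e →L[ℝ] ℝ} {N : ℰ e} {j : ℝ≥0}

lemma pp_low (hM : 0 ≤ M) (hl : ‖l‖ ≤ M) (X : ℰ e) (L : GG (e+1) m) : gradNormSq L ≤ (((e+1:ℕ)*m:ℝ) * (1+M)^2) * ‖Pp (l,X,L)‖^2 := by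
  have h1 : L = (Pp (l,X,L)).comp (Rd l) := by
    show L = (L.comp (Sd l)).comp (Rd l)
    rw [ContinuousLinearMap.comp_assoc, Sd_Rd, ContinuousLinearMap.comp_id]
  have h2 : ‖L‖ ≤ ‖Pp (l,X,L)‖ * (1+M) := by
    conv_lhs => rw [h1]
    exact (ContinuousLinearMap.opNorm_comp_le _ _).trans (mul_le_mul_of_nonneg_left (Rd_norm hM hl) (norm_nonneg _))
  refine (gn_le L).trans ?_
  have h3 : ‖L‖^2 ≤ (1+M)^2 * ‖Pp (l,X,L)‖^2 := by
    calc ‖L‖^2 ≤ (‖Pp (l,X,L)‖ * (1+M))^2 := by gcongr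
      _ = _ := by ring
  have h4 : (0:ℝ) ≤ ((e+1:ℕ)*m:ℝ) := by positivity
  have h5 := mul_le_mul_of_nonneg_left h3 h4
  rw [← mul_assoc] at h5; exact h5

lemma con_Ab (A : Coeff (e+1) m) (n : ℰ e → ℰ e) (X : ℰ e) (L : GG (e+1) m) (y : YY m) :
    Ab A X L ((innerSL ℝ (n X)).smulRight y) = ∑ α, y α * conormalDeriv A n X L α := by
  rw [Ab_apply]
  have h1 : ∀ (i : Fin (e+1)) (α : Fin m), ((innerSL ℝ (n X)).smulRight y : GG (e+1) m) (EuclideanSpace.single i (1:ℝ)) α = n X i * y α := by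
    intro i α; simp [PiLp.inner_apply, Pi.single_apply]
  simp only [h1, conormalDeriv, Finset.mul_sum, gradEntry]
  calc _ = ∑ i, ∑ α, ∑ j, ∑ β, A X i j α β * L (EuclideanSpace.single j 1) β * (n X i * y α) :=
        Finset.sum_congr rfl fun i _ => Finset.sum_comm
    _ = ∑ α, ∑ i, ∑ j, ∑ β, A X i j α β * L (EuclideanSpace.single j 1) β * (n X i * y α) := Finset.sum_comm
    _ = _ := by
      refine Finset.sum_congr rfl fun α _ => Finset.sum_congr rfl fun i _ => Finset.sum_congr rfl fun j _ => Finset.sum_congr rfl fun β _ => ?_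
      ring

lemma con_up {μ : ℝ} (hμ : 0 < μ) {A : Coeff (e + 1) m} (hA : IsElliptic μ A) (hs : IsSymmCoeff A) (n : ℰ e → ℰ e) (X : ℰ e) (hN : ‖n X‖ = 1) (L : GG (e+1) m) :
    conormalNormSq A n X L ≤ (m * (μ⁻¹*((e+1:ℕ)*m))^2) * ‖L‖^2 := by
  unfold conormalNormSq
  have h1 : ∀ α, (conormalDeriv A n X L α)^2 ≤ (μ⁻¹*((e+1:ℕ)*m))^2 * ‖L‖^2 := by
    intro α
    have h2 : conormalDeriv A n X L α = Ab A X L ((innerSL ℝ (n X)).smulRight (Pi.single α 1)) := by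
      rw [con_Ab]; simp [Pi.single_apply]
    have h3 : ‖(innerSL ℝ (n X)).smulRight (Pi.single α (1:ℝ) : YY m)‖ ≤ 1 := by
      rw [ContinuousLinearMap.norm_smulRight_apply, innerSL_apply_norm, hN, Pi.norm_single]; simp
    have h4 : |conormalDeriv A n X L α| ≤ (μ⁻¹*((e+1:ℕ)*m)) * ‖L‖ := by
      rw [h2, ← Real.norm_eq_abs]
      refine (ContinuousLinearMap.le_opNorm₂ _ _ _).trans ?_
      calc _ ≤ ‖Ab A X‖ * ‖L‖ * 1 := by gcongr
        _ ≤ _ := by rw [mul_one]; exact mul_le_mul_of_nonneg_right (Ab_upper hμ hA hs X) (norm_nonneg _)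
    calc _ = |conormalDeriv A n X L α|^2 := (sq_abs _).symm
      _ ≤ ((μ⁻¹*((e+1:ℕ)*m)) * ‖L‖)^2 := by gcongr
      _ = _ := by ring
  calc _ ≤ ∑ α : Fin m, (μ⁻¹*((e+1:ℕ)*m))^2 * ‖L‖^2 := Finset.sum_le_sum fun α _ => h1 α
    _ = _ := by simp; ring

lemma pn_up (hM : 0 ≤ M) (A : Coeff (e + 1) m) (n : ℰ e → ℰ e) (X : ℰ e) (g : Gd M l (n X) j) (L : GG (e+1) m) :
    ‖Pn A (l,X,L)‖^2 ≤ ((1+M)^2 * m) * conormalNormSq A n X L := by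
  set c := conormalDeriv A n X L with hc
  have h1 : ∀ y, Pn A (l,X,L) y = -(j * ∑ α, y α * c α) := by
    intro y
    show pull (Rd l) (Ab A X) (L.comp (Sd l)) (dtL (EE e) (YY m) y) = _
    rw [pull_apply, ContinuousLinearMap.comp_assoc, Sd_Rd, ContinuousLinearMap.comp_id, ← con_Ab]
    have h2 : (dtL (EE e) (YY m) y).comp (Rd l) = (-(j:ℝ)) • (innerSL ℝ (n X)).smulRight y := by
      ext Z α
      have h3 := g.h2 (projLast e Z) (Z (Fin.last e))
      rw [io_proj] at h3
      have h4 : (innerSL ℝ (n X)) Z = ∑ i, Z i * n X i := by simp [PiLp.inner_apply]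
      simp only [ContinuousLinearMap.comp_apply, smul_apply, ContinuousLinearMap.smulRight_apply, dtL_apply', Rd_apply, h4, Pi.smul_apply, smul_eq_mul]
      linear_combination y α * h3
    rw [h2, map_smul, smul_eq_mul]; ring
  have hj0 : (0:ℝ) ≤ j := j.2
  have hs0 : 0 ≤ ∑ α, |c α| := Finset.sum_nonneg fun α _ => abs_nonneg _
  have h2 : ‖Pn A (l,X,L)‖ ≤ (1+M) * ∑ α, |c α| := by
    refine ContinuousLinearMap.opNorm_le_bound _ (by positivity) fun y => ?_
    rw [h1, norm_neg, norm_mul, Real.norm_eq_abs, abs_of_nonneg hj0, mul_assoc]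
    refine mul_le_mul g.h4 ?_ (norm_nonneg _) (by positivity)
    refine (norm_sum_le _ _).trans ?_
    rw [Finset.sum_mul]
    refine Finset.sum_le_sum fun α _ => ?_
    rw [norm_mul, mul_comm, Real.norm_eq_abs (c α)]
    exact mul_le_mul_of_nonneg_left (norm_le_pi_norm y α) (abs_nonneg _)
  have h3 : (∑ α, |c α|)^2 ≤ m * ∑ α, (c α)^2 := by
    have := sq_sum_le_card_mul_sum_sq (s := Finset.univ) (f := fun α => |c α|)
    simpa using this
  calc _ ≤ ((1+M) * ∑ α, |c α|)^2 := by gcongr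
    _ = (1+M)^2 * (∑ α, |c α|)^2 := by ring
    _ ≤ (1+M)^2 * (m * ∑ α, (c α)^2) := by gcongr
    _ = _ := by unfold conormalNormSq; rw [← hc]; ring

lemma tan_up (hN : ‖N‖ = 1) (L : GG (e+1) m) : tanGradNormSq N L ≤ ((e+1:ℕ)*m:ℝ) * ‖L‖^2 := by
  refine le_trans ?_ (gn_le L)
  unfold tanGradNormSq gradNormSq
  refine Finset.sum_le_sum fun α _ => ?_
  have hs : ∑ i, N i ^2 = 1 := by
    have := EuclideanSpace.real_norm_sq_eq N
    rw [hN] at this; linarith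
  set g := gradEntry L α
  have key : ∀ t : ℝ, ∑ i, (g i - t * N i)^2 = ∑ i, g i ^2 - 2*t*(∑ i, g i * N i) + t^2 * ∑ i, N i^2 := by
    intro t
    rw [Finset.mul_sum, Finset.mul_sum, ← Finset.sum_sub_distrib, ← Finset.sum_add_distrib]
    refine Finset.sum_congr rfl fun i _ => ?_
    ring
  rw [key, hs]
  nlinarith [sq_nonneg (∑ k, g k * N k)]

lemma pt_up (hM : 0 ≤ M) (hl : ‖l‖ ≤ M) (g : Gd M l N j) (X : ℰ e) (L : GG (e+1) m) : ‖Pt (l,X,L)‖^2 ≤ (2+M)^2 * tanGradNormSq N L := by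
  set t := tanGradNormSq N L with ht
  have t0 : 0 ≤ t := by rw [ht]; unfold tanGradNormSq; positivity
  have h1 : ‖Pt (l,X,L)‖ ≤ (2+M) * Real.sqrt t := by
    refine ContinuousLinearMap.opNorm_le_bound _ (by positivity) fun z => ?_
    have e1 : Pt (l,X,L) z = L (Sd l (z.1, 0)) := by
      show L (Sd l (tanP (EE e) z)) = _
      simp [tanP]
    set v := Sd l (z.1,0) with hv'
    have hvn : ‖v‖ ≤ (2+M) * ‖z‖ := by
      refine (ContinuousLinearMap.le_opNorm _ _).trans (mul_le_mul (Sd_norm hM hl) ?_ (norm_nonneg _) (by positivity))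
      rw [Prod.norm_def]; simp; exact norm_fst_le z
    have hvN : ∑ i, v i * N i = 0 := by
      have h2 := g.h2 z.1 (l z.1 + 0)
      rw [← Sd_apply l (z.1,0), ← hv'] at h2
      have h3 := g.h3
      have h4 : (j:ℝ) ≠ 0 := by linarith
      have h5 : (j:ℝ) * ∑ i, v i * N i = 0 := by rw [h2]; ring
      exact (mul_eq_zero.1 h5).resolve_left h4
    rw [e1, pi_norm_le_iff_of_nonneg (by positivity)]
    intro α
    rw [Real.norm_eq_abs]
    have h6 : L v α = ∑ i, v i * (gradEntry L α i - (∑ k, gradEntry L α k * N k) * N i) := by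
      rw [vec_sum]
      have : ∑ i, v i * (gradEntry L α i - (∑ k, gradEntry L α k * N k) * N i) = ∑ i, v i * gradEntry L α i - (∑ k, gradEntry L α k * N k) * ∑ i, v i * N i := by
        rw [Finset.mul_sum, ← Finset.sum_sub_distrib]
        refine Finset.sum_congr rfl fun i _ => ?_
        ring
      rw [this, hvN]; ring
    have h7 : (L v α)^2 ≤ ‖v‖^2 * t := by
      rw [h6]
      refine (Finset.sum_mul_sq_le_sq_mul_sq _ _ _).trans ?_
      rw [EuclideanSpace.real_norm_sq_eq]
      refine mul_le_mul_of_nonneg_left ?_ (by positivity)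
      rw [ht]; unfold tanGradNormSq
      exact Finset.single_le_sum (f := fun α => ∑ i, (gradEntry L α i - (∑ k, gradEntry L α k * N k) * N i)^2) (fun α _ => by positivity) (Finset.mem_univ α)
    have h8 : |L v α| ≤ ‖v‖ * Real.sqrt t := by
      refine abs_le_of_sq_le_sq ?_ (by positivity)
      rw [mul_pow, Real.sq_sqrt t0]; exact h7
    calc _ ≤ ‖v‖ * Real.sqrt t := h8
      _ ≤ ((2+M) * ‖z‖) * Real.sqrt t := by gcongr
      _ = _ := by ring
  calc _ ≤ ((2+M) * Real.sqrt t)^2 := by gcongr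
    _ = _ := by rw [mul_pow, Real.sq_sqrt t0]

end

section
variable {e m : ℕ}
variable {C₀ M r : ℝ} {ψ : EE e → ℝ} {u : ℰ e → YY m} {G : ℰ e → GG (e+1) m} {n : ℰ e → ℰ e} {J : EE e → ℝ≥0}

lemma fin_gen (B : Bd M ψ n J) (S : Fl C₀ M ψ r u G) (h : ℰ e → ℝ) (h0 : ∀ P, 0 ≤ h P)
    (hme : AEStronglyMeasurable (fun x => h (St ψ (x,0))) (volume.restrict (ℬ e (4*r))))
    {Kb K1 K2 C D : ℝ} (hKb : 0 ≤ Kb) (hK1 : 0 ≤ K1) (hK2 : 0 ≤ K2) (hC : 0 ≤ C) (hD : 0 ≤ D)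
    (hb : ∀ᵐ x : EE e, h (St ψ (x,0)) ≤ Kb * ‖G (St ψ (x,0))‖^2) (f1 f2 : EE e → ℝ≥0∞)
    (hp : ∀ᵐ x : EE e, ENNReal.ofReal (gradNormSq (G (St ψ (x,0)))) ≤ ENNReal.ofReal K1 * f1 x)
    (hq : ∀ᵐ x : EE e, f2 x ≤ ENNReal.ofReal (K2 * h (St ψ (x,0))))
    (hc : ∫⁻ x in ℬ e r, f1 x ≤ ENNReal.ofReal C * (∫⁻ x in ℬ e (4*r), f2 x) + ENNReal.ofReal D) :
    ∫ P in graphDelta e ψ r, gradNormSq (G P) ∂(surfMeasure (e+1) (graphDomain e ψ)) ≤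
      ((1+M)*K1*C*K2) * (∫ P in graphDelta e ψ (4*r), h P ∂(surfMeasure (e+1) (graphDomain e ψ))) + (1+M)*K1*D := by
  have hM := S.hM
  have gnn : ∀ L : GG (e+1) m, 0 ≤ gradNormSq L := fun L => by unfold gradNormSq; positivity
  set σ := surfMeasure (e+1) (graphDomain e ψ) with hσ
  have hint : IntegrableOn h (graphDelta e ψ (4*r)) σ := by
    refine B.int h (4*r) ⟨B.hJm.coe_nnreal_real.aestronglyMeasurable.mul hme, ?_⟩
    have hl : ∫⁻ x in ℬ e (4*r), ENNReal.ofReal ((1+M)*Kb) * ‖G (St ψ (x,0))‖ₑ^2 < ∞ := by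
      rw [lintegral_const_mul' _ _ ENNReal.ofReal_ne_top]
      exact ENNReal.mul_lt_top ENNReal.ofReal_lt_top S.g_fin.lt_top
    refine lt_of_le_of_lt (lintegral_mono_ae (ae_restrict_of_ae ?_)) hl
    filter_upwards [hb, B.gd] with x h1 h2
    have h3 := h2.h4
    have h4 : (0:ℝ) ≤ J x := (J x).2
    rw [← ofReal_norm, ← ofReal_norm (G _), ← ENNReal.ofReal_pow (norm_nonneg _), ← ENNReal.ofReal_mul (by positivity)]
    refine ENNReal.ofReal_le_ofReal ?_
    rw [Real.norm_eq_abs, abs_of_nonneg (mul_nonneg h4 (h0 _)), mul_assoc]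
    exact mul_le_mul h3 h1 (h0 _) (by positivity)
  have hI : ∫⁻ x in ℬ e (4*r), f2 x ≤ ENNReal.ofReal (K2 * ∫ P in graphDelta e ψ (4*r), h P ∂σ) := by
    rw [ENNReal.ofReal_mul hK2, ofReal_integral_eq_lintegral_ofReal hint (Eventually.of_forall h0), B.lint, ← lintegral_const_mul' _ _ ENNReal.ofReal_ne_top]
    refine lintegral_mono_ae (ae_restrict_of_ae ?_)
    filter_upwards [hq, B.gd] with x h1 h2
    refine h1.trans ?_
    rw [ENNReal.ofReal_mul hK2]
    refine mul_le_mul_right ?_ _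
    have h3 : (1:ℝ≥0∞) ≤ J x := by exact_mod_cast h2.h3
    calc _ = 1 * ENNReal.ofReal (h (St ψ (x,0))) := (one_mul _).symm
      _ ≤ _ := mul_le_mul_left h3 _
  have hi0 : 0 ≤ ∫ P in graphDelta e ψ (4*r), h P ∂σ := integral_nonneg h0
  set I := ∫ P in graphDelta e ψ (4*r), h P ∂σ with hIdef
  have hL : ENNReal.ofReal (∫ P in graphDelta e ψ r, gradNormSq (G P) ∂σ) ≤ ENNReal.ofReal ((1+M)*K1) * ∫⁻ x in ℬ e r, f1 x := by
    refine (ENNReal.ofReal_le_ofReal (le_abs_self _)).trans ?_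
    rw [← Real.norm_eq_abs, ofReal_norm]
    refine (enorm_integral_le_lintegral_enorm _).trans ?_
    rw [B.lint, ← lintegral_const_mul' _ _ ENNReal.ofReal_ne_top]
    refine lintegral_mono_ae (ae_restrict_of_ae ?_)
    filter_upwards [hp, B.gd] with x h1 h2
    rw [Real.enorm_of_nonneg (gnn _), ENNReal.ofReal_mul (by positivity), mul_assoc]
    refine mul_le_mul' ?_ h1
    rw [← ENNReal.ofReal_coe_nnreal]
    exact ENNReal.ofReal_le_ofReal h2.h4
  have hfin : ENNReal.ofReal (∫ P in graphDelta e ψ r, gradNormSq (G P) ∂σ) ≤ ENNReal.ofReal (((1+M)*K1*C*K2) * I + (1+M)*K1*D) := by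
    refine hL.trans ((mul_le_mul_right (hc.trans (add_le_add (mul_le_mul_right hI _) le_rfl)) _).trans (le_of_eq ?_))
    rw [← ENNReal.ofReal_mul hC, ← ENNReal.ofReal_add (by positivity) hD, ← ENNReal.ofReal_mul (by positivity)]
    congr 1; ring
  exact (ENNReal.ofReal_le_ofReal_iff (by positivity)).1 hfin

lemma con_meas (B : Bd M ψ n J) (S : Fl C₀ M ψ r u G) {A : Coeff (e + 1) m} (hA2 : ∀ i j α β, ContDiff ℝ 2 (fun Z => A Z i j α β)) :
    AEStronglyMeasurable (fun x => conormalNormSq A n (St ψ (x,0)) (G (St ψ (x,0)))) (volume.restrict (ℬ e (4*r))) := by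
  have hg : ∀ α i, AEMeasurable (fun x => gradEntry (G (St ψ (x,0))) α i) (volume.restrict (ℬ e (4*r))) := fun α i => by
    have hc : Continuous (fun L : GG (e+1) m => gradEntry L α i) := by unfold gradEntry; fun_prop
    exact (hc.comp_aestronglyMeasurable S.g_meas).aemeasurable
  have hn : ∀ i, AEMeasurable (fun x => n (St ψ (x,0)) i) (volume.restrict (ℬ e (4*r))) := fun i => (B.nm i).restrict
  have hs : Continuous (fun x : EE e => St ψ (x,0)) := (St_cont S.hψ.continuous).comp (by fun_prop)
  have ha : ∀ i j α β, AEMeasurable (fun x => A (St ψ (x,0)) i j α β) (volume.restrict (ℬ e (4*r))) := fun i j α β =>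
    ((hA2 i j α β).continuous.comp hs).aemeasurable
  refine AEMeasurable.aestronglyMeasurable ?_
  refine Finset.aemeasurable_fun_sum _ fun α _ => AEMeasurable.pow_const ?_ 2
  refine Finset.aemeasurable_fun_sum _ fun i _ => Finset.aemeasurable_fun_sum _ fun j _ => Finset.aemeasurable_fun_sum _ fun β _ => ?_
  exact ((hn i).mul (ha i j α β)).mul (hg β j)

lemma tan_meas (B : Bd M ψ n J) (S : Fl C₀ M ψ r u G) :
    AEStronglyMeasurable (fun x => tanGradNormSq (n (St ψ (x,0))) (G (St ψ (x,0)))) (volume.restrict (ℬ e (4*r))) := by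
  have hg : ∀ α i, AEMeasurable (fun x => gradEntry (G (St ψ (x,0))) α i) (volume.restrict (ℬ e (4*r))) := fun α i => by
    have hc : Continuous (fun L : GG (e+1) m => gradEntry L α i) := by unfold gradEntry; fun_prop
    exact (hc.comp_aestronglyMeasurable S.g_meas).aemeasurable
  have hn : ∀ i, AEMeasurable (fun x => n (St ψ (x,0)) i) (volume.restrict (ℬ e (4*r))) := fun i => (B.nm i).restrict
  unfold tanGradNormSq
  refine AEMeasurable.aestronglyMeasurable ?_
  fun_prop

lemma en_sq {V : Type*} [NormedAddCommGroup V] (v : V) : ‖v‖ₑ^2 = ENNReal.ofReal (‖v‖^2) := by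
  rw [← ofReal_norm, ENNReal.ofReal_pow (norm_nonneg _)]

lemma final (hm : 1 ≤ m) {μ lam τ : ℝ} (hμ : 0 < μ) (hlam : lam ∈ Set.Ioo (0 : ℝ) 1) (hτ : 0 ≤ τ) (hM : 0 ≤ M) (hC₀ : 1 < C₀) :
    ∃ C : ℝ, 0 < C ∧ ∀ ψ : EE e → ℝ, LipschitzWith (Real.toNNReal M) ψ → ψ 0 = 0 →
      ∀ A : Coeff (e + 1) m, MemLambdaClass μ lam τ A → IsSymmCoeff A →
        (∀ i j α β, ContDiff ℝ 2 (fun Z => A Z i j α β)) →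
      ∀ n, IsOutwardNormal (graphDomain e ψ) n →
      ∀ r : ℝ, 0 < r →
      ∀ (u : ℰ e → YY m) (G : ℰ e → GG (e+1) m),
        ContDiffOn ℝ 2 u (graphD e M ψ (8 * r)) →
        IsWeakSolution A (graphD e M ψ (8 * r)) u →
        (∫⁻ P in graphDelta e ψ (6 * r),
          (ntMax C₀ (graphD e M ψ (8 * r)) (frontier (graphDomain e ψ))
            (fun X => fderiv ℝ u X) P) ^ 2 ∂(surfMeasure (e + 1) (graphDomain e ψ))) ≠ ⊤ →
        (∀ᵐ P ∂((surfMeasure (e + 1) (graphDomain e ψ)).restrict (graphDelta e ψ (6 * r))),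
          NTLim C₀ (graphD e M ψ (8 * r)) (frontier (graphDomain e ψ))
            (fun X => fderiv ℝ u X) P (G P)) →
        (∫ P in graphDelta e ψ r, gradNormSq (G P) ∂(surfMeasure (e + 1) (graphDomain e ψ)) ≤
            C * (∫ P in graphDelta e ψ (4 * r), conormalNormSq A n P (G P) ∂(surfMeasure (e + 1) (graphDomain e ψ))) +
            (C / r) * ∫ X in graphD e M ψ (4 * r), gradSq u X) ∧
        (∫ P in graphDelta e ψ r, gradNormSq (G P) ∂(surfMeasure (e + 1) (graphDomain e ψ)) ≤
            C * (∫ P in graphDelta e ψ (4 * r), tanGradNormSq (n P) (G P) ∂(surfMeasure (e + 1) (graphDomain e ψ))) +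
            (C / r) * ∫ X in graphD e M ψ (4 * r), gradSq u X) := by
  obtain ⟨C, hC, H⟩ := core_lim (e := e) hm hμ hlam hτ hM
  have hm' : (0:ℝ) < m := by exact_mod_cast hm
  set K1 : ℝ := (((e+1:ℕ)*m:ℝ) * (1+M)^2) with hK1
  have K1p : 0 < K1 := by rw [hK1]; positivity
  set Ka : ℝ := (1+M)^2 * m with hKa
  set Kt : ℝ := (2+M)^2 with hKt
  have Kap : 0 ≤ Ka := by rw [hKa]; positivity
  have Ktp : 0 ≤ Kt := by rw [hKt]; positivity
  refine ⟨(1+M)*K1*C*(1+Ka+Kt), by positivity, ?_⟩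
  intro ψ hψ h0 A hA hs hA2 n hn r hr u G hu hw hN hG
  obtain ⟨J, hJm, hJ⟩ := surf_J hM hψ
  have B : Bd M ψ n J := ⟨hM, hψ, hJm, hJ, hn⟩
  have S : Fl C₀ M ψ r u G := by
    refine ⟨hM, hC₀, hψ, h0, hr, hu, ?_, ?_⟩
    · rw [B.lint] at hN
      refine ne_top_of_le_ne_top hN (lintegral_mono_ae (ae_restrict_of_ae ?_))
      filter_upwards [B.gd] with x h2
      have h3 : (1:ℝ≥0∞) ≤ J x := by exact_mod_cast h2.h3
      calc _ = 1 * NN C₀ M ψ r u x ^ 2 := (one_mul _).symm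
        _ ≤ _ := mul_le_mul_left h3 _
    · filter_upwards [B.ae_of _ hG, B.gd] with x h1 h2 h3
      refine h1 h3 fun h4 => ?_
      have := h2.h3
      rw [h4] at this; norm_num at this
  have hE : 0 ≤ ∫ X in graphD e M ψ (4 * r), gradSq u X := integral_nonneg (gs_nn u)
  have hl : ∀ x, ‖fderiv ℝ ψ x‖ ≤ M := fun x => by
    have := norm_fderiv_le_of_lipschitz ℝ hψ (x₀ := x)
    rwa [Real.coe_toNNReal _ hM] at this
  have hp : ∀ᵐ x : EE e, ENNReal.ofReal (gradNormSq (G (St ψ (x,0)))) ≤ ENNReal.ofReal K1 * ‖gI Pp ψ G 0 x‖ₑ^2 := by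
    refine Eventually.of_forall fun x => ?_
    rw [en_sq, ← ENNReal.ofReal_mul K1p.le]
    exact ENNReal.ofReal_le_ofReal (pp_low hM (hl x) _ _)
  have wrap : ∀ (L Q I E : ℝ), 0 ≤ Q → Q ≤ 1+Ka+Kt → 0 ≤ I → 0 ≤ E → L ≤ ((1+M)*K1*C*Q)*I + (1+M)*K1*(C/r*E) →
      L ≤ ((1+M)*K1*C*(1+Ka+Kt))*I + ((1+M)*K1*C*(1+Ka+Kt)/r)*E := by
    intro L Q I E hQ hQ2 hI hE hL
    refine hL.trans (add_le_add ?_ ?_)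
    · gcongr
    · calc _ = ((1+M)*K1*C*1/r)*E := by ring
        _ ≤ _ := by
          have : (1:ℝ) ≤ 1+Ka+Kt := by linarith
          gcongr
  obtain ⟨H1, H2⟩ := H ψ A hA hs hA2 C₀ r u G S hw
  have cn : ∀ P, 0 ≤ conormalNormSq A n P (G P) := fun P => by unfold conormalNormSq; positivity
  have tn' : ∀ P, 0 ≤ tanGradNormSq (n P) (G P) := fun P => by unfold tanGradNormSq; positivity
  constructor
  · refine wrap _ Ka _ _ Kap (by linarith) (integral_nonneg cn) hE ?_
    refine fin_gen B S (fun P => conormalNormSq A n P (G P)) cn (con_meas B S hA2) (Kb := m * (μ⁻¹*((e+1:ℕ)*m))^2) (by positivity) K1p.le Kap hC.le (by positivity) ?_ _ _ hp ?_ H1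
    · filter_upwards [B.gd] with x h
      exact con_up hμ hA.1 hs n _ h.h1 _
    · filter_upwards [B.gd] with x h
      rw [en_sq]
      exact ENNReal.ofReal_le_ofReal (pn_up hM A n _ h _)
  · refine wrap _ Kt _ _ Ktp (by linarith) (integral_nonneg tn') hE ?_
    refine fin_gen B S (fun P => tanGradNormSq (n P) (G P)) tn' (tan_meas B S) (Kb := (e+1:ℕ)*m) (by positivity) K1p.le Ktp hC.le (by positivity) ?_ _ _ hp ?_ H2
    · filter_upwards [B.gd] with x h
      exact tan_up h.h1 _
    · filter_upwards [B.gd] with x h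
      rw [en_sq]
      exact ENNReal.ofReal_le_ofReal (pt_up hM (hl x) h _ _)

end

end
end Rell

/-- **Theorem 8.1** (Rellich estimates for all scales on a Lipschitz graph): for
`A ∈ Λ(μ,λ,τ)` symmetric and of class `C²`, and for a solution `u` of `L(u) = 0` in
`D(8r)` whose gradient has an `L²(Δ(6r))` nontangential maximal function and
nontangential limits `G` a.e. on `Δ(6r)`,
`∫_{Δ(r)}|∇u|²dσ ≤ C∫_{Δ(4r)}|∂u/∂ν|²dσ + (C/r)∫_{D(4r)}|∇u|²dX`, and similarly with
`∇_tan u`; `C` depends only on `μ,λ,τ` and `M`. -/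
theorem statement_19
    (e m : ℕ) (he : 2 ≤ e) (hm : 1 ≤ m)
    (μ lam τ M C₀ : ℝ)
    (hμ : 0 < μ) (hlam : lam ∈ Set.Ioo (0 : ℝ) 1) (hτ : 0 ≤ τ)
    (hM : 0 ≤ M) (hC₀ : 1 < C₀) :
    ∃ C : ℝ, 0 < C ∧
      ∀ ψ : EuclideanSpace ℝ (Fin e) → ℝ,
        LipschitzWith (Real.toNNReal M) ψ → ψ 0 = 0 →
      ∀ σD : Measure (EuclideanSpace ℝ (Fin (e + 1))),
        σD = surfMeasure (e + 1) (graphDomain e ψ) →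
      ∀ A : Coeff (e + 1) m, MemLambdaClass μ lam τ A → IsSymmCoeff A →
        (∀ i j α β, ContDiff ℝ 2 (fun Z => A Z i j α β)) →
      ∀ n, IsOutwardNormal (graphDomain e ψ) n →
      ∀ r : ℝ, 0 < r →
      ∀ (u : EuclideanSpace ℝ (Fin (e + 1)) → Fin m → ℝ)
        (G : EuclideanSpace ℝ (Fin (e + 1)) →
          (EuclideanSpace ℝ (Fin (e + 1)) →L[ℝ] (Fin m → ℝ))),
        ContDiffOn ℝ 2 u (graphD e M ψ (8 * r)) →
        IsWeakSolution A (graphD e M ψ (8 * r)) u →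
        (∫⁻ P in graphDelta e ψ (6 * r),
          (ntMax C₀ (graphD e M ψ (8 * r)) (frontier (graphDomain e ψ))
            (fun X => fderiv ℝ u X) P) ^ 2 ∂σD) ≠ ⊤ →
        (∀ᵐ P ∂(σD.restrict (graphDelta e ψ (6 * r))),
          NTLim C₀ (graphD e M ψ (8 * r)) (frontier (graphDomain e ψ))
            (fun X => fderiv ℝ u X) P (G P)) →
        (∫ P in graphDelta e ψ r, gradNormSq (G P) ∂σD ≤
            C * ∫ P in graphDelta e ψ (4 * r), conormalNormSq A n P (G P) ∂σD +
            (C / r) * ∫ X in graphD e M ψ (4 * r), gradSq u X) ∧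
        (∫ P in graphDelta e ψ r, gradNormSq (G P) ∂σD ≤
            C * ∫ P in graphDelta e ψ (4 * r), tanGradNormSq (n P) (G P) ∂σD +
            (C / r) * ∫ X in graphD e M ψ (4 * r), gradSq u X) := by
  obtain ⟨C, hC, H⟩ := Rell.final (e := e) hm hμ hlam hτ hM hC₀
  refine ⟨C, hC, ?_⟩
  intro ψ hψ h0 σD hσ A hA hs hA2 n hn r hr u G hu hw hN hG
  subst hσ
  exact H ψ hψ h0 A hA hs hA2 n hn r hr u G hu hw hN hG

end
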